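/- Let 1 < p < ∞, m ∈ ℝ and α < 2. Let A = [[Q, qᵗ],[q, γ]] be a real symmetric positive definite (N+1)×(N+1) matrix (Q ∈ ℝ^{N×N}, q ∈ ℝ^N, γ > 0), v = (d,c) ∈ ℝ^{N+1}, b ∈ ℝ, and assume D := b/γ + ((c/γ − 1)/2)² ≥ 0. With s₁ := (c/γ−1)/2 − √D and s₂ := (c/γ−1)/2 + √D, assume s₁ + max(−α,0) < (m+1)/p < s₂ + 2 − α and (m+1)/p > s₁ + 1 − α. Then there exists C > 0 such that for every φ ∈ C_c^∞(ℝ^N × [0,∞)) with ∂_y φ ≡ 0 on {y ≤ δ} for some δ > 0, setting u(x,y) := y^{−s₁} φ(x,y) and ℒu := y^{α} Tr(A D²u) + y^{α−1} v·∇u − b y^{α−2} u, one has Σ_{i,j=1}^{N} ‖y^{α} ∂²u/∂x_i∂x_j‖_{L^p_m} + ‖y^{α}(γ ∂²u/∂y² + c y^{−1} ∂_y u − b y^{−2} u)‖_{L^p_m} + Σ_{i=1}^{N} ‖y^{α} ∂²u/∂x_i∂y‖_{L^p_m} + ‖y^{α−1} ∇_x u‖_{L^p_m} ≤ C ‖ℒu‖_{L^p_m}.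 -/

import Mathlib

open MeasureTheory Real

noncomputable section

/-- Points of `ℝ^{N+1} = ℝ^N × ℝ`; we write `z = (x, y)` with `x : Fin N → ℝ` and `y : ℝ`. -/
abbrev Pt (N : ℕ) := (Fin N → ℝ) × ℝ

/-- Directional (partial) derivative of `u` at `z` in the direction `v`. -/
def pd {N : ℕ} (v : Pt N) (u : Pt N → ℝ) (z : Pt N) : ℝ := fderiv ℝ u z v

/-- The unit vector in the `i`-th `x`-direction. -/
def ex {N : ℕ} (i : Fin N) : Pt N := (Pi.single i 1, 0)

/-- The unit vector in the `y`-direction. -/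
def ey {N : ℕ} : Pt N := (0, 1)

/-- The `i`-th coordinate direction of `ℝ^{N+1}`, `(x_1, …, x_N, y)`. -/
def bvec {N : ℕ} (i : Fin (N + 1)) : Pt N :=
  if h : (i : ℕ) < N then ex ⟨i, h⟩ else ey

/-- The block matrix `[[Q, qᵗ], [q, γ]]`. -/
def blockA {N : ℕ} (Q : Matrix (Fin N) (Fin N) ℝ) (q : Fin N → ℝ) (γ : ℝ) :
    Matrix (Fin (N + 1)) (Fin (N + 1)) ℝ := Matrix.of fun i j =>
  if hi : (i : ℕ) < N then
    if hj : (j : ℕ) < N then Q ⟨i, hi⟩ ⟨j, hj⟩ else q ⟨i, hi⟩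
  else if hj : (j : ℕ) < N then q ⟨j, hj⟩ else γ

/-- `Tr (A D² u)` at the point `z`: `∑_{i,j} a_{ij} ∂²u/∂z_i∂z_j`. -/
def trHess {N : ℕ} (A : Matrix (Fin (N + 1)) (Fin (N + 1)) ℝ) (u : Pt N → ℝ) (z : Pt N) : ℝ :=
  ∑ i, ∑ j, A i j * pd (bvec i) (pd (bvec j) u) z

/-- The norm of `L^p_m(ℝ^{N+1}_+) = L^p(ℝ^{N+1}_+ ; y^m dx dy)`. -/
def LpmNorm (N : ℕ) (p m : ℝ) (f : Pt N → ℝ) : ℝ :=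
  (∫ z in {z : Pt N | 0 < z.2}, |f z| ^ p * z.2 ^ m) ^ (1 / p)

section dev1
/-! ### Gaussian measure -/

def rho1 (x : ℝ) : ℝ := ProbabilityTheory.gaussianPDFReal 0 2 x

lemma rho1_eq (x : ℝ) : rho1 x = (Real.sqrt (2 * π * 2))⁻¹ * Real.exp (-(1/4) * x ^ 2) := by
  unfold rho1 ProbabilityTheory.gaussianPDFReal
  simp only [NNReal.coe_ofNat, sub_zero]
  congr 2
  ring

lemma rho1_nonneg (x : ℝ) : 0 ≤ rho1 x := ProbabilityTheory.gaussianPDFReal_nonneg _ _ _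

lemma rho1_cont : Continuous rho1 := by
  have : rho1 = fun x => (Real.sqrt (2 * π * 2))⁻¹ * Real.exp (-(1/4) * x ^ 2) := funext rho1_eq
  rw [this]; fun_prop

lemma rho1_int : Integrable rho1 := ProbabilityTheory.integrable_gaussianPDFReal _ _

lemma rho1_integral : ∫ x, rho1 x = 1 :=
  ProbabilityTheory.integral_gaussianPDFReal_eq_one 0 (by norm_num)

lemma rho1_mul_int : Integrable (fun x => x * rho1 x) := by
  have h := (integrable_mul_exp_neg_mul_sq (b := 1/4) (by norm_num)).const_mul
    ((Real.sqrt (2 * π * 2))⁻¹)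
  refine h.congr (Filter.Eventually.of_forall fun x => ?_)
  simp only [rho1_eq]; ring

lemma rho1_deriv (x : ℝ) : HasDerivAt rho1 (-(x / 2) * rho1 x) x := by
  have : rho1 = fun x => (Real.sqrt (2 * π * 2))⁻¹ * Real.exp (-(1/4) * x ^ 2) := funext rho1_eq
  rw [this]
  have h1 : HasDerivAt (fun x : ℝ => -(1/4) * x ^ 2) (-(1/4) * (2 * x)) x := by
    exact ((hasDerivAt_pow 2 x).const_mul (-(1/4) : ℝ)).congr_deriv (by norm_num)
  exact ((h1.exp).const_mul ((Real.sqrt (2 * π * 2))⁻¹)).congr_deriv (by ring)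

variable {ι : Type} [Fintype ι]

def rho (s : ι → ℝ) : ℝ := ∏ i, rho1 (s i)

lemma rho_nonneg (s : ι → ℝ) : 0 ≤ rho s := Finset.prod_nonneg fun _ _ => rho1_nonneg _

lemma rho_cont : Continuous (rho : (ι → ℝ) → ℝ) := by
  unfold rho
  exact continuous_finsetProd _ fun i _ => rho1_cont.comp (continuous_apply i)

lemma rho_int : Integrable (rho : (ι → ℝ) → ℝ) :=
  Integrable.fintype_prod (f := fun _ : ι => rho1) (μ := fun _ => volume) (fun _ => rho1_int)

lemma rho_integral : ∫ s : ι → ℝ, rho s = 1 := by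
  unfold rho
  rw [integral_fintype_prod_volume_eq_prod (f := fun _ : ι => rho1)]
  simp [rho1_integral]

lemma rho_mul_int (i : ι) : Integrable (fun s : ι → ℝ => s i * rho s) := by
  classical
  have h := Integrable.fintype_prod (f := fun j : ι => if j = i then (fun x => x * rho1 x) else rho1)
    (μ := fun _ => volume) (fun j => by
      by_cases hj : j = i
      · simp only [hj, if_true]; exact rho1_mul_int
      · simp only [hj, if_false]; exact rho1_int)
  refine h.congr (Filter.Eventually.of_forall fun s => ?_)
  simp only [rho]
  rw [← Finset.mul_prod_erase Finset.univ _ (Finset.mem_univ i),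
    ← Finset.mul_prod_erase Finset.univ (fun j => rho1 (s j)) (Finset.mem_univ i)]
  simp only [if_true, mul_assoc]
  congr 2
  refine Finset.prod_congr rfl fun j hj => ?_
  rw [if_neg (Finset.ne_of_mem_erase hj)]

variable (ι) in
/-- product Gaussian measure with variance 2 in every coordinate -/
def gm : Measure (ι → ℝ) := volume.withDensity fun s => ENNReal.ofReal (rho s)

instance gm_prob : IsProbabilityMeasure (gm ι) := by
  constructor
  rw [gm, withDensity_apply _ MeasurableSet.univ, Measure.restrict_univ,
    ← ofReal_integral_eq_lintegral_ofReal rho_int (Filter.Eventually.of_forall rho_nonneg),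
    rho_integral, ENNReal.ofReal_one]

lemma gm_integral (G : (ι → ℝ) → ℝ) : ∫ s, G s ∂(gm ι) = ∫ s, rho s * G s := by
  rw [gm, integral_withDensity_eq_integral_toReal_smul
    (rho_cont.measurable.ennreal_ofReal) (Filter.Eventually.of_forall fun s => ENNReal.ofReal_lt_top)]
  simp only [ENNReal.toReal_ofReal (rho_nonneg _), smul_eq_mul]

lemma gm_integrable (G : (ι → ℝ) → ℝ) :
    Integrable G (gm ι) ↔ Integrable (fun s => rho s * G s) := by
  rw [gm, integrable_withDensity_iff_integrable_smul'
    (rho_cont.measurable.ennreal_ofReal) (Filter.Eventually.of_forall fun s => ENNReal.ofReal_lt_top)]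
  simp only [ENNReal.toReal_ofReal (rho_nonneg _), smul_eq_mul]

lemma gm_int_coord (i : ι) : Integrable (fun s : ι → ℝ => s i) (gm ι) := by
  rw [gm_integrable]
  simpa [mul_comm] using rho_mul_int i

lemma rho_fderiv [DecidableEq ι] (i : ι) (s : ι → ℝ) :
    DifferentiableAt ℝ (rho : (ι → ℝ) → ℝ) s ∧
    fderiv ℝ (rho : (ι → ℝ) → ℝ) s (Pi.single i 1) = -(s i / 2) * rho s := by
  have h : HasFDerivAt (rho : (ι → ℝ) → ℝ)
      (∑ j, (∏ k ∈ Finset.univ.erase j, rho1 (s k)) •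
        ((-(s j / 2) * rho1 (s j)) • (ContinuousLinearMap.proj j : (ι → ℝ) →L[ℝ] ℝ))) s := by
    unfold rho
    have := HasFDerivAt.finsetProd (u := (Finset.univ : Finset ι))
      (g := fun j (s : ι → ℝ) => rho1 (s j))
      (g' := fun j => ((-(s j / 2) * rho1 (s j)) • (ContinuousLinearMap.proj j : (ι → ℝ) →L[ℝ] ℝ)))
      (x := s) (fun j _ => (rho1_deriv (s j)).comp_hasFDerivAt s (hasFDerivAt_apply j s))
    exact this
  refine ⟨h.differentiableAt, ?_⟩
  rw [h.fderiv]
  simp only [sum_apply, smul_apply,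
    ContinuousLinearMap.proj_apply, smul_eq_mul]
  rw [Finset.sum_eq_single i]
  · rw [Pi.single_eq_same, rho, ← Finset.mul_prod_erase Finset.univ _ (Finset.mem_univ i)]; ring
  · intro j _ hj; rw [Pi.single_eq_of_ne hj]; ring
  · intro h; exact absurd (Finset.mem_univ i) h

/-- Stein's identity. -/
lemma stein [DecidableEq ι] (i : ι) (G : (ι → ℝ) → ℝ) (hG : Differentiable ℝ G)
    (hGc : Continuous (fun s => fderiv ℝ G s (Pi.single i 1)))
    (B : ℝ) (hB : ∀ s, |G s| ≤ B) (hB' : ∀ s, |fderiv ℝ G s (Pi.single i 1)| ≤ B) :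
    ∫ s, s i * G s ∂(gm ι) = 2 * ∫ s, fderiv ℝ G s (Pi.single i 1) ∂(gm ι) := by
  rw [gm_integral, gm_integral]
  have hf : (fun s : ι → ℝ => fderiv ℝ (rho : (ι → ℝ) → ℝ) s (Pi.single i 1)) =
      fun s => -(1/2) * (s i * rho s) := by
    funext s; rw [(rho_fderiv i s).2]; ring
  have key := integral_mul_fderiv_eq_neg_fderiv_mul_of_integrable (𝕜 := ℝ) (μ := (volume : Measure (ι → ℝ)))
    (f := (rho : (ι → ℝ) → ℝ)) (g := G) (v := Pi.single i 1)
    (by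
      have : Integrable (fun s : ι → ℝ => (-(1/2) * (s i * rho s)) * G s) :=
        Integrable.mul_bdd (c := B) ((rho_mul_int i).const_mul _)
          hG.continuous.aestronglyMeasurable (Filter.Eventually.of_forall fun s => by
            rw [Real.norm_eq_abs]; exact hB s)
      refine this.congr (Filter.Eventually.of_forall fun s => ?_)
      have := congrFun hf s
      simp only at this ⊢
      rw [this])
    (Integrable.mul_bdd (c := B) rho_int hGc.aestronglyMeasurable
      (Filter.Eventually.of_forall fun s => by rw [Real.norm_eq_abs]; exact hB' s))
    (Integrable.mul_bdd (c := B) rho_int hG.continuous.aestronglyMeasurable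
      (Filter.Eventually.of_forall fun s => by rw [Real.norm_eq_abs]; exact hB s))
    (fun s _ => (rho_fderiv i s).1) (fun s _ => hG s)
  rw [key, ← integral_neg, ← integral_const_mul]
  congr 1
  funext s
  rw [(rho_fderiv i s).2]; ring
end dev1

section dev2
/-! ### Test functions and the heat operator -/

variable {N : ℕ}

def TF (g : Pt N → ℝ) : Prop := ContDiff ℝ (⊤ : ℕ∞) g ∧ HasCompactSupport g

namespace TF
variable {f g : Pt N → ℝ}

lemma cont (hg : TF g) : Continuous g := hg.1.continuous
lemma diff (hg : TF g) : Differentiable ℝ g := hg.1.differentiable (by simp)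
lemma contfd (hg : TF g) : Continuous (fderiv ℝ g) := hg.1.continuous_fderiv (by simp)

lemma pd (hg : TF g) (v : Pt N) : TF (pd v g) := by
  constructor
  · have h : ContDiff ℝ (⊤ : ℕ∞) (fderiv ℝ g) := hg.1.fderiv_right (by simp)
    exact h.clm_apply contDiff_const
  · exact hg.2.fderiv_apply (𝕜 := ℝ) v

lemma add (hf : TF f) (hg : TF g) : TF (fun z => f z + g z) := ⟨hf.1.add hg.1, hf.2.add hg.2⟩
lemma const_mul (hg : TF g) (c : ℝ) : TF (fun z => c * g z) :=
  ⟨contDiff_const.mul hg.1, hg.2.mul_left⟩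
lemma neg (hg : TF g) : TF (fun z => - g z) := by
  have := hg.const_mul (-1); simpa using this
lemma sub (hf : TF f) (hg : TF g) : TF (fun z => f z - g z) := by
  have := hf.add hg.neg; simpa [sub_eq_add_neg] using this
lemma zero : TF (fun _ : Pt N => (0 : ℝ)) := ⟨contDiff_const, HasCompactSupport.zero⟩
lemma smul_left (hg : TF g) (hf : ContDiff ℝ (⊤ : ℕ∞) f) : TF (fun z => f z * g z) :=
  ⟨hf.mul hg.1, hg.2.mul_left⟩
lemma sum {κ : Type*} (s : Finset κ) (F : κ → Pt N → ℝ) (h : ∀ k ∈ s, TF (F k)) :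
    TF (fun z => ∑ k ∈ s, F k z) := by
  classical
  induction s using Finset.induction_on with
  | empty => simpa using TF.zero
  | insert a s ha ih =>
    have := (h a (Finset.mem_insert_self _ _)).add
      (ih fun k hk => h k (Finset.mem_insert_of_mem hk))
    refine (Eq.mp ?_ this)
    congr 1; funext z; rw [Finset.sum_insert ha]

lemma bdd (hg : TF g) : ∃ B, 0 ≤ B ∧ ∀ z, |g z| ≤ B := by
  obtain ⟨B, hB⟩ := hg.2.exists_bound_of_continuous hg.cont
  exact ⟨max B 0, le_max_right _ _, fun z => (hB z).trans (le_max_left _ _)⟩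

lemma bddfd (hg : TF g) : ∃ B, 0 ≤ B ∧ ∀ z, ‖fderiv ℝ g z‖ ≤ B := by
  obtain ⟨B, hB⟩ := (hg.2.fderiv (𝕜 := ℝ)).exists_bound_of_continuous hg.contfd
  exact ⟨max B 0, le_max_right _ _, fun z => (hB z).trans (le_max_left _ _)⟩

lemma integrable (hg : TF g) : Integrable g := hg.cont.integrable_of_hasCompactSupport hg.2

lemma rpow_int (hg : TF g) {p : ℝ} (hp : 0 < p) : Integrable (fun z => |g z| ^ p) := by
  refine Continuous.integrable_of_hasCompactSupport ?_ ?_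
  · exact hg.cont.abs.rpow_const fun z => Or.inr hp.le
  · exact hg.2.comp_left (g := fun x : ℝ => |x| ^ p) (by simp [Real.zero_rpow hp.ne'])

end TF

lemma pd_add {f g : Pt N → ℝ} (v : Pt N) (hf : Differentiable ℝ f) (hg : Differentiable ℝ g) :
    pd v (fun z => f z + g z) = fun z => pd v f z + pd v g z := by
  funext z; unfold pd; rw [fderiv_fun_add (hf z) (hg z)]; rfl

lemma pd_const_mul {g : Pt N → ℝ} (v : Pt N) (c : ℝ) (hg : Differentiable ℝ g) :
    pd v (fun z => c * g z) = fun z => c * pd v g z := by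
  funext z; unfold pd; rw [fderiv_const_mul (hg z)]; rfl

lemma pd_mul {f g : Pt N → ℝ} (v : Pt N) (hf : Differentiable ℝ f) (hg : Differentiable ℝ g) :
    pd v (fun z => f z * g z) = fun z => f z * pd v g z + pd v f z * g z := by
  funext z; unfold pd; rw [fderiv_fun_mul (hf z) (hg z)]
  simp [mul_comm]

lemma pd_sum {κ : Type*} (s : Finset κ) (F : κ → Pt N → ℝ) (v : Pt N)
    (h : ∀ k ∈ s, Differentiable ℝ (F k)) :
    pd v (fun z => ∑ k ∈ s, F k z) = fun z => ∑ k ∈ s, pd v (F k) z := by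
  funext z; unfold pd; rw [fderiv_fun_sum (fun k hk => h k hk z)]; simp

lemma pd_comm {g : Pt N → ℝ} (hg : ContDiff ℝ (⊤ : ℕ∞) g) (v w : Pt N) :
    pd v (pd w g) = pd w (pd v g) := by
  funext z
  have hd : Differentiable ℝ (fderiv ℝ g) :=
    (hg.fderiv_right (m := (⊤ : ℕ∞)) (by simp)).differentiable (by simp)
  have h2 : IsSymmSndFDerivAt ℝ g z := by
    refine ContDiffAt.isSymmSndFDerivAt (n := (⊤ : ℕ∞)) hg.contDiffAt ?_
    rw [minSmoothness_of_isRCLikeNormedField]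
    exact WithTop.coe_le_coe.2 (le_top : (2 : ℕ∞) ≤ ⊤)
  have key : ∀ a b : Pt N, pd a (pd b g) z = fderiv ℝ (fderiv ℝ g) z a b := by
    intro a b
    have h1 := (ContinuousLinearMap.apply ℝ ℝ b).hasFDerivAt.comp z (hd z).hasFDerivAt
    have h3 : (fun x => fderiv ℝ g x b) = (ContinuousLinearMap.apply ℝ ℝ b) ∘ (fderiv ℝ g) := by
      funext x; simp
    show fderiv ℝ (fun x => fderiv ℝ g x b) z a = _
    rw [h3, h1.fderiv]; simp
  rw [key, key]; exact h2 v w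

lemma pd_add_dir {g : Pt N → ℝ} (v w : Pt N) (z : Pt N) : pd (v + w) g z = pd v g z + pd w g z := by
  unfold pd; rw [map_add]
lemma pd_smul_dir {g : Pt N → ℝ} (c : ℝ) (v : Pt N) (z : Pt N) : pd (c • v) g z = c * pd v g z := by
  unfold pd; rw [map_smul]; rfl

variable {ι : Type} [Fintype ι]

def lin (e : ι → Pt N) : (ι → ℝ) →L[ℝ] Pt N :=
  ∑ i, (ContinuousLinearMap.proj i : (ι → ℝ) →L[ℝ] ℝ).smulRight (e i)

lemma lin_apply (e : ι → Pt N) (s : ι → ℝ) : lin e s = ∑ i, s i • e i := by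
  simp [lin]

lemma lin_single [DecidableEq ι] (e : ι → Pt N) (i : ι) : lin e (Pi.single i 1) = e i := by
  rw [lin_apply, Finset.sum_eq_single i]
  · simp
  · intro j _ hj; simp [Pi.single_eq_of_ne hj]
  · simp

def heat (e : ι → Pt N) (t : ℝ) (g : Pt N → ℝ) (z : Pt N) : ℝ :=
  ∫ s, g (z - Real.sqrt t • lin e s) ∂(gm ι)

variable (e : ι → Pt N) {g : Pt N → ℝ}

lemma heat_zero : heat e 0 g = g := by
  funext z; simp [heat]

lemma heat_abs_le {B : ℝ} (hB : ∀ z, |g z| ≤ B) (t : ℝ) (z : Pt N) : |heat e t g z| ≤ B := by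
  have := norm_integral_le_of_norm_le_const (μ := gm ι) (C := B)
    (f := fun s => g (z - Real.sqrt t • lin e s)) (Filter.Eventually.of_forall fun s => hB _)
  simpa [heat] using this

lemma heat_integrand_cont (hg : Continuous g) (t : ℝ) (z : Pt N) :
    Continuous (fun s : ι → ℝ => g (z - Real.sqrt t • lin e s)) := by fun_prop

lemma int_of_bdd {α : Type*} [MeasurableSpace α] {μ : Measure α} [IsFiniteMeasure μ] {f : α → ℝ}
    (hf : AEStronglyMeasurable f μ) {B : ℝ} (hB : ∀ z, |f z| ≤ B) : Integrable f μ :=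
  Integrable.of_bound hf B (Filter.Eventually.of_forall hB)

lemma heat_integrable_integrand (hg : TF g) (t : ℝ) (z : Pt N) :
    Integrable (fun s : ι → ℝ => g (z - Real.sqrt t • lin e s)) (gm ι) := by
  obtain ⟨B, _, hB⟩ := hg.bdd
  exact int_of_bdd (heat_integrand_cont e hg.cont t z).aestronglyMeasurable fun s => hB _

lemma heat_cont (hg : TF g) : Continuous (fun q : ℝ × Pt N => heat e q.1 g q.2) := by
  obtain ⟨B, _, hB⟩ := hg.bdd
  have hc := hg.cont
  unfold heat
  refine continuous_of_dominated (bound := fun _ => B) ?_ ?_ (integrable_const B) ?_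
  · intro q; exact (heat_integrand_cont e hg.cont q.1 q.2).aestronglyMeasurable
  · intro q; exact Filter.Eventually.of_forall fun s => hB _
  · refine Filter.Eventually.of_forall fun s => ?_
    have : Continuous (fun q : ℝ × Pt N => q.2 - Real.sqrt q.1 • lin e s) :=
      continuous_snd.sub ((Real.continuous_sqrt.comp continuous_fst).smul continuous_const)
    exact hc.comp this

lemma heat_cont_z (hg : TF g) (t : ℝ) : Continuous (heat e t g) :=
  (heat_cont e hg).comp (Continuous.prodMk_right t)

lemma heat_hasFDerivAt (hg : TF g) (t : ℝ) (z : Pt N) :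
    HasFDerivAt (heat e t g) (∫ s, fderiv ℝ g (z - Real.sqrt t • lin e s) ∂(gm ι)) z := by
  obtain ⟨B, _, hB⟩ := hg.bddfd
  have hc := hg.contfd
  unfold heat
  refine hasFDerivAt_integral_of_dominated_of_fderiv_le (bound := fun _ => B)
    (F' := fun x s => fderiv ℝ g (x - Real.sqrt t • lin e s))
    (s := Set.univ) Filter.univ_mem ?_ ?_ ?_ ?_ (integrable_const B) ?_
  · exact Filter.Eventually.of_forall fun x =>
      (heat_integrand_cont e hg.cont t x).aestronglyMeasurable
  · exact heat_integrable_integrand e hg t z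
  · have : Continuous (fun s : ι → ℝ => fderiv ℝ g (z - Real.sqrt t • lin e s)) := by fun_prop
    exact this.aestronglyMeasurable
  · exact Filter.Eventually.of_forall fun s x _ => hB _
  · refine Filter.Eventually.of_forall fun s x _ => ?_
    have h1 : HasFDerivAt (fun x : Pt N => x - Real.sqrt t • lin e s)
      (ContinuousLinearMap.id ℝ (Pt N)) x := (hasFDerivAt_id x).sub_const _
    have := (hg.diff (x - Real.sqrt t • lin e s)).hasFDerivAt.comp x h1
    rw [ContinuousLinearMap.comp_id] at this
    exact this

lemma heat_diff (hg : TF g) (t : ℝ) : Differentiable ℝ (heat e t g) :=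
  fun z => (heat_hasFDerivAt e hg t z).differentiableAt

lemma pd_heat (hg : TF g) (v : Pt N) (t : ℝ) : pd v (heat e t g) = heat e t (pd v g) := by
  funext z
  unfold pd
  rw [(heat_hasFDerivAt e hg t z).fderiv]
  obtain ⟨B, _, hB⟩ := hg.bddfd
  have hc := hg.contfd
  have hcont : Continuous (fun s : ι → ℝ => fderiv ℝ g (z - Real.sqrt t • lin e s)) := by fun_prop
  have hIntg : Integrable (fun s : ι → ℝ => fderiv ℝ g (z - Real.sqrt t • lin e s)) (gm ι) :=
    Integrable.of_bound hcont.aestronglyMeasurable B (Filter.Eventually.of_forall fun s => hB _)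
  rw [ContinuousLinearMap.integral_apply hIntg]
  rfl

lemma heat_add {f : Pt N → ℝ} (hf : TF f) (hg : TF g) (t : ℝ) :
    heat e t (fun z => f z + g z) = fun z => heat e t f z + heat e t g z := by
  funext z
  exact integral_add (heat_integrable_integrand e hf t z) (heat_integrable_integrand e hg t z)

lemma heat_const_mul (c : ℝ) (t : ℝ) :
    heat e t (fun z => c * g z) = fun z => c * heat e t g z := by
  funext z
  exact integral_const_mul _ _

lemma heat_neg (t : ℝ) :
    heat e t (fun z => - g z) = fun z => - heat e t g z := by
  funext z
  exact integral_neg _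

lemma heat_sum {κ : Type*} (s : Finset κ) (F : κ → Pt N → ℝ) (h : ∀ k ∈ s, TF (F k)) (t : ℝ) :
    heat e t (fun z => ∑ k ∈ s, F k z) = fun z => ∑ k ∈ s, heat e t (F k) z := by
  funext z
  exact integral_finsetSum _ (fun k hk => heat_integrable_integrand e (h k hk) t z)

/-- Stein form -/
lemma heat_stein (hg : TF g) (i : ι) (t : ℝ) (z : Pt N) :
    ∫ s, s i * g (z - Real.sqrt t • lin e s) ∂(gm ι) = - (2 * Real.sqrt t) * heat e t (pd (e i) g) z := by
  classical
  obtain ⟨B, hB0, hB⟩ := hg.bdd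
  obtain ⟨B', hB0', hB'⟩ := (hg.pd (e i)).bdd
  have hder : ∀ s : ι → ℝ, HasFDerivAt (fun s : ι → ℝ => g (z - Real.sqrt t • lin e s))
      ((fderiv ℝ g (z - Real.sqrt t • lin e s)).comp (-(Real.sqrt t • lin e))) s := by
    intro s
    have h1 : HasFDerivAt (fun s : ι → ℝ => z - Real.sqrt t • lin e s) (-(Real.sqrt t • lin e)) s := by
      exact ((Real.sqrt t • lin e).hasFDerivAt).const_sub z
    exact (hg.diff _).hasFDerivAt.comp s h1
  have hval : ∀ s : ι → ℝ, fderiv ℝ (fun s : ι → ℝ => g (z - Real.sqrt t • lin e s)) s (Pi.single i 1)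
      = - Real.sqrt t * pd (e i) g (z - Real.sqrt t • lin e s) := by
    intro s
    rw [(hder s).fderiv]
    simp [lin_single, pd]
  have hpc := (hg.pd (e i)).cont
  have := stein i (fun s : ι → ℝ => g (z - Real.sqrt t • lin e s))
    (fun s => (hder s).differentiableAt) (by simp_rw [hval]; fun_prop) (max B (Real.sqrt t * B'))
    (fun s => (hB _).trans (le_max_left _ _)) (fun s => by
      rw [hval, abs_mul, abs_neg, abs_of_nonneg (Real.sqrt_nonneg t)]
      exact (mul_le_mul_of_nonneg_left (hB' _) (Real.sqrt_nonneg t)).trans (le_max_right _ _))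
  rw [this]
  simp_rw [hval]
  rw [integral_const_mul, heat]; ring

def lap (e : ι → Pt N) (g : Pt N → ℝ) (z : Pt N) : ℝ := ∑ i, pd (e i) (pd (e i) g) z

lemma lap_TF (hg : TF g) : TF (lap e g) := TF.sum _ _ fun _ _ => (hg.pd _).pd _

lemma norm_lin_le (s : ι → ℝ) : ‖lin e s‖ ≤ ∑ i, |s i| * ‖e i‖ := by
  rw [lin_apply]
  refine (norm_sum_le _ _).trans (Finset.sum_le_sum fun i _ => ?_)
  rw [norm_smul, Real.norm_eq_abs]

lemma heat_hasDerivAt (hg : TF g) (t : ℝ) (ht : 0 < t) (z : Pt N) :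
    HasDerivAt (fun t => heat e t g z) (heat e t (lap e g) z) t := by
  obtain ⟨B, hB0, hB⟩ := hg.bddfd
  have hc := hg.contfd
  have key := hasDerivAt_integral_of_dominated_loc_of_deriv_le (μ := gm ι) (𝕜 := ℝ)
    (F := fun t s => g (z - Real.sqrt t • lin e s)) (x₀ := t) (s := Set.Ioi (t/2))
    (F' := fun t s => fderiv ℝ g (z - Real.sqrt t • lin e s) (-((1 / (2 * Real.sqrt t)) • lin e s)))
    (bound := fun s => B * ((1 / (2 * Real.sqrt (t/2))) * ∑ i, |s i| * ‖e i‖))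
    (Ioi_mem_nhds (by linarith))
    (Filter.Eventually.of_forall fun x => (heat_integrand_cont e hg.cont x z).aestronglyMeasurable)
    (heat_integrable_integrand e hg t z)
    (by
      have : Continuous (fun s : ι → ℝ => fderiv ℝ g (z - Real.sqrt t • lin e s) (-((1 / (2 * Real.sqrt t)) • lin e s))) := by
        fun_prop
      exact this.aestronglyMeasurable)
    (Filter.Eventually.of_forall fun s x hx => by
      refine (ContinuousLinearMap.le_opNorm _ _).trans ?_
      refine mul_le_mul (hB _) ?_ (norm_nonneg _) hB0
      rw [norm_neg, norm_smul]
      have hx' : t / 2 < x := hx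
      have h1 : 0 < Real.sqrt (t/2) := Real.sqrt_pos.mpr (by linarith)
      have h2 : Real.sqrt (t/2) ≤ Real.sqrt x := Real.sqrt_le_sqrt hx'.le
      refine mul_le_mul ?_ (norm_lin_le e s) (norm_nonneg _) (by positivity)
      rw [Real.norm_of_nonneg (by positivity)]
      gcongr)
    (by
      refine ((integrable_finsetSum _ fun i _ => ?_).const_mul _).const_mul _
      exact (gm_int_coord i).abs.mul_const _)
    (Filter.Eventually.of_forall fun s x hx => by
      have hx' : t / 2 < x := hx
      have hx0 : x ≠ 0 := by linarith
      have h1 : HasDerivAt (fun x : ℝ => z - Real.sqrt x • lin e s)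
          (-((1 / (2 * Real.sqrt x)) • lin e s)) x :=
        ((Real.hasDerivAt_sqrt hx0).smul_const _).const_sub z
      exact (hg.diff _).hasFDerivAt.comp_hasDerivAt x h1)
  have h2 := key.2
  refine h2.congr_deriv ?_
  have hst : 0 < Real.sqrt t := Real.sqrt_pos.mpr ht
  have e1 : ∀ s : ι → ℝ, fderiv ℝ g (z - Real.sqrt t • lin e s) (-((1 / (2 * Real.sqrt t)) • lin e s))
     = ∑ i, -(1 / (2 * Real.sqrt t)) * (s i * pd (e i) g (z - Real.sqrt t • lin e s)) := by
    intro s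
    rw [map_neg, map_smul, lin_apply, map_sum, smul_eq_mul, ← neg_mul, Finset.mul_sum]
    refine Finset.sum_congr rfl fun i _ => ?_
    rw [map_smul]; rfl
  simp_rw [e1]
  rw [integral_finsetSum _ (fun i _ => ?_)]
  · unfold lap
    rw [heat_sum e _ _ (fun i _ => (hg.pd _).pd _)]
    refine Finset.sum_congr rfl fun i _ => ?_
    rw [integral_const_mul, heat_stein e (hg.pd (e i)) i t z]
    field_simp
  · obtain ⟨B', hB0', hB'⟩ := (hg.pd (e i)).bdd
    refine ((gm_int_coord i).mul_bdd (c := B') (heat_integrand_cont e (hg.pd (e i)).cont t z).aestronglyMeasurable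
      (Filter.Eventually.of_forall fun s => hB' _)).const_mul _
end dev2

section dev3
variable {N : ℕ} {ι : Type} [Fintype ι] (e : ι → Pt N) {g : Pt N → ℝ}

instance haarPt (N : ℕ) : (volume : Measure (Pt N)).IsAddHaarMeasure :=
  inferInstanceAs (((volume : Measure (Fin N → ℝ)).prod (volume : Measure ℝ)).IsAddHaarMeasure)

/-! ### Integrability of heat evolutions -/

lemma heatw_integrable (hg : Continuous g) (hgi : Integrable g) (w : (ι → ℝ) → ℝ) (hwc : Continuous w)
    (hw : Integrable w (gm ι)) (t : ℝ) :
    Integrable (fun q : Pt N × (ι → ℝ) => w q.2 * g (q.1 - Real.sqrt t • lin e q.2))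
      ((volume : Measure (Pt N)).prod (gm ι)) := by
  have hcont : Continuous (fun q : Pt N × (ι → ℝ) => w q.2 * g (q.1 - Real.sqrt t • lin e q.2)) := by
    fun_prop
  rw [integrable_prod_iff' hcont.aestronglyMeasurable]
  constructor
  · exact Filter.Eventually.of_forall fun s =>
      (hgi.comp_sub_right (Real.sqrt t • lin e s)).const_mul (w s)
  · have : (fun s : ι → ℝ => ∫ z : Pt N, ‖w s * g (z - Real.sqrt t • lin e s)‖) =
      fun s => |w s| * ∫ z, |g z| := by
      funext s
      simp only [norm_mul, Real.norm_eq_abs]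
      rw [integral_const_mul, integral_sub_right_eq_self (fun z => |g z|)]
    simp only [this]
    exact hw.abs.mul_const _

lemma heatw_integral (hg : Continuous g) (hgi : Integrable g) (w : (ι → ℝ) → ℝ) (hwc : Continuous w)
    (hw : Integrable w (gm ι)) (t : ℝ) :
    ∫ z, ∫ s, w s * g (z - Real.sqrt t • lin e s) ∂(gm ι) = (∫ s, w s ∂(gm ι)) * ∫ z, g z := by
  rw [integral_integral_swap (heatw_integrable e hg hgi w hwc hw t), ← integral_mul_const]
  congr 1; funext s
  rw [integral_const_mul, integral_sub_right_eq_self g]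

lemma heatw_integrable_z (hg : Continuous g) (hgi : Integrable g) (w : (ι → ℝ) → ℝ)
    (hwc : Continuous w) (hw : Integrable w (gm ι)) (t : ℝ) :
    Integrable (fun z => ∫ s, w s * g (z - Real.sqrt t • lin e s) ∂(gm ι)) :=
  (heatw_integrable e hg hgi w hwc hw t).integral_prod_left

lemma heat_integrable' (hg : Continuous g) (hgi : Integrable g) (t : ℝ) :
    Integrable (heat e t g) := by
  have := heatw_integrable_z e hg hgi (fun _ => 1) continuous_const (integrable_const _) t
  simp only [one_mul] at this
  exact this

lemma heat_integral (hg : Continuous g) (hgi : Integrable g) (t : ℝ) :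
    ∫ z, heat e t g z = ∫ z, g z := by
  have := heatw_integral e hg hgi (fun _ => 1) continuous_const (integrable_const _) t
  simpa [heat] using this

lemma heat_integrable (hg : TF g) (t : ℝ) : Integrable (heat e t g) :=
  heat_integrable' e hg.cont hg.integrable t

lemma heat_abs_le_heat (t : ℝ) (z : Pt N) : |heat e t g z| ≤ heat e t (fun z => |g z|) z := by
  unfold heat
  exact norm_integral_le_integral_norm (fun s : ι → ℝ => g (z - Real.sqrt t • lin e s))

lemma heat_norm_integral (hg : TF g) (t : ℝ) : ∫ z, |heat e t g z| ≤ ∫ z, |g z| := by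
  rw [← heat_integral e (g := fun z => |g z|) hg.cont.abs hg.integrable.abs t]
  exact integral_mono (heat_integrable e hg t).abs
    (heat_integrable' e hg.cont.abs hg.integrable.abs t) fun z => heat_abs_le_heat e t z

lemma heat_st_integrable (hg : TF g) (T : ℝ) :
    Integrable (fun q : ℝ × Pt N => heat e q.1 g q.2)
      ((volume.restrict (Set.Ioc 0 T)).prod (volume : Measure (Pt N))) := by
  rw [integrable_prod_iff (heat_cont e hg).aestronglyMeasurable]
  refine ⟨Filter.Eventually.of_forall fun t => heat_integrable e hg t, ?_⟩
  have hm : AEStronglyMeasurable (fun t : ℝ => ∫ z : Pt N, ‖heat e t g z‖) (volume.restrict (Set.Ioc 0 T)) := by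
    have := (heat_cont e hg).norm.aestronglyMeasurable
      (μ := (volume.restrict (Set.Ioc 0 T)).prod (volume : Measure (Pt N)))
    exact this.integral_prod_right'
  refine Integrable.of_bound hm (∫ z, |g z|) (Filter.Eventually.of_forall fun t => ?_)
  rw [Real.norm_of_nonneg (integral_nonneg fun z => norm_nonneg _)]
  exact heat_norm_integral e hg t

lemma pd_heat2 (hg : TF g) (v w : Pt N) (t : ℝ) :
    pd v (pd w (heat e t g)) = heat e t (pd v (pd w g)) := by
  rw [pd_heat e hg, pd_heat e (hg.pd w)]

lemma lap_heat (hg : TF g) (t : ℝ) : lap e (heat e t g) = heat e t (lap e g) := by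
  unfold lap
  rw [heat_sum e _ _ (fun i _ => (hg.pd _).pd _)]
  funext z
  refine Finset.sum_congr rfl fun i _ => ?_
  rw [pd_heat2 e hg]

lemma heat_ibp {a b : Pt N → ℝ} (ha : TF a) (hb : TF b) (v : Pt N) (t : ℝ) :
    ∫ z, heat e t a z * heat e t (pd v b) z = - ∫ z, heat e t (pd v a) z * heat e t b z := by
  obtain ⟨A, _, hA⟩ := ha.bdd
  obtain ⟨A', _, hA'⟩ := (ha.pd v).bdd
  have e1 : ∀ z, heat e t (pd v b) z = fderiv ℝ (heat e t b) z v := fun z => by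
    rw [← pd_heat e hb]; rfl
  have e2 : ∀ z, heat e t (pd v a) z = fderiv ℝ (heat e t a) z v := fun z => by
    rw [← pd_heat e ha]; rfl
  have key := integral_mul_fderiv_eq_neg_fderiv_mul_of_integrable (𝕜 := ℝ) (μ := (volume : Measure (Pt N)))
    (f := heat e t a) (g := heat e t b) (v := v) (by
      simp_rw [← e2]
      exact (heat_integrable e hb t).bdd_mul (c := A') (heat_cont_z e (ha.pd v) t).aestronglyMeasurable
        (Filter.Eventually.of_forall fun z => heat_abs_le e hA' t z))
    (by
      simp_rw [← e1]
      exact (heat_integrable e (hb.pd v) t).bdd_mul (c := A) (heat_cont_z e ha t).aestronglyMeasurable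
        (Filter.Eventually.of_forall fun z => heat_abs_le e hA t z))
    ((heat_integrable e hb t).bdd_mul (c := A) (heat_cont_z e ha t).aestronglyMeasurable
        (Filter.Eventually.of_forall fun z => heat_abs_le e hA t z))
    (fun z _ => heat_diff e ha t z) (fun z _ => heat_diff e hb t z)
  simp_rw [e1, e2]
  exact key

lemma heat_mul_integrable {a b : Pt N → ℝ} (ha : TF a) (hb : TF b) (t : ℝ) :
    Integrable (fun z => heat e t a z * heat e t b z) := by
  obtain ⟨A, _, hA⟩ := ha.bdd
  exact (heat_integrable e hb t).bdd_mul (c := A) (heat_cont_z e ha t).aestronglyMeasurable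
        (Filter.Eventually.of_forall fun z => heat_abs_le e hA t z)

lemma young_simple {p q : ℝ} (hpq : p.HolderConjugate q) {x y : ℝ} (hx : 0 ≤ x) (hy : 0 ≤ y) :
    x * y ≤ x ^ p + y ^ q := by
  have h := Real.young_inequality_of_nonneg hx hy hpq
  have h1 : x ^ p / p ≤ x ^ p := div_le_self (by positivity) hpq.lt.le
  have h2 : y ^ q / q ≤ y ^ q := div_le_self (by positivity) hpq.symm.lt.le
  linarith

lemma heat_jensen {p q : ℝ} (hpq : p.HolderConjugate q) {a : Pt N → ℝ} (ha : TF a) (t : ℝ)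
    (z : Pt N) {c : ℝ} (hc : 0 ≤ c) :
    |heat e t a z| * c ≤ heat e t (fun z => |a z| ^ p) z + c ^ q := by
  have hp := hpq.pos
  obtain ⟨A, hA0, hA⟩ := ha.bdd
  have hcont : Continuous (fun z => |a z| ^ p) := ha.cont.abs.rpow_const fun z => Or.inr hp.le
  have hi : Integrable (fun s : ι → ℝ => |a (z - Real.sqrt t • lin e s)| ^ p) (gm ι) := by
    refine int_of_bdd (heat_integrand_cont e hcont t z).aestronglyMeasurable (B := A ^ p) fun s => ?_
    rw [abs_of_nonneg (by positivity)]
    exact Real.rpow_le_rpow (abs_nonneg _) (hA _) hp.le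
  calc |heat e t a z| * c ≤ (∫ s, |a (z - Real.sqrt t • lin e s)| ∂(gm ι)) * c :=
        mul_le_mul_of_nonneg_right (heat_abs_le_heat e t z) hc
    _ = ∫ s, |a (z - Real.sqrt t • lin e s)| * c ∂(gm ι) := (integral_mul_const _ _).symm
    _ ≤ ∫ s, (|a (z - Real.sqrt t • lin e s)| ^ p + c ^ q) ∂(gm ι) := by
        refine integral_mono ((heat_integrable_integrand e ha t z).abs.mul_const _)
          (hi.add (integrable_const _)) fun s => young_simple hpq (abs_nonneg _) hc
    _ = _ := by
        rw [integral_add hi (integrable_const _)]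
        simp [heat]

def mom (i : ι) : ℝ := ∫ s : ι → ℝ, |s i| ∂(gm ι)

lemma mom_nonneg (i : ι) : 0 ≤ mom i := integral_nonneg fun _ => abs_nonneg _

lemma heat_bilin {p q : ℝ} (hpq : p.HolderConjugate q) {a b : Pt N → ℝ} (ha : TF a) (hb : TF b)
    (k : ι) (t : ℝ) :
    (2 * Real.sqrt t) * |∫ z, heat e t a z * heat e t (pd (e k) b) z| ≤
      mom k * ((∫ z, |a z| ^ p) + ∫ z, |b z| ^ q) := by
  have hp := hpq.pos
  have hq := hpq.symm.pos
  have hac : Continuous (fun z => |a z| ^ p) := ha.cont.abs.rpow_const fun z => Or.inr hp.le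
  have hbc : Continuous (fun z => |b z| ^ q) := hb.cont.abs.rpow_const fun z => Or.inr hq.le
  have hai := ha.rpow_int hp
  have hbi := hb.rpow_int hq
  obtain ⟨B, hB0, hB⟩ := hb.bdd
  have hst : 0 ≤ 2 * Real.sqrt t := by positivity
  have hsc : Continuous (fun s : ι → ℝ => |s k|) := by fun_prop
  have hsi := (gm_int_coord k).abs
  have pt : ∀ z, (2 * Real.sqrt t) * |heat e t a z * heat e t (pd (e k) b) z| ≤
      mom k * heat e t (fun z => |a z| ^ p) z +
        ∫ s, |s k| * |b (z - Real.sqrt t • lin e s)| ^ q ∂(gm ι) := by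
    intro z
    have h1 := heat_stein e hb k t z
    have h2 : (2 * Real.sqrt t) * |heat e t (pd (e k) b) z| ≤
        ∫ s, |s k| * |b (z - Real.sqrt t • lin e s)| ∂(gm ι) := by
      have : (2 * Real.sqrt t) * |heat e t (pd (e k) b) z| =
        |∫ s, s k * b (z - Real.sqrt t • lin e s) ∂(gm ι)| := by
        rw [h1, abs_mul, abs_neg, abs_of_nonneg hst]
      rw [this]
      refine (abs_integral_le_integral_abs).trans (le_of_eq ?_)
      simp only [abs_mul]
    have hbi2 : Integrable (fun s : ι → ℝ => |s k| * |b (z - Real.sqrt t • lin e s)|) (gm ι) :=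
      hsi.mul_bdd (c := B) (heat_integrand_cont e hb.cont.abs t z).aestronglyMeasurable
        (Filter.Eventually.of_forall fun s => by simpa using hB _)
    have hbi3 : Integrable (fun s : ι → ℝ => |s k| * |b (z - Real.sqrt t • lin e s)| ^ q) (gm ι) :=
      hsi.mul_bdd (c := B ^ q) (heat_integrand_cont e hbc t z).aestronglyMeasurable
        (Filter.Eventually.of_forall fun s => by
          rw [Real.norm_of_nonneg (by positivity)]
          exact Real.rpow_le_rpow (abs_nonneg _) (hB _) hq.le)
    calc (2 * Real.sqrt t) * |heat e t a z * heat e t (pd (e k) b) z|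
        = |heat e t a z| * ((2 * Real.sqrt t) * |heat e t (pd (e k) b) z|) := by rw [abs_mul]; ring
      _ ≤ |heat e t a z| * ∫ s, |s k| * |b (z - Real.sqrt t • lin e s)| ∂(gm ι) := by gcongr
      _ = ∫ s, |s k| * (|heat e t a z| * |b (z - Real.sqrt t • lin e s)|) ∂(gm ι) := by
          rw [← integral_const_mul]; congr 1; funext s; ring
      _ ≤ ∫ s, (|s k| * heat e t (fun z => |a z| ^ p) z + |s k| * |b (z - Real.sqrt t • lin e s)| ^ q) ∂(gm ι) := by
          refine integral_mono ?_ ((hsi.mul_const _).add hbi3) fun s => ?_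
          · refine (hbi2.const_mul |heat e t a z|).congr (Filter.Eventually.of_forall fun s => ?_)
            simp only; ring
          · rw [← mul_add]
            exact mul_le_mul_of_nonneg_left (heat_jensen e hpq ha t z (abs_nonneg _)) (abs_nonneg _)
      _ = _ := by
          rw [integral_add (hsi.mul_const _) hbi3, integral_mul_const]; rfl
  calc (2 * Real.sqrt t) * |∫ z, heat e t a z * heat e t (pd (e k) b) z|
      ≤ (2 * Real.sqrt t) * ∫ z, |heat e t a z * heat e t (pd (e k) b) z| :=
        mul_le_mul_of_nonneg_left abs_integral_le_integral_abs hst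
    _ = ∫ z, (2 * Real.sqrt t) * |heat e t a z * heat e t (pd (e k) b) z| := (integral_const_mul _ _).symm
    _ ≤ ∫ z, (mom k * heat e t (fun z => |a z| ^ p) z +
        ∫ s, |s k| * |b (z - Real.sqrt t • lin e s)| ^ q ∂(gm ι)) :=
        integral_mono ((heat_mul_integrable e ha (hb.pd _) t).abs.const_mul _)
          (((heat_integrable' e hac hai t).const_mul _).add
            (heatw_integrable_z e hbc hbi (fun s => |s k|) hsc hsi t)) pt
    _ = _ := by
        rw [integral_add ((heat_integrable' e hac hai t).const_mul _)
            (heatw_integrable_z e hbc hbi (fun s => |s k|) hsc hsi t), integral_const_mul,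
          heat_integral e hac hai, heatw_integral e hbc hbi (fun s => |s k|) hsc hsi t, mul_add]
        rfl
end dev3

section dev4
/-! ### The Bellman function -/

def bN (ε v : ℝ) : ℝ := v ^ 2 + ε ^ 2
def bW (q ε u v : ℝ) : ℝ := Real.sqrt (bN ε v ^ q + bN ε v * u ^ 2)
def bQ (p q K ε u v : ℝ) : ℝ := bN ε u ^ (p / 2) + K * bN ε v ^ (q / 2) + bW q ε u v
def bS (q ε u v : ℝ) : ℝ := q * bN ε v ^ (q - 1) + u ^ 2
def bQu (p q ε u v : ℝ) : ℝ := p * u * bN ε u ^ (p / 2 - 1) + bN ε v * u / bW q ε u v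
def bQv (q K ε u v : ℝ) : ℝ := v * (K * q * bN ε v ^ (q / 2 - 1) + bS q ε u v / bW q ε u v)
def bQuu (p q ε u v : ℝ) : ℝ := p * bN ε u ^ (p / 2 - 1) + p * (p - 2) * u ^ 2 * bN ε u ^ (p / 2 - 1 - 1)
  + bN ε v / bW q ε u v - bN ε v ^ 2 * u ^ 2 / bW q ε u v ^ 3
def bQuv (q ε u v : ℝ) : ℝ := u * v * (2 / bW q ε u v - bN ε v * bS q ε u v / bW q ε u v ^ 3)
def bQvv (q K ε u v : ℝ) : ℝ := K * q * bN ε v ^ (q / 2 - 1)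
  + K * q * (q - 2) * v ^ 2 * bN ε v ^ (q / 2 - 1 - 1)
  + bS q ε u v / bW q ε u v
  + v ^ 2 * (2 * q * (q - 1) * bN ε v ^ (q - 1 - 1) / bW q ε u v - bS q ε u v ^ 2 / bW q ε u v ^ 3)

lemma bN_pos {ε : ℝ} (hε : 0 < ε) (v : ℝ) : 0 < bN ε v := by unfold bN; positivity

lemma bWi_pos {ε : ℝ} (hε : 0 < ε) (q u v : ℝ) : 0 < bN ε v ^ q + bN ε v * u ^ 2 := by
  have := bN_pos hε v
  positivity

lemma bW_pos {ε : ℝ} (hε : 0 < ε) (q u v : ℝ) : 0 < bW q ε u v := Real.sqrt_pos.mpr (bWi_pos hε q u v)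

lemma bW_sq {ε : ℝ} (hε : 0 < ε) (q u v : ℝ) : bW q ε u v ^ 2 = bN ε v ^ q + bN ε v * u ^ 2 :=
  Real.sq_sqrt (bWi_pos hε q u v).le

section deriv
variable {F : Type*} [NormedAddCommGroup F] [NormedSpace ℝ F] {u v : F → ℝ} {u' v' : F →L[ℝ] ℝ} {x : F}

lemma bN_hasFDerivAt (ε : ℝ) (hv : HasFDerivAt v v' x) :
    HasFDerivAt (fun x => bN ε (v x)) ((2 * v x) • v') x := by
  unfold bN
  have := (hv.pow 2).add_const (ε ^ 2)
  refine this.congr_fderiv ?_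
  ext w; simp

lemma bW_hasFDerivAt {q ε : ℝ} (hε : 0 < ε) (hu : HasFDerivAt u u' x) (hv : HasFDerivAt v v' x) :
    HasFDerivAt (fun x => bW q ε (u x) (v x))
      ((bN ε (v x) * u x / bW q ε (u x) (v x)) • u' + (v x * bS q ε (u x) (v x) / bW q ε (u x) (v x)) • v') x := by
  have hn := bN_hasFDerivAt ε hv
  have h1 := (hn.rpow_const (p := q) (Or.inl (bN_pos hε _).ne')).add (hn.mul (hu.pow 2))
  have h2 := h1.sqrt (bWi_pos hε q (u x) (v x)).ne'
  refine h2.congr_fderiv ?_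
  have hW := bW_pos hε q (u x) (v x)
  ext w
  simp only [smul_apply, add_apply, smul_eq_mul, Pi.add_apply, Pi.mul_apply, Pi.pow_apply]
  change 1 / (2 * bW q ε (u x) (v x)) * _ = _
  unfold bS
  field_simp
  simp
  ring

lemma bQ_hasFDerivAt {p q K ε : ℝ} (hε : 0 < ε) (hu : HasFDerivAt u u' x) (hv : HasFDerivAt v v' x) :
    HasFDerivAt (fun x => bQ p q K ε (u x) (v x))
      (bQu p q ε (u x) (v x) • u' + bQv q K ε (u x) (v x) • v') x := by
  have hn := bN_hasFDerivAt ε hv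
  have hm := bN_hasFDerivAt ε hu
  have h := ((hm.rpow_const (p := p / 2) (Or.inl (bN_pos hε _).ne')).add
    ((hn.rpow_const (p := q / 2) (Or.inl (bN_pos hε _).ne')).const_mul K)).add
    (bW_hasFDerivAt (q := q) hε hu hv)
  refine h.congr_fderiv ?_
  ext w
  simp only [smul_apply, add_apply, smul_eq_mul, bQu, bQv]
  ring

lemma bS_hasFDerivAt {q ε : ℝ} (hε : 0 < ε) (hu : HasFDerivAt u u' x) (hv : HasFDerivAt v v' x) :
    HasFDerivAt (fun x => bS q ε (u x) (v x))
      ((2 * u x) • u' + (2 * v x * q * (q - 1) * bN ε (v x) ^ (q - 1 - 1)) • v') x := by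
  have hn := bN_hasFDerivAt ε hv
  have h := ((hn.rpow_const (p := q - 1) (Or.inl (bN_pos hε _).ne')).const_mul q).add (hu.pow 2)
  refine h.congr_fderiv ?_
  ext w
  simp only [smul_apply, add_apply, smul_eq_mul]
  simp
  ring

lemma fd_div (hu : HasFDerivAt u u' x) (hv : HasFDerivAt v v' x) (h : v x ≠ 0) :
    HasFDerivAt (fun x => u x / v x) ((1 / v x) • u' - (u x / v x ^ 2) • v') x := by
  have h1 := hu.mul ((hasDerivAt_inv h).comp_hasFDerivAt x hv)
  refine h1.congr_fderiv ?_
  ext w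
  simp
  field_simp
  ring

lemma bQu_hasFDerivAt {p q ε : ℝ} (hε : 0 < ε) (hu : HasFDerivAt u u' x) (hv : HasFDerivAt v v' x) :
    HasFDerivAt (fun x => bQu p q ε (u x) (v x))
      (bQuu p q ε (u x) (v x) • u' + bQuv q ε (u x) (v x) • v') x := by
  have hn := bN_hasFDerivAt ε hv
  have hm := bN_hasFDerivAt ε hu
  have hW := bW_pos hε q (u x) (v x)
  have h := ((hu.const_mul p).mul (hm.rpow_const (p := p / 2 - 1) (Or.inl (bN_pos hε _).ne'))).add
    (fd_div (hn.mul hu) (bW_hasFDerivAt (q := q) hε hu hv) hW.ne')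
  refine h.congr_fderiv ?_
  ext w
  simp only [smul_apply, add_apply, smul_eq_mul, bQuu, bQuv, sub_apply, Pi.mul_apply]
  field_simp
  ring

lemma bQv_hasFDerivAt {q K ε : ℝ} (hε : 0 < ε) (hu : HasFDerivAt u u' x) (hv : HasFDerivAt v v' x) :
    HasFDerivAt (fun x => bQv q K ε (u x) (v x))
      (bQuv q ε (u x) (v x) • u' + bQvv q K ε (u x) (v x) • v') x := by
  have hn := bN_hasFDerivAt ε hv
  have hW := bW_pos hε q (u x) (v x)
  have h := hv.mul (((hn.rpow_const (p := q / 2 - 1) (Or.inl (bN_pos hε _).ne')).const_mul (K * q)).add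
    (fd_div (bS_hasFDerivAt (q := q) hε hu hv) (bW_hasFDerivAt (q := q) hε hu hv) hW.ne'))
  refine h.congr_fderiv ?_
  ext w
  simp only [smul_apply, add_apply, smul_eq_mul, bQvv, bQuv, sub_apply, Pi.mul_apply, Pi.add_apply]
  field_simp
  ring

end deriv

section cont
variable {p q K ε : ℝ}

lemma bQ_cont (hp : 0 ≤ p) (hq : 0 ≤ q) :
    Continuous (fun w : ℝ × ℝ × ℝ => bQ p q K w.1 w.2.1 w.2.2) := by
  have h1 : Continuous (fun w : ℝ × ℝ × ℝ => bN w.1 w.2.1) := by unfold bN; fun_prop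
  have h2 : Continuous (fun w : ℝ × ℝ × ℝ => bN w.1 w.2.2) := by unfold bN; fun_prop
  unfold bQ bW
  refine ((h1.rpow_const fun _ => Or.inr (by positivity)).add
    (continuous_const.mul (h2.rpow_const fun _ => Or.inr (by positivity)))).add ?_
  exact Real.continuous_sqrt.comp ((h2.rpow_const fun _ => Or.inr hq).add (h2.mul (by fun_prop)))

lemma bN_cont1 : Continuous (fun w : ℝ × ℝ => bN ε w.1) := by unfold bN; fun_prop
lemma bN_cont2 : Continuous (fun w : ℝ × ℝ => bN ε w.2) := by unfold bN; fun_prop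
lemma bN_pow1 (hε : 0 < ε) (r : ℝ) : Continuous (fun w : ℝ × ℝ => bN ε w.1 ^ r) :=
  bN_cont1.rpow_const fun _ => Or.inl (bN_pos hε _).ne'
lemma bN_pow2 (hε : 0 < ε) (r : ℝ) : Continuous (fun w : ℝ × ℝ => bN ε w.2 ^ r) :=
  bN_cont2.rpow_const fun _ => Or.inl (bN_pos hε _).ne'
lemma bW_cont (hε : 0 < ε) : Continuous (fun w : ℝ × ℝ => bW q ε w.1 w.2) := by
  unfold bW
  exact Real.continuous_sqrt.comp ((bN_pow2 hε q).add (bN_cont2.mul (by fun_prop)))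
lemma bS_cont (hε : 0 < ε) : Continuous (fun w : ℝ × ℝ => bS q ε w.1 w.2) := by
  unfold bS
  exact (continuous_const.mul (bN_pow2 hε _)).add (by fun_prop)

lemma bQu_cont (hε : 0 < ε) : Continuous (fun w : ℝ × ℝ => bQu p q ε w.1 w.2) := by
  unfold bQu
  have h1 := bN_pow1 hε (p / 2 - 1)
  have h2 : Continuous (fun w : ℝ × ℝ => bN ε w.2) := bN_cont2
  have h3 := bW_cont (q := q) hε
  exact ((continuous_const.mul continuous_fst).mul h1).add
    ((h2.mul continuous_fst).div h3 fun w => (bW_pos hε _ _ _).ne')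

lemma bQv_cont (hε : 0 < ε) : Continuous (fun w : ℝ × ℝ => bQv q K ε w.1 w.2) := by
  unfold bQv
  have h1 := bN_pow2 hε (q / 2 - 1)
  exact continuous_snd.mul ((continuous_const.mul h1).add
    ((bS_cont hε).div (bW_cont hε) fun w => (bW_pos hε _ _ _).ne'))

lemma bQuu_cont (hε : 0 < ε) : Continuous (fun w : ℝ × ℝ => bQuu p q ε w.1 w.2) := by
  unfold bQuu
  have h1 := bN_pow1 hε (p / 2 - 1)
  have h1' := bN_pow1 hε (p / 2 - 1 - 1)
  have h2 : Continuous (fun w : ℝ × ℝ => bN ε w.2) := bN_cont2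
  have h3 := bW_cont (q := q) hε
  exact (((continuous_const.mul h1).add ((continuous_const.mul (continuous_fst.pow 2)).mul h1')).add
    (h2.div h3 fun w => (bW_pos hε _ _ _).ne')).sub
    (((h2.pow 2).mul (continuous_fst.pow 2)).div (h3.pow 3) fun w => (pow_pos (bW_pos hε _ _ _) 3).ne')

lemma bQuv_cont (hε : 0 < ε) : Continuous (fun w : ℝ × ℝ => bQuv q ε w.1 w.2) := by
  unfold bQuv
  have h2 : Continuous (fun w : ℝ × ℝ => bN ε w.2) := bN_cont2
  have h3 := bW_cont (q := q) hε
  exact (continuous_fst.mul continuous_snd).mul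
    ((continuous_const.div h3 fun w => (bW_pos hε _ _ _).ne').sub
      ((h2.mul (bS_cont hε)).div (h3.pow 3) fun w => (pow_pos (bW_pos hε _ _ _) 3).ne'))

lemma bQvv_cont (hε : 0 < ε) : Continuous (fun w : ℝ × ℝ => bQvv q K ε w.1 w.2) := by
  unfold bQvv
  have h3 := bW_cont (q := q) hε
  exact (((continuous_const.mul (bN_pow2 hε _)).add
    ((continuous_const.mul (continuous_snd.pow 2)).mul (bN_pow2 hε _))).add
    ((bS_cont hε).div h3 fun w => (bW_pos hε _ _ _).ne')).add
    ((continuous_snd.pow 2).mul (((continuous_const.mul (bN_pow2 hε _)).div h3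
      fun w => (bW_pos hε _ _ _).ne').sub
      (((bS_cont hε).pow 2).div (h3.pow 3) fun w => (pow_pos (bW_pos hε _ _ _) 3).ne')))

end cont

lemma bdd_on_box {f : ℝ × ℝ → ℝ} (hf : Continuous f) (B : ℝ) :
    ∃ C, 0 ≤ C ∧ ∀ u v : ℝ, |u| ≤ B → |v| ≤ B → |f (u, v)| ≤ C := by
  obtain ⟨C, hC⟩ := ((isCompact_Icc (a := -B) (b := B)).prod (isCompact_Icc (a := -B) (b := B))).exists_bound_of_continuousOn
    hf.continuousOn
  refine ⟨max C 0, le_max_right _ _, fun u v hu hv => (hC (u, v) ?_).trans (le_max_left _ _)⟩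
  exact ⟨abs_le.mp hu, abs_le.mp hv⟩
end dev4

section dev5
/-! ### Hessian lower bound -/

section hess
variable {p q ε u v : ℝ}

lemma bK_pos (hq1 : 1 < q) : 0 < 12 / (q * (q - 1)) := by
  have : 0 < q - 1 := by linarith
  positivity

lemma bQuu_ge (hp : 2 ≤ p) (hpq : p.HolderConjugate q) (hε : 0 < ε) :
    (1 / 3) * (bN ε v ^ (q / 2 - 1))⁻¹ ≤ bQuu p q ε u v := by
  set n := bN ε v with hn
  have hn0 : 0 < n := bN_pos hε v
  set W := bW q ε u v with hW
  have hW0 : 0 < W := bW_pos hε q u v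
  have hWsq : W ^ 2 = n ^ q + n * u ^ 2 := bW_sq hε q u v
  have hNu : 0 < bN ε u := bN_pos hε u
  set m := n ^ (q - 1) with hm
  have hm0 : 0 < m := by positivity
  have hnq : n ^ q = n * m := by
    rw [hm, ← Real.rpow_one_add' hn0.le (by have := hpq.symm.lt; linarith)]; ring_nf
  set β := n ^ (q / 2 - 1) with hβ
  have hβ0 : 0 < β := by positivity
  have hβ2 : β ^ 2 * n = m := by
    rw [hβ, hm, ← Real.rpow_natCast, ← Real.rpow_mul hn0.le, ← Real.rpow_add_one hn0.ne']
    norm_num; ring_nf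
  rw [hnq] at hWsq
  have hA : 0 ≤ p * (p - 2) * u ^ 2 * bN ε u ^ (p / 2 - 1 - 1) := by
    have : 0 ≤ p - 2 := by linarith
    positivity
  have hB : n / W - n ^ 2 * u ^ 2 / W ^ 3 = n ^ 2 * m / W ^ 3 := by
    field_simp
    rw [hWsq]; ring
  have hge : p * bN ε u ^ (p / 2 - 1) + n ^ 2 * m / W ^ 3 ≤ bQuu p q ε u v := by
    rw [← hB]; unfold bQuu; rw [← hn, ← hW]; linarith
  refine le_trans ?_ hge
  have hX0 : 0 ≤ n ^ 2 * m / W ^ 3 := by positivity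
  have hY0 : 0 ≤ p * bN ε u ^ (p / 2 - 1) := by positivity
  rcases le_total (u ^ 2) m with hum | hum
  · have : (1 / 3) * β⁻¹ ≤ n ^ 2 * m / W ^ 3 := by
      refine (sq_le_sq₀ (by positivity) hX0).mp ?_
      have hW6 : W ^ 6 ≤ 8 * n ^ 3 * m ^ 3 := by
        have : W ^ 2 ≤ 2 * n * m := by rw [hWsq]; nlinarith
        calc W ^ 6 = (W ^ 2) ^ 3 := by ring
          _ ≤ (2 * n * m) ^ 3 := by gcongr
          _ = _ := by ring
      have e1 : (n ^ 2 * m / W ^ 3) ^ 2 = n ^ 4 * m ^ 2 / W ^ 6 := by field_simp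
      have e2 : (1 / 3 * β⁻¹) ^ 2 = n / (9 * m) := by
        rw [← hβ2]; field_simp; norm_num
      rw [e1, e2, div_le_div_iff₀ (by positivity) (by positivity)]
      nlinarith [mul_le_mul_of_nonneg_left hW6 hn0.le, show 0 < n ^ 4 * m ^ 3 by positivity]
    linarith
  · have h1 : m ^ (p / 2 - 1) ≤ bN ε u ^ (p / 2 - 1) := by
      apply Real.rpow_le_rpow hm0.le _ (by linarith)
      unfold bN; nlinarith [sq_nonneg ε]
    have h2 : m ^ (p / 2 - 1) = β⁻¹ := by
      rw [hm, hβ, ← Real.rpow_neg hn0.le, ← Real.rpow_mul hn0.le]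
      congr 1
      have := hpq.sub_one_mul_conj
      have h3 : (p - 1) * (q - 1) = 1 := by
        have := hpq.sub_one_mul_conj; linarith
      linarith
    rw [h2] at h1
    have : 0 < β⁻¹ := by positivity
    nlinarith

lemma bQuv_le (hq1 : 1 < q) (hq2 : q ≤ 2) (hε : 0 < ε) : |bQuv q ε u v| ≤ 1 := by
  set n := bN ε v with hn
  have hn0 : 0 < n := bN_pos hε v
  set W := bW q ε u v with hW
  have hW0 : 0 < W := bW_pos hε q u v
  have hWsq : W ^ 2 = n ^ q + n * u ^ 2 := bW_sq hε q u v
  set m := n ^ (q - 1) with hm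
  have hm0 : 0 < m := by positivity
  have hnq : n ^ q = n * m := by
    rw [hm, ← Real.rpow_one_add' hn0.le (by linarith)]; ring_nf
  rw [hnq] at hWsq
  have e : bQuv q ε u v = u * v * (n * ((2 - q) * m + u ^ 2)) / W ^ 3 := by
    unfold bQuv bS; rw [← hn, ← hW, ← hm]
    field_simp
    rw [hWsq]; ring
  have hvn : v ^ 2 ≤ n := by rw [hn]; unfold bN; nlinarith [sq_nonneg ε]
  have huv : |u * v| ≤ W := by
    apply abs_le_of_sq_le_sq _ hW0.le
    rw [hWsq]; nlinarith [sq_nonneg u, mul_pos hn0 hm0]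
  have h2 : n * ((2 - q) * m + u ^ 2) ≤ W ^ 2 := by rw [hWsq]; nlinarith [mul_pos hn0 hm0]
  have h3 : 0 ≤ n * ((2 - q) * m + u ^ 2) := by
    have : 0 ≤ 2 - q := by linarith
    positivity
  rw [e, abs_div, abs_mul, abs_of_nonneg h3, abs_of_pos (pow_pos hW0 3), div_le_one (by positivity)]
  calc _ ≤ W * W ^ 2 := by gcongr
    _ = W ^ 3 := by ring

lemma bQvv_ge (hq1 : 1 < q) (hq2 : q ≤ 2) (hε : 0 < ε) :
    12 * bN ε v ^ (q / 2 - 1) ≤ bQvv q (12 / (q * (q - 1))) ε u v := by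
  set n := bN ε v with hn
  have hn0 : 0 < n := bN_pos hε v
  set W := bW q ε u v with hW
  have hW0 : 0 < W := bW_pos hε q u v
  have hWsq : W ^ 2 = n ^ q + n * u ^ 2 := bW_sq hε q u v
  set m := n ^ (q - 1) with hm
  have hm0 : 0 < m := by positivity
  have hnq : n ^ q = n * m := by
    rw [hm, ← Real.rpow_one_add' hn0.le (by linarith)]; ring_nf
  rw [hnq] at hWsq
  set β := n ^ (q / 2 - 1) with hβ
  have hβ0 : 0 < β := by positivity
  have e1 : n ^ (q / 2 - 1 - 1) = β / n := by rw [Real.rpow_sub_one hn0.ne']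
  have e2 : n ^ (q - 1 - 1) = m / n := by rw [Real.rpow_sub_one hn0.ne']
  have hvn : v ^ 2 ≤ n := by rw [hn]; unfold bN; nlinarith [sq_nonneg ε]
  have hq0 : 0 < q - 1 := by linarith
  set K := 12 / (q * (q - 1)) with hK
  have hKq : K * q * (q - 1) = 12 := by rw [hK]; field_simp
  have hK0 : 0 < K := bK_pos hq1
  unfold bQvv bS
  rw [← hn, ← hW, ← hm, e1, e2, ← hβ]
  have hA : 12 * β ≤ K * q * β + K * q * (q - 2) * v ^ 2 * (β / n) := by
    have h1 : v ^ 2 / n ≤ 1 := by rw [div_le_one hn0]; exact hvn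
    have h2 : K * q * (q - 2) * v ^ 2 * (β / n) = K * q * (q - 2) * β * (v ^ 2 / n) := by ring
    have h3 : 0 ≤ K * q * (2 - q) * β := by
      have : 0 ≤ 2 - q := by linarith
      positivity
    rw [h2, ← hKq]
    nlinarith
  have hB : 0 ≤ (q * m + u ^ 2) / W
      + v ^ 2 * (2 * q * (q - 1) * (m / n) / W - (q * m + u ^ 2) ^ 2 / W ^ 3) := by
    have e : (q * m + u ^ 2) / W
      + v ^ 2 * (2 * q * (q - 1) * (m / n) / W - (q * m + u ^ 2) ^ 2 / W ^ 3)
      = ((q * m + u ^ 2) * (m + u ^ 2) * (n - v ^ 2)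
        + v ^ 2 * ((q - 1) * m * (q * m + (2 * q - 1) * u ^ 2))) / W ^ 3 := by
      have : (q * m + u ^ 2) / W
        + v ^ 2 * (2 * q * (q - 1) * (m / n) / W - (q * m + u ^ 2) ^ 2 / W ^ 3)
        = ((q * m + u ^ 2) * W ^ 2 + v ^ 2 * (2 * q * (q - 1) * (m / n) * W ^ 2 - (q * m + u ^ 2) ^ 2))
          / W ^ 3 := by field_simp
      rw [this, hWsq]
      congr 1
      field_simp
      ring
    rw [e]
    have : 0 ≤ n - v ^ 2 := by linarith
    have : 0 ≤ 2 * q - 1 := by linarith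
    positivity
  linarith

lemma bHess_ge (hp : 2 ≤ p) (hpq : p.HolderConjugate q) (hε : 0 < ε) (x y : ℝ) :
    (1 / 6) * (x ^ 2 * (bN ε v ^ (q / 2 - 1))⁻¹ + y ^ 2 * bN ε v ^ (q / 2 - 1))
    ≤ bQuu p q ε u v * x ^ 2 + 2 * bQuv q ε u v * (x * y)
      + bQvv q (12 / (q * (q - 1))) ε u v * y ^ 2 := by
  have hq1 : 1 < q := hpq.symm.lt
  have hq2 : q ≤ 2 := by
    have := hpq.sub_one_mul_conj
    nlinarith
  have h1 := bQuu_ge (u := u) (v := v) hp hpq hε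
  have h2 := bQuv_le (u := u) (v := v) hq1 hq2 hε
  have h3 := bQvv_ge (u := u) (v := v) hq1 hq2 hε
  set β := bN ε v ^ (q / 2 - 1)
  have hβ0 : 0 < β := Real.rpow_pos_of_pos (bN_pos hε v) _
  have h4 : -|x * y| ≤ bQuv q ε u v * (x * y) := by
    have : |bQuv q ε u v * (x * y)| ≤ |x * y| := by
      rw [abs_mul]; nlinarith [abs_nonneg (x * y)]
    linarith [neg_abs_le (bQuv q ε u v * (x * y))]
  have h5 : |x * y| ≤ (1 / 12) * (x ^ 2 * β⁻¹) + 3 * (y ^ 2 * β) := by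
    have : (1 / 12) * (x ^ 2 * β⁻¹) + 3 * (y ^ 2 * β) = (x ^ 2 + 36 * (y * β) ^ 2) / (12 * β) := by
      field_simp; ring
    rw [this, le_div_iff₀ (by positivity)]
    rw [abs_mul, mul_pow, ← sq_abs x, ← sq_abs y]
    nlinarith [sq_nonneg (|x| - 6 * (|y| * β))]
  nlinarith [sq_nonneg x, sq_nonneg y, mul_le_mul_of_nonneg_right h1 (sq_nonneg x),
    mul_le_mul_of_nonneg_right h3 (sq_nonneg y), mul_nonneg (sq_nonneg y) hβ0.le]

lemma pair_le {β x y : ℝ} (hβ : 0 < β) : (1 / 3) * (|x| * |y|) ≤ (1 / 6) * (x ^ 2 * β⁻¹ + y ^ 2 * β) := by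
  have : x ^ 2 * β⁻¹ + y ^ 2 * β = (x ^ 2 + (y * β) ^ 2) / β := by field_simp
  rw [this]
  have : 2 * (|x| * |y|) ≤ (x ^ 2 + (y * β) ^ 2) / β := by
    rw [le_div_iff₀ hβ]
    rw [mul_pow, ← sq_abs x, ← sq_abs y]
    nlinarith [sq_nonneg (|x| - |y| * β)]
  linarith

lemma bHess_sum {ι : Type*} [Fintype ι] (hp : 2 ≤ p) (hpq : p.HolderConjugate q) (hε : 0 < ε) (x y : ι → ℝ)
    (j k : ι) :
    (1 / 3) * (|x j| * |y k|) ≤ ∑ i, (bQuu p q ε u v * x i ^ 2 + 2 * bQuv q ε u v * (x i * y i)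
      + bQvv q (12 / (q * (q - 1))) ε u v * y i ^ 2) := by
  set β := bN ε v ^ (q / 2 - 1)
  have hβ0 : 0 < β := Real.rpow_pos_of_pos (bN_pos hε v) _
  refine (pair_le hβ0).trans (le_trans ?_ (Finset.sum_le_sum fun i _ => bHess_ge hp hpq hε (x i) (y i)))
  rw [← Finset.mul_sum, Finset.sum_add_distrib]
  gcongr
  · exact Finset.single_le_sum (f := fun i => x i ^ 2 * β⁻¹) (fun i _ => by positivity) (Finset.mem_univ j)
  · exact Finset.single_le_sum (f := fun i => y i ^ 2 * β) (fun i _ => by positivity) (Finset.mem_univ k)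

end hess
end dev5

section dev6
variable {N : ℕ} {ι : Type} [Fintype ι] (e : ι → Pt N)

lemma heat_st_mul_integrable {a b : Pt N → ℝ} (ha : TF a) (hb : TF b) (T : ℝ) :
    Integrable (fun q : ℝ × Pt N => heat e q.1 a q.2 * heat e q.1 b q.2)
      ((volume.restrict (Set.Ioc 0 T)).prod (volume : Measure (Pt N))) := by
  obtain ⟨A, _, hA⟩ := ha.bdd
  exact (heat_st_integrable e hb T).bdd_mul (c := A) (heat_cont e ha).aestronglyMeasurable
        (Filter.Eventually.of_forall fun z => heat_abs_le e hA _ _)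

/-- divergence theorem in a direction -/
lemma int_fderiv_zero {G : Pt N → ℝ} {G' : Pt N → Pt N →L[ℝ] ℝ} (w : Pt N)
    (hG : ∀ z, HasFDerivAt G (G' z) z) (hi : Integrable G) (hi' : Integrable (fun z => G' z w)) :
    ∫ z, G' z w = 0 := by
  have h := integral_mul_fderiv_eq_neg_fderiv_mul_of_integrable (𝕜 := ℝ) (μ := (volume : Measure (Pt N)))
    (f := fun _ => (1 : ℝ)) (g := G) (v := w) (by simp) (by simpa [(hG _).fderiv] using hi')
    (by simpa using hi) (fun z _ => by fun_prop) (fun z _ => (hG z).differentiableAt)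
  simpa [(hG _).fderiv] using h

section bell
variable {p q ε : ℝ} {F h : Pt N → ℝ}

/-- time derivative of the Bellman function along the flow -/
def bD (p q K ε : ℝ) (F h : Pt N → ℝ) (t : ℝ) (z : Pt N) : ℝ :=
  bQu p q ε (heat e t F z) (heat e t h z) * heat e t (lap e F) z
    + bQv q K ε (heat e t F z) (heat e t h z) * heat e t (lap e h) z

def bHs (p q K ε : ℝ) (F h : Pt N → ℝ) (t : ℝ) (z : Pt N) : ℝ :=
  ∑ i, (bQuu p q ε (heat e t F z) (heat e t h z) * heat e t (pd (e i) F) z ^ 2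
    + 2 * bQuv q ε (heat e t F z) (heat e t h z) * (heat e t (pd (e i) F) z * heat e t (pd (e i) h) z)
    + bQvv q K ε (heat e t F z) (heat e t h z) * heat e t (pd (e i) h) z ^ 2)

lemma bcomp_cont {f : ℝ × ℝ → ℝ} (hf : Continuous f) (hF : TF F) (hh : TF h) :
    Continuous (fun r : ℝ × Pt N => f (heat e r.1 F r.2, heat e r.1 h r.2)) :=
  hf.comp ((heat_cont e hF).prodMk (heat_cont e hh))

lemma bcomp_bdd {f : ℝ × ℝ → ℝ} (hf : Continuous f) (hF : TF F) (hh : TF h) :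
    ∃ C, ∀ t z, |f (heat e t F z, heat e t h z)| ≤ C := by
  obtain ⟨A, _, hA⟩ := hF.bdd
  obtain ⟨B, _, hB⟩ := hh.bdd
  obtain ⟨C, _, hC⟩ := bdd_on_box hf (max A B)
  exact ⟨C, fun t z => hC _ _ ((heat_abs_le e hA t z).trans (le_max_left _ _))
    ((heat_abs_le e hB t z).trans (le_max_right _ _))⟩

lemma bcomp_int {f : ℝ × ℝ → ℝ} (hf : Continuous f) (hF : TF F) (hh : TF h) {a : Pt N → ℝ} (t : ℝ)
    (ha : Integrable a) : Integrable (fun z => f (heat e t F z, heat e t h z) * a z) := by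
  obtain ⟨C, hC⟩ := bcomp_bdd e hf hF hh
  exact ha.bdd_mul (c := C) ((bcomp_cont e hf hF hh).comp (Continuous.prodMk_right t)).aestronglyMeasurable
    (Filter.Eventually.of_forall fun z => hC t z)

lemma bcomp_st_int {f : ℝ × ℝ → ℝ} (hf : Continuous f) (hF : TF F) (hh : TF h) {a : Pt N → ℝ} (T : ℝ)
    (ha : TF a) : Integrable (fun r : ℝ × Pt N => f (heat e r.1 F r.2, heat e r.1 h r.2) * heat e r.1 a r.2)
      ((volume.restrict (Set.Ioc 0 T)).prod (volume : Measure (Pt N))) := by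
  obtain ⟨C, hC⟩ := bcomp_bdd e hf hF hh
  exact (heat_st_integrable e ha T).bdd_mul (c := C) (bcomp_cont e hf hF hh).aestronglyMeasurable
    (Filter.Eventually.of_forall fun z => hC _ _)

lemma bD_st_int (hε : 0 < ε) (K : ℝ) (hF : TF F) (hh : TF h) (T : ℝ) :
    Integrable (fun r : ℝ × Pt N => bD e p q K ε F h r.1 r.2)
      ((volume.restrict (Set.Ioc 0 T)).prod (volume : Measure (Pt N))) :=
  (bcomp_st_int e (bQu_cont hε) hF hh T (lap_TF e hF)).add
    (bcomp_st_int e (bQv_cont hε) hF hh T (lap_TF e hh))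

lemma bHs_int (hε : 0 < ε) (K : ℝ) (hF : TF F) (hh : TF h) (t : ℝ) :
    Integrable (bHs e p q K ε F h t) := by
  unfold bHs
  refine integrable_finsetSum _ fun i _ => Integrable.add (Integrable.add ?_ ?_) ?_
  · have := bcomp_int e (bQuu_cont (p := p) (q := q) hε) hF hh t (heat_mul_integrable e (hF.pd (e i)) (hF.pd (e i)) t)
    simpa [pow_two] using this
  · have := (bcomp_int e (bQuv_cont (q := q) hε) hF hh t (heat_mul_integrable e (hF.pd (e i)) (hh.pd (e i)) t)).const_mul 2
    simpa [mul_assoc] using this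
  · have := bcomp_int e (bQvv_cont (q := q) (K := K) hε) hF hh t (heat_mul_integrable e (hh.pd (e i)) (hh.pd (e i)) t)
    simpa [pow_two] using this

lemma heat_fd (hF : TF F) (t : ℝ) (z : Pt N) : HasFDerivAt (heat e t F) (fderiv ℝ (heat e t F) z) z :=
  (heat_diff e hF t z).hasFDerivAt

lemma heat_fd_apply (hF : TF F) (t : ℝ) (z w : Pt N) : fderiv ℝ (heat e t F) z w = heat e t (pd w F) z := by
  rw [← pd_heat e hF]; rfl

lemma bHs_eq (hε : 0 < ε) (K : ℝ) (hF : TF F) (hh : TF h) (t : ℝ) :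
    ∫ z, bHs e p q K ε F h t z = - ∫ z, bD e p q K ε F h t z := by
  have hD : Integrable (bD e p q K ε F h t) :=
    (bcomp_int e (bQu_cont hε) hF hh t (heat_integrable e (lap_TF e hF) t)).add
      (bcomp_int e (bQv_cont hε) hF hh t (heat_integrable e (lap_TF e hh) t))
  rw [eq_neg_iff_add_eq_zero, ← integral_add (bHs_int e hε K hF hh t) hD]
  have hlap : ∀ {g : Pt N → ℝ} (_ : TF g) (z : Pt N),
      heat e t (lap e g) z = ∑ i, heat e t (pd (e i) (pd (e i) g)) z := by
    intro g hg z
    unfold lap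
    rw [heat_sum e _ _ (fun i _ => (hg.pd _).pd _)]
  let G' : ι → Pt N → (Pt N →L[ℝ] ℝ) := fun i z =>
    (bQu p q ε (heat e t F z) (heat e t h z) • fderiv ℝ (heat e t (pd (e i) F)) z
      + heat e t (pd (e i) F) z • (bQuu p q ε (heat e t F z) (heat e t h z) • fderiv ℝ (heat e t F) z
        + bQuv q ε (heat e t F z) (heat e t h z) • fderiv ℝ (heat e t h) z))
    + (bQv q K ε (heat e t F z) (heat e t h z) • fderiv ℝ (heat e t (pd (e i) h)) z
      + heat e t (pd (e i) h) z • (bQuv q ε (heat e t F z) (heat e t h z) • fderiv ℝ (heat e t F) z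
        + bQvv q K ε (heat e t F z) (heat e t h z) • fderiv ℝ (heat e t h) z))
  have hG : ∀ i z, HasFDerivAt (fun z => bQu p q ε (heat e t F z) (heat e t h z) * heat e t (pd (e i) F) z
      + bQv q K ε (heat e t F z) (heat e t h z) * heat e t (pd (e i) h) z) (G' i z) z := fun i z =>
    ((bQu_hasFDerivAt hε (heat_fd e hF t z) (heat_fd e hh t z)).mul (heat_fd e (hF.pd (e i)) t z)).add
      ((bQv_hasFDerivAt hε (heat_fd e hF t z) (heat_fd e hh t z)).mul (heat_fd e (hh.pd (e i)) t z))
  have hG' : ∀ i z, G' i z (e i) =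
      (bQuu p q ε (heat e t F z) (heat e t h z) * heat e t (pd (e i) F) z ^ 2
    + 2 * bQuv q ε (heat e t F z) (heat e t h z) * (heat e t (pd (e i) F) z * heat e t (pd (e i) h) z)
    + bQvv q K ε (heat e t F z) (heat e t h z) * heat e t (pd (e i) h) z ^ 2)
    + (bQu p q ε (heat e t F z) (heat e t h z) * heat e t (pd (e i) (pd (e i) F)) z
    + bQv q K ε (heat e t F z) (heat e t h z) * heat e t (pd (e i) (pd (e i) h)) z) := by
    intro i z
    simp only [G', add_apply, smul_apply, smul_eq_mul, heat_fd_apply e hF,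
      heat_fd_apply e hh, heat_fd_apply e (hF.pd (e i)), heat_fd_apply e (hh.pd (e i))]
    ring
  have hIntg : ∀ i, Integrable (fun z => G' i z (e i)) := by
    intro i
    simp only [hG']
    refine Integrable.add (Integrable.add (Integrable.add ?_ ?_) ?_) (Integrable.add ?_ ?_)
    · have := bcomp_int e (bQuu_cont (p := p) (q := q) hε) hF hh t (heat_mul_integrable e (hF.pd (e i)) (hF.pd (e i)) t)
      simpa [pow_two] using this
    · have := (bcomp_int e (bQuv_cont (q := q) hε) hF hh t (heat_mul_integrable e (hF.pd (e i)) (hh.pd (e i)) t)).const_mul 2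
      simpa [mul_assoc] using this
    · have := bcomp_int e (bQvv_cont (q := q) (K := K) hε) hF hh t (heat_mul_integrable e (hh.pd (e i)) (hh.pd (e i)) t)
      simpa [pow_two] using this
    · exact bcomp_int e (bQu_cont hε) hF hh t (heat_integrable e ((hF.pd _).pd _) t)
    · exact bcomp_int e (bQv_cont hε) hF hh t (heat_integrable e ((hh.pd _).pd _) t)
  have hz : ∀ i, ∫ z, G' i z (e i) = 0 := fun i => by
    refine int_fderiv_zero (e i) (hG i) ?_ (hIntg i)
    exact (bcomp_int e (bQu_cont hε) hF hh t (heat_integrable e (hF.pd _) t)).add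
      (bcomp_int e (bQv_cont hε) hF hh t (heat_integrable e (hh.pd _) t))
  have heq : ∀ z, bHs e p q K ε F h t z + bD e p q K ε F h t z = ∑ i, G' i z (e i) := by
    intro z
    simp only [hG', Finset.sum_add_distrib, ← Finset.mul_sum, ← hlap hF, ← hlap hh, bHs, bD]
  simp only [heq]
  rw [integral_finsetSum _ (fun i _ => hIntg i)]
  simp [hz]

lemma bQ_ge (hp : 0 ≤ p) (hq : 0 ≤ q) {K : ℝ} (hK : 0 ≤ K) (u v : ℝ) :
    bQ p q K ε 0 0 ≤ bQ p q K ε u v := by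
  unfold bQ bW bN
  have h0 : (0 : ℝ) ^ 2 + ε ^ 2 ≤ u ^ 2 + ε ^ 2 := by nlinarith [sq_nonneg u]
  have h1 : (0 : ℝ) ^ 2 + ε ^ 2 ≤ v ^ 2 + ε ^ 2 := by nlinarith [sq_nonneg v]
  have h2 : ((0 : ℝ) ^ 2 + ε ^ 2) * 0 ^ 2 ≤ (v ^ 2 + ε ^ 2) * u ^ 2 := by
    have : 0 ≤ (v ^ 2 + ε ^ 2) * u ^ 2 := by positivity
    simpa using this
  gcongr

lemma bQ_int (hp : 0 ≤ p) (hq : 0 ≤ q) {K : ℝ} (hF : TF F) (hh : TF h) (ε : ℝ) :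
    Integrable (fun z => bQ p q K ε (F z) (h z) - bQ p q K ε 0 0) := by
  apply Continuous.integrable_of_hasCompactSupport
  · have := (bQ_cont (K := K) hp hq).comp ((continuous_const (y := ε)).prodMk (hF.cont.prodMk hh.cont))
    exact this.sub continuous_const
  · refine HasCompactSupport.of_support_subset_isCompact (hF.2.isCompact.union hh.2.isCompact) ?_
    intro z hz
    by_contra hn
    rw [Set.mem_union, not_or] at hn
    apply hz
    simp only
    rw [image_eq_zero_of_notMem_tsupport hn.1, image_eq_zero_of_notMem_tsupport hn.2, sub_self]

lemma bell_eps (hp : 2 ≤ p) (hpq : p.HolderConjugate q) (hε : 0 < ε) (hF : TF F) (hh : TF h)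
    {T : ℝ} (hT : 0 < T) (j k : ι) :
    ∫ t in Set.Ioc 0 T, ∫ z, |heat e t (pd (e j) F) z * heat e t (pd (e k) h) z| ≤
      3 * ∫ z, (bQ p q (12 / (q * (q - 1))) ε (F z) (h z) - bQ p q (12 / (q * (q - 1))) ε 0 0) := by
  set K := 12 / (q * (q - 1)) with hK
  have hK0 : 0 < K := bK_pos hpq.symm.lt
  have hDst := bD_st_int e (p := p) (q := q) hε K hF hh T
  have h1 : ∫ t in Set.Ioc 0 T, ∫ z, |heat e t (pd (e j) F) z * heat e t (pd (e k) h) z| ≤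
      ∫ t in Set.Ioc 0 T, 3 * - ∫ z, bD e p q K ε F h t z := by
    refine integral_mono (heat_st_mul_integrable e (hF.pd _) (hh.pd _) T).abs.integral_prod_left
      (hDst.integral_prod_left.neg.const_mul 3) fun t => ?_
    change ∫ z, |heat e t (pd (e j) F) z * heat e t (pd (e k) h) z| ≤ 3 * - ∫ z, bD e p q K ε F h t z
    rw [← bHs_eq e hε K hF hh t, ← integral_const_mul]
    refine integral_mono (heat_mul_integrable e (hF.pd _) (hh.pd _) t).abs
      ((bHs_int e hε K hF hh t).const_mul 3) fun z => ?_
    have := bHess_sum (u := heat e t F z) (v := heat e t h z) hp hpq hε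
      (fun i => heat e t (pd (e i) F) z) (fun i => heat e t (pd (e i) h) z) j k
    change |heat e t (pd (e j) F) z * heat e t (pd (e k) h) z| ≤ 3 * bHs e p q K ε F h t z
    rw [abs_mul]
    unfold bHs
    linarith
  refine h1.trans ?_
  rw [integral_const_mul, integral_neg]
  rw [integral_integral_swap hDst, ← integral_neg]
  refine mul_le_mul_of_nonneg_left ?_ (by norm_num)
  have hftc : ∀ z, ∫ t in Set.Ioc 0 T, bD e p q K ε F h t z
      = bQ p q K ε (heat e T F z) (heat e T h z) - bQ p q K ε (F z) (h z) := by
    intro z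
    rw [← intervalIntegral.integral_of_le hT.le]
    have hc : Continuous (fun t => bD e p q K ε F h t z) := by
      have hz : Continuous (fun t : ℝ => (t, z)) := Continuous.prodMk_left z
      exact (((bcomp_cont e (bQu_cont hε) hF hh).comp hz).mul ((heat_cont e (lap_TF e hF)).comp hz)).add
        (((bcomp_cont e (bQv_cont hε) hF hh).comp hz).mul ((heat_cont e (lap_TF e hh)).comp hz))
    have := intervalIntegral.integral_eq_sub_of_hasDerivAt_of_le hT.le
      (f := fun t => bQ p q K ε (heat e t F z) (heat e t h z)) (f' := fun t => bD e p q K ε F h t z)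
      ?_ ?_ (hc.intervalIntegrable _ _)
    · rw [this]; simp only [heat_zero]
    · have hz : Continuous (fun t : ℝ => (t, z)) := Continuous.prodMk_left z
      have h1 := (heat_cont e hF).comp hz
      have h2 := (heat_cont e hh).comp hz
      have := (bQ_cont (K := K) hpq.pos.le hpq.symm.pos.le).comp
        ((continuous_const (y := ε)).prodMk (h1.prodMk h2))
      exact this.continuousOn
    · intro t ht
      have h1 := (heat_hasDerivAt e hF t ht.1 z).hasFDerivAt
      have h2 := (heat_hasDerivAt e hh t ht.1 z).hasFDerivAt
      have h3 := (bQ_hasFDerivAt (p := p) (q := q) (K := K) hε h1 h2).hasDerivAt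
      refine h3.congr_deriv ?_
      simp [bD]
  have hi := hDst.integral_prod_right.neg
  refine integral_mono hi (bQ_int hpq.pos.le hpq.symm.pos.le hF hh ε) fun z => ?_
  change - ∫ t in Set.Ioc 0 T, bD e p q K ε F h t z ≤ _
  rw [hftc]
  have := bQ_ge (ε := ε) hpq.pos.le hpq.symm.pos.le hK0.le (heat e T F z) (heat e T h z)
  linarith

lemma bQ_zero_le (hpq : p.HolderConjugate q) {K : ℝ} (u v : ℝ) :
    bQ p q K 0 u v - bQ p q K 0 0 0 ≤ 2 * |u| ^ p + (K + 2) * |v| ^ q := by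
  have hp := hpq.pos
  have hq := hpq.symm.pos
  have e1 : ∀ (x r : ℝ), (x ^ 2) ^ (r / 2) = |x| ^ r := by
    intro x r
    rw [← sq_abs, ← Real.rpow_natCast, ← Real.rpow_mul (abs_nonneg _)]; congr 1; push_cast; ring
  have e2 : (v ^ 2) ^ q = (|v| ^ q) ^ 2 := by
    rw [← sq_abs, ← Real.rpow_natCast, ← Real.rpow_natCast, ← Real.rpow_mul (abs_nonneg _),
      ← Real.rpow_mul (abs_nonneg _), mul_comm]
  have h0 : bQ p q K 0 0 0 = 0 := by
    unfold bQ bW bN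
    simp [Real.zero_rpow hp.ne', Real.zero_rpow hq.ne', Real.zero_rpow (show p / 2 ≠ 0 by positivity),
      Real.zero_rpow (show q / 2 ≠ 0 by positivity)]
  have h1 : Real.sqrt ((v ^ 2) ^ q + v ^ 2 * u ^ 2) ≤ |v| ^ q + |u| * |v| := by
    rw [e2]
    apply Real.sqrt_le_iff.mpr
    refine ⟨by positivity, ?_⟩
    rw [← sq_abs v, ← sq_abs u]
    have : 0 ≤ |v| ^ q * (|u| * |v|) := by positivity
    nlinarith
  have h2 := young_simple hpq (abs_nonneg u) (abs_nonneg v)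
  rw [h0]
  unfold bQ bW bN
  simp only [ne_eq, OfNat.ofNat_ne_zero, not_false_eq_true, zero_pow, add_zero, sub_zero]
  rw [e1, e1]
  linarith

lemma bell_ge2 (hp : 2 ≤ p) (hpq : p.HolderConjugate q) (hF : TF F) (hh : TF h)
    {T : ℝ} (hT : 0 < T) (j k : ι) :
    ∫ t in Set.Ioc 0 T, ∫ z, |heat e t (pd (e j) F) z * heat e t (pd (e k) h) z| ≤
      3 * ((12 / (q * (q - 1))) + 2) * ((∫ z, |F z| ^ p) + ∫ z, |h z| ^ q) := by
  set K := 12 / (q * (q - 1)) with hK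
  have hK0 : 0 < K := bK_pos hpq.symm.lt
  set s := tsupport F ∪ tsupport h with hs
  have hsc : IsCompact s := hF.2.isCompact.union hh.2.isCompact
  have hfun : ∀ ε, ∫ z, (bQ p q K ε (F z) (h z) - bQ p q K ε 0 0)
      = ∫ z in s, (bQ p q K ε (F z) (h z) - bQ p q K ε 0 0) := by
    intro ε
    symm
    apply setIntegral_eq_integral_of_forall_compl_eq_zero
    intro z hz
    rw [hs, Set.mem_union, not_or] at hz
    rw [image_eq_zero_of_notMem_tsupport hz.1, image_eq_zero_of_notMem_tsupport hz.2, sub_self]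
  have hcont : Continuous (fun ε : ℝ => ∫ z in s, (bQ p q K ε (F z) (h z) - bQ p q K ε 0 0)) := by
    apply continuous_parametric_integral_of_continuous _ hsc
    have hQ := bQ_cont (K := K) hpq.pos.le hpq.symm.pos.le
    have a1 : Continuous (fun w : ℝ × Pt N => (w.1, F w.2, h w.2)) :=
      continuous_fst.prodMk ((hF.cont.comp continuous_snd).prodMk (hh.cont.comp continuous_snd))
    have a2 : Continuous (fun w : ℝ × Pt N => (w.1, (0 : ℝ), (0 : ℝ))) := by fun_prop
    exact (hQ.comp a1).sub (hQ.comp a2)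
  have hlim : ∫ t in Set.Ioc 0 T, ∫ z, |heat e t (pd (e j) F) z * heat e t (pd (e k) h) z| ≤
      3 * ∫ z, (bQ p q K 0 (F z) (h z) - bQ p q K 0 0 0) := by
    rw [hfun]
    have ht : Filter.Tendsto (fun ε : ℝ => 3 * ∫ z in s, (bQ p q K ε (F z) (h z) - bQ p q K ε 0 0))
      (nhdsWithin 0 (Set.Ioi 0)) (nhds (3 * ∫ z in s, (bQ p q K 0 (F z) (h z) - bQ p q K 0 0 0))) :=
      ((hcont.tendsto 0).const_mul 3).mono_left nhdsWithin_le_nhds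
    refine ge_of_tendsto ht ?_
    filter_upwards [self_mem_nhdsWithin] with ε hε
    rw [← hfun]
    exact bell_eps e hp hpq hε hF hh hT j k
  refine hlim.trans ?_
  rw [mul_assoc]
  refine mul_le_mul_of_nonneg_left ?_ (by norm_num)
  have i1 := hF.rpow_int hpq.pos
  have i2 := hh.rpow_int hpq.symm.pos
  calc _ ≤ ∫ z, (2 * |F z| ^ p + (K + 2) * |h z| ^ q) :=
        integral_mono (bQ_int hpq.pos.le hpq.symm.pos.le hF hh 0)
          ((i1.const_mul 2).add (i2.const_mul _)) fun z => bQ_zero_le hpq _ _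
    _ = 2 * (∫ z, |F z| ^ p) + (K + 2) * ∫ z, |h z| ^ q := by
        rw [integral_add (i1.const_mul 2) (i2.const_mul _), integral_const_mul, integral_const_mul]
    _ ≤ _ := by
        have : 0 ≤ ∫ z, |F z| ^ p := integral_nonneg fun z => by positivity
        nlinarith

lemma bell (hpq : p.HolderConjugate q) : ∃ C, 0 ≤ C ∧ ∀ F h : Pt N → ℝ, TF F → TF h →
    ∀ T > 0, ∀ j k : ι, 
    |∫ t in Set.Ioc 0 T, ∫ z, heat e t (pd (e j) F) z * heat e t (pd (e k) h) z| ≤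
      C * ((∫ z, |F z| ^ p) + ∫ z, |h z| ^ q) := by
  have key : ∀ F h : Pt N → ℝ, TF F → TF h → ∀ T > 0, ∀ j k : ι,
    |∫ t in Set.Ioc 0 T, ∫ z, heat e t (pd (e j) F) z * heat e t (pd (e k) h) z| ≤
    ∫ t in Set.Ioc 0 T, ∫ z, |heat e t (pd (e j) F) z * heat e t (pd (e k) h) z| := by
    intro F h hF hh T hT j k
    have hi := heat_st_mul_integrable e (hF.pd (e j)) (hh.pd (e k)) T
    refine (abs_integral_le_integral_abs).trans (integral_mono hi.integral_prod_left.abs hi.abs.integral_prod_left fun t => ?_)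
    exact abs_integral_le_integral_abs
  rcases le_total 2 p with hp | hp
  · refine ⟨3 * ((12 / (q * (q - 1))) + 2), ?_, fun F h hF hh T hT j k =>
      (key F h hF hh T hT j k).trans (bell_ge2 e hp hpq hF hh hT j k)⟩
    have := bK_pos hpq.symm.lt; positivity
  · have hq2 : 2 ≤ q := by
      have := hpq.sub_one_mul_conj
      have := hpq.lt
      have := hpq.symm.lt
      nlinarith
    refine ⟨3 * ((12 / (p * (p - 1))) + 2), ?_, fun F h hF hh T hT j k =>
      (key F h hF hh T hT j k).trans ?_⟩
    · have := bK_pos hpq.lt; positivity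
    · have := bell_ge2 e hq2 hpq.symm hh hF hT k j
      simpa only [mul_comm (heat e _ (pd (e k) h) _), add_comm (∫ z, |h z| ^ q)] using this

end bell
end dev6

section dev7
variable {N : ℕ} {ι : Type} [Fintype ι] (e : ι → Pt N)

/-! ### Flat Calderon-Zygmund estimate -/

section flat
variable {p q : ℝ}

lemma heat_lap_symm {a b : Pt N → ℝ} (ha : TF a) (hb : TF b) (t : ℝ) :
    ∫ z, heat e t a z * heat e t (lap e b) z = ∫ z, heat e t (lap e a) z * heat e t b z := by
  have hl : ∀ {g : Pt N → ℝ} (_ : TF g), heat e t (lap e g) = fun z => ∑ i, heat e t (pd (e i) (pd (e i) g)) z := by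
    intro g hg
    unfold lap
    rw [heat_sum e _ _ (fun i _ => (hg.pd _).pd _)]
  rw [hl ha, hl hb]
  simp only [Finset.mul_sum, Finset.sum_mul]
  rw [integral_finsetSum _ (fun i _ => heat_mul_integrable e ha ((hb.pd _).pd _) t),
    integral_finsetSum _ (fun i _ => heat_mul_integrable e ((ha.pd _).pd _) hb t)]
  refine Finset.sum_congr rfl fun i _ => ?_
  rw [heat_ibp e ha (hb.pd _), heat_ibp e (ha.pd _) hb, neg_neg]

lemma heat_pair_ftc {a b : Pt N → ℝ} (ha : TF a) (hb : TF b) {T : ℝ} (hT : 0 < T) :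
    (∫ z, heat e T a z * heat e T b z) - ∫ z, a z * b z =
      2 * ∫ t in Set.Ioc 0 T, ∫ z, heat e t (lap e a) z * heat e t b z := by
  have i1 := heat_st_mul_integrable e (lap_TF e ha) hb T
  have i2 := heat_st_mul_integrable e ha (lap_TF e hb) T
  have h1 : ∫ t in Set.Ioc 0 T, ∫ z, (heat e t (lap e a) z * heat e t b z + heat e t a z * heat e t (lap e b) z)
      = 2 * ∫ t in Set.Ioc 0 T, ∫ z, heat e t (lap e a) z * heat e t b z := by
    rw [← integral_const_mul]
    congr 1
    funext t
    rw [integral_add (heat_mul_integrable e (lap_TF e ha) hb t) (heat_mul_integrable e ha (lap_TF e hb) t),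
      heat_lap_symm e ha hb]
    ring
  rw [← h1, integral_integral_swap (i1.add i2)]
  have hab := heat_mul_integrable e ha hb 0
  simp only [heat_zero] at hab
  rw [← integral_sub (heat_mul_integrable e ha hb T) hab]
  congr 1
  funext z
  rw [← intervalIntegral.integral_of_le hT.le]
  have hz : Continuous (fun t : ℝ => (t, z)) := Continuous.prodMk_left z
  have c1 : Continuous (fun t => heat e t a z) := (heat_cont e ha).comp hz
  have c2 : Continuous (fun t => heat e t b z) := (heat_cont e hb).comp hz
  have c3 : Continuous (fun t => heat e t (lap e a) z) := (heat_cont e (lap_TF e ha)).comp hz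
  have c4 : Continuous (fun t => heat e t (lap e b) z) := (heat_cont e (lap_TF e hb)).comp hz
  have := intervalIntegral.integral_eq_sub_of_hasDerivAt_of_le hT.le
      (f := fun t => heat e t a z * heat e t b z)
      (f' := fun t => heat e t (lap e a) z * heat e t b z + heat e t a z * heat e t (lap e b) z)
      (c1.mul c2).continuousOn (fun t ht => (heat_hasDerivAt e ha t ht.1 z).mul (heat_hasDerivAt e hb t ht.1 z))
      (((c3.mul c2).add (c1.mul c4)).intervalIntegrable _ _)
  rw [this]
  simp only [heat_zero]

lemma lap_pd {g : Pt N → ℝ} (hg : TF g) (w : Pt N) : lap e (pd w g) = pd w (lap e g) := by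
  have h : pd w (lap e g) = fun z => ∑ i, pd w (pd (e i) (pd (e i) g)) z := by
    unfold lap
    exact pd_sum _ _ w fun i _ => ((hg.pd _).pd _).diff
  rw [h]
  funext z
  unfold lap
  refine Finset.sum_congr rfl fun i _ => ?_
  rw [pd_comm hg.1 (e i) w, pd_comm (hg.pd (e i)).1 (e i) w]

lemma heat_bilin' (hpq : p.HolderConjugate q) {a b : Pt N → ℝ} (ha : TF a) (hb : TF b)
    (k : ι) {s t : ℝ} (hs : 0 < s) (ht : 0 < t) :
    |∫ z, heat e t a z * heat e t (pd (e k) b) z| ≤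
      mom k / (2 * s * Real.sqrt t) * ((∫ z, |s * a z| ^ p) + ∫ z, |b z| ^ q) := by
  have h := heat_bilin e hpq (ha.const_mul s) hb k t
  rw [heat_const_mul] at h
  simp only [mul_assoc s] at h
  rw [integral_const_mul, abs_mul, abs_of_pos hs] at h
  have ht' := Real.sqrt_pos.mpr ht
  rw [div_mul_eq_mul_div, le_div_iff₀ (by positivity)]
  linarith

lemma sqrt_inv_int {T : ℝ} (hT : 0 < T) : IntegrableOn (fun t : ℝ => 1 / Real.sqrt t) (Set.Ioc 0 T) ∧
    ∫ t in Set.Ioc 0 T, 1 / Real.sqrt t = 2 * Real.sqrt T := by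
  have e1 : ∀ t ∈ Set.Ioc 0 T, 1 / Real.sqrt t = t ^ (-(1 / 2) : ℝ) := fun t ht => by
    rw [Real.rpow_neg ht.1.le, Real.sqrt_eq_rpow, one_div]
  have hi : IntervalIntegrable (fun t : ℝ => t ^ (-(1 / 2) : ℝ)) volume 0 T :=
    intervalIntegral.intervalIntegrable_rpow' (by norm_num)
  constructor
  · rw [integrableOn_congr_fun e1 measurableSet_Ioc]
    exact (intervalIntegrable_iff_integrableOn_Ioc_of_le hT.le).mp hi
  · rw [setIntegral_congr_fun measurableSet_Ioc e1, ← intervalIntegral.integral_of_le hT.le,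
      integral_rpow (Or.inl (by norm_num))]
    rw [Real.sqrt_eq_rpow]
    norm_num
    ring

lemma flat_dual (hpq : p.HolderConjugate q) : ∃ C, 0 ≤ C ∧ ∀ (V g h : Pt N → ℝ) (F : ι → Pt N → ℝ),
    TF V → TF g → TF h → (∀ j, TF (F j)) → (∀ z, lap e V z = (∑ j, pd (e j) (F j) z) + g z) →
    ∀ r > 0, ∀ k : ι, |∫ z, pd (e k) V z * h z| ≤
      C * ((∑ j, ∫ z, |F j z| ^ p) + (∫ z, |r * g z| ^ p) + (∫ z, |r⁻¹ * V z| ^ p) + ∫ z, |h z| ^ q) := by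
  obtain ⟨C, hC0, hC⟩ := bell (N := N) e hpq
  set M := ∑ k : ι, mom k with hM
  have hM0 : 0 ≤ M := Finset.sum_nonneg fun k _ => mom_nonneg k
  have hMk : ∀ k : ι, mom k ≤ M := fun k =>
    Finset.single_le_sum (f := fun k : ι => mom k) (fun i _ => mom_nonneg i) (Finset.mem_univ k)
  set n : ℝ := (Fintype.card ι : ℝ) with hn
  have hn0 : 0 ≤ n := by positivity
  refine ⟨3 * M + 2 * C * (n + 1), by positivity, ?_⟩
  intro V g h F hV hg hh hF heq r hr k
  have hT : 0 < r ^ 2 := by positivity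
  set X := ∑ j, ∫ z, |F j z| ^ p with hX
  set G := ∫ z, |r * g z| ^ p with hG
  set Y := ∫ z, |r⁻¹ * V z| ^ p with hY
  set H := ∫ z, |h z| ^ q with hH
  have hX0 : 0 ≤ X := Finset.sum_nonneg fun j _ => integral_nonneg fun z => by positivity
  have hG0 : 0 ≤ G := integral_nonneg fun z => by positivity
  have hY0 : 0 ≤ Y := integral_nonneg fun z => by positivity
  have hH0 : 0 ≤ H := integral_nonneg fun z => by positivity
  have hlapeq : lap e V = fun z => (∑ j, pd (e j) (F j) z) + g z := funext heq
  have hftc := heat_pair_ftc e (hV.pd (e k)) hh hT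
  have hinner : ∀ t, ∫ z, heat e t (lap e (pd (e k) V)) z * heat e t h z
      = -((∑ j, ∫ z, heat e t (pd (e j) (F j)) z * heat e t (pd (e k) h) z)
        + ∫ z, heat e t g z * heat e t (pd (e k) h) z) := by
    intro t
    rw [lap_pd e hV]
    have := heat_ibp e (lap_TF e hV) hh (e k) t
    have hsum : TF (fun z => ∑ j, pd (e j) (F j) z) := TF.sum _ _ fun j _ => (hF j).pd _
    rw [← neg_eq_iff_eq_neg.mpr this, hlapeq, heat_add e hsum hg, heat_sum e _ _ (fun j _ => (hF j).pd _)]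
    simp only [add_mul, Finset.sum_mul]
    rw [integral_add (integrable_finsetSum _ fun j _ => heat_mul_integrable e ((hF j).pd _) (hh.pd _) t)
      (heat_mul_integrable e hg (hh.pd _) t),
      integral_finsetSum _ fun j _ => heat_mul_integrable e ((hF j).pd _) (hh.pd _) t]
  have hFi : ∀ j, Integrable (fun t => ∫ z, heat e t (pd (e j) (F j)) z * heat e t (pd (e k) h) z)
      (volume.restrict (Set.Ioc 0 (r ^ 2))) := fun j =>
    (heat_st_mul_integrable e ((hF j).pd (e j)) (hh.pd (e k)) (r ^ 2)).integral_prod_left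
  have hgi : Integrable (fun t => ∫ z, heat e t g z * heat e t (pd (e k) h) z)
      (volume.restrict (Set.Ioc 0 (r ^ 2))) :=
    (heat_st_mul_integrable e hg (hh.pd (e k)) (r ^ 2)).integral_prod_left
  simp only [hinner] at hftc
  rw [integral_neg, integral_add (integrable_finsetSum _ fun j _ => hFi j) hgi,
    integral_finsetSum _ fun j _ => hFi j] at hftc
  -- bounds
  have hsq : Real.sqrt (r ^ 2) = r := Real.sqrt_sq hr.le
  have b1 : |∫ z, heat e (r ^ 2) (pd (e k) V) z * heat e (r ^ 2) h z| ≤ M * (Y + H) := by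
    have h1 := heat_ibp e hV hh (e k) (r ^ 2)
    have h2 := heat_bilin' e hpq hV hh k (inv_pos.mpr hr) hT
    rw [h1, abs_neg, hsq] at h2
    refine h2.trans ?_
    have : mom k / (2 * r⁻¹ * r) = mom k / 2 := by field_simp
    rw [this]
    have := hMk k
    have := mom_nonneg k
    gcongr
    linarith
  have b2 : |∑ j, ∫ t in Set.Ioc 0 (r ^ 2), ∫ z, heat e t (pd (e j) (F j)) z * heat e t (pd (e k) h) z|
      ≤ C * (X + n * H) := by
    refine (Finset.abs_sum_le_sum_abs _ _).trans ((Finset.sum_le_sum fun j _ =>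
      hC (F j) h (hF j) hh (r ^ 2) hT j k).trans (le_of_eq ?_))
    rw [← Finset.mul_sum, Finset.sum_add_distrib]
    simp [hn, hX, hH]
  have b3 : |∫ t in Set.Ioc 0 (r ^ 2), ∫ z, heat e t g z * heat e t (pd (e k) h) z| ≤ M * (G + H) := by
    obtain ⟨s1, s2⟩ := sqrt_inv_int hT
    rw [hsq] at s2
    have : ∫ t in Set.Ioc 0 (r ^ 2), (mom k / (2 * r) * (G + H)) * (1 / Real.sqrt t) = mom k * (G + H) := by
      rw [integral_const_mul, s2]; field_simp
    have hk := hMk k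
    refine le_trans ?_ (show mom k * (G + H) ≤ M * (G + H) by gcongr)
    rw [← this, ← Real.norm_eq_abs]
    refine norm_integral_le_of_norm_le (s1.const_mul _) ?_
    rw [ae_restrict_iff' measurableSet_Ioc]
    refine Filter.Eventually.of_forall fun t ht => ?_
    rw [Real.norm_eq_abs]
    refine (heat_bilin' e hpq hg hh k hr ht.1).trans (le_of_eq ?_)
    have := Real.sqrt_pos.mpr ht.1
    rw [← hG, ← hH]
    field_simp
  have hfin : ∫ z, pd (e k) V z * h z = (∫ z, heat e (r ^ 2) (pd (e k) V) z * heat e (r ^ 2) h z)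
      + 2 * (∑ j, ∫ t in Set.Ioc 0 (r ^ 2), ∫ z, heat e t (pd (e j) (F j)) z * heat e t (pd (e k) h) z)
      + 2 * ∫ t in Set.Ioc 0 (r ^ 2), ∫ z, heat e t g z * heat e t (pd (e k) h) z := by linarith
  rw [hfin]
  rw [abs_le] at b1 b2 b3 ⊢
  have c1 : M * (Y + H) + 2 * (C * (X + n * H)) + 2 * (M * (G + H)) ≤
      (3 * M + 2 * C * (n + 1)) * (X + G + Y + H) := by
    have : 0 ≤ M * X := by positivity
    have : 0 ≤ M * G := by positivity
    have : 0 ≤ M * Y := by positivity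
    have : 0 ≤ C * X := by positivity
    have : 0 ≤ C * G := by positivity
    have : 0 ≤ C * Y := by positivity
    have : 0 ≤ C * H := by positivity
    have : 0 ≤ C * n * X := by positivity
    have : 0 ≤ C * n * G := by positivity
    have : 0 ≤ C * n * Y := by positivity
    nlinarith
  constructor <;> linarith [b1.1, b1.2, b2.1, b2.2, b3.1, b3.2]

lemma test_TF {W : Pt N → ℝ} (hW : TF W) (s c : ℝ) {ε : ℝ} (hε : 0 < ε) :
    TF (fun z => c * (W z ^ 2 + ε ^ 2) ^ s * W z) := by
  refine hW.smul_left (contDiff_const.mul ?_)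
  refine ContDiff.rpow_const_of_ne ((hW.1.pow 2).add contDiff_const) ?_
  intro z; positivity

lemma flat_cz (hpq : p.HolderConjugate q) : ∃ C, 0 ≤ C ∧ ∀ (V g : Pt N → ℝ) (F : ι → Pt N → ℝ),
    TF V → TF g → (∀ j, TF (F j)) → (∀ z, lap e V z = (∑ j, pd (e j) (F j) z) + g z) →
    ∀ r > 0, ∀ k : ι, ∫ z, |pd (e k) V z| ^ p ≤
      C * ((∑ j, ∫ z, |F j z| ^ p) + (∫ z, |r * g z| ^ p) + (∫ z, |r⁻¹ * V z| ^ p)) := by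
  obtain ⟨C, hC0, hC⟩ := flat_dual (N := N) e hpq
  have hp := hpq.lt
  have hq := hpq.symm.lt
  obtain ⟨c, hc0, hc⟩ : ∃ c : ℝ, 0 < c ∧ C * c ^ q ≤ c / 2 := by
    refine ⟨(1 / (2 * C + 1)) ^ (1 / (q - 1)), by positivity, ?_⟩
    set c := (1 / (2 * C + 1)) ^ (1 / (q - 1)) with hcd
    have hc0 : 0 < c := by positivity
    have h1 : c ^ (q - 1) = 1 / (2 * C + 1) := by
      rw [hcd, ← Real.rpow_mul (by positivity), one_div_mul_cancel (by linarith), Real.rpow_one]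
    have h2 : c ^ q = c * (1 / (2 * C + 1)) := by
      rw [← h1, ← Real.rpow_one_add' hc0.le (by linarith)]; ring_nf
    rw [h2]
    have : C * (1 / (2 * C + 1)) ≤ 1 / 2 := by
      rw [mul_one_div, div_le_div_iff₀ (by positivity) (by norm_num)]; linarith
    nlinarith
  refine ⟨2 * C / c, by positivity, ?_⟩
  intro V g F hV hg hF heq r hr k
  set W := pd (e k) V with hW
  have hWT : TF W := hV.pd _
  set X := (∑ j, ∫ z, |F j z| ^ p) + (∫ z, |r * g z| ^ p) + (∫ z, |r⁻¹ * V z| ^ p) with hX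
  obtain ⟨B, hB0, hB⟩ := hWT.bdd
  set S : ℝ := (p - 2) / 2 with hS
  have hpoint : ∀ ε : ℝ, 0 < ε → (∫ z, W z * (c * (W z ^ 2 + ε ^ 2) ^ S * W z)) ≤
      C * (X + ∫ z, |c * (W z ^ 2 + ε ^ 2) ^ S * W z| ^ q) := fun ε hε =>
    (le_abs_self _).trans (hC V g _ F hV hg (test_TF hWT S c hε) hF heq r hr k)
  have hqp : (p - 1) * q = p := by have := hpq.sub_one_mul_conj; linarith
  have habs : ∀ w ε : ℝ, 0 < ε → |(w ^ 2 + ε ^ 2) ^ S * w| ≤ (w ^ 2 + ε ^ 2) ^ ((p - 1) / 2) := by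
    intro w ε hε
    have hpos : 0 < w ^ 2 + ε ^ 2 := by positivity
    rw [abs_mul, abs_of_pos (Real.rpow_pos_of_pos hpos _)]
    have h1 : |w| ≤ (w ^ 2 + ε ^ 2) ^ (1 / 2 : ℝ) := by
      rw [← Real.sqrt_eq_rpow]; apply Real.abs_le_sqrt; nlinarith
    calc _ ≤ (w ^ 2 + ε ^ 2) ^ S * (w ^ 2 + ε ^ 2) ^ (1 / 2 : ℝ) := by gcongr
      _ = _ := by rw [← Real.rpow_add hpos]; congr 1; rw [hS]; ring
  have hmon : ∀ (w ε s : ℝ), |w| ≤ B → 0 < ε → ε ≤ 1 → 0 ≤ s →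
      (w ^ 2 + ε ^ 2) ^ s ≤ (B ^ 2 + 1) ^ s := by
    intro w ε s hw hε hε1 hs
    have : w ^ 2 ≤ B ^ 2 := by rw [← sq_abs]; gcongr
    have : ε ^ 2 ≤ 1 := by nlinarith
    gcongr
  have hsupp : IsCompact (tsupport W) := hWT.2.isCompact
  have hdomint : ∀ M : ℝ, Integrable ((tsupport W).indicator fun _ => M) := fun M =>
    (integrable_indicator_iff hsupp.measurableSet).mpr (integrableOn_const hsupp.measure_lt_top.ne)
  have hev : ∀ᶠ ε : ℝ in nhdsWithin 0 (Set.Ioi 0), 0 < ε ∧ ε ≤ 1 := by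
    have : Set.Ioc (0 : ℝ) 1 ∈ nhdsWithin (0 : ℝ) (Set.Ioi 0) := Ioc_mem_nhdsGT (by norm_num)
    filter_upwards [this] with ε hε using hε
  have hbase : ∀ z, W z ≠ 0 → Filter.Tendsto (fun ε : ℝ => c * (W z ^ 2 + ε ^ 2) ^ S * W z)
      (nhdsWithin 0 (Set.Ioi 0)) (nhds (c * (|W z| ^ (p - 2)) * W z)) := by
    intro z hz
    have hw : (W z ^ 2) ^ S = |W z| ^ (p - 2) := by
      rw [← sq_abs, ← Real.rpow_natCast, ← Real.rpow_mul (abs_nonneg _), hS]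
      congr 1; push_cast; ring
    have : ContinuousAt (fun ε : ℝ => c * (W z ^ 2 + ε ^ 2) ^ S * W z) 0 := by
      refine ContinuousAt.mul (ContinuousAt.mul continuousAt_const ?_) continuousAt_const
      refine ContinuousAt.rpow_const (by fun_prop) (Or.inl ?_)
      positivity
    have h2 := this.tendsto
    simp only [ne_eq, OfNat.ofNat_ne_zero, not_false_eq_true, zero_pow, add_zero, hw] at h2
    exact h2.mono_left nhdsWithin_le_nhds
  have t1 : Filter.Tendsto (fun ε : ℝ => ∫ z, W z * (c * (W z ^ 2 + ε ^ 2) ^ S * W z))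
      (nhdsWithin 0 (Set.Ioi 0)) (nhds (∫ z, c * |W z| ^ p)) := by
    refine tendsto_integral_filter_of_dominated_convergence
      ((tsupport W).indicator fun _ => B * (c * (B ^ 2 + 1) ^ ((p - 1) / 2))) ?_ ?_ (hdomint _) ?_
    · filter_upwards [hev] with ε hε
      exact (hWT.cont.mul (test_TF hWT S c hε.1).cont).aestronglyMeasurable
    · filter_upwards [hev] with ε hε
      refine Filter.Eventually.of_forall fun z => ?_
      by_cases hz : z ∈ tsupport W
      · rw [Set.indicator_of_mem hz, norm_mul, mul_assoc, norm_mul]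
        simp only [Real.norm_eq_abs, abs_of_pos hc0]
        gcongr
        · exact hB z
        · exact (habs _ _ hε.1).trans (hmon _ _ _ (hB z) hε.1 hε.2 (by linarith))
      · rw [Set.indicator_of_notMem hz, image_eq_zero_of_notMem_tsupport hz]; simp
    · refine Filter.Eventually.of_forall fun z => ?_
      by_cases hz : W z = 0
      · simp [hz, Real.zero_rpow (show p ≠ 0 by linarith)]
      · have := (hbase z hz).const_mul (W z)
        convert this using 2
        have h0 : 0 < |W z| := abs_pos.mpr hz
        have e1 : |W z| ^ p = |W z| ^ (p - 2) * (W z) ^ 2 := by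
          rw [← sq_abs, ← Real.rpow_natCast, ← Real.rpow_add h0]; congr 1; push_cast; ring
        rw [e1]; ring
  have t2 : Filter.Tendsto (fun ε : ℝ => ∫ z, |c * (W z ^ 2 + ε ^ 2) ^ S * W z| ^ q)
      (nhdsWithin 0 (Set.Ioi 0)) (nhds (∫ z, c ^ q * |W z| ^ p)) := by
    refine tendsto_integral_filter_of_dominated_convergence
      ((tsupport W).indicator fun _ => (c * (B ^ 2 + 1) ^ ((p - 1) / 2)) ^ q) ?_ ?_ (hdomint _) ?_
    · filter_upwards [hev] with ε hε
      exact ((test_TF hWT S c hε.1).cont.abs.rpow_const fun _ => Or.inr (by linarith)).aestronglyMeasurable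
    · filter_upwards [hev] with ε hε
      refine Filter.Eventually.of_forall fun z => ?_
      rw [Real.norm_eq_abs, abs_of_nonneg (by positivity)]
      by_cases hz : z ∈ tsupport W
      · rw [Set.indicator_of_mem hz, mul_assoc, abs_mul, abs_of_pos hc0]
        gcongr
        exact (habs _ _ hε.1).trans (hmon _ _ _ (hB z) hε.1 hε.2 (by linarith))
      · rw [Set.indicator_of_notMem hz, image_eq_zero_of_notMem_tsupport hz]
        simp [Real.zero_rpow (show q ≠ 0 by linarith)]
    · refine Filter.Eventually.of_forall fun z => ?_
      by_cases hz : W z = 0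
      · simp [hz, Real.zero_rpow (show p ≠ 0 by linarith), Real.zero_rpow (show q ≠ 0 by linarith)]
      · have := ((hbase z hz).abs).rpow_const (p := q) (Or.inr (by linarith))
        convert this using 2
        have h0 : 0 < |W z| := abs_pos.mpr hz
        have e1 : |c * |W z| ^ (p - 2) * W z| = c * |W z| ^ (p - 1) := by
          rw [abs_mul, abs_mul, abs_of_pos hc0, abs_of_pos (Real.rpow_pos_of_pos h0 _), mul_assoc,
            ← Real.rpow_add_one h0.ne']
          congr 2; ring
        rw [e1, Real.mul_rpow hc0.le (by positivity), ← Real.rpow_mul h0.le, hqp]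
  have hlim := le_of_tendsto_of_tendsto t1 ((t2.const_add X).const_mul C)
    (by filter_upwards [hev] with ε hε using hpoint ε hε.1)
  rw [integral_const_mul, integral_const_mul] at hlim
  set I := ∫ z, |W z| ^ p with hI
  have hI0 : 0 ≤ I := integral_nonneg fun z => by positivity
  rw [div_mul_eq_mul_div, le_div_iff₀ hc0]
  nlinarith

end flat
end dev7

section dev8
variable {N : ℕ} {ι : Type} [Fintype ι] (e : ι → Pt N)

/-! ### Strip decomposition -/

def Half (N : ℕ) : Set (Pt N) := {z | 0 < z.2}

lemma Half_meas : MeasurableSet (Half N) := measurableSet_lt measurable_const measurable_snd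

/-- weighted `p`-th power integral -/
def wl (p m : ℝ) (G : Pt N → ℝ) : ENNReal := ∫⁻ z in Half N, ENNReal.ofReal (|G z| ^ p * z.2 ^ m)

def opL (w : Pt N) (φ : Pt N → ℝ) (z : Pt N) : ℝ := lap e φ z + z.2⁻¹ * pd w φ z

def bmp : ContDiffBump (3 / 2 : ℝ) := ⟨1 / 2, 1, by norm_num, by norm_num⟩
def chi (s : ℝ) : ℝ := bmp s
def chi1 (s : ℝ) : ℝ := bmp s / s

lemma chi_smooth : ContDiff ℝ (⊤ : ℕ∞) chi := bmp.contDiff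
lemma chi_zero {s : ℝ} (h : s ∉ Set.Icc (1 / 2 : ℝ) (5 / 2)) : chi s = 0 := by
  apply bmp.zero_of_le_dist
  rw [Real.dist_eq]
  change 1 ≤ |s - 3 / 2|
  rw [Set.mem_Icc, not_and_or, not_le, not_le] at h
  rw [le_abs]
  rcases h with h | h
  · right; linarith
  · left; linarith
lemma chi_one {s : ℝ} (h : s ∈ Set.Icc (1 : ℝ) 2) : chi s = 1 := by
  apply bmp.one_of_mem_closedBall
  rw [Metric.mem_closedBall, Real.dist_eq, abs_le]
  change -(1/2) ≤ s - 3 / 2 ∧ s - 3 / 2 ≤ 1/2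
  constructor <;> linarith [h.1, h.2]
lemma chi1_smooth : ContDiff ℝ (⊤ : ℕ∞) chi1 := by
  rw [contDiff_iff_contDiffAt]
  intro s
  by_cases hs : s = 0
  · have : chi1 =ᶠ[nhds s] fun _ => 0 := by
      have : Set.Iio (1 / 2 : ℝ) ∈ nhds s := Iio_mem_nhds (by rw [hs]; norm_num)
      filter_upwards [this] with x hx
      have : chi x = 0 := chi_zero (fun h => by have := h.1; have := Set.mem_Iio.mp hx; linarith)
      change chi x / x = 0
      rw [this, zero_div]
    exact contDiffAt_const.congr_of_eventuallyEq this
  · exact (chi_smooth.contDiffAt).div contDiffAt_id hs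
lemma chi1_zero {s : ℝ} (h : s ∉ Set.Icc (1 / 2 : ℝ) (5 / 2)) : chi1 s = 0 := by
  change chi s / s = 0
  rw [chi_zero h, zero_div]

lemma deriv_zero_off {f : ℝ → ℝ} (hf : ∀ s, s ∉ Set.Icc (1 / 2 : ℝ) (5 / 2) → f s = 0) :
    ∀ s, s ∉ Set.Icc (1 / 2 : ℝ) (5 / 2) → deriv f s = 0 := by
  intro s hs
  have : f =ᶠ[nhds s] fun _ => 0 := by
    filter_upwards [isClosed_Icc.isOpen_compl.mem_nhds hs] with x hx using hf x hx
  rw [this.deriv_eq]; simp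

lemma bdd_off {f : ℝ → ℝ} (hc : Continuous f) (hf : ∀ s, s ∉ Set.Icc (1 / 2 : ℝ) (5 / 2) → f s = 0) :
    ∃ M, 0 ≤ M ∧ ∀ s, |f s| ≤ M := by
  obtain ⟨M, hM⟩ := (isCompact_Icc (a := (1/2:ℝ)) (b := 5/2)).exists_bound_of_continuousOn hc.continuousOn
  refine ⟨max M 0, le_max_right _ _, fun s => ?_⟩
  by_cases hs : s ∈ Set.Icc (1 / 2 : ℝ) (5 / 2)
  · exact (hM s hs).trans (le_max_left _ _)
  · rw [hf s hs]; simp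

lemma deriv_smooth {f : ℝ → ℝ} (hf : ContDiff ℝ (⊤ : ℕ∞) f) : ContDiff ℝ (⊤ : ℕ∞) (deriv f) := by
  have h := (contDiff_infty_iff_deriv.mp hf).2
  exact h

lemma chi_bounds : ∃ M, 0 ≤ M ∧ (∀ s, |chi s| ≤ M) ∧ (∀ s, |chi1 s| ≤ M) ∧ (∀ s, |deriv chi s| ≤ M) ∧
    (∀ s, |deriv chi1 s| ≤ M) ∧ (∀ s, |deriv (deriv chi) s| ≤ M) := by
  have z0 : ∀ s, s ∉ Set.Icc (1 / 2 : ℝ) (5 / 2) → chi s = 0 := fun s h => chi_zero h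
  have z1 : ∀ s, s ∉ Set.Icc (1 / 2 : ℝ) (5 / 2) → chi1 s = 0 := fun s h => chi1_zero h
  obtain ⟨M1, p1, h1⟩ := bdd_off chi_smooth.continuous z0
  obtain ⟨M2, p2, h2⟩ := bdd_off chi1_smooth.continuous z1
  obtain ⟨M3, p3, h3⟩ := bdd_off (deriv_smooth chi_smooth).continuous (deriv_zero_off z0)
  obtain ⟨M4, p4, h4⟩ := bdd_off (deriv_smooth chi1_smooth).continuous (deriv_zero_off z1)
  obtain ⟨M5, p5, h5⟩ := bdd_off (deriv_smooth (deriv_smooth chi_smooth)).continuous (deriv_zero_off (deriv_zero_off z0))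
  refine ⟨M1 + M2 + M3 + M4 + M5, by positivity, ?_, ?_, ?_, ?_, ?_⟩ <;> intro s
  · linarith [h1 s]
  · linarith [h2 s]
  · linarith [h3 s]
  · linarith [h4 s]
  · linarith [h5 s]

def ysc (f : ℝ → ℝ) (r : ℝ) (z : Pt N) : ℝ := f (r⁻¹ * z.2)

lemma ysc_smooth {f : ℝ → ℝ} (hf : ContDiff ℝ (⊤ : ℕ∞) f) (r : ℝ) : ContDiff ℝ (⊤ : ℕ∞) (ysc (N := N) f r) :=
  hf.comp (contDiff_const.mul contDiff_snd)

lemma pd_ysc {f : ℝ → ℝ} (hf : ContDiff ℝ (⊤ : ℕ∞) f) (r : ℝ) (w z : Pt N) :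
    pd w (ysc f r) z = r⁻¹ * w.2 * ysc (deriv f) r z := by
  unfold pd ysc
  have h1 : HasFDerivAt (fun z : Pt N => r⁻¹ * z.2) (r⁻¹ • ContinuousLinearMap.snd ℝ (Fin N → ℝ) ℝ) z :=
    hasFDerivAt_snd.const_mul r⁻¹
  have h2 : HasDerivAt f (deriv f (r⁻¹ * z.2)) (r⁻¹ * z.2) :=
    ((hf.differentiable (by simp)) _).hasDerivAt
  have := (h2.comp_hasFDerivAt z h1).fderiv
  change fderiv ℝ (f ∘ fun z : Pt N => r⁻¹ * z.2) z w = _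
  rw [this]
  simp
  ring

lemma pd_lin {g : Pt N → ℝ} (α : ι → ℝ) (z : Pt N) : pd (∑ j, α j • e j) g z = ∑ j, α j * pd (e j) g z := by
  unfold pd; rw [map_sum]; simp

section strip
variable {p q : ℝ} {φ : Pt N → ℝ} {a w : Pt N} {α ω : ι → ℝ}

def sV (a : Pt N) (φ : Pt N → ℝ) (r : ℝ) (z : Pt N) : ℝ := ysc chi r z * pd a φ z
def sH (w : Pt N) (φ : Pt N → ℝ) (r : ℝ) (z : Pt N) : ℝ :=
  ysc chi r z * lap e φ z + r⁻¹ * ysc chi1 r z * pd w φ z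
def sF (a w : Pt N) (α ω : ι → ℝ) (φ : Pt N → ℝ) (r : ℝ) (j : ι) (z : Pt N) : ℝ :=
  α j * sH e w φ r z + (2 * (r⁻¹ * (e j).2 * ysc (deriv chi) r z) * pd a φ z
    - ω j * (r⁻¹ * ysc chi1 r z * pd a φ z))
def sG (a w : Pt N) (φ : Pt N → ℝ) (r : ℝ) (z : Pt N) : ℝ :=
  (r⁻¹ * r⁻¹ * (w.2 * ysc (deriv chi1) r z - (∑ k, (e k).2 ^ 2) * ysc (deriv (deriv chi)) r z)) * pd a φ z

lemma sV_TF (hφ : TF φ) (r : ℝ) : TF (sV a φ r) := (hφ.pd a).smul_left (ysc_smooth chi_smooth r)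
lemma sH_TF (hφ : TF φ) (r : ℝ) : TF (sH e w φ r) :=
  ((lap_TF e hφ).smul_left (ysc_smooth chi_smooth r)).add
    ((hφ.pd w).smul_left (contDiff_const.mul (ysc_smooth chi1_smooth r)))
lemma sF1_TF (hφ : TF φ) (r : ℝ) (j : ι) :
    TF (fun z => 2 * (r⁻¹ * (e j).2 * ysc (deriv chi) r z) * pd a φ z) :=
  (hφ.pd a).smul_left (contDiff_const.mul (contDiff_const.mul (ysc_smooth (deriv_smooth chi_smooth) r)))
lemma sF2_TF (hφ : TF φ) (r : ℝ) :
    TF (fun z => r⁻¹ * ysc chi1 r z * pd a φ z) :=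
  (hφ.pd a).smul_left (contDiff_const.mul (ysc_smooth chi1_smooth r))
lemma sF_TF (hφ : TF φ) (r : ℝ) (j : ι) : TF (sF e a w α ω φ r j) :=
  ((sH_TF e hφ r).const_mul _).add ((sF1_TF e hφ r j).sub ((sF2_TF hφ r).const_mul _))
lemma sG_TF (hφ : TF φ) (r : ℝ) : TF (sG e a w φ r) :=
  (hφ.pd a).smul_left (contDiff_const.mul ((contDiff_const.mul (ysc_smooth (deriv_smooth chi1_smooth) r)).sub
    (contDiff_const.mul (ysc_smooth (deriv_smooth (deriv_smooth chi_smooth)) r))))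

lemma pd_prod_ysc {f : ℝ → ℝ} (hf : ContDiff ℝ (⊤ : ℕ∞) f) {g : Pt N → ℝ} (hg : TF g) (r c : ℝ) (v z : Pt N) :
    pd v (fun z => c * ysc f r z * g z) z = c * ysc f r z * pd v g z + c * (r⁻¹ * v.2 * ysc (deriv f) r z) * g z := by
  have h := (ysc_smooth (N := N) hf r).differentiable (by simp)
  have h' : Differentiable ℝ (fun z => c * ysc (N := N) f r z) := h.const_mul c
  rw [pd_mul v h' hg.diff, pd_const_mul v c h]
  simp only [pd_ysc hf]

lemma strip_eq (hφ : TF φ) (ha : a = ∑ j, α j • e j) (hw : w = ∑ j, ω j • e j) (ha2 : a.2 = 0)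
    (r : ℝ) (z : Pt N) :
    lap e (sV a φ r) z = (∑ j, pd (e j) (sF e a w α ω φ r j) z) + sG e a w φ r z := by
  have hv := hφ.pd a
  -- left side
  have hL : ∀ k, pd (e k) (pd (e k) (sV a φ r)) z = ysc chi r z * pd (e k) (pd (e k) (pd a φ)) z
      + 2 * (r⁻¹ * (e k).2 * ysc (deriv chi) r z) * pd (e k) (pd a φ) z
      + r⁻¹ * r⁻¹ * (e k).2 ^ 2 * ysc (deriv (deriv chi)) r z * pd a φ z := by
    intro k
    have h1 : pd (e k) (sV a φ r) = fun z => 1 * ysc chi r z * pd (e k) (pd a φ) z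
        + (r⁻¹ * (e k).2) * ysc (deriv chi) r z * pd a φ z := by
      funext z
      have := pd_prod_ysc chi_smooth hv r 1 (e k) z
      simp only [one_mul] at this ⊢
      exact this
    have t1 : TF (fun z => 1 * ysc chi r z * pd (e k) (pd a φ) z) :=
      (hv.pd (e k)).smul_left (contDiff_const.mul (ysc_smooth chi_smooth r))
    have t2 : TF (fun z => (r⁻¹ * (e k).2) * ysc (deriv chi) r z * pd a φ z) :=
      hv.smul_left (contDiff_const.mul (ysc_smooth (deriv_smooth chi_smooth) r))
    rw [h1, pd_add _ t1.diff t2.diff]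
    simp only []
    rw [pd_prod_ysc chi_smooth (hv.pd (e k)), pd_prod_ysc (deriv_smooth chi_smooth) hv]
    ring
  have hR : ∀ j, pd (e j) (sF e a w α ω φ r j) z = α j * pd (e j) (sH e w φ r) z
      + (2 * (r⁻¹ * (e j).2 * ysc (deriv chi) r z) * pd (e j) (pd a φ) z
        + 2 * r⁻¹ * r⁻¹ * (e j).2 ^ 2 * ysc (deriv (deriv chi)) r z * pd a φ z
        - ω j * (pd (e j) (fun z => r⁻¹ * ysc chi1 r z * pd a φ z) z)) := by
    intro j
    have hH := sH_TF e (w := w) hφ r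
    have h1 := sF1_TF e (a := a) hφ r j
    have h2 := sF2_TF (a := a) hφ r
    unfold sF
    rw [pd_add _ (hH.const_mul _).diff (h1.sub (h2.const_mul _)).diff]
    have hsub : pd (e j) (fun z => 2 * (r⁻¹ * (e j).2 * ysc (deriv chi) r z) * pd a φ z
        - ω j * (r⁻¹ * ysc chi1 r z * pd a φ z)) z
        = pd (e j) (fun z => 2 * (r⁻¹ * (e j).2 * ysc (deriv chi) r z) * pd a φ z) z
        - ω j * pd (e j) (fun z => r⁻¹ * ysc chi1 r z * pd a φ z) z := by
      have := congrFun (pd_add (e j) h1.diff ((h2.const_mul (-ω j)).diff)) z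
      rw [pd_const_mul _ _ h2.diff] at this
      simp only [neg_mul, ← sub_eq_add_neg] at this
      exact this
    simp only [hsub, pd_const_mul _ _ hH.diff]
    have h3 := pd_prod_ysc (deriv_smooth chi_smooth) hv r (2 * (r⁻¹ * (e j).2)) (e j) z
    simp only [mul_assoc] at h3 ⊢
    rw [h3]
    ring
  have hsumH : ∑ j, α j * pd (e j) (sH e w φ r) z = pd a (sH e w φ r) z := by rw [ha, pd_lin]
  have hsumW : ∑ j, ω j * pd (e j) (fun z => r⁻¹ * ysc chi1 r z * pd a φ z) z
      = pd w (fun z => r⁻¹ * ysc chi1 r z * pd a φ z) z := by rw [hw, pd_lin]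
  have hH : pd a (sH e w φ r) z = ysc chi r z * lap e (pd a φ) z + r⁻¹ * ysc chi1 r z * pd w (pd a φ) z := by
    unfold sH
    have t1 : TF (fun z => 1 * ysc chi r z * lap e φ z) :=
      (lap_TF e hφ).smul_left (contDiff_const.mul (ysc_smooth chi_smooth r))
    have t2 : TF (fun z => r⁻¹ * ysc chi1 r z * pd w φ z) := sF2_TF hφ r
    have := congrFun (pd_add a t1.diff t2.diff) z
    rw [pd_prod_ysc chi_smooth (lap_TF e hφ), pd_prod_ysc chi1_smooth (hφ.pd w), ha2] at this
    simp only [one_mul, mul_zero, zero_mul, add_zero] at this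
    rw [this, lap_pd e hφ, pd_comm hφ.1 a w]
  have hW := pd_prod_ysc chi1_smooth hv r r⁻¹ w z
  simp only [hR, Finset.sum_add_distrib, Finset.sum_sub_distrib]
  rw [hsumH, hsumW, hH, hW]
  have e0 : lap e (sV a φ r) z = ∑ k, pd (e k) (pd (e k) (sV a φ r)) z := rfl
  have e1 : lap e (pd a φ) z = ∑ k, pd (e k) (pd (e k) (pd a φ)) z := rfl
  rw [e0, e1]
  simp only [hL, Finset.sum_add_distrib, ← Finset.mul_sum, ← Finset.sum_mul, sG]
  ring

end strip
end dev8

section dev9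
variable {N : ℕ} {ι : Type} [Fintype ι] (e : ι → Pt N)

section strip2
variable {p q : ℝ} {φ : Pt N → ℝ} {a w : Pt N} {α ω : ι → ℝ}

lemma two_rpow_bound {p A B : ℝ} (hp : 0 < p) (hA : 0 ≤ A) (hB : 0 ≤ B) :
    (A + B) ^ p ≤ 2 ^ p * (A ^ p + B ^ p) := by
  have h1 : A + B ≤ 2 * max A B := by linarith [le_max_left A B, le_max_right A B]
  have h2 : (max A B) ^ p ≤ A ^ p + B ^ p := by
    have := Real.rpow_nonneg hA p
    have := Real.rpow_nonneg hB p
    rcases max_choice A B with h | h <;> rw [h] <;> linarith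
  have h0 : 0 ≤ max A B := hA.trans (le_max_left _ _)
  calc (A + B) ^ p ≤ (2 * max A B) ^ p := by gcongr
    _ = 2 ^ p * (max A B) ^ p := Real.mul_rpow (by norm_num) h0
    _ ≤ _ := by gcongr

def strip (N : ℕ) (r : ℝ) : Set (Pt N) := {z | 2⁻¹ * r ≤ z.2 ∧ z.2 < 4 * r}
lemma strip_meas (r : ℝ) : MeasurableSet (strip N r) :=
  (measurableSet_le measurable_const measurable_snd).inter (measurableSet_lt measurable_snd measurable_const)

/-- the density controlling everything -/
def gS (p : ℝ) (a w : Pt N) (φ : Pt N → ℝ) (z : Pt N) : ℝ :=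
  |opL e w φ z| ^ p + |z.2⁻¹ * pd a φ z| ^ p

lemma opL_meas (hφ : TF φ) : Measurable (opL e w φ) :=
  (lap_TF e hφ).cont.measurable.add (measurable_snd.inv.mul (hφ.pd w).cont.measurable)

lemma gS_meas (hφ : TF φ) : Measurable (gS e p a w φ) := by
  unfold gS
  have h1 := opL_meas e (w := w) hφ
  have h2 : Measurable (fun z : Pt N => z.2⁻¹ * pd a φ z) := measurable_snd.inv.mul (hφ.pd a).cont.measurable
  have h3 : Measurable (fun z => |opL e w φ z|) := continuous_abs.measurable.comp h1
  have h4 : Measurable (fun z : Pt N => |z.2⁻¹ * pd a φ z|) := continuous_abs.measurable.comp h2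
  exact (h3.pow_const p).add (h4.pow_const p)

lemma ysc_off {f : ℝ → ℝ} (hf : ∀ s, s ∉ Set.Icc (1 / 2 : ℝ) (5 / 2) → f s = 0) {r : ℝ} (hr : 0 < r)
    {z : Pt N} (hz : z ∉ strip N r) : ysc f r z = 0 := by
  apply hf
  intro h
  apply hz
  have h1 : z.2 = r * (r⁻¹ * z.2) := by field_simp
  constructor
  · rw [h1]; nlinarith [h.1]
  · rw [h1]; nlinarith [h.2]

lemma strip_pt (p : ℝ) (hp : 0 < p) : ∃ D, 0 ≤ D ∧ ∀ (φ : Pt N → ℝ) (r : ℝ) (z : Pt N), 0 < r →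
    (∀ j, |sF e a w α ω φ r j z| ^ p ≤ (strip N r).indicator (fun z => D * gS e p a w φ z) z) ∧
    |r * sG e a w φ r z| ^ p ≤ (strip N r).indicator (fun z => D * gS e p a w φ z) z ∧
    |r⁻¹ * sV a φ r z| ^ p ≤ (strip N r).indicator (fun z => D * gS e p a w φ z) z := by
  obtain ⟨M, hM0, m1, m2, m3, m4, m5⟩ := chi_bounds
  have z0 : ∀ s, s ∉ Set.Icc (1 / 2 : ℝ) (5 / 2) → chi s = 0 := fun s h => chi_zero h
  have z1 : ∀ s, s ∉ Set.Icc (1 / 2 : ℝ) (5 / 2) → chi1 s = 0 := fun s h => chi1_zero h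
  set D0 := ∑ j, (M * |α j| + 8 * M * |(e j).2| + 4 * M * |ω j|) + 4 * M * |w.2| + 4 * M * (∑ k, (e k).2 ^ 2) + 4 * M
    with hD0
  have hΓ : 0 ≤ ∑ k, (e k).2 ^ 2 := Finset.sum_nonneg fun k _ => sq_nonneg _
  have hS : 0 ≤ ∑ j, (M * |α j| + 8 * M * |(e j).2| + 4 * M * |ω j|) := Finset.sum_nonneg fun j _ => by positivity
  have hD00 : 0 ≤ D0 := by positivity
  have hw2 : 0 ≤ 4 * M * |w.2| := by positivity
  have hMG : 0 ≤ 4 * M * (∑ k, (e k).2 ^ 2) := by positivity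
  refine ⟨D0 ^ p * 2 ^ p, by positivity, ?_⟩
  intro φ r z hr
  by_cases hz : z ∈ strip N r
  · simp only [Set.indicator_of_mem hz]
    have hy : 0 < z.2 := by have := hz.1; nlinarith
    have hry : r⁻¹ ≤ 4 * z.2⁻¹ := by
      rw [← div_eq_mul_inv, le_div_iff₀ hy, inv_mul_le_iff₀ hr]; linarith [hz.2]
    set A := |opL e w φ z| with hA
    set B := |z.2⁻¹ * pd a φ z| with hB
    have hA0 : 0 ≤ A := abs_nonneg _
    have hB0 : 0 ≤ B := abs_nonneg _
    have hrv : r⁻¹ * |pd a φ z| ≤ 4 * B := by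
      rw [hB, abs_mul, abs_of_pos (inv_pos.mpr hy)]; nlinarith [abs_nonneg (pd a φ z)]
    have fin : ∀ x : ℝ, |x| ≤ D0 * (A + B) → |x| ^ p ≤ D0 ^ p * 2 ^ p * gS e p a w φ z := by
      intro x hx
      calc |x| ^ p ≤ (D0 * (A + B)) ^ p := by gcongr
        _ = D0 ^ p * (A + B) ^ p := Real.mul_rpow hD00 (by positivity)
        _ ≤ D0 ^ p * (2 ^ p * (A ^ p + B ^ p)) := by gcongr; exact two_rpow_bound hp hA0 hB0
        _ = _ := by unfold gS; ring
    have hHeq : sH e w φ r z = chi (r⁻¹ * z.2) * opL e w φ z := by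
      unfold sH opL ysc chi1
      change _ + r⁻¹ * (chi (r⁻¹ * z.2) / (r⁻¹ * z.2)) * _ = _
      field_simp
    have hHle : |sH e w φ r z| ≤ M * A := by
      rw [hHeq, abs_mul]; gcongr; exact m1 _
    refine ⟨fun j => fin _ ?_, fin _ ?_, fin _ ?_⟩
    · have hj : M * |α j| + 8 * M * |(e j).2| + 4 * M * |ω j| ≤ D0 := by
        have := Finset.single_le_sum (f := fun j => M * |α j| + 8 * M * |(e j).2| + 4 * M * |ω j|)
          (fun i _ => by positivity) (Finset.mem_univ j)
        linarith
      have t1 : |α j * sH e w φ r z| ≤ M * |α j| * A := by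
        rw [abs_mul]
        calc _ ≤ |α j| * (M * A) := by gcongr
          _ = _ := by ring
      have t2 : |2 * (r⁻¹ * (e j).2 * ysc (deriv chi) r z) * pd a φ z| ≤ 8 * M * |(e j).2| * B := by
        have : |2 * (r⁻¹ * (e j).2 * ysc (deriv chi) r z) * pd a φ z|
          = 2 * |(e j).2| * |ysc (deriv chi) r z| * (r⁻¹ * |pd a φ z|) := by
          simp only [abs_mul, abs_of_pos (inv_pos.mpr hr)]; norm_num; ring
        rw [this]
        calc _ ≤ 2 * |(e j).2| * M * (4 * B) := by gcongr; exact m3 _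
          _ = _ := by ring
      have t3 : |ω j * (r⁻¹ * ysc chi1 r z * pd a φ z)| ≤ 4 * M * |ω j| * B := by
        have : |ω j * (r⁻¹ * ysc chi1 r z * pd a φ z)| = |ω j| * |ysc chi1 r z| * (r⁻¹ * |pd a φ z|) := by
          simp only [abs_mul, abs_of_pos (inv_pos.mpr hr)]; ring
        rw [this]
        calc _ ≤ |ω j| * M * (4 * B) := by gcongr; exact m2 _
          _ = _ := by ring
      unfold sF
      have := abs_add_le (α j * sH e w φ r z) (2 * (r⁻¹ * (e j).2 * ysc (deriv chi) r z) * pd a φ z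
        - ω j * (r⁻¹ * ysc chi1 r z * pd a φ z))
      have := abs_sub (2 * (r⁻¹ * (e j).2 * ysc (deriv chi) r z) * pd a φ z) (ω j * (r⁻¹ * ysc chi1 r z * pd a φ z))
      have k1 : 0 ≤ M * |α j| * B := by positivity
      have k2 : 0 ≤ 8 * M * |(e j).2| * A := by positivity
      have k3 : 0 ≤ 4 * M * |ω j| * A := by positivity
      have k4 := mul_le_mul_of_nonneg_right hj (add_nonneg hA0 hB0)
      nlinarith
    · have : |r * sG e a w φ r z| = |w.2 * ysc (deriv chi1) r z - (∑ k, (e k).2 ^ 2) * ysc (deriv (deriv chi)) r z|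
          * (r⁻¹ * |pd a φ z|) := by
        have h : r * sG e a w φ r z = (w.2 * ysc (deriv chi1) r z - (∑ k, (e k).2 ^ 2) * ysc (deriv (deriv chi)) r z)
          * (r⁻¹ * pd a φ z) := by unfold sG; field_simp
        rw [h, abs_mul, abs_mul r⁻¹, abs_of_pos (inv_pos.mpr hr)]
      rw [this]
      have h1 : |w.2 * ysc (deriv chi1) r z - (∑ k, (e k).2 ^ 2) * ysc (deriv (deriv chi)) r z| ≤
          |w.2| * M + (∑ k, (e k).2 ^ 2) * M := by
        refine (abs_sub _ _).trans ?_
        rw [abs_mul, abs_mul, abs_of_nonneg hΓ]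
        gcongr
        · exact m4 _
        · exact m5 _
      calc _ ≤ (|w.2| * M + (∑ k, (e k).2 ^ 2) * M) * (4 * B) := by gcongr
        _ = (4 * M * |w.2| + 4 * M * (∑ k, (e k).2 ^ 2)) * B := by ring
        _ ≤ D0 * (A + B) := by
          apply mul_le_mul _ (by linarith) hB0 hD00
          rw [hD0]; linarith
    · have : |r⁻¹ * sV a φ r z| = |ysc chi r z| * (r⁻¹ * |pd a φ z|) := by
        unfold sV; simp only [abs_mul, abs_of_pos (inv_pos.mpr hr)]; ring
      rw [this]
      calc _ ≤ M * (4 * B) := by gcongr; exact m1 _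
        _ = 4 * M * B := by ring
        _ ≤ D0 * (A + B) := by
          apply mul_le_mul _ (by linarith) hB0 hD00
          rw [hD0]; linarith
  · simp only [Set.indicator_of_notMem hz]
    have y0 := ysc_off z0 hr hz
    have y1 := ysc_off z1 hr hz
    have y2 := ysc_off (deriv_zero_off z0) hr hz
    have y3 := ysc_off (deriv_zero_off z1) hr hz
    have y4 := ysc_off (deriv_zero_off (deriv_zero_off z0)) hr hz
    refine ⟨fun j => ?_, ?_, ?_⟩
    · simp [sF, sH, y0, y1, y2, Real.zero_rpow hp.ne']
    · simp [sG, y3, y4, Real.zero_rpow hp.ne']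
    · simp [sV, y0, Real.zero_rpow hp.ne']

def slab (N : ℕ) (r : ℝ) : Set (Pt N) := {z | r ≤ z.2 ∧ z.2 < 2 * r}
lemma slab_meas (r : ℝ) : MeasurableSet (slab N r) :=
  (measurableSet_le measurable_const measurable_snd).inter (measurableSet_lt measurable_snd measurable_const)

lemma ofReal_int_TF {g : Pt N → ℝ} (hg : TF g) {p : ℝ} (hp : 0 < p) :
    ENNReal.ofReal (∫ z, |g z| ^ p) = ∫⁻ z, ENNReal.ofReal (|g z| ^ p) :=
  ofReal_integral_eq_lintegral_ofReal (hg.rpow_int hp) (Filter.Eventually.of_forall fun z => by positivity)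

lemma strip_one (hpq : p.HolderConjugate q) (ha : a = ∑ j, α j • e j) (hw : w = ∑ j, ω j • e j)
    (ha2 : a.2 = 0) : ∃ C, 0 ≤ C ∧ ∀ (φ : Pt N → ℝ), TF φ → ∀ r > 0, ∀ k,
    ∫⁻ z in slab N r, ENNReal.ofReal (|pd (e k) (pd a φ) z| ^ p) ≤
      ENNReal.ofReal C * ∫⁻ z in strip N r, ENNReal.ofReal (gS e p a w φ z) := by
  obtain ⟨C, hC0, hC⟩ := flat_cz (N := N) e hpq
  obtain ⟨D, hD0, hD⟩ := strip_pt (N := N) e (a := a) (w := w) (α := α) (ω := ω) p hpq.pos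
  have hp := hpq.pos
  set n : ℝ := (Fintype.card ι : ℝ) with hn
  refine ⟨C * ((n + 2) * D), by positivity, ?_⟩
  intro φ hφ r hr k
  have h := hC (sV a φ r) (sG e a w φ r) (sF e a w α ω φ r) (sV_TF hφ r) (sG_TF e hφ r) (sF_TF e hφ r)
    (strip_eq e hφ ha hw ha2 r) r hr k
  have hI : ∀ g : Pt N → ℝ, TF g → (∀ z, |g z| ^ p ≤ (strip N r).indicator (fun z => D * gS e p a w φ z) z) →
      ENNReal.ofReal (∫ z, |g z| ^ p) ≤ ENNReal.ofReal D * ∫⁻ z in strip N r, ENNReal.ofReal (gS e p a w φ z) := by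
    intro g hg hle
    rw [ofReal_int_TF hg hp, ← lintegral_const_mul' _ _ ENNReal.ofReal_ne_top, ← lintegral_indicator (strip_meas r)]
    refine lintegral_mono fun z => (ENNReal.ofReal_le_ofReal (hle z)).trans ?_
    by_cases hz : z ∈ strip N r
    · simp only [Set.indicator_of_mem hz]; rw [ENNReal.ofReal_mul hD0]
    · simp [Set.indicator_of_notMem hz]
  set L := ∫⁻ z in strip N r, ENNReal.ofReal (gS e p a w φ z) with hL
  have hFj : ∀ j, 0 ≤ ∫ z, |sF e a w α ω φ r j z| ^ p := fun j => integral_nonneg fun z => by positivity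
  have hG0 : 0 ≤ ∫ z, |r * sG e a w φ r z| ^ p := integral_nonneg fun z => by positivity
  have hV0 : 0 ≤ ∫ z, |r⁻¹ * sV a φ r z| ^ p := integral_nonneg fun z => by positivity
  calc ∫⁻ z in slab N r, ENNReal.ofReal (|pd (e k) (pd a φ) z| ^ p)
      = ∫⁻ z in slab N r, ENNReal.ofReal (|pd (e k) (sV a φ r) z| ^ p) := ?_
    _ ≤ ∫⁻ z, ENNReal.ofReal (|pd (e k) (sV a φ r) z| ^ p) := setLIntegral_le_lintegral _ _
    _ = ENNReal.ofReal (∫ z, |pd (e k) (sV a φ r) z| ^ p) := (ofReal_int_TF ((sV_TF hφ r).pd _) hp).symm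
    _ ≤ ENNReal.ofReal _ := ENNReal.ofReal_le_ofReal h
    _ = ENNReal.ofReal C * ((∑ j, ENNReal.ofReal (∫ z, |sF e a w α ω φ r j z| ^ p)) +
        ENNReal.ofReal (∫ z, |r * sG e a w φ r z| ^ p) + ENNReal.ofReal (∫ z, |r⁻¹ * sV a φ r z| ^ p)) := by
        rw [ENNReal.ofReal_mul hC0, ENNReal.ofReal_add (by have := Finset.sum_nonneg (s := Finset.univ) fun j _ => hFj j; positivity) hV0,
          ENNReal.ofReal_add (Finset.sum_nonneg fun j _ => hFj j) hG0, ENNReal.ofReal_sum_of_nonneg fun j _ => hFj j]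
    _ ≤ ENNReal.ofReal C * ((∑ j : ι, ENNReal.ofReal D * L) + ENNReal.ofReal D * L + ENNReal.ofReal D * L) := by
        gcongr with j
        · exact hI _ (sF_TF e hφ r j) fun z => (hD φ r z hr).1 j
        · exact hI _ ((sG_TF e hφ r).const_mul r) fun z => (hD φ r z hr).2.1
        · exact hI _ ((sV_TF hφ r).const_mul r⁻¹) fun z => (hD φ r z hr).2.2
    _ = ENNReal.ofReal (C * ((n + 2) * D)) * L := by
        rw [ENNReal.ofReal_mul hC0, ENNReal.ofReal_mul (by positivity), ENNReal.ofReal_add (by positivity) (by norm_num), hn,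
          ENNReal.ofReal_natCast]
        simp only [Finset.sum_const, Finset.card_univ, nsmul_eq_mul]
        rw [show ENNReal.ofReal 2 = 2 by simp]
        ring
  have hae : ∀ z ∈ interior (slab N r), pd (e k) (pd a φ) z = pd (e k) (sV a φ r) z := by
    intro z hz
    have : sV a φ r =ᶠ[nhds z] pd a φ := by
      filter_upwards [isOpen_interior.mem_nhds hz] with x hx
      have hx' := interior_subset hx
      unfold sV ysc
      rw [chi_one, one_mul]
      constructor
      · rw [← div_eq_inv_mul, le_div_iff₀ hr]; linarith [hx'.1]
      · rw [← div_eq_inv_mul, div_le_iff₀ hr]; linarith [hx'.2]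
    unfold pd
    rw [this.fderiv_eq]
    rfl
  refine setLIntegral_congr_fun (slab_meas r) fun z hz => ?_
  -- equality of derivatives on the whole slab by an explicit product rule
  have h1 := pd_prod_ysc chi_smooth (hφ.pd a) r 1 (e k) z
  simp only [one_mul] at h1
  have hmem : r⁻¹ * z.2 ∈ Set.Icc (1 : ℝ) 2 := by
    constructor
    · rw [← div_eq_inv_mul, le_div_iff₀ hr]; linarith [hz.1]
    · rw [← div_eq_inv_mul, div_le_iff₀ hr]; linarith [hz.2]
  have hd : ysc (deriv chi) r z = 0 := by
    unfold ysc
    apply IsLocalMax.deriv_eq_zero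
    refine Filter.Eventually.of_forall fun x => ?_
    rw [chi_one hmem]
    exact bmp.le_one
  have h2 : pd (e k) (sV a φ r) z = pd (e k) (pd a φ) z := by
    change pd (e k) (fun z => ysc chi r z * pd a φ z) z = _
    rw [h1, hd]
    unfold ysc
    rw [chi_one hmem]; ring
  simp only [h2]

end strip2
end dev9

section dev10
variable {N : ℕ} {ι : Type} [Fintype ι] (e : ι → Pt N)

section dyadic
variable {p q : ℝ} {a w : Pt N} {α ω : ι → ℝ}

lemma rpow_comp {r y : ℝ} (hr : 0 < r) (hy : 0 < y) (h1 : y ≤ 4 * r) (m : ℝ) (h2 : r ≤ 4 * y) :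
    y ^ m ≤ 4 ^ |m| * r ^ m := by
  have : y ^ m = (y / r) ^ m * r ^ m := by
    rw [← Real.mul_rpow (by positivity) hr.le]; congr 1; field_simp
  rw [this]
  gcongr
  rcases le_total 0 m with hm | hm
  · rw [abs_of_nonneg hm]
    apply Real.rpow_le_rpow (by positivity) _ hm
    rw [div_le_iff₀ hr]; exact h1
  · rw [abs_of_nonpos hm, show (y / r) ^ m = (r / y) ^ (-m) by
      rw [Real.rpow_neg (by positivity), ← Real.inv_rpow (by positivity), inv_div]]
    apply Real.rpow_le_rpow (by positivity) _ (by linarith)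
    rw [div_le_iff₀ hy]; exact h2

lemma slab_cover : Half N ⊆ ⋃ n : ℤ, slab N ((2 : ℝ) ^ n) := by
  intro z hz
  obtain ⟨n, h1, h2⟩ := exists_mem_Ico_zpow (x := z.2) (y := (2 : ℝ)) hz (by norm_num)
  refine Set.mem_iUnion.mpr ⟨n, h1, ?_⟩
  rw [zpow_add_one₀ (by norm_num)] at h2
  linarith

lemma slab_disj : Pairwise (Function.onFun Disjoint fun n : ℤ => slab N ((2 : ℝ) ^ n)) := by
  have key : ∀ a b : ℤ, ∀ z : Pt N, z ∈ slab N ((2 : ℝ) ^ a) → z ∈ slab N ((2 : ℝ) ^ b) → a ≤ b := by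
    intro a b z h1 h2
    have : (2 : ℝ) ^ a < 2 ^ (b + 1) := by
      rw [zpow_add_one₀ (by norm_num)]; linarith [h1.1, h2.2]
    have := (zpow_lt_zpow_iff_right₀ (by norm_num : (1 : ℝ) < 2)).mp this
    omega
  intro a b hab
  rw [Function.onFun, Set.disjoint_left]
  intro z h1 h2
  exact hab (le_antisymm (key a b z h1 h2) (key b a z h2 h1))

lemma strip_sub (n : ℤ) : strip N ((2 : ℝ) ^ n) ⊆
    (slab N ((2 : ℝ) ^ (n + -1)) ∪ slab N ((2 : ℝ) ^ n)) ∪ slab N ((2 : ℝ) ^ (n + 1)) := by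
  intro z hz
  have e1 : (2 : ℝ) ^ (n + -1) = 2⁻¹ * 2 ^ n := by rw [zpow_add₀ (by norm_num)]; norm_num; ring
  have e2 : (2 : ℝ) ^ (n + 1) = 2 * 2 ^ n := by rw [zpow_add_one₀ (by norm_num)]; ring
  unfold slab
  simp only [Set.mem_union, Set.mem_setOf_eq, e1, e2]
  obtain ⟨h1, h2⟩ := hz
  by_cases c1 : z.2 < 2 ^ n
  · left; left; constructor <;> linarith
  · by_cases c2 : z.2 < 2 * 2 ^ n
    · left; right; constructor <;> linarith
    · right; constructor <;> linarith

lemma strip_sum (G : Pt N → ENNReal) :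
    ∑' n : ℤ, ∫⁻ z in strip N ((2 : ℝ) ^ n), G z ≤ 3 * ∫⁻ z in Half N, G z := by
  have hs : ∑' n : ℤ, ∫⁻ z in slab N ((2 : ℝ) ^ n), G z ≤ ∫⁻ z in Half N, G z := by
    rw [← lintegral_iUnion (fun n => slab_meas _) slab_disj]
    apply lintegral_mono_set
    intro z hz
    obtain ⟨n, hn⟩ := Set.mem_iUnion.mp hz
    exact lt_of_lt_of_le (by positivity) hn.1
  have sh : ∀ k : ℤ, ∑' n : ℤ, ∫⁻ z in slab N ((2 : ℝ) ^ (n + k)), G z = ∑' n : ℤ, ∫⁻ z in slab N ((2 : ℝ) ^ n), G z :=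
    fun k => (Equiv.addRight k).tsum_eq fun n : ℤ => ∫⁻ z in slab N ((2 : ℝ) ^ n), G z
  calc ∑' n : ℤ, ∫⁻ z in strip N ((2 : ℝ) ^ n), G z
      ≤ ∑' n : ℤ, ((∫⁻ z in slab N ((2 : ℝ) ^ (n + -1)), G z) + (∫⁻ z in slab N ((2 : ℝ) ^ n), G z)
        + ∫⁻ z in slab N ((2 : ℝ) ^ (n + 1)), G z) := by
        refine ENNReal.tsum_le_tsum fun n => ?_
        refine (lintegral_mono_set (strip_sub n)).trans ((lintegral_union_le _ _ _).trans ?_)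
        gcongr
        exact lintegral_union_le _ _ _
    _ = (∑' n : ℤ, ∫⁻ z in slab N ((2 : ℝ) ^ n), G z) + (∑' n : ℤ, ∫⁻ z in slab N ((2 : ℝ) ^ n), G z) +
        (∑' n : ℤ, ∫⁻ z in slab N ((2 : ℝ) ^ n), G z) := by
        rw [ENNReal.tsum_add, ENNReal.tsum_add, sh, sh]
    _ ≤ (∫⁻ z in Half N, G z) + (∫⁻ z in Half N, G z) + (∫⁻ z in Half N, G z) := by gcongr
    _ = _ := by ring

/-- Second derivatives with at least one tangential direction. -/
lemma thm2 (m : ℝ) (hpq : p.HolderConjugate q) (ha : a = ∑ j, α j • e j) (hw : w = ∑ j, ω j • e j)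
    (ha2 : a.2 = 0) : ∃ C, 0 ≤ C ∧ ∀ (φ : Pt N → ℝ), TF φ → ∀ k,
    wl p m (pd (e k) (pd a φ)) ≤
      ENNReal.ofReal C * (wl p m (opL e w φ) + wl p m (fun z => z.2⁻¹ * pd a φ z)) := by
  obtain ⟨C, hC0, hC⟩ := strip_one e hpq ha hw ha2
  set K : ℝ := 4 ^ |m| with hK
  have hK0 : 0 < K := by positivity
  refine ⟨3 * (K * C * K), by positivity, fun φ hφ k => ?_⟩
  have hpos : ∀ n : ℤ, (0 : ℝ) < 2 ^ n := fun n => by positivity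
  have step : ∀ n : ℤ, ∫⁻ z in slab N ((2 : ℝ) ^ n), ENNReal.ofReal (|pd (e k) (pd a φ) z| ^ p * z.2 ^ m) ≤
      ENNReal.ofReal (K * C * K) * ∫⁻ z in strip N ((2 : ℝ) ^ n), ENNReal.ofReal (gS e p a w φ z * z.2 ^ m) := by
    intro n
    set r := (2 : ℝ) ^ n
    have hr : 0 < r := hpos n
    have hrm : 0 < r ^ m := by positivity
    calc ∫⁻ z in slab N r, ENNReal.ofReal (|pd (e k) (pd a φ) z| ^ p * z.2 ^ m)
        ≤ ∫⁻ z in slab N r, ENNReal.ofReal (K * r ^ m) * ENNReal.ofReal (|pd (e k) (pd a φ) z| ^ p) := by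
          refine setLIntegral_mono' (slab_meas r) fun z hz => ?_
          rw [← ENNReal.ofReal_mul (by positivity), mul_comm]
          apply ENNReal.ofReal_le_ofReal
          gcongr
          exact rpow_comp hr (hr.trans_le hz.1) (by linarith [hz.2]) m (by linarith [hz.1])
      _ = ENNReal.ofReal (K * r ^ m) * ∫⁻ z in slab N r, ENNReal.ofReal (|pd (e k) (pd a φ) z| ^ p) :=
          lintegral_const_mul' _ _ ENNReal.ofReal_ne_top
      _ ≤ ENNReal.ofReal (K * r ^ m) * (ENNReal.ofReal C * ∫⁻ z in strip N r, ENNReal.ofReal (gS e p a w φ z)) := by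
          gcongr; exact hC φ hφ r hr k
      _ = ENNReal.ofReal (K * C) * ∫⁻ z in strip N r, ENNReal.ofReal (r ^ m) * ENNReal.ofReal (gS e p a w φ z) := by
          rw [lintegral_const_mul' _ _ ENNReal.ofReal_ne_top, ENNReal.ofReal_mul hK0.le, ENNReal.ofReal_mul hK0.le]
          ring
      _ ≤ ENNReal.ofReal (K * C) * ∫⁻ z in strip N r, ENNReal.ofReal K * ENNReal.ofReal (gS e p a w φ z * z.2 ^ m) := by
          gcongr _ * ?_
          refine setLIntegral_mono' (strip_meas r) fun z hz => ?_
          have hz2 : 0 < z.2 := lt_of_lt_of_le (by positivity) hz.1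
          have h0 : 0 ≤ gS e p a w φ z := by unfold gS; positivity
          rw [← ENNReal.ofReal_mul hrm.le, ← ENNReal.ofReal_mul hK0.le]
          apply ENNReal.ofReal_le_ofReal
          have := rpow_comp hz2 hr (by linarith [hz.1]) m (by linarith [hz.2])
          calc r ^ m * gS e p a w φ z ≤ (K * z.2 ^ m) * gS e p a w φ z := by gcongr
            _ = _ := by ring
      _ = _ := by
          rw [lintegral_const_mul' _ _ ENNReal.ofReal_ne_top, ENNReal.ofReal_mul (p := K * C) (by positivity), mul_assoc]
  calc wl p m (pd (e k) (pd a φ)) ≤ ∫⁻ z in ⋃ n : ℤ, slab N ((2 : ℝ) ^ n), ENNReal.ofReal (|pd (e k) (pd a φ) z| ^ p * z.2 ^ m) :=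
        lintegral_mono_set slab_cover
    _ ≤ ∑' n : ℤ, ∫⁻ z in slab N ((2 : ℝ) ^ n), ENNReal.ofReal (|pd (e k) (pd a φ) z| ^ p * z.2 ^ m) := lintegral_iUnion_le _ _
    _ ≤ ∑' n : ℤ, ENNReal.ofReal (K * C * K) * ∫⁻ z in strip N ((2 : ℝ) ^ n), ENNReal.ofReal (gS e p a w φ z * z.2 ^ m) :=
        ENNReal.tsum_le_tsum step
    _ ≤ ENNReal.ofReal (K * C * K) * (3 * ∫⁻ z in Half N, ENNReal.ofReal (gS e p a w φ z * z.2 ^ m)) := by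
        rw [ENNReal.tsum_mul_left]; gcongr; exact strip_sum _
    _ = ENNReal.ofReal (3 * (K * C * K)) * (∫⁻ z in Half N, ENNReal.ofReal (gS e p a w φ z * z.2 ^ m)) := by
        rw [ENNReal.ofReal_mul (by norm_num : (0 : ℝ) ≤ 3)]
        rw [show ENNReal.ofReal 3 = 3 by simp]; ring
    _ = _ := by
        congr 1
        unfold wl
        rw [← lintegral_add_left]
        · refine setLIntegral_congr_fun Half_meas fun z hz => ?_
          have : 0 ≤ z.2 ^ m := Real.rpow_nonneg (le_of_lt hz) m
          simp only
          rw [← ENNReal.ofReal_add (by positivity) (by positivity)]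
          congr 1; unfold gS; ring
        · have h3 : Measurable (fun z => |opL e w φ z|) := continuous_abs.measurable.comp (opL_meas e hφ)
          exact ((h3.pow_const p).mul (measurable_snd.pow_const m)).ennreal_ofReal

end dyadic
end dev10

section dev11
variable {N : ℕ} {ι : Type} [Fintype ι] (e : ι → Pt N)

section energy

lemma pdA_mul {f g : Pt N → ℝ} {z : Pt N} (v : Pt N) (hf : DifferentiableAt ℝ f z) (hg : DifferentiableAt ℝ g z) :
    pd v (fun z => f z * g z) z = f z * pd v g z + g z * pd v f z := by
  unfold pd
  rw [(hf.hasFDerivAt.fun_mul hg.hasFDerivAt).fderiv]; simp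

lemma pdA_add {f g : Pt N → ℝ} {z : Pt N} (v : Pt N) (hf : DifferentiableAt ℝ f z) (hg : DifferentiableAt ℝ g z) :
    pd v (fun z => f z + g z) z = pd v f z + pd v g z := by
  unfold pd
  rw [(hf.hasFDerivAt.fun_add hg.hasFDerivAt).fderiv]; simp

lemma pdA_sub {f g : Pt N → ℝ} {z : Pt N} (v : Pt N) (hf : DifferentiableAt ℝ f z) (hg : DifferentiableAt ℝ g z) :
    pd v (fun z => f z - g z) z = pd v f z - pd v g z := by
  unfold pd
  rw [(hf.hasFDerivAt.fun_sub hg.hasFDerivAt).fderiv]; simp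

lemma pdA_comp {k : ℝ → ℝ} {k' : ℝ} {f : Pt N → ℝ} {z : Pt N} (v : Pt N) (hk : HasDerivAt k k' (f z))
    (hf : DifferentiableAt ℝ f z) : pd v (fun z => k (f z)) z = k' * pd v f z := by
  unfold pd
  have := hk.comp_hasFDerivAt z hf.hasFDerivAt
  rw [show (fun z => k (f z)) = k ∘ f from rfl, this.fderiv]; simp

lemma cda_pd {f : Pt N → ℝ} {z : Pt N} (v : Pt N) (hf : ContDiffAt ℝ (⊤ : ℕ∞) f z) :
    ContDiffAt ℝ (⊤ : ℕ∞) (pd v f) z := by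
  have h : ContDiffAt ℝ (⊤ : ℕ∞) (fderiv ℝ f) z := hf.fderiv_right (by simp)
  exact h.clm_apply contDiffAt_const

lemma cda_diff {f : Pt N → ℝ} {z : Pt N} (hf : ContDiffAt ℝ (⊤ : ℕ∞) f z) : DifferentiableAt ℝ f z :=
  hf.differentiableAt (by simp)

lemma pd_congr {f g : Pt N → ℝ} {z : Pt N} (v : Pt N) (h : f =ᶠ[nhds z] g) : pd v f z = pd v g z := by
  unfold pd; rw [h.fderiv_eq]

lemma pd_congr_ev {f g : Pt N → ℝ} {z : Pt N} (v : Pt N) (h : f =ᶠ[nhds z] g) : pd v f =ᶠ[nhds z] pd v g := by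
  filter_upwards [h.eventuallyEq_nhds] with x hx using pd_congr v hx

lemma pd_zero_fun (v z : Pt N) : pd v (fun _ : Pt N => (0 : ℝ)) z = 0 := by
  unfold pd; simp

lemma pd_ev_zero {f : Pt N → ℝ} {z : Pt N} (v : Pt N) (h : f =ᶠ[nhds z] fun _ => 0) :
    pd v f =ᶠ[nhds z] fun _ => 0 := by
  filter_upwards [pd_congr_ev v h] with x hx
  rw [hx, pd_zero_fun]

/-! the regularised powers -/
def kk (p δ x : ℝ) : ℝ := (x ^ 2 + δ ^ 2) ^ (p / 2) - (δ ^ 2) ^ (p / 2)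
def k1 (p δ x : ℝ) : ℝ := p * x * (x ^ 2 + δ ^ 2) ^ (p / 2 - 1)
def k2 (p δ x : ℝ) : ℝ := p * (x ^ 2 + δ ^ 2) ^ (p / 2 - 1) + 
  p * x * ((p / 2 - 1) * (x ^ 2 + δ ^ 2) ^ (p / 2 - 2) * (2 * x))

variable {p δ : ℝ}

lemma base_pos (hδ : δ ≠ 0) (x : ℝ) : 0 < x ^ 2 + δ ^ 2 := by positivity

lemma kk_deriv (hδ : δ ≠ 0) (x : ℝ) : HasDerivAt (kk p δ) (k1 p δ x) x := by
  have h1 : HasDerivAt (fun x : ℝ => x ^ 2 + δ ^ 2) (2 * x) x := by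
    simpa using (hasDerivAt_pow 2 x).add_const (δ ^ 2)
  have h2 := (h1.rpow_const (p := p / 2) (Or.inl (base_pos hδ x).ne')).sub_const ((δ ^ 2) ^ (p / 2))
  refine h2.congr_deriv ?_
  unfold k1; ring

lemma k1_deriv (hδ : δ ≠ 0) (x : ℝ) : HasDerivAt (k1 p δ) (k2 p δ x) x := by
  have h1 : HasDerivAt (fun x : ℝ => x ^ 2 + δ ^ 2) (2 * x) x := by
    simpa using (hasDerivAt_pow 2 x).add_const (δ ^ 2)
  have h2 := (h1.rpow_const (p := p / 2 - 1) (Or.inl (base_pos hδ x).ne'))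
  have h3 := ((hasDerivAt_id x).const_mul p).mul h2
  refine h3.congr_deriv ?_
  unfold k2
  rw [show p / 2 - 1 - 1 = p / 2 - 2 by ring]
  simp only [id]
  ring

lemma k2_nonneg (hp : 1 ≤ p) (hδ : δ ≠ 0) (x : ℝ) : 0 ≤ k2 p δ x := by
  have hb := base_pos hδ x
  have : k2 p δ x = p * (x ^ 2 + δ ^ 2) ^ (p / 2 - 2) * ((p - 1) * x ^ 2 + δ ^ 2) := by
    unfold k2
    rw [show p / 2 - 1 = (p / 2 - 2) + 1 by ring, Real.rpow_add_one hb.ne']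
    ring
  rw [this]
  have : 0 ≤ (p - 1) * x ^ 2 := mul_nonneg (by linarith) (sq_nonneg x)
  have := Real.rpow_nonneg hb.le (p / 2 - 2)
  positivity

lemma kk_smooth (hδ : δ ≠ 0) : ContDiff ℝ (⊤ : ℕ∞) (kk p δ) :=
  ((ContDiff.rpow_const_of_ne (by fun_prop) fun x => (base_pos hδ x).ne')).sub contDiff_const
lemma k1_smooth (hδ : δ ≠ 0) : ContDiff ℝ (⊤ : ℕ∞) (k1 p δ) :=
  (contDiff_const.mul contDiff_id).mul (ContDiff.rpow_const_of_ne (by fun_prop) fun x => (base_pos hδ x).ne')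

lemma kk_zero : kk p δ 0 = 0 := by simp [kk]
lemma k1_zero : k1 p δ 0 = 0 := by simp [k1]

/-- adjoint operator -/
def adj (w : Pt N) (μ : Pt N → ℝ) (z : Pt N) : ℝ := lap e μ z - pd w (fun z => z.2⁻¹ * μ z) z

variable {W G μ : Pt N → ℝ} {Ω : Set (Pt N)}

lemma ext_TF (hΩ : IsOpen Ω) (hs : tsupport μ ⊆ Ω) (hK : IsCompact (tsupport μ ∩ tsupport W)) {F : Pt N → ℝ}
    (h1 : ∀ z ∈ Ω, ContDiffAt ℝ (⊤ : ℕ∞) F z) (h2 : ∀ z, z ∉ tsupport μ → F z = 0)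
    (h3 : ∀ z, z ∉ tsupport W → F z = 0) : TF F := by
  constructor
  · rw [contDiff_iff_contDiffAt]
    intro z
    by_cases hz : z ∈ tsupport μ
    · exact h1 z (hs hz)
    · have : F =ᶠ[nhds z] fun _ => 0 := by
        filter_upwards [(isClosed_tsupport μ).isOpen_compl.mem_nhds hz] with x hx using h2 x hx
      exact contDiffAt_const.congr_of_eventuallyEq this
  · refine HasCompactSupport.intro hK fun z hz => ?_
    by_cases hz1 : z ∈ tsupport μ
    · exact h3 z fun h => hz ⟨hz1, h⟩
    · exact h2 z hz1

lemma int_pd_zero {F : Pt N → ℝ} (hF : TF F) (v : Pt N) : ∫ z, pd v F z = 0 :=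
  int_fderiv_zero v (fun z => (hF.diff z).hasFDerivAt) hF.integrable (hF.pd v).integrable

def en (p δ : ℝ) (w : Pt N) (W G μ : Pt N → ℝ) (z : Pt N) : ℝ :=
  k1 p δ (W z / G z) * (μ z * opL e w W z) -
    (kk p δ (W z / G z) * (G z * adj e w μ z - μ z * opL e w G z) + 
      k1 p δ (W z / G z) * (W z / G z) * (μ z * opL e w G z))

lemma notin_ev {f : Pt N → ℝ} {z : Pt N} (hz : z ∉ tsupport f) : f =ᶠ[nhds z] fun _ => 0 :=
  notMem_tsupport_iff_eventuallyEq.mp hz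

lemma adj_off (w : Pt N) {z : Pt N} (hz : z ∉ tsupport μ) : adj e w μ z = 0 := by
  have h := notin_ev hz
  unfold adj lap
  rw [Finset.sum_eq_zero fun i _ => (pd_ev_zero (e i) (pd_ev_zero (e i) h)).self_of_nhds]
  rw [pd_congr w (g := fun _ => 0), pd_zero_fun, sub_zero]
  filter_upwards [h] with x hx
  rw [hx, mul_zero]

lemma en_off1 (w : Pt N) {z : Pt N} (hz : z ∉ tsupport μ) : en e p δ w W G μ z = 0 := by
  unfold en
  rw [adj_off e w hz, image_eq_zero_of_notMem_tsupport hz]; simp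

lemma en_off2 (w : Pt N) {z : Pt N} (hz : z ∉ tsupport W) : en e p δ w W G μ z = 0 := by
  unfold en
  rw [image_eq_zero_of_notMem_tsupport hz]; simp [kk_zero, k1_zero]

lemma cda_lap {f : Pt N → ℝ} {z : Pt N} (hf : ContDiffAt ℝ (⊤ : ℕ∞) f z) : ContDiffAt ℝ (⊤ : ℕ∞) (lap e f) z := by
  unfold lap
  exact ContDiffAt.sum fun i _ => cda_pd _ (cda_pd _ hf)

lemma cda_yinv {z : Pt N} (hz : 0 < z.2) : ContDiffAt ℝ (⊤ : ℕ∞) (fun z : Pt N => z.2⁻¹) z :=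
  ContDiffAt.inv contDiffAt_snd hz.ne'

lemma cda_opL {f : Pt N → ℝ} {z : Pt N} (w : Pt N) (hf : ContDiffAt ℝ (⊤ : ℕ∞) f z) (hz : 0 < z.2) :
    ContDiffAt ℝ (⊤ : ℕ∞) (opL e w f) z :=
  (cda_lap e hf).add ((cda_yinv hz).mul (cda_pd w hf))

lemma cda_adj {f : Pt N → ℝ} {z : Pt N} (w : Pt N) (hf : ContDiffAt ℝ (⊤ : ℕ∞) f z) (hz : 0 < z.2) :
    ContDiffAt ℝ (⊤ : ℕ∞) (adj e w f) z :=
  (cda_lap e hf).sub (cda_pd w ((cda_yinv hz).mul hf))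

/-- flux in direction `v` -/
def flx (p δ : ℝ) (W G μ : Pt N → ℝ) (v z : Pt N) : ℝ :=
  G z * μ z * (k1 p δ (W z / G z) * pd v (fun z => W z / G z) z) +
    kk p δ (W z / G z) * (pd v G z * μ z - G z * pd v μ z)

def flw (p δ : ℝ) (W G μ : Pt N → ℝ) (z : Pt N) : ℝ := kk p δ (W z / G z) * (G z * (z.2⁻¹ * μ z))

lemma flux_id (hδ : δ ≠ 0) {z : Pt N} (v : Pt N) (hW : ContDiffAt ℝ (⊤ : ℕ∞) W z) (hG : ContDiffAt ℝ (⊤ : ℕ∞) G z)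
    (hG0 : ∀ᶠ x in nhds z, 0 < G x) (hμ : ContDiffAt ℝ (⊤ : ℕ∞) μ z) :
    k1 p δ (W z / G z) * (μ z * pd v (pd v W) z) -
    (kk p δ (W z / G z) * (G z * pd v (pd v μ) z - μ z * pd v (pd v G) z) + 
      k1 p δ (W z / G z) * (W z / G z) * (μ z * pd v (pd v G) z)) =
    pd v (flx p δ W G μ v) z - G z * μ z * (k2 p δ (W z / G z) * (pd v (fun z => W z / G z) z) ^ 2) := by
  set Z : Pt N → ℝ := fun z => W z / G z with hZ
  have hGz : G z ≠ 0 := hG0.self_of_nhds.ne'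
  have cZ : ContDiffAt ℝ (⊤ : ℕ∞) Z z := hW.div hG hGz
  have hWev : W =ᶠ[nhds z] fun z => G z * Z z := by
    filter_upwards [hG0] with x hx
    simp only [hZ]; field_simp
  have hcev : ∀ᶠ x in nhds z, ContDiffAt ℝ 1 G x ∧ ContDiffAt ℝ 1 Z x :=
    ((hG.of_le (by exact_mod_cast le_top)).eventually (by simp)).and ((cZ.of_le (by exact_mod_cast le_top)).eventually (by simp))
  have h1 : pd v W =ᶠ[nhds z] fun x => G x * pd v Z x + Z x * pd v G x := by
    filter_upwards [hWev.eventuallyEq_nhds, hcev] with x hx hc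
    rw [pd_congr v hx, pdA_mul v (hc.1.differentiableAt (by simp)) (hc.2.differentiableAt (by simp))]
  have dG := cda_diff hG
  have dZ := cda_diff cZ
  have dμ := cda_diff hμ
  have dGv := cda_diff (cda_pd v hG)
  have dZv := cda_diff (cda_pd v cZ)
  have dμv := cda_diff (cda_pd v hμ)
  have dk1 : DifferentiableAt ℝ (fun x => k1 p δ (Z x)) z := (k1_deriv hδ (Z z)).differentiableAt.comp z dZ
  have dkk : DifferentiableAt ℝ (fun x => kk p δ (Z x)) z := (kk_deriv hδ (Z z)).differentiableAt.comp z dZ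
  have h2 : pd v (pd v W) z = G z * pd v (pd v Z) z + pd v Z z * pd v G z + (Z z * pd v (pd v G) z + pd v G z * pd v Z z) := by
    rw [pd_congr v h1, pdA_add v (dG.fun_mul dZv) (dZ.fun_mul dGv), pdA_mul v dG dZv, pdA_mul v dZ dGv]
  have h3 : pd v (flx p δ W G μ v) z = 
      (G z * μ z) * (k1 p δ (Z z) * pd v (pd v Z) z + pd v Z z * (k2 p δ (Z z) * pd v Z z)) +
      (k1 p δ (Z z) * pd v Z z) * (G z * pd v μ z + μ z * pd v G z) +
      (kk p δ (Z z) * (pd v G z * pd v μ z + μ z * pd v (pd v G) z - (G z * pd v (pd v μ) z + pd v μ z * pd v G z)) +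
        (pd v G z * μ z - G z * pd v μ z) * (k1 p δ (Z z) * pd v Z z)) := by
    have : flx p δ W G μ v = fun z => (G z * μ z) * (k1 p δ (Z z) * pd v Z z) +
      kk p δ (Z z) * (pd v G z * μ z - G z * pd v μ z) := rfl
    rw [this, pdA_add v ((dG.fun_mul dμ).fun_mul (dk1.fun_mul dZv)) (dkk.fun_mul ((dGv.fun_mul dμ).fun_sub (dG.fun_mul dμv))),
      pdA_mul v (dG.fun_mul dμ) (dk1.fun_mul dZv), pdA_mul v dk1 dZv, pdA_mul v dG dμ, 
      pdA_mul v dkk ((dGv.fun_mul dμ).fun_sub (dG.fun_mul dμv)), pdA_sub v (dGv.fun_mul dμ) (dG.fun_mul dμv),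
      pdA_mul v dGv dμ, pdA_mul v dG dμv, pdA_comp v (k1_deriv hδ (Z z)) dZ, pdA_comp v (kk_deriv hδ (Z z)) dZ]
  rw [h2, h3, show W z / G z = Z z from rfl]
  ring

lemma flw_id (hδ : δ ≠ 0) {z : Pt N} (w : Pt N) (hW : ContDiffAt ℝ (⊤ : ℕ∞) W z) (hG : ContDiffAt ℝ (⊤ : ℕ∞) G z)
    (hG0 : ∀ᶠ x in nhds z, 0 < G x) (hμ : ContDiffAt ℝ (⊤ : ℕ∞) μ z) (hz : 0 < z.2) :
    k1 p δ (W z / G z) * (μ z * (z.2⁻¹ * pd w W z)) -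
    (kk p δ (W z / G z) * (G z * (- pd w (fun z => z.2⁻¹ * μ z) z) - μ z * (z.2⁻¹ * pd w G z)) + 
      k1 p δ (W z / G z) * (W z / G z) * (μ z * (z.2⁻¹ * pd w G z))) =
    pd w (flw p δ W G μ) z := by
  set Z : Pt N → ℝ := fun z => W z / G z with hZ
  have hGz : G z ≠ 0 := hG0.self_of_nhds.ne'
  have cZ : ContDiffAt ℝ (⊤ : ℕ∞) Z z := hW.div hG hGz
  have hWev : W =ᶠ[nhds z] fun z => G z * Z z := by
    filter_upwards [hG0] with x hx
    simp only [hZ]; field_simp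
  have dG := cda_diff hG
  have dZ := cda_diff cZ
  have dm : DifferentiableAt ℝ (fun z : Pt N => z.2⁻¹ * μ z) z := cda_diff ((cda_yinv hz).mul hμ)
  have dkk : DifferentiableAt ℝ (fun x => kk p δ (Z x)) z := (kk_deriv hδ (Z z)).differentiableAt.comp z dZ
  have : flw p δ W G μ = fun z => kk p δ (Z z) * (G z * (z.2⁻¹ * μ z)) := rfl
  rw [this, pdA_mul w dkk (dG.fun_mul dm), pdA_mul w dG dm, pdA_comp w (kk_deriv hδ (Z z)) dZ,
    pd_congr w hWev, pdA_mul w dG dZ, show W z / G z = Z z from rfl]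
  ring

lemma energy_reg (hp : 1 ≤ p) (hδ : δ ≠ 0) (w : Pt N) (hΩ : IsOpen Ω) (hΩ2 : ∀ z ∈ Ω, 0 < z.2)
    (hW : ContDiff ℝ (⊤ : ℕ∞) W) (hG : ContDiffOn ℝ (⊤ : ℕ∞) G Ω) (hG0 : ∀ z ∈ Ω, 0 < G z)
    (hμ : ContDiff ℝ (⊤ : ℕ∞) μ) (hμ0 : ∀ z, 0 ≤ μ z) (hs : tsupport μ ⊆ Ω) 
    (hK : IsCompact (tsupport μ ∩ tsupport W)) : ∫ z, en e p δ w W G μ z ≤ 0 := by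
  have cG : ∀ z ∈ Ω, ContDiffAt ℝ (⊤ : ℕ∞) G z := fun z hz => hG.contDiffAt (hΩ.mem_nhds hz)
  have cW : ∀ z, ContDiffAt ℝ (⊤ : ℕ∞) W z := fun z => hW.contDiffAt
  have cμ : ∀ z, ContDiffAt ℝ (⊤ : ℕ∞) μ z := fun z => hμ.contDiffAt
  have cZ : ∀ z ∈ Ω, ContDiffAt ℝ (⊤ : ℕ∞) (fun z => W z / G z) z := fun z hz => (cW z).div (cG z hz) (hG0 z hz).ne'
  have ck1 : ∀ z ∈ Ω, ContDiffAt ℝ (⊤ : ℕ∞) (fun z => k1 p δ (W z / G z)) z := fun z hz =>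
    (k1_smooth hδ).contDiffAt.comp z (cZ z hz)
  have ckk : ∀ z ∈ Ω, ContDiffAt ℝ (⊤ : ℕ∞) (fun z => kk p δ (W z / G z)) z := fun z hz =>
    (kk_smooth hδ).contDiffAt.comp z (cZ z hz)
  have T0 : TF (en e p δ w W G μ) := by
    refine ext_TF hΩ hs hK (fun z hz => ?_) (fun z hz => en_off1 e w hz) (fun z hz => en_off2 e w hz)
    have c1 := cda_opL e w (cW z) (hΩ2 z hz)
    have c2 := cda_opL e w (cG z hz) (hΩ2 z hz)
    have c3 := cda_adj e w (cμ z) (hΩ2 z hz)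
    exact ((ck1 z hz).mul ((cμ z).mul c1)).sub (((ckk z hz).mul (((cG z hz).mul c3).sub ((cμ z).mul c2))).add
      (((ck1 z hz).mul (cZ z hz)).mul ((cμ z).mul c2)))
  have T1 : ∀ v, TF (flx p δ W G μ v) := by
    intro v
    refine ext_TF hΩ hs hK (fun z hz => ?_) (fun z hz => ?_) (fun z hz => ?_)
    · exact (((cG z hz).mul (cμ z)).mul ((ck1 z hz).mul (cda_pd v (cZ z hz)))).add
        ((ckk z hz).mul (((cda_pd v (cG z hz)).mul (cμ z)).sub ((cG z hz).mul (cda_pd v (cμ z)))))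
    · unfold flx
      rw [image_eq_zero_of_notMem_tsupport hz, (pd_ev_zero v (notin_ev hz)).self_of_nhds]; simp
    · unfold flx
      rw [image_eq_zero_of_notMem_tsupport hz]; simp [kk_zero, k1_zero]
  have T2 : TF (flw p δ W G μ) := by
    refine ext_TF hΩ hs hK (fun z hz => ?_) (fun z hz => ?_) (fun z hz => ?_)
    · exact (ckk z hz).mul ((cG z hz).mul ((cda_yinv (hΩ2 z hz)).mul (cμ z)))
    · unfold flw
      rw [image_eq_zero_of_notMem_tsupport hz]; simp
    · unfold flw
      rw [image_eq_zero_of_notMem_tsupport hz]; simp [kk_zero]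
  have key : ∀ z, en e p δ w W G μ z ≤ (∑ i, pd (e i) (flx p δ W G μ (e i)) z) + pd w (flw p δ W G μ) z := by
    intro z
    by_cases hz : z ∈ tsupport μ
    · have hz' := hs hz
      have hGe : ∀ᶠ x in nhds z, 0 < G x := by
        filter_upwards [hΩ.mem_nhds hz'] with x hx using hG0 x hx
      have s1 : ∀ i, pd (e i) (flx p δ W G μ (e i)) z ≥ k1 p δ (W z / G z) * (μ z * pd (e i) (pd (e i) W) z) -
          (kk p δ (W z / G z) * (G z * pd (e i) (pd (e i) μ) z - μ z * pd (e i) (pd (e i) G) z) + 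
          k1 p δ (W z / G z) * (W z / G z) * (μ z * pd (e i) (pd (e i) G) z)) := by
        intro i
        rw [flux_id hδ (e i) (cW z) (cG z hz') hGe (cμ z)]
        have : 0 ≤ G z * μ z * (k2 p δ (W z / G z) * pd (e i) (fun z => W z / G z) z ^ 2) :=
          mul_nonneg (mul_nonneg (hG0 z hz').le (hμ0 z)) (mul_nonneg (k2_nonneg hp hδ _) (sq_nonneg _))
        linarith
      have s2 := Finset.sum_le_sum fun i (_ : i ∈ Finset.univ) => s1 i
      rw [← flw_id hδ w (cW z) (cG z hz') hGe (cμ z) (hΩ2 z hz')]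
      refine le_trans (le_of_eq ?_) (add_le_add_left s2 _)
      unfold en opL adj lap
      simp only [Finset.sum_sub_distrib, Finset.sum_add_distrib, ← Finset.mul_sum]
      ring
    · rw [en_off1 e w hz]
      have z1 : ∀ v, flx p δ W G μ v =ᶠ[nhds z] fun _ => 0 := by
        intro v
        filter_upwards [notin_ev hz, pd_ev_zero v (notin_ev hz)] with x h1 h2
        simp [flx, h1, h2]
      have z2 : flw p δ W G μ =ᶠ[nhds z] fun _ => 0 := by
        filter_upwards [notin_ev hz] with x h1
        simp [flw, h1]
      rw [Finset.sum_eq_zero fun i _ => (pd_ev_zero (e i) (z1 (e i))).self_of_nhds, (pd_ev_zero w z2).self_of_nhds]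
      simp
  calc ∫ z, en e p δ w W G μ z ≤ ∫ z, ((∑ i, pd (e i) (flx p δ W G μ (e i)) z) + pd w (flw p δ W G μ) z) :=
        integral_mono T0.integrable ((integrable_finsetSum _ fun i _ => ((T1 (e i)).pd (e i)).integrable).add
          (T2.pd w).integrable) key
    _ = 0 := by
        rw [integral_add (integrable_finsetSum _ fun i _ => ((T1 (e i)).pd (e i)).integrable) (T2.pd w).integrable,
          integral_finsetSum _ fun i _ => ((T1 (e i)).pd (e i)).integrable, int_pd_zero T2,
          Finset.sum_eq_zero fun i _ => int_pd_zero (T1 (e i)) (e i), add_zero]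

end energy
end dev11

section dev12
section energy0
variable {N : ℕ} {ι : Type} [Fintype ι] (e : ι → Pt N)

lemma kk0 {p : ℝ} (hp : 1 < p) (x : ℝ) : kk p 0 x = |x| ^ p := by
  unfold kk
  rw [zero_pow two_ne_zero, add_zero, Real.zero_rpow (by positivity), sub_zero, ← sq_abs, ← Real.rpow_natCast,
    ← Real.rpow_mul (abs_nonneg x)]
  congr 1; push_cast; ring

lemma k10_abs {p : ℝ} (hp : 1 < p) (x : ℝ) : |k1 p 0 x| = p * |x| ^ (p - 1) := by
  unfold k1
  rw [zero_pow two_ne_zero, add_zero]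
  rcases eq_or_ne x 0 with rfl | hx
  · rw [abs_zero, Real.zero_rpow (by linarith)]; simp
  have hx' : 0 < |x| := abs_pos.mpr hx
  rw [← sq_abs, ← Real.rpow_natCast, ← Real.rpow_mul hx'.le, abs_mul, abs_mul, abs_of_pos (by linarith : 0 < p),
    abs_of_nonneg (Real.rpow_nonneg hx'.le _), mul_assoc, ← Real.rpow_one_add' hx'.le (by push_cast; linarith)]
  congr 2; push_cast; ring

lemma k10_mul {p : ℝ} (hp : 1 < p) (x : ℝ) : k1 p 0 x * x = p * |x| ^ p := by
  unfold k1
  rw [zero_pow two_ne_zero, add_zero]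
  rcases eq_or_ne x 0 with rfl | hx
  · rw [abs_zero, Real.zero_rpow (by linarith)]; simp
  have hx' : 0 < |x| := abs_pos.mpr hx
  have : |x| ^ p = (x ^ 2) ^ (p / 2 - 1) * (x ^ 2) := by
    rw [← Real.rpow_add_one (by positivity), ← sq_abs, ← Real.rpow_natCast, ← Real.rpow_mul hx'.le]
    congr 1; push_cast; ring
  rw [this]; ring

lemma k1_bd {p δ : ℝ} (hp : 1 < p) (hδ : δ ≠ 0) (hδ1 : δ ^ 2 ≤ 1) (x : ℝ) : |k1 p δ x| ≤ p * (x ^ 2 + 1) ^ ((p - 1) / 2) := by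
  have hb := base_pos hδ x
  unfold k1
  rw [abs_mul, abs_mul, abs_of_pos (by linarith : 0 < p), abs_of_nonneg (Real.rpow_nonneg hb.le _), mul_assoc]
  refine mul_le_mul_of_nonneg_left ?_ (by linarith)
  calc |x| * (x ^ 2 + δ ^ 2) ^ (p / 2 - 1) ≤ (x ^ 2 + δ ^ 2) ^ (1 / 2 : ℝ) * (x ^ 2 + δ ^ 2) ^ (p / 2 - 1) := by
        refine mul_le_mul_of_nonneg_right ?_ (Real.rpow_nonneg hb.le _)
        rw [← Real.sqrt_eq_rpow]
        exact Real.abs_le_sqrt (by nlinarith [sq_nonneg δ])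
    _ = (x ^ 2 + δ ^ 2) ^ ((p - 1) / 2) := by
        rw [← Real.rpow_add hb]; congr 1; ring
    _ ≤ _ := Real.rpow_le_rpow hb.le (by linarith) (by linarith)

lemma kk_bd {p δ : ℝ} (hp : 1 < p) (hδ1 : δ ^ 2 ≤ 1) (x : ℝ) : |kk p δ x| ≤ (x ^ 2 + 1) ^ (p / 2) := by
  unfold kk
  have h1 : (δ ^ 2) ^ (p / 2) ≤ (x ^ 2 + δ ^ 2) ^ (p / 2) :=
    Real.rpow_le_rpow (sq_nonneg _) (by nlinarith [sq_nonneg x]) (by linarith)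
  have h2 : (x ^ 2 + δ ^ 2) ^ (p / 2) ≤ (x ^ 2 + 1) ^ (p / 2) :=
    Real.rpow_le_rpow (by positivity) (by linarith) (by linarith)
  have h3 := Real.rpow_nonneg (sq_nonneg δ) (p / 2)
  rw [abs_of_nonneg (by linarith)]
  linarith

lemma kk_tend {p : ℝ} (hp : 1 < p) (x : ℝ) : Filter.Tendsto (fun δ => kk p δ x) (nhds 0) (nhds (kk p 0 x)) := by
  unfold kk
  have : Continuous fun δ : ℝ => (x ^ 2 + δ ^ 2) ^ (p / 2) - (δ ^ 2) ^ (p / 2) :=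
    (Continuous.rpow_const (by fun_prop) fun _ => Or.inr (by linarith)).sub
      (Continuous.rpow_const (by fun_prop) fun _ => Or.inr (by linarith))
  exact this.tendsto 0

lemma k1_tend {p : ℝ} (x : ℝ) : Filter.Tendsto (fun δ => k1 p δ x) (nhds 0) (nhds (k1 p 0 x)) := by
  rcases eq_or_ne x 0 with rfl | hx
  · simp only [k1_zero]; exact tendsto_const_nhds
  unfold k1
  have : Continuous fun δ : ℝ => p * x * (x ^ 2 + δ ^ 2) ^ (p / 2 - 1) :=
    continuous_const.mul (Continuous.rpow_const (by fun_prop) fun δ => Or.inl (by positivity))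
  exact this.tendsto 0

variable {W G μ : Pt N → ℝ} {Ω : Set (Pt N)} {p : ℝ}

/-- the energy inequality with `δ = 0` -/
lemma energy0 (hp : 1 < p) (w : Pt N) (hΩ : IsOpen Ω) (hΩ2 : ∀ z ∈ Ω, 0 < z.2)
    (hW : ContDiff ℝ (⊤ : ℕ∞) W) (hG : ContDiffOn ℝ (⊤ : ℕ∞) G Ω) (hG0 : ∀ z ∈ Ω, 0 < G z)
    (hμ : ContDiff ℝ (⊤ : ℕ∞) μ) (hμ0 : ∀ z, 0 ≤ μ z) (hs : tsupport μ ⊆ Ω)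
    (hK : IsCompact (tsupport μ ∩ tsupport W)) :
    Integrable (en e p 0 w W G μ) ∧ ∫ z, en e p 0 w W G μ z ≤ 0 := by
  set K := tsupport μ ∩ tsupport W with hKdef
  have hKΩ : K ⊆ Ω := fun z hz => hs hz.1
  have cG : ∀ z ∈ Ω, ContDiffAt ℝ (⊤ : ℕ∞) G z := fun z hz => hG.contDiffAt (hΩ.mem_nhds hz)
  have c1 : ContinuousOn (fun z => μ z * opL e w W z) K := fun z hz =>
    ((hμ.contDiffAt.mul (cda_opL e w hW.contDiffAt (hΩ2 z (hKΩ hz)))).continuousAt).continuousWithinAt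
  have c2 : ContinuousOn (fun z => G z * adj e w μ z - μ z * opL e w G z) K := fun z hz =>
    ((((cG z (hKΩ hz)).mul (cda_adj e w hμ.contDiffAt (hΩ2 z (hKΩ hz)))).sub
      (hμ.contDiffAt.mul (cda_opL e w (cG z (hKΩ hz)) (hΩ2 z (hKΩ hz))))).continuousAt).continuousWithinAt
  have c3 : ContinuousOn (fun z => μ z * opL e w G z) K := fun z hz =>
    ((hμ.contDiffAt.mul (cda_opL e w (cG z (hKΩ hz)) (hΩ2 z (hKΩ hz)))).continuousAt).continuousWithinAt
  have cZ : ContinuousOn (fun z => W z / G z) K := fun z hz =>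
    ((hW.contDiffAt.div (cG z (hKΩ hz)) (hG0 z (hKΩ hz)).ne').continuousAt).continuousWithinAt
  have hoff : ∀ δ z, z ∉ K → en e p δ w W G μ z = 0 := by
    intro δ z hz
    by_cases h : z ∈ tsupport μ
    · exact en_off2 e w fun h' => hz ⟨h, h'⟩
    · exact en_off1 e w h
  let bd : Pt N → ℝ := fun z => p * ((W z / G z) ^ 2 + 1) ^ ((p - 1) / 2) * |μ z * opL e w W z| +
    (((W z / G z) ^ 2 + 1) ^ (p / 2) * |G z * adj e w μ z - μ z * opL e w G z| +
    p * ((W z / G z) ^ 2 + 1) ^ ((p - 1) / 2) * |W z / G z| * |μ z * opL e w G z|)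
  have cbd : ContinuousOn bd K := by
    have a1 : ContinuousOn (fun z => ((W z / G z) ^ 2 + 1) ^ ((p - 1) / 2)) K :=
      ContinuousOn.rpow_const ((cZ.pow 2).add continuousOn_const) fun _ _ => Or.inr (by linarith)
    have a2 : ContinuousOn (fun z => ((W z / G z) ^ 2 + 1) ^ (p / 2)) K :=
      ContinuousOn.rpow_const ((cZ.pow 2).add continuousOn_const) fun _ _ => Or.inr (by linarith)
    exact ((continuousOn_const.mul a1).mul c1.abs).add ((a2.mul c2.abs).add
      (((continuousOn_const.mul a1).mul cZ.abs).mul c3.abs))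
  have ibd : Integrable (K.indicator bd) :=
    (integrable_indicator_iff hK.measurableSet).mpr (cbd.integrableOn_compact hK)
  let δs : ℕ → ℝ := fun n => 1 / ((n : ℝ) + 1)
  have hδ0 : ∀ n, δs n ≠ 0 := fun n => by positivity
  have hδ1 : ∀ n, δs n ^ 2 ≤ 1 := fun n => by
    have h1 : 0 ≤ δs n := by positivity
    have h2 : δs n ≤ 1 := by
      simp only [δs]; rw [div_le_one (by positivity)]; linarith [Nat.cast_nonneg (α := ℝ) n]
    nlinarith
  have hδt : Filter.Tendsto δs Filter.atTop (nhds 0) := tendsto_one_div_add_atTop_nhds_zero_nat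
  have hmeas : ∀ n, AEStronglyMeasurable (en e p (δs n) w W G μ) volume := by
    intro n
    have : en e p (δs n) w W G μ = K.indicator (en e p (δs n) w W G μ) := by
      ext z
      by_cases hz : z ∈ K
      · rw [Set.indicator_of_mem hz]
      · rw [Set.indicator_of_notMem hz, hoff _ z hz]
    rw [this, aestronglyMeasurable_indicator_iff hK.measurableSet]
    have ck1 : ContinuousOn (fun z => k1 p (δs n) (W z / G z)) K := (k1_smooth (hδ0 n)).continuous.comp_continuousOn cZ
    have ckk : ContinuousOn (fun z => kk p (δs n) (W z / G z)) K := (kk_smooth (hδ0 n)).continuous.comp_continuousOn cZ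
    exact ((ck1.mul c1).sub ((ckk.mul c2).add ((ck1.mul cZ).mul c3))).aestronglyMeasurable hK.measurableSet
  have hbound : ∀ n, ∀ᵐ z, ‖en e p (δs n) w W G μ z‖ ≤ K.indicator bd z := by
    intro n
    refine Filter.Eventually.of_forall fun z => ?_
    by_cases hz : z ∈ K
    · rw [Set.indicator_of_mem hz, Real.norm_eq_abs]
      unfold en
      have b1 := k1_bd hp (hδ0 n) (hδ1 n) (W z / G z)
      have b2 := kk_bd hp (hδ1 n) (W z / G z)
      refine (abs_sub _ _).trans (add_le_add ?_ ((abs_add_le _ _).trans (add_le_add ?_ ?_)))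
      · rw [abs_mul]; exact mul_le_mul_of_nonneg_right b1 (abs_nonneg _)
      · rw [abs_mul]; exact mul_le_mul_of_nonneg_right b2 (abs_nonneg _)
      · rw [abs_mul, abs_mul]
        exact mul_le_mul_of_nonneg_right (mul_le_mul_of_nonneg_right b1 (abs_nonneg _)) (abs_nonneg _)
    · rw [Set.indicator_of_notMem hz, hoff _ z hz, norm_zero]
  have hlim : ∀ᵐ z, Filter.Tendsto (fun n => en e p (δs n) w W G μ z) Filter.atTop (nhds (en e p 0 w W G μ z)) := by
    refine Filter.Eventually.of_forall fun z => ?_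
    have t1 := (k1_tend (p := p) (W z / G z)).comp hδt
    have t2 := (kk_tend hp (W z / G z)).comp hδt
    exact (t1.mul_const _).sub ((t2.mul_const _).add ((t1.mul_const _).mul_const _))
  have hT := tendsto_integral_of_dominated_convergence _ hmeas ibd hbound hlim
  refine ⟨?_, ?_⟩
  · refine Integrable.mono' ibd (aestronglyMeasurable_of_tendsto_ae _ hmeas hlim) ?_
    have hb' : ∀ᵐ z, ∀ n, ‖en e p (δs n) w W G μ z‖ ≤ K.indicator bd z := ae_all_iff.mpr hbound
    filter_upwards [hb', hlim] with z h1 h2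
    exact le_of_tendsto' h2.norm h1
  · exact le_of_tendsto' hT fun n => energy_reg e hp.le (hδ0 n) w hΩ hΩ2 hW hG hG0 hμ hμ0 hs hK

/-- comparison from a nonpositive integral -/
lemma gen_cmp {f A B : Pt N → ℝ} (hf : Integrable f) (h0 : ∫ z, f z ≤ 0) (hA : ∀ z, 0 ≤ A z) (hB : ∀ z, 0 ≤ B z)
    (h : ∀ z, A z ≤ f z + B z) : ∫⁻ z, ENNReal.ofReal (A z) ≤ ∫⁻ z, ENNReal.ofReal (B z) := by
  have hm : AEMeasurable (fun z => ENNReal.ofReal (f z)) := hf.1.aemeasurable.ennreal_ofReal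
  have e1 := integral_eq_lintegral_pos_part_sub_lintegral_neg_part hf
  have fin1 : ∫⁻ z, ENNReal.ofReal (f z) ≠ ⊤ := by
    refine ne_top_of_le_ne_top hf.2.ne (lintegral_mono fun z => ?_)
    rw [← ofReal_norm]; exact ENNReal.ofReal_le_ofReal (le_abs_self _)
  have fin2 : ∫⁻ z, ENNReal.ofReal (- f z) ≠ ⊤ := by
    refine ne_top_of_le_ne_top hf.2.ne (lintegral_mono fun z => ?_)
    rw [← ofReal_norm]; exact ENNReal.ofReal_le_ofReal (neg_le_abs _)
  have e2 : ∫⁻ z, ENNReal.ofReal (f z) ≤ ∫⁻ z, ENNReal.ofReal (- f z) := by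
    rw [e1] at h0
    exact (ENNReal.toReal_le_toReal fin1 fin2).mp (by linarith)
  have e3 : (∫⁻ z, ENNReal.ofReal (A z)) + ∫⁻ z, ENNReal.ofReal (- f z) ≤
      (∫⁻ z, ENNReal.ofReal (B z)) + ∫⁻ z, ENNReal.ofReal (- f z) := by
    calc (∫⁻ z, ENNReal.ofReal (A z)) + ∫⁻ z, ENNReal.ofReal (- f z)
        ≤ ∫⁻ z, (ENNReal.ofReal (A z) + ENNReal.ofReal (- f z)) := le_lintegral_add _ _
      _ ≤ ∫⁻ z, (ENNReal.ofReal (f z) + ENNReal.ofReal (B z)) := by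
          refine lintegral_mono fun z => ?_
          have hz := h z
          have hb := hB z
          rcases le_total 0 (f z) with hf0 | hf0
          · rw [ENNReal.ofReal_of_nonpos (by linarith : - f z ≤ 0), add_zero, ← ENNReal.ofReal_add hf0 hb]
            exact ENNReal.ofReal_le_ofReal hz
          · rw [ENNReal.ofReal_of_nonpos hf0, zero_add]
            rw [← ENNReal.ofReal_add (hA z) (by linarith)]
            exact ENNReal.ofReal_le_ofReal (by linarith)
      _ = (∫⁻ z, ENNReal.ofReal (f z)) + ∫⁻ z, ENNReal.ofReal (B z) := lintegral_add_left' hm _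
      _ ≤ _ := by rw [add_comm]; gcongr
  exact (ENNReal.add_le_add_iff_right fin2).mp e3

end energy0
end dev12

section dev13
section doubling
variable {N : ℕ} {ι : Type} [Fintype ι] (e : ι → Pt N)

/-- doubling variable -/
def hc (z : Pt (N + 1)) : ℝ := z.1 0

/-- the shifted projection -/
def ellL (σ : ℝ) (a : Pt N) : Pt (N + 1) →L[ℝ] Pt N :=
  LinearMap.toContinuousLinearMap
    { toFun := fun z => (fun i => z.1 i.succ, z.2) + (σ * z.1 0) • a
      map_add' := by
        intro x y
        ext i <;> simp <;> ring
      map_smul' := by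
        intro t x
        ext i <;> simp <;> ring }

lemma ellL_apply (σ : ℝ) (a : Pt N) (z : Pt (N + 1)) :
    ellL σ a z = (fun i => z.1 i.succ, z.2) + (σ * z.1 0) • a := rfl

lemma ellL_snd (σ : ℝ) {a : Pt N} (ha : a.2 = 0) (z : Pt (N + 1)) : (ellL σ a z).2 = z.2 := by
  rw [ellL_apply]; simp [ha]

def up (v : Pt N) : Pt (N + 1) := (Fin.cons 0 v.1, v.2)
def e0 : Pt (N + 1) := (Fin.cons 1 0, 0)

lemma ellL_up (σ : ℝ) (a v : Pt N) : ellL σ a (up v) = v := by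
  rw [ellL_apply]; ext i <;> simp [up]

lemma ellL_e0 (σ t : ℝ) (a : Pt N) : ellL σ a (t • e0) = (t * σ) • a := by
  rw [ellL_apply]; ext i <;> simp [e0] <;> left <;> ring

lemma pd_comp_clm {M : ℕ} (L : Pt M →L[ℝ] Pt N) {g : Pt N → ℝ} (hg : Differentiable ℝ g) (v : Pt M) :
    pd v (fun z => g (L z)) = fun z => pd (L v) g (L z) := by
  ext z
  unfold pd
  have := ((hg (L z)).hasFDerivAt).comp z L.hasFDerivAt
  rw [show (fun z => g (L z)) = g ∘ L from rfl, this.fderiv]; rfl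

open Classical in
/-- lifted directions -/
def eD (γ : ℝ) (k0 : ι) (k : ι) : Pt (N + 1) := if k = k0 then √γ • e0 else up (e k)

lemma opL_lift {γ : ℝ} (hγ : 0 < γ) (k0 : ι) (w : Pt N) (ha : (e k0).2 = 0) {σ : ℝ} (hσ : (√γ * σ) ^ 2 = 1)
    {φ : Pt N → ℝ} (hφ : TF φ) (z : Pt (N + 1)) :
    opL (eD e γ k0) (up w) (fun z => φ (ellL σ (e k0) z)) z = opL e w φ (ellL σ (e k0) z) := by
  unfold opL lap
  rw [ellL_snd σ ha, pd_comp_clm _ hφ.diff, ellL_up]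
  congr 1
  refine Finset.sum_congr rfl fun k _ => ?_
  rw [pd_comp_clm _ hφ.diff, pd_comp_clm _ (hφ.pd _).diff]
  by_cases hk : k = k0
  · subst hk
    simp only [eD, if_true, ellL_e0]
    rw [pd_smul_dir]
    have : pd ((√γ * σ) • e k) φ = fun z => (√γ * σ) * pd (e k) φ z := by
      ext z; rw [pd_smul_dir]
    rw [this, pd_const_mul _ _ (hφ.pd _).diff]
    rw [← mul_assoc, ← sq, hσ, one_mul]
  · simp only [eD, if_neg hk, ellL_up]

lemma gram_h {γ : ℝ} (hγ : 0 < γ) (k0 : ι) : ∑ k, (eD e γ k0 k).1 0 * (eD e γ k0 k).1 0 = γ := by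
  rw [Finset.sum_eq_single k0]
  · simp [eD, e0, Real.mul_self_sqrt hγ.le]
  · intro k _ hk; simp [eD, hk, up]
  · simp

lemma gram_y {γ : ℝ} (k0 : ι) (ha : (e k0).2 = 0) (hg : ∑ k, (e k).2 ^ 2 = γ) :
    ∑ k, (eD e γ k0 k).2 * (eD e γ k0 k).2 = γ := by
  rw [← hg]
  refine Finset.sum_congr rfl fun k _ => ?_
  by_cases hk : k = k0
  · subst hk; simp [eD, e0, ha]
  · simp [eD, hk, up, sq]

lemma gram_hy {γ : ℝ} (k0 : ι) (k : ι) : (eD e γ k0 k).1 0 * (eD e γ k0 k).2 = 0 := by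
  by_cases hk : k = k0
  · subst hk; simp [eD, e0]
  · simp [eD, hk, up]

/-- integration over the doubled space -/
lemma shift_int (σ : ℝ) {a : Pt N} (ha : a.2 = 0) {J : Pt N → ENNReal} (hJ : Measurable J)
    {wg : ℝ → ℝ → ENNReal} (hw : Measurable (Function.uncurry wg)) :
    ∫⁻ z : Pt (N + 1), J (ellL σ a z) * wg (z.1 0) z.2 = ∫⁻ ζ : Pt N, J ζ * ∫⁻ h, wg h ζ.2 := by
  have mp1 := volume_preserving_piFinSuccAbove (fun _ : Fin (N + 1) => ℝ) 0
  have mp2 : MeasurePreserving (Prod.map (MeasurableEquiv.piFinSuccAbove (fun _ : Fin (N + 1) => ℝ) 0) (id : ℝ → ℝ))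
      (volume : Measure (Pt (N + 1))) ((volume : Measure (ℝ × (Fin N → ℝ))).prod (volume : Measure ℝ)) :=
    mp1.prod (MeasurePreserving.id volume)
  have mp3 : MeasurePreserving (MeasurableEquiv.prodAssoc : (ℝ × (Fin N → ℝ)) × ℝ ≃ᵐ ℝ × ((Fin N → ℝ) × ℝ))
      ((volume : Measure (ℝ × (Fin N → ℝ))).prod (volume : Measure ℝ)) (volume : Measure (ℝ × Pt N)) :=
    measurePreserving_prodAssoc volume volume volume
  have mp := mp3.comp mp2
  have hw1 : Measurable fun q : ℝ × Pt N => wg q.1 q.2.2 :=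
    hw.comp (measurable_fst.prodMk (measurable_snd.comp measurable_snd))
  have hJ1 : Measurable fun q : ℝ × Pt N => J (q.2 + (σ * q.1) • a) := by
    refine hJ.comp ?_
    have : Continuous fun q : ℝ × Pt N => q.2 + (σ * q.1) • a := by fun_prop
    exact this.measurable
  have hF : Measurable fun q : ℝ × Pt N => J (q.2 + (σ * q.1) • a) * wg q.1 q.2.2 := hJ1.mul hw1
  have h1 := mp.lintegral_comp hF
  have h2 : ∫⁻ z : Pt (N + 1), J (ellL σ a z) * wg (z.1 0) z.2 =
      ∫⁻ q : ℝ × Pt N, J (q.2 + (σ * q.1) • a) * wg q.1 q.2.2 := by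
    rw [← h1]; rfl
  rw [h2, show (volume : Measure (ℝ × Pt N)) = (volume : Measure ℝ).prod (volume : Measure (Pt N)) from rfl,
    lintegral_prod _ hF.aemeasurable]
  have h3 : ∀ h : ℝ, ∫⁻ ζ : Pt N, J (ζ + (σ * h) • a) * wg h ζ.2 = ∫⁻ ζ : Pt N, J ζ * wg h ζ.2 := by
    intro h
    have := lintegral_add_right_eq_self (μ := (volume : Measure (Pt N))) (fun ζ : Pt N => J ζ * wg h ζ.2) ((σ * h) • a)
    rw [← this]
    refine lintegral_congr fun ζ => ?_
    simp [ha]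
  simp_rw [h3]
  rw [lintegral_lintegral_swap]
  · refine lintegral_congr fun ζ => ?_
    exact lintegral_const_mul (J ζ) (f := fun h => wg h ζ.2) (hw.comp (measurable_id.prodMk measurable_const))
  · exact ((hJ.comp measurable_snd).mul hw1).aemeasurable

end doubling
end dev13

section dev14
section monomials
variable {N : ℕ} {ι : Type} [Fintype ι] (e : ι → Pt (N + 1))

/-- weight monomials `h^A y^B (h²+y²)^(K/2)` -/
def mon (A B K : ℝ) (z : Pt (N + 1)) : ℝ := (z.1 0) ^ A * z.2 ^ B * ((z.1 0) ^ 2 + z.2 ^ 2) ^ (K / 2)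

/-- the quadrant -/
def Quad (N : ℕ) : Set (Pt (N + 1)) := {z | 0 < z.1 0 ∧ 0 < z.2}

lemma cont_hc : Continuous fun z : Pt (N + 1) => z.1 0 := by fun_prop

lemma Quad_open : IsOpen (Quad N) :=
  (isOpen_lt continuous_const cont_hc).inter (isOpen_lt continuous_const continuous_snd)

lemma hc_hasF (z : Pt (N + 1)) : HasFDerivAt (fun z : Pt (N + 1) => z.1 0)
    ((ContinuousLinearMap.proj 0).comp (ContinuousLinearMap.fst ℝ (Fin (N + 1) → ℝ) ℝ)) z :=
  ((ContinuousLinearMap.proj (R := ℝ) (φ := fun _ : Fin (N + 1) => ℝ) 0).comp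
    (ContinuousLinearMap.fst ℝ (Fin (N + 1) → ℝ) ℝ)).hasFDerivAt

lemma hc_diff (z : Pt (N + 1)) : DifferentiableAt ℝ (fun z : Pt (N + 1) => z.1 0) z := (hc_hasF z).differentiableAt
lemma y_diff (z : Pt (N + 1)) : DifferentiableAt ℝ (fun z : Pt (N + 1) => z.2) z := differentiableAt_snd
lemma pd_hc (v z : Pt (N + 1)) : pd v (fun z : Pt (N + 1) => z.1 0) z = v.1 0 := by
  unfold pd; rw [(hc_hasF z).fderiv]; rfl
lemma pd_y (v z : Pt (N + 1)) : pd v (fun z : Pt (N + 1) => z.2) z = v.2 := by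
  unfold pd; rw [hasFDerivAt_snd.fderiv]; rfl

/-- logarithmic derivative of the monomial in direction `v` -/
def lgd (A B K : ℝ) (v z : Pt (N + 1)) : ℝ := A * v.1 0 * (z.1 0)⁻¹ + B * v.2 * z.2⁻¹ +
  K * (z.1 0 * v.1 0 + z.2 * v.2) * ((z.1 0) ^ 2 + z.2 ^ 2)⁻¹

lemma mon_cda (A B K : ℝ) {z : Pt (N + 1)} (hz : z ∈ Quad N) : ContDiffAt ℝ (⊤ : ℕ∞) (mon A B K) z := by
  have c1 : ContDiff ℝ (⊤ : ℕ∞) fun z : Pt (N + 1) => z.1 0 := by fun_prop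
  have c2 : ContDiff ℝ (⊤ : ℕ∞) fun z : Pt (N + 1) => z.2 := by fun_prop
  have hr : (z.1 0) ^ 2 + z.2 ^ 2 ≠ 0 := by have := hz.1; positivity
  exact ((c1.contDiffAt.rpow_const_of_ne hz.1.ne').mul (c2.contDiffAt.rpow_const_of_ne hz.2.ne')).mul
    (((c1.pow 2).add (c2.pow 2)).contDiffAt.rpow_const_of_ne hr)

lemma mon_pos (A B K : ℝ) {z : Pt (N + 1)} (hz : z ∈ Quad N) : 0 < mon A B K z := by
  have h1 := hz.1
  have h2 := hz.2
  unfold mon; positivity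

lemma pd_sq (v : Pt (N + 1)) (z : Pt (N + 1)) :
    pd v (fun z : Pt (N + 1) => (z.1 0) ^ 2 + z.2 ^ 2) z = 2 * (z.1 0 * v.1 0 + z.2 * v.2) := by
  have e1 : (fun z : Pt (N + 1) => (z.1 0) ^ 2 + z.2 ^ 2) = fun z => z.1 0 * z.1 0 + z.2 * z.2 := by ext z; ring
  rw [e1, pdA_add v ((hc_diff z).fun_mul (hc_diff z)) ((y_diff z).fun_mul (y_diff z)), pdA_mul v (hc_diff z) (hc_diff z),
    pdA_mul v (y_diff z) (y_diff z), pd_hc, pd_y]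
  ring

lemma sq_diff (z : Pt (N + 1)) : DifferentiableAt ℝ (fun z : Pt (N + 1) => (z.1 0) ^ 2 + z.2 ^ 2) z := by
  exact ((hc_diff z).pow 2).add ((y_diff z).pow 2)

lemma pd_mon (A B K : ℝ) (v : Pt (N + 1)) {z : Pt (N + 1)} (hz : z ∈ Quad N) :
    pd v (mon A B K) z = mon A B K z * lgd A B K v z := by
  obtain ⟨hh, hy⟩ := hz
  have hr : 0 < (z.1 0) ^ 2 + z.2 ^ 2 := by positivity
  have d1 : HasDerivAt (fun x : ℝ => x ^ A) (A * (z.1 0) ^ (A - 1)) (z.1 0) := Real.hasDerivAt_rpow_const (Or.inl hh.ne')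
  have d2 : HasDerivAt (fun x : ℝ => x ^ B) (B * z.2 ^ (B - 1)) z.2 := Real.hasDerivAt_rpow_const (Or.inl hy.ne')
  have d3 : HasDerivAt (fun x : ℝ => x ^ (K / 2)) (K / 2 * ((z.1 0) ^ 2 + z.2 ^ 2) ^ (K / 2 - 1)) ((z.1 0) ^ 2 + z.2 ^ 2) :=
    Real.hasDerivAt_rpow_const (Or.inl hr.ne')
  have D1 : DifferentiableAt ℝ (fun z : Pt (N + 1) => (z.1 0) ^ A) z :=
    DifferentiableAt.comp (g := fun x : ℝ => x ^ A) z d1.differentiableAt (hc_diff z)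
  have D2 : DifferentiableAt ℝ (fun z : Pt (N + 1) => z.2 ^ B) z := d2.differentiableAt.comp z (y_diff z)
  have D3 : DifferentiableAt ℝ (fun z : Pt (N + 1) => ((z.1 0) ^ 2 + z.2 ^ 2) ^ (K / 2)) z :=
    DifferentiableAt.comp (g := fun x : ℝ => x ^ (K / 2)) z d3.differentiableAt (sq_diff z)
  unfold mon lgd
  rw [pdA_mul v (D1.fun_mul D2) D3, pdA_mul v D1 D2, pdA_comp v d1 (hc_diff z), pdA_comp v d2 (y_diff z),
    pdA_comp v d3 (sq_diff z), pd_hc, pd_y, pd_sq, Real.rpow_sub_one hh.ne', Real.rpow_sub_one hy.ne', Real.rpow_sub_one hr.ne']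
  field_simp
  ring

/-- second logarithmic derivative -/
def lgd2 (A B K : ℝ) (v z : Pt (N + 1)) : ℝ := - A * (v.1 0) ^ 2 * ((z.1 0) ^ 2)⁻¹ - B * v.2 ^ 2 * (z.2 ^ 2)⁻¹ +
  K * ((v.1 0) ^ 2 + v.2 ^ 2) * ((z.1 0) ^ 2 + z.2 ^ 2)⁻¹ -
  2 * K * (z.1 0 * v.1 0 + z.2 * v.2) ^ 2 * (((z.1 0) ^ 2 + z.2 ^ 2) ^ 2)⁻¹

lemma lgd_diff (A B K : ℝ) (v : Pt (N + 1)) {z : Pt (N + 1)} (hz : z ∈ Quad N) :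
    DifferentiableAt ℝ (lgd A B K v) z := by
  obtain ⟨hh, hy⟩ := hz
  have hr : (z.1 0) ^ 2 + z.2 ^ 2 ≠ 0 := by positivity
  have i1 := (hc_diff z).fun_inv hh.ne'
  have i2 := (y_diff z).fun_inv hy.ne'
  have i3 := (sq_diff z).fun_inv hr
  exact ((i1.const_mul _).add (i2.const_mul _)).add
    (((((hc_diff z).mul_const _).add ((y_diff z).mul_const _)).const_mul K).mul i3)

lemma pd_inv {f : Pt (N + 1) → ℝ} {z : Pt (N + 1)} (v : Pt (N + 1)) (hf : DifferentiableAt ℝ f z) (h0 : f z ≠ 0) :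
    pd v (fun z => (f z)⁻¹) z = - ((f z) ^ 2)⁻¹ * pd v f z := by
  rw [pdA_comp v (hasDerivAt_inv h0) hf]

lemma pd_lgd (A B K : ℝ) (v : Pt (N + 1)) {z : Pt (N + 1)} (hz : z ∈ Quad N) :
    pd v (lgd A B K v) z = lgd2 A B K v z := by
  obtain ⟨hh, hy⟩ := hz
  have hr : (z.1 0) ^ 2 + z.2 ^ 2 ≠ 0 := by positivity
  have i1 := (hc_diff z).fun_inv hh.ne'
  have i2 := (y_diff z).fun_inv hy.ne'
  have i3 := (sq_diff z).fun_inv hr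
  have cd : ∀ c : ℝ, DifferentiableAt ℝ (fun _ : Pt (N + 1) => c) z := fun c => differentiableAt_const c
  have pc : ∀ c : ℝ, pd v (fun _ : Pt (N + 1) => c) z = 0 := by intro c; unfold pd; simp
  have l1 : DifferentiableAt ℝ (fun z : Pt (N + 1) => z.1 0 * v.1 0 + z.2 * v.2) z :=
    ((hc_diff z).mul_const _).add ((y_diff z).mul_const _)
  have q1 : pd v (fun z : Pt (N + 1) => z.1 0 * v.1 0 + z.2 * v.2) z = (v.1 0) ^ 2 + v.2 ^ 2 := by
    rw [pdA_add v ((hc_diff z).mul_const _) ((y_diff z).mul_const _), pdA_mul v (hc_diff z) (cd _),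
      pdA_mul v (y_diff z) (cd _), pc, pc, pd_hc, pd_y]; ring
  unfold lgd lgd2
  rw [pdA_add v ((i1.const_mul _).fun_add (i2.const_mul _)) ((l1.const_mul K).fun_mul i3), 
    pdA_add v (i1.const_mul _) (i2.const_mul _), pdA_mul v (cd _) i1, pdA_mul v (cd _) i2,
    pdA_mul v (l1.const_mul K) i3, pdA_mul v (cd K) l1, q1, pc, pc, pc, pd_inv v (hc_diff z) hh.ne', pd_inv v (y_diff z) hy.ne',
    pd_inv v (sq_diff z) hr, pd_hc, pd_y, pd_sq]
  ring

/-- products of a monomial with functions of each variable -/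
def mc (A B K : ℝ) (f1 f2 : ℝ → ℝ) (z : Pt (N + 1)) : ℝ := mon A B K z * (f1 (z.1 0) * f2 z.2)

variable {f1 f2 f1' f2' f1'' f2'' : ℝ → ℝ}

lemma mon_diff (A B K : ℝ) {z : Pt (N + 1)} (hz : z ∈ Quad N) : DifferentiableAt ℝ (mon A B K) z :=
  cda_diff (mon_cda A B K hz)

lemma pd_mc (A B K : ℝ) (v : Pt (N + 1)) {z : Pt (N + 1)} (hz : z ∈ Quad N)
    (h1 : ∀ x > 0, HasDerivAt f1 (f1' x) x) (h2 : ∀ x > 0, HasDerivAt f2 (f2' x) x) :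
    pd v (mc A B K f1 f2) z = mon A B K z * (lgd A B K v z * (f1 (z.1 0) * f2 z.2) +
      (v.1 0 * (f1' (z.1 0) * f2 z.2) + v.2 * (f1 (z.1 0) * f2' z.2))) := by
  have d1 : DifferentiableAt ℝ (fun z : Pt (N + 1) => f1 (z.1 0)) z := (h1 _ hz.1).differentiableAt.comp z (hc_diff z)
  have d2 : DifferentiableAt ℝ (fun z : Pt (N + 1) => f2 z.2) z := (h2 _ hz.2).differentiableAt.comp z (y_diff z)
  unfold mc
  rw [pdA_mul v (mon_diff A B K hz) (d1.fun_mul d2), pdA_mul v d1 d2, pdA_comp v (h1 _ hz.1) (hc_diff z),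
    pdA_comp v (h2 _ hz.2) (y_diff z), pd_mon A B K v hz, pd_hc, pd_y]
  ring

lemma pd2_mc (A B K : ℝ) (v : Pt (N + 1)) {z : Pt (N + 1)} (hz : z ∈ Quad N)
    (h1 : ∀ x > 0, HasDerivAt f1 (f1' x) x) (h2 : ∀ x > 0, HasDerivAt f2 (f2' x) x)
    (h1' : ∀ x > 0, HasDerivAt f1' (f1'' x) x) (h2' : ∀ x > 0, HasDerivAt f2' (f2'' x) x) :
    pd v (pd v (mc A B K f1 f2)) z = mon A B K z * ((lgd A B K v z ^ 2 + lgd2 A B K v z) * (f1 (z.1 0) * f2 z.2) +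
      2 * lgd A B K v z * (v.1 0 * (f1' (z.1 0) * f2 z.2) + v.2 * (f1 (z.1 0) * f2' z.2)) +
      ((v.1 0) ^ 2 * (f1'' (z.1 0) * f2 z.2) + 2 * (v.1 0 * v.2) * (f1' (z.1 0) * f2' z.2) +
        v.2 ^ 2 * (f1 (z.1 0) * f2'' z.2))) := by
  have ev : pd v (mc A B K f1 f2) =ᶠ[nhds z] fun z => mon A B K z * (lgd A B K v z * (f1 (z.1 0) * f2 z.2) +
      (v.1 0 * (f1' (z.1 0) * f2 z.2) + v.2 * (f1 (z.1 0) * f2' z.2))) := by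
    filter_upwards [Quad_open.mem_nhds hz] with x hx using pd_mc A B K v hx h1 h2
  have d1 : DifferentiableAt ℝ (fun z : Pt (N + 1) => f1 (z.1 0)) z := (h1 _ hz.1).differentiableAt.comp z (hc_diff z)
  have d2 : DifferentiableAt ℝ (fun z : Pt (N + 1) => f2 z.2) z := (h2 _ hz.2).differentiableAt.comp z (y_diff z)
  have d1' : DifferentiableAt ℝ (fun z : Pt (N + 1) => f1' (z.1 0)) z := (h1' _ hz.1).differentiableAt.comp z (hc_diff z)
  have d2' : DifferentiableAt ℝ (fun z : Pt (N + 1) => f2' z.2) z := (h2' _ hz.2).differentiableAt.comp z (y_diff z)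
  have dl := lgd_diff A B K v hz
  have cd : ∀ c : ℝ, DifferentiableAt ℝ (fun _ : Pt (N + 1) => c) z := fun c => differentiableAt_const c
  have pc : ∀ c : ℝ, pd v (fun _ : Pt (N + 1) => c) z = 0 := by intro c; unfold pd; simp
  have t1 := d1'.fun_mul d2
  have t2 := d1.fun_mul d2'
  have t0 := d1.fun_mul d2
  rw [pd_congr v ev, pdA_mul v (mon_diff A B K hz) ((dl.fun_mul t0).fun_add ((t1.const_mul _).fun_add (t2.const_mul _))),
    pdA_add v (dl.fun_mul t0) ((t1.const_mul _).fun_add (t2.const_mul _)), pdA_add v (t1.const_mul _) (t2.const_mul _),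
    pdA_mul v dl t0, pdA_mul v (cd _) t1, pdA_mul v (cd _) t2, pdA_mul v d1 d2, pdA_mul v d1' d2, pdA_mul v d1 d2', pc, pc,
    pdA_comp v (h1 _ hz.1) (hc_diff z), pdA_comp v (h2 _ hz.2) (y_diff z), pdA_comp v (h1' _ hz.1) (hc_diff z),
    pdA_comp v (h2' _ hz.2) (y_diff z), pd_mon A B K v hz, pd_lgd A B K v hz, pd_hc, pd_y]
  ring

variable {γ : ℝ}

lemma gram_sum (g1 : ∑ k, (e k).1 0 * (e k).1 0 = γ) (g2 : ∑ k, (e k).2 * (e k).2 = γ) (g3 : ∀ k, (e k).1 0 * (e k).2 = 0)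
    {F : ι → ℝ} {X Y R : ℝ} (hF : ∀ k, F k = (e k).1 0 * (e k).1 0 * X + (e k).2 * (e k).2 * Y + (e k).1 0 * (e k).2 * R) :
    ∑ k, F k = γ * (X + Y) := by
  simp_rw [hF, g3, zero_mul, add_zero]
  rw [Finset.sum_add_distrib, ← Finset.sum_mul, ← Finset.sum_mul, g1, g2]; ring

lemma lap_mc (A B K : ℝ) {z : Pt (N + 1)} (hz : z ∈ Quad N)
    (g1 : ∑ k, (e k).1 0 * (e k).1 0 = γ) (g2 : ∑ k, (e k).2 * (e k).2 = γ) (g3 : ∀ k, (e k).1 0 * (e k).2 = 0)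
    (h1 : ∀ x > 0, HasDerivAt f1 (f1' x) x) (h2 : ∀ x > 0, HasDerivAt f2 (f2' x) x)
    (h1' : ∀ x > 0, HasDerivAt f1' (f1'' x) x) (h2' : ∀ x > 0, HasDerivAt f2' (f2'' x) x) :
    lap e (mc A B K f1 f2) z = γ * (mon A B K z * (
      (A * (A - 1) / (z.1 0) ^ 2 + B * (B - 1) / z.2 ^ 2 + K * (K + 2 * A + 2 * B) / ((z.1 0) ^ 2 + z.2 ^ 2)) *
        (f1 (z.1 0) * f2 z.2) +
      (2 * (A / z.1 0 + K * z.1 0 / ((z.1 0) ^ 2 + z.2 ^ 2)) * f1' (z.1 0) + f1'' (z.1 0)) * f2 z.2 +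
      f1 (z.1 0) * (2 * (B / z.2 + K * z.2 / ((z.1 0) ^ 2 + z.2 ^ 2)) * f2' z.2 + f2'' z.2))) := by
  have hh := hz.1
  have hy := hz.2
  have hr : (z.1 0) ^ 2 + z.2 ^ 2 ≠ 0 := by positivity
  unfold lap
  set H := z.1 0 with hH
  set y := z.2 with hyy
  set r2 := H ^ 2 + y ^ 2 with hr2
  have key := gram_sum e g1 g2 g3 (F := fun k => pd (e k) (pd (e k) (mc A B K f1 f2)) z)
    (X := mon A B K z * (((A / H + K * H / r2) ^ 2 - A / H ^ 2 + K / r2 - 2 * K * H ^ 2 / r2 ^ 2) * (f1 H * f2 y) +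
      2 * (A / H + K * H / r2) * (f1' H * f2 y) + f1'' H * f2 y))
    (Y := mon A B K z * (((B / y + K * y / r2) ^ 2 - B / y ^ 2 + K / r2 - 2 * K * y ^ 2 / r2 ^ 2) * (f1 H * f2 y) +
      2 * (B / y + K * y / r2) * (f1 H * f2' y) + f1 H * f2'' y))
    (R := mon A B K z * ((2 * (A / H + K * H / r2) * (B / y + K * y / r2) - 4 * K * H * y / r2 ^ 2) * (f1 H * f2 y) +
      2 * (A / H + K * H / r2) * (f1 H * f2' y) + 2 * (B / y + K * y / r2) * (f1' H * f2 y) + 2 * (f1' H * f2' y)))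
    (fun k => by
      rw [pd2_mc A B K (e k) hz h1 h2 h1' h2']
      unfold lgd lgd2
      rw [← hH, ← hyy, ← hr2]
      simp only [div_eq_mul_inv, inv_pow]
      ring)
  rw [key]
  congr 1
  rw [← mul_add]
  congr 1
  have : ((A / H + K * H / r2) ^ 2 - A / H ^ 2 + K / r2 - 2 * K * H ^ 2 / r2 ^ 2) +
    ((B / y + K * y / r2) ^ 2 - B / y ^ 2 + K / r2 - 2 * K * y ^ 2 / r2 ^ 2) = 
    A * (A - 1) / H ^ 2 + B * (B - 1) / y ^ 2 + K * (K + 2 * A + 2 * B) / r2 := by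
    field_simp
    rw [hr2]; ring
  rw [← this]; ring

lemma mon_shift (A B K : ℝ) {z : Pt (N + 1)} (hz : z ∈ Quad N) : z.2⁻¹ * mon A B K z = mon A (B - 1) K z := by
  unfold mon
  rw [Real.rpow_sub_one hz.2.ne']; ring

lemma adj_mc (A c K : ℝ) {z : Pt (N + 1)} (hz : z ∈ Quad N) {w : Pt (N + 1)} (hw0 : w.1 0 = 0) (hw : w.2 = c * γ)
    (g1 : ∑ k, (e k).1 0 * (e k).1 0 = γ) (g2 : ∑ k, (e k).2 * (e k).2 = γ) (g3 : ∀ k, (e k).1 0 * (e k).2 = 0)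
    (h1 : ∀ x > 0, HasDerivAt f1 (f1' x) x) (h2 : ∀ x > 0, HasDerivAt f2 (f2' x) x)
    (h1' : ∀ x > 0, HasDerivAt f1' (f1'' x) x) (h2' : ∀ x > 0, HasDerivAt f2' (f2'' x) x) :
    adj e w (mc A c K f1 f2) z = γ * (mon A c K z * (
      (A * (A - 1) / (z.1 0) ^ 2 + K * (K + 2 * A + c) / ((z.1 0) ^ 2 + z.2 ^ 2)) * (f1 (z.1 0) * f2 z.2) +
      (2 * (A / z.1 0 + K * z.1 0 / ((z.1 0) ^ 2 + z.2 ^ 2)) * f1' (z.1 0) + f1'' (z.1 0)) * f2 z.2 +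
      f1 (z.1 0) * ((c / z.2 + 2 * K * z.2 / ((z.1 0) ^ 2 + z.2 ^ 2)) * f2' z.2 + f2'' z.2))) := by
  have hh := hz.1
  have hy := hz.2
  have hr : (z.1 0) ^ 2 + z.2 ^ 2 ≠ 0 := by positivity
  have ev : (fun z : Pt (N + 1) => z.2⁻¹ * mc A c K f1 f2 z) =ᶠ[nhds z] mc A (c - 1) K f1 f2 := by
    filter_upwards [Quad_open.mem_nhds hz] with x hx
    unfold mc
    rw [← mul_assoc, mon_shift A c K hx]
  unfold adj
  rw [lap_mc e A c K hz g1 g2 g3 h1 h2 h1' h2', pd_congr w ev, pd_mc A (c - 1) K w hz h1 h2, ← mon_shift A c K hz, hw0, hw]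
  unfold lgd
  rw [hw0, hw]
  field_simp
  ring

lemma opL_mon (A B K c : ℝ) {z : Pt (N + 1)} (hz : z ∈ Quad N) {w : Pt (N + 1)} (hw0 : w.1 0 = 0) (hw : w.2 = c * γ)
    (g1 : ∑ k, (e k).1 0 * (e k).1 0 = γ) (g2 : ∑ k, (e k).2 * (e k).2 = γ) (g3 : ∀ k, (e k).1 0 * (e k).2 = 0) :
    opL e w (mon A B K) z = γ * (mon A B K z * 
      (A * (A - 1) / (z.1 0) ^ 2 + B * (B - 1 + c) / z.2 ^ 2 + K * (K + 2 * A + 2 * B + c) / ((z.1 0) ^ 2 + z.2 ^ 2))) := by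
  have hh := hz.1
  have hy := hz.2
  have hr : (z.1 0) ^ 2 + z.2 ^ 2 ≠ 0 := by positivity
  have e1 : mon A B K = mc (N := N) A B K (fun _ => 1) (fun _ => 1) := by ext z; simp [mc]
  have h1 : ∀ x > 0, HasDerivAt (fun _ : ℝ => (1 : ℝ)) ((fun _ : ℝ => (0 : ℝ)) x) x := fun x _ => hasDerivAt_const _ _
  have h0 : ∀ x > 0, HasDerivAt (fun _ : ℝ => (0 : ℝ)) ((fun _ : ℝ => (0 : ℝ)) x) x := fun x _ => hasDerivAt_const _ _
  unfold opL
  rw [pd_mon A B K w hz]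
  have := lap_mc e A B K hz g1 g2 g3 h1 h1 h0 h0
  rw [← e1] at this
  rw [this]
  unfold lgd
  rw [hw0, hw]
  field_simp
  ring

end monomials
end dev14

section dev15
section scalars

/-- scalar monomials -/
def mS (A B K h y : ℝ) : ℝ := h ^ A * y ^ B * (h ^ 2 + y ^ 2) ^ (K / 2)

lemma mS_pos (A B K : ℝ) {h y : ℝ} (hh : 0 < h) (hy : 0 < y) : 0 < mS A B K h y := by unfold mS; positivity

lemma mS_mul (A B K A' B' K' : ℝ) {h y : ℝ} (hh : 0 < h) (hy : 0 < y) :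
    mS A B K h y * mS A' B' K' h y = mS (A + A') (B + B') (K + K') h y := by
  have hr : 0 < h ^ 2 + y ^ 2 := by positivity
  unfold mS
  rw [Real.rpow_add hh, Real.rpow_add hy, add_div, Real.rpow_add hr]; ring

lemma mS_rpow (A B K q : ℝ) {h y : ℝ} (hh : 0 < h) (hy : 0 < y) :
    (mS A B K h y) ^ q = mS (A * q) (B * q) (K * q) h y := by
  have hr : 0 < h ^ 2 + y ^ 2 := by positivity
  unfold mS
  rw [Real.mul_rpow (by positivity) (by positivity), Real.mul_rpow (by positivity) (by positivity),
    ← Real.rpow_mul hh.le, ← Real.rpow_mul hy.le, ← Real.rpow_mul hr.le]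
  congr 2; ring

lemma rpow_between {X : ℝ} (h1 : 1 ≤ X) (h2 : X ≤ 2) (q : ℝ) : X ^ q ≤ 2 ^ |q| ∧ (2 ^ |q|)⁻¹ ≤ X ^ q := by
  have hX : 0 < X := by linarith
  have e1 : X ^ |q| ≤ 2 ^ |q| := Real.rpow_le_rpow hX.le h2 (abs_nonneg q)
  constructor
  · exact (Real.rpow_le_rpow_of_exponent_le h1 (le_abs_self q)).trans e1
  · calc (2 ^ |q|)⁻¹ ≤ (X ^ |q|)⁻¹ := inv_anti₀ (by positivity) e1
      _ = X ^ (-|q|) := by rw [Real.rpow_neg hX.le]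
      _ ≤ X ^ q := Real.rpow_le_rpow_of_exponent_le h1 (neg_abs_le q)

lemma mS_small_eq (A B K : ℝ) {h y : ℝ} (hy : 0 < y) :
    mS A B K h y = h ^ A * y ^ (B + K) * ((h ^ 2 + y ^ 2) / y ^ 2) ^ (K / 2) := by
  unfold mS
  rw [Real.div_rpow (by positivity) (by positivity), Real.rpow_add hy,
    show (y ^ 2) ^ (K / 2) = y ^ K by
      rw [← Real.rpow_natCast, ← Real.rpow_mul hy.le]; congr 1; push_cast; ring]
  have : (0 : ℝ) < y ^ K := by positivity
  field_simp

lemma mS_big_eq (A B K : ℝ) {h y : ℝ} (hh : 0 < h) :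
    mS A B K h y = h ^ (A + K) * y ^ B * ((h ^ 2 + y ^ 2) / h ^ 2) ^ (K / 2) := by
  unfold mS
  rw [Real.div_rpow (by positivity) (by positivity), Real.rpow_add hh,
    show (h ^ 2) ^ (K / 2) = h ^ K by
      rw [← Real.rpow_natCast, ← Real.rpow_mul hh.le]; congr 1; push_cast; ring]
  have : (0 : ℝ) < h ^ K := by positivity
  field_simp

lemma mS_small (A B K : ℝ) {h y : ℝ} (hh : 0 < h) (hy : 0 < y) (hle : h ≤ y) :
    mS A B K h y ≤ 2 ^ |K / 2| * (h ^ A * y ^ (B + K)) ∧ (2 ^ |K / 2|)⁻¹ * (h ^ A * y ^ (B + K)) ≤ mS A B K h y := by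
  rw [mS_small_eq A B K hy]
  have h1 : 1 ≤ (h ^ 2 + y ^ 2) / y ^ 2 := by rw [le_div_iff₀ (by positivity)]; nlinarith
  have h2 : (h ^ 2 + y ^ 2) / y ^ 2 ≤ 2 := by rw [div_le_iff₀ (by positivity)]; nlinarith
  obtain ⟨b1, b2⟩ := rpow_between h1 h2 (K / 2)
  have : 0 ≤ h ^ A * y ^ (B + K) := by positivity
  constructor
  · rw [mul_comm (2 ^ |K / 2|)]; exact mul_le_mul_of_nonneg_left b1 this
  · rw [mul_comm (2 ^ |K / 2|)⁻¹]; exact mul_le_mul_of_nonneg_left b2 this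

lemma mS_big (A B K : ℝ) {h y : ℝ} (hh : 0 < h) (hy : 0 < y) (hle : y ≤ h) :
    mS A B K h y ≤ 2 ^ |K / 2| * (h ^ (A + K) * y ^ B) ∧ (2 ^ |K / 2|)⁻¹ * (h ^ (A + K) * y ^ B) ≤ mS A B K h y := by
  rw [mS_big_eq A B K hh]
  have h1 : 1 ≤ (h ^ 2 + y ^ 2) / h ^ 2 := by rw [le_div_iff₀ (by positivity)]; nlinarith
  have h2 : (h ^ 2 + y ^ 2) / h ^ 2 ≤ 2 := by rw [div_le_iff₀ (by positivity)]; nlinarith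
  obtain ⟨b1, b2⟩ := rpow_between h1 h2 (K / 2)
  have : 0 ≤ h ^ (A + K) * y ^ B := by positivity
  constructor
  · rw [mul_comm (2 ^ |K / 2|)]; exact mul_le_mul_of_nonneg_left b1 this
  · rw [mul_comm (2 ^ |K / 2|)⁻¹]; exact mul_le_mul_of_nonneg_left b2 this

/-- choice of parameters -/
lemma params {p c θ : ℝ} (hp : 1 < p) (hc : 1 ≤ c) (h1 : 1 < θ) (h2 : θ < c + 1) :
    ∃ a s : ℝ, 0 < a ∧ a < 1 ∧ 0 < a + θ - 2 ∧ 0 < c + a + 2 - θ ∧ p * (θ - 2) + 1 - c < (p - 1) * s ∧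
      (1 < c → 0 < s ∧ s < c - 1) ∧ (c = 1 → s < 0) := by
  have hs : ∃ s : ℝ, p * (θ - 2) + 1 - c < (p - 1) * s ∧ (1 < c → 0 < s ∧ s < c - 1) ∧ (c = 1 → s < 0) := by
    rcases eq_or_lt_of_le hc with h | h
    · subst h
      refine ⟨p * (θ - 2) / (2 * (p - 1)), ?_, fun h => absurd h (lt_irrefl _), fun _ => ?_⟩
      · have : (p - 1) * (p * (θ - 2) / (2 * (p - 1))) = p * (θ - 2) / 2 := by
          have : p - 1 ≠ 0 := by linarith
          field_simp
        rw [this]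
        have : p * (2 - θ) > 0 := mul_pos (by linarith) (by linarith)
        nlinarith
      · refine div_neg_of_neg_of_pos ?_ (by linarith)
        have : p * (2 - θ) > 0 := mul_pos (by linarith) (by linarith)
        nlinarith
    · have hlt : max 0 ((p * (θ - 2) + 1 - c) / (p - 1)) < c - 1 := by
        refine max_lt (by linarith) ?_
        rw [div_lt_iff₀ (by linarith)]
        nlinarith
      obtain ⟨s, hs1, hs2⟩ := exists_between hlt
      refine ⟨s, ?_, fun _ => ⟨(le_max_left _ _).trans_lt hs1, hs2⟩, fun h' => by linarith⟩
      have := (le_max_right _ _).trans_lt hs1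
      rw [div_lt_iff₀ (by linarith)] at this
      linarith
  obtain ⟨s, hs1, hs2, hs3⟩ := hs
  have hlt : max 0 (max (2 - θ) (θ - 2 - c)) < 1 := max_lt (by linarith) (max_lt (by linarith) (by linarith))
  obtain ⟨a, ha1, ha2⟩ := exists_between hlt
  have b1 := (le_max_left _ _).trans_lt ha1
  have b2 := ((le_max_left _ _).trans (le_max_right _ _)).trans_lt ha1
  have b3 := ((le_max_right _ _).trans (le_max_right _ _)).trans_lt ha1
  exact ⟨a, s, b1, ha2, by linarith, by linarith, hs1, hs2, hs3⟩

/-- choice of the perturbation -/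
lemma wt {k l c s : ℝ} (hk : 0 < k) (hl : 0 < l) (hc : 1 ≤ c) (hs1 : 1 < c → 0 < s ∧ s < c - 1) (hs2 : c = 1 → s < 0) :
    ∃ η κ : ℝ, 0 < κ ∧ ∀ X B : ℝ, 1 ≤ X → 0 ≤ B →
      κ * max 1 (X ^ (s / 2)) ≤ 1 + η * X ^ (s / 2) ∧
      κ * (B + X ^ (s / 2)) ≤ k * l / X + B + η * X ^ (s / 2) * (B + s * (c - 1 - s) + (k - s) * (l - s) / X) := by
  have hkl : 0 < k * l := mul_pos hk hl
  generalize hQ : (k - s) * (l - s) = Q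
  generalize hkl' : k * l = kl at hkl ⊢
  set M := |Q| with hM
  have hM0 : 0 ≤ M := abs_nonneg _
  have hMle : -M ≤ Q := neg_abs_le _
  have hMle' : Q ≤ M := le_abs_self _
  rcases eq_or_lt_of_le hc with h | h
  · have hs := hs2 h.symm
    obtain ⟨η', hη1, hη2⟩ := exists_between (lt_min (by norm_num : (0 : ℝ) < 1 / 2) (by positivity : 0 < kl / (M + 1)))
    have hη3 := hη2.trans_le (min_le_left _ _)
    have hη4 := hη2.trans_le (min_le_right _ _)
    rw [lt_div_iff₀ (by linarith)] at hη4
    obtain ⟨κ, hκ1, hκ2⟩ := exists_between (lt_min (by norm_num : (0 : ℝ) < 1 / 2) (mul_pos hη1 (by nlinarith) : 0 < η' * s ^ 2))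
    have hκ3 := hκ2.trans_le (min_le_left _ _)
    have hκ4 := hκ2.trans_le (min_le_right _ _)
    refine ⟨-η', κ, hκ1, fun X B hX hB => ?_⟩
    have hX0 : 0 < X := by linarith
    set T := X ^ (s / 2) with hT
    have hT0 : 0 < T := by positivity
    have hT1 : T ≤ 1 := Real.rpow_le_one_of_one_le_of_nonpos hX (by linarith)
    constructor
    · rw [max_eq_left hT1]
      have : η' * T ≤ η' := by nlinarith
      linarith
    · have e1 : kl / X + B + -η' * T * (B + s * (c - 1 - s) + Q / X) =
          (kl - η' * T * (Q)) / X + B * (1 - η' * T) + η' * s ^ 2 * T := by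
        rw [← h]; field_simp; ring
      rw [e1]
      have e2 : 0 ≤ (kl - η' * T * (Q)) / X := by
        refine div_nonneg ?_ hX0.le
        have : η' * T ≤ η' := by nlinarith
        have h3 : 0 ≤ η' * T := by positivity
        nlinarith
      have e3 : κ * B ≤ B * (1 - η' * T) := by
        have : η' * T ≤ η' := by nlinarith
        nlinarith
      have e4 : κ * T ≤ η' * s ^ 2 * T := by nlinarith
      linarith
  · obtain ⟨hs, hsc⟩ := hs1 h
    set σ := s * (c - 1 - s) with hσ
    have hσ0 : 0 < σ := mul_pos hs (by linarith)
    -- threshold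
    set X0 := 1 + 2 * M / σ with hX0d
    have hX01 : 1 ≤ X0 := by
      have : 0 ≤ 2 * M / σ := by positivity
      linarith
    set T0 := X0 ^ (s / 2) with hT0d
    have hT00 : 0 < T0 := by positivity
    set η := kl / (T0 * (M + 1)) with hη
    have hη0 : 0 < η := by positivity
    have hη1 : η * T0 * (M + 1) = kl := by rw [hη]; field_simp
    obtain ⟨κ, hκ1, hκ2⟩ := exists_between (lt_min (lt_min one_pos hη0) (by positivity : 0 < η * σ / 2))
    have hκ3 := (hκ2.trans_le (min_le_left _ _)).trans_le (min_le_left _ _)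
    have hκ5 := (hκ2.trans_le (min_le_left _ _)).trans_le (min_le_right _ _)
    have hκ4 := hκ2.trans_le (min_le_right _ _)
    refine ⟨η, κ, hκ1, fun X B hX hB => ?_⟩
    have hX0 : 0 < X := by linarith
    set T := X ^ (s / 2) with hT
    have hT0 : 0 < T := by positivity
    clear_value η
    constructor
    · rcases max_cases 1 T with ⟨hm, _⟩ | ⟨hm, _⟩ <;> rw [hm]
      · have : 0 < η * T := by positivity
        linarith
      · have := mul_le_mul_of_nonneg_right hκ5.le hT0.le
        linarith
    · have e0 : κ * T ≤ η * σ / 2 * T := mul_le_mul_of_nonneg_right hκ4.le hT0.le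
      have e1 : κ * B ≤ B := mul_le_of_le_one_left hB hκ3.le
      have e2 : 0 ≤ η * T * B := by positivity
      suffices hh : 0 ≤ kl / X + η * T * (σ / 2 + Q / X) by
        have e5 : η * T * (B + σ + Q / X) =
          η * T * B + η * σ / 2 * T + η * T * (σ / 2 + Q / X) := by ring
        rw [e5, mul_add]
        linarith
      rcases le_total X X0 with hle | hle
      · have hTT : T ≤ T0 := Real.rpow_le_rpow hX0.le hle (by linarith)
        have : kl / X + η * T * (σ / 2 + Q / X) =
          (kl + η * T * (Q)) / X + η * T * σ / 2 := by field_simp; ring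
        rw [this]
        have h3 : 0 ≤ η * T * σ / 2 := by positivity
        have h4 : 0 ≤ (kl + η * T * (Q)) / X := by
          refine div_nonneg ?_ hX0.le
          have h5 : η * T * (M + 1) ≤ kl := by
            rw [← hη1]; gcongr
          have h6 : 0 ≤ η * T := by positivity
          have h7 := mul_le_mul_of_nonneg_left hMle h6
          linarith
        linarith
      · have h3 : 0 ≤ σ / 2 + Q / X := by
          have h4 : M / X ≤ σ / 2 := by
            rw [div_le_iff₀ hX0]
            have : 2 * M / σ ≤ X := by linarith
            rw [div_le_iff₀ hσ0] at this
            linarith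
          have h5 : - (M / X) ≤ Q / X := by
            rw [← neg_div]; exact div_le_div_of_nonneg_right hMle hX0.le
          linarith
        have h4 : 0 ≤ kl / X := by positivity
        have h5 : 0 ≤ η * T := by positivity
        have h6 := mul_nonneg h5 h3
        linarith

lemma int_small {q y : ℝ} (hq : -1 < q) (hy : 0 < y) :
    ∫⁻ h in Set.Ioc 0 y, ENNReal.ofReal (h ^ q) = ENNReal.ofReal (y ^ (q + 1) / (q + 1)) := by
  have hi : IntervalIntegrable (fun h : ℝ => h ^ q) volume 0 y := intervalIntegral.intervalIntegrable_rpow' hq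
  rw [← ofReal_integral_eq_lintegral_ofReal]
  · rw [← intervalIntegral.integral_of_le hy.le, integral_rpow (Or.inl hq), Real.zero_rpow (by linarith), sub_zero]
  · exact (intervalIntegrable_iff_integrableOn_Ioc_of_le hy.le).mp hi
  · exact (ae_restrict_iff' measurableSet_Ioc).mpr (Filter.Eventually.of_forall fun h hh => Real.rpow_nonneg hh.1.le _)

lemma int_big {q y : ℝ} (hq : q < -1) (hy : 0 < y) :
    ∫⁻ h in Set.Ioi y, ENNReal.ofReal (h ^ q) = ENNReal.ofReal (y ^ (q + 1) / (-(q + 1))) := by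
  rw [← ofReal_integral_eq_lintegral_ofReal]
  · rw [integral_Ioi_rpow_of_lt hq hy]; congr 1; rw [div_neg, neg_div]
  · exact integrableOn_Ioi_rpow_of_lt hq hy
  · exact (ae_restrict_iff' measurableSet_Ioi).mpr
      (Filter.Eventually.of_forall fun h hh => Real.rpow_nonneg (hy.trans hh).le _)

end scalars
end dev15

section dev16
section weights

/-- admissible parameters -/
structure WP (p c θ a k l s η κ : ℝ) : Prop where
  hp : 1 < p
  hc : 1 ≤ c
  hθ1 : 1 < θ
  hθ2 : θ < c + 1
  ha0 : 0 < a
  ha1 : a < 1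
  hk : k = a + θ - 2
  hk0 : 0 < k
  hl : l = c + a + 2 - θ
  hl0 : 0 < l
  hs : p * (θ - 2) + 1 - c < (p - 1) * s
  hs1 : 1 < c → 0 < s ∧ s < c - 1
  hs2 : c = 1 → s < 0
  hκ : 0 < κ
  hw : ∀ X B : ℝ, 1 ≤ X → 0 ≤ B →
      κ * max 1 (X ^ (s / 2)) ≤ 1 + η * X ^ (s / 2) ∧
      κ * (B + X ^ (s / 2)) ≤ k * l / X + B + η * X ^ (s / 2) * (B + s * (c - 1 - s) + (k - s) * (l - s) / X)

lemma WP_exists {p c θ : ℝ} (hp : 1 < p) (hc : 1 ≤ c) (h1 : 1 < θ) (h2 : θ < c + 1) :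
    ∃ a k l s η κ : ℝ, WP p c θ a k l s η κ := by
  obtain ⟨a, s, ha0, ha1, hk0, hl0, hs, hs1, hs2⟩ := params hp hc h1 h2
  obtain ⟨η, κ, hκ, hw⟩ := wt hk0 hl0 hc hs1 hs2
  exact ⟨a, _, _, s, η, κ, hp, hc, h1, h2, ha0, ha1, rfl, hk0, rfl, hl0, hs, hs1, hs2, hκ, hw⟩

variable {p c θ a k l s η κ γ : ℝ}

/-- `t^{-s}` -/
def TT (s h y : ℝ) : ℝ := mS 0 (-s) s h y
def Gs (a k s η h y : ℝ) : ℝ := mS a 0 (-k) h y * (1 + η * TT s h y)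
def psl (p a c k l s κ γ h y : ℝ) : ℝ :=
  (p - 1) * γ * κ * (mS a c (-l) h y * mS a 0 (-k) h y * (a * (1 - a) / h ^ 2 + TT s h y / y ^ 2))

lemma TT_eq {h y : ℝ} (hy : 0 < y) : TT s h y = ((h ^ 2 + y ^ 2) / y ^ 2) ^ (s / 2) := by
  unfold TT; rw [mS_small_eq _ _ _ hy]; simp

lemma one_le_X {h y : ℝ} (hy : 0 < y) : 1 ≤ (h ^ 2 + y ^ 2) / y ^ 2 := by
  rw [le_div_iff₀ (by positivity)]; nlinarith [sq_nonneg h]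

lemma TT_pos {h y : ℝ} (hh : 0 < h) (hy : 0 < y) : 0 < TT s h y := mS_pos _ _ _ hh hy

lemma WP.G_low (P : WP p c θ a k l s η κ) {h y : ℝ} (hh : 0 < h) (hy : 0 < y) :
    κ * (mS a 0 (-k) h y * max 1 (TT s h y)) ≤ Gs a k s η h y := by
  have := (P.hw _ 0 (one_le_X (h := h) hy) le_rfl).1
  rw [← TT_eq hy] at this
  unfold Gs
  calc κ * (mS a 0 (-k) h y * max 1 (TT s h y)) = mS a 0 (-k) h y * (κ * max 1 (TT s h y)) := by ring
    _ ≤ _ := mul_le_mul_of_nonneg_left this (mS_pos _ _ _ hh hy).le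

lemma WP.G_pos (P : WP p c θ a k l s η κ) {h y : ℝ} (hh : 0 < h) (hy : 0 < y) : 0 < Gs a k s η h y := by
  refine lt_of_lt_of_le ?_ (P.G_low hh hy)
  have := P.hκ
  have := mS_pos a 0 (-k) hh hy
  have : (0 : ℝ) < max 1 (TT s h y) := lt_of_lt_of_le one_pos (le_max_left _ _)
  positivity

lemma psl_pos (P : WP p c θ a k l s η κ) (hγ : 0 < γ) {h y : ℝ} (hh : 0 < h) (hy : 0 < y) : 0 < psl p a c k l s κ γ h y := by
  have h1 := P.hκ
  have h2 : 0 < p - 1 := by linarith [P.hp]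
  have h3 := mS_pos a 0 (-k) hh hy
  have h4 := mS_pos a c (-l) hh hy
  have h5 := TT_pos (s := s) hh hy
  have h6 : 0 < 1 - a := by linarith [P.ha1]
  have h7 := P.ha0
  unfold psl; positivity

/-- lower bound for `-ℒG` -/
lemma WP.G_op (P : WP p c θ a k l s η κ) {h y : ℝ} (hh : 0 < h) (hy : 0 < y) :
    κ * (a * (1 - a) / h ^ 2 + TT s h y / y ^ 2) ≤
    (k * l / (h ^ 2 + y ^ 2) + a * (1 - a) / h ^ 2) + η * TT s h y *
      (a * (1 - a) / h ^ 2 + s * (c - 1 - s) / y ^ 2 + (k - s) * (l - s) / (h ^ 2 + y ^ 2)) := by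
  have h6 : 0 < 1 - a := by linarith [P.ha1]
  have h7 := P.ha0
  have := (P.hw _ (a * (1 - a) * y ^ 2 / h ^ 2) (one_le_X (h := h) hy) (by positivity)).2
  rw [← TT_eq hy] at this
  have hr : 0 < h ^ 2 + y ^ 2 := by positivity
  have h8 := div_le_div_of_nonneg_right this (by positivity : 0 ≤ y ^ 2)
  refine le_trans (le_of_eq ?_) (h8.trans (le_of_eq ?_))
  · field_simp
  · field_simp

lemma WP.deg (P : WP p c θ a k l s η κ) : a * (2 - p) + (c - l + (p - 1) * k) = p * (θ - 2) := by
  rw [P.hk, P.hl]; ring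

/-- bound for `μ₀ G^{1-p}` near `h ≤ y` -/
lemma WP.P_bd (P : WP p c θ a k l s η κ) : ∃ C, 0 < C ∧ ∀ h y, 0 < h → 0 < y →
    (h ≤ y → mS a c (-l) h y * Gs a k s η h y ^ (1 - p) ≤ C * (h ^ (a * (2 - p)) * y ^ (c - l + (p - 1) * k))) ∧
    (y ≤ h → mS a c (-l) h y * Gs a k s η h y ^ (1 - p) ≤
      C * (h ^ (-(c + (p - 1) * max s 0 - p * (θ - 2))) * y ^ (c + (p - 1) * max s 0))) := by
  set K := -l + (p - 1) * k with hK
  set C := κ ^ (1 - p) * 2 ^ |K / 2| with hC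
  have hκ := P.hκ
  have hC0 : 0 < C := by positivity
  refine ⟨C, hC0, fun h y hh hy => ?_⟩
  have hp := P.hp
  have m0 := mS_pos a 0 (-k) hh hy
  have mx : (1 : ℝ) ≤ max 1 (TT s h y) := le_max_left _ _
  have base : mS a c (-l) h y * Gs a k s η h y ^ (1 - p) ≤
      κ ^ (1 - p) * (mS (a * (2 - p)) c K h y * (max 1 (TT s h y)) ^ (1 - p)) := by
    have h1 := Real.rpow_le_rpow_of_nonpos (by positivity : 0 < κ * (mS a 0 (-k) h y * max 1 (TT s h y)))
      (P.G_low hh hy) (by linarith : 1 - p ≤ 0)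
    calc mS a c (-l) h y * Gs a k s η h y ^ (1 - p) ≤ mS a c (-l) h y * (κ * (mS a 0 (-k) h y * max 1 (TT s h y))) ^ (1 - p) :=
          mul_le_mul_of_nonneg_left h1 (mS_pos _ _ _ hh hy).le
      _ = κ ^ (1 - p) * ((mS a c (-l) h y * mS a 0 (-k) h y ^ (1 - p)) * (max 1 (TT s h y)) ^ (1 - p)) := by
          rw [Real.mul_rpow hκ.le (by positivity), Real.mul_rpow m0.le (by positivity)]; ring
      _ = _ := by
          rw [mS_rpow _ _ _ _ hh hy, mS_mul _ _ _ _ _ _ hh hy]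
          rw [show a + a * (1 - p) = a * (2 - p) by ring, show c + 0 * (1 - p) = c by ring,
            show -l + -k * (1 - p) = K by rw [hK]; ring]
  have mp := mS_pos (a * (2 - p)) c K hh hy
  constructor
  · intro hle
    refine base.trans ?_
    have h1 : (max 1 (TT s h y)) ^ (1 - p) ≤ 1 := Real.rpow_le_one_of_one_le_of_nonpos mx (by linarith)
    have h2 := (mS_small (a * (2 - p)) c K hh hy hle).1
    rw [hC, mul_assoc]
    refine mul_le_mul_of_nonneg_left ?_ (by positivity)
    calc _ ≤ mS (a * (2 - p)) c K h y := mul_le_of_le_one_right mp.le h1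
      _ ≤ _ := h2
      _ = _ := by rw [show c + K = c - l + (p - 1) * k by rw [hK]; ring]
  · intro hle
    refine base.trans ?_
    have h2 := (mS_big (a * (2 - p)) c K hh hy hle).1
    have h3 : (h / y) ^ (max s 0) ≤ max 1 (TT s h y) := by
      rcases le_total s 0 with hs | hs
      · rw [max_eq_right hs, Real.rpow_zero]; exact mx
      · rw [max_eq_left hs]
        refine le_trans ?_ (le_max_right _ _)
        rw [TT_eq hy]
        have : (h / y) ^ s = ((h / y) ^ 2) ^ (s / 2) := by
          rw [← Real.rpow_natCast, ← Real.rpow_mul (by positivity)]; congr 1; push_cast; ring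
        rw [this]
        refine Real.rpow_le_rpow (by positivity) ?_ (by linarith)
        rw [div_pow]
        exact div_le_div_of_nonneg_right (by nlinarith) (by positivity)
    have h4 := Real.rpow_le_rpow_of_nonpos (by positivity) h3 (by linarith : 1 - p ≤ 0)
    rw [hC, mul_assoc]
    refine mul_le_mul_of_nonneg_left ?_ (by positivity)
    calc _ ≤ (2 ^ |K / 2| * (h ^ (a * (2 - p) + K) * y ^ c)) * ((h / y) ^ (max s 0)) ^ (1 - p) :=
          mul_le_mul h2 h4 (by positivity) (by positivity)
      _ = 2 ^ |K / 2| * ((h ^ (a * (2 - p) + K) * h ^ (max s 0 * (1 - p))) * (y ^ c * y ^ (-(max s 0 * (1 - p))))) := by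
          rw [← Real.rpow_mul (by positivity), Real.div_rpow hh.le hy.le, Real.rpow_neg hy.le]
          field_simp
      _ = _ := by
          rw [← Real.rpow_add hh, ← Real.rpow_add hy, hK, P.hl, P.hk]
          congr 2
          · congr 1; ring
          · congr 1; ring

/-- bound for `μ₀^p ψ^{1-p}` -/
lemma WP.R_bd (P : WP p c θ a k l s η κ) (hγ : 0 < γ) : ∃ C, 0 < C ∧ ∀ h y, 0 < h → 0 < y →
    (h ≤ y → mS a c (-l) h y ^ p * psl p a c k l s κ γ h y ^ (1 - p) ≤
      C * (h ^ (a * (2 - p) + 2 * (p - 1)) * y ^ (c - l + (p - 1) * k))) ∧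
    (y ≤ h → mS a c (-l) h y ^ p * psl p a c k l s κ γ h y ^ (1 - p) ≤
      C * (h ^ (-(c + (p - 1) * s - p * (θ - 2))) * y ^ (c + (p - 1) * s + 2 * (p - 1)))) := by
  have hp := P.hp
  have hp1 : 0 < p - 1 := by linarith
  have hκ := P.hκ
  have ha0 := P.ha0
  have ha1 : 0 < 1 - a := by linarith [P.ha1]
  set D := (p - 1) * γ * κ * (a * (1 - a)) with hD
  set D' := (p - 1) * γ * κ with hD'
  have hD0 : 0 < D := by positivity
  have hD0' : 0 < D' := by positivity
  set K1 := -l + (p - 1) * k with hK1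
  set K2 := -l + (p - 1) * k - (p - 1) * s with hK2
  set C := D ^ (1 - p) * 2 ^ |K1 / 2| + D' ^ (1 - p) * 2 ^ |K2 / 2| with hC
  have hC1 : D ^ (1 - p) * 2 ^ |K1 / 2| ≤ C := by
    have : 0 < D' ^ (1 - p) * 2 ^ |K2 / 2| := by positivity
    linarith
  have hC2 : D' ^ (1 - p) * 2 ^ |K2 / 2| ≤ C := by
    have : 0 < D ^ (1 - p) * 2 ^ |K1 / 2| := by positivity
    linarith
  refine ⟨C, by positivity, fun h y hh hy => ?_⟩
  have m0 := mS_pos a 0 (-k) hh hy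
  have m1 := mS_pos a c (-l) hh hy
  have t0 := TT_pos (s := s) hh hy
  have i1 : a * (1 - a) / h ^ 2 = a * (1 - a) * mS (-2) 0 0 h y := by
    unfold mS; rw [Real.rpow_neg hh.le]; simp; rfl
  have i2 : TT s h y / y ^ 2 = mS 0 (-s - 2) s h y := by
    have : (1 : ℝ) / y ^ 2 = mS 0 (-2) 0 h y := by unfold mS; rw [Real.rpow_neg hy.le]; simp
    rw [div_eq_mul_one_div, this]; unfold TT; rw [mS_mul _ _ _ _ _ _ hh hy]; congr 1 <;> ring
  constructor
  · intro hle
    have low : D * mS (2 * a - 2) c (-l - k) h y ≤ psl p a c k l s κ γ h y := by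
      unfold psl
      rw [i1, hD]
      have : mS (2 * a - 2) c (-l - k) h y = mS a c (-l) h y * mS a 0 (-k) h y * mS (-2) 0 0 h y := by
        rw [mS_mul _ _ _ _ _ _ hh hy, mS_mul _ _ _ _ _ _ hh hy]; congr 1 <;> ring
      rw [this]
      have h1 : 0 ≤ (p - 1) * γ * κ * (mS a c (-l) h y * mS a 0 (-k) h y * (TT s h y / y ^ 2)) := by positivity
      nlinarith [h1]
    have mm := mS_pos (2 * a - 2) c (-l - k) hh hy
    have h1 := Real.rpow_le_rpow_of_nonpos (by positivity) low (by linarith : 1 - p ≤ 0)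
    calc mS a c (-l) h y ^ p * psl p a c k l s κ γ h y ^ (1 - p)
        ≤ mS a c (-l) h y ^ p * (D * mS (2 * a - 2) c (-l - k) h y) ^ (1 - p) :=
          mul_le_mul_of_nonneg_left h1 (by positivity)
      _ = D ^ (1 - p) * mS (a * (2 - p) + 2 * (p - 1)) c K1 h y := by
          rw [Real.mul_rpow hD0.le mm.le, mS_rpow _ _ _ _ hh hy, mS_rpow _ _ _ _ hh hy, mul_left_comm,
            mS_mul _ _ _ _ _ _ hh hy, hK1]
          congr 2 <;> ring
      _ ≤ D ^ (1 - p) * (2 ^ |K1 / 2| * (h ^ (a * (2 - p) + 2 * (p - 1)) * y ^ (c + K1))) :=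
          mul_le_mul_of_nonneg_left (mS_small _ _ _ hh hy hle).1 (by positivity)
      _ = D ^ (1 - p) * 2 ^ |K1 / 2| * (h ^ (a * (2 - p) + 2 * (p - 1)) * y ^ (c - l + (p - 1) * k)) := by
          rw [show c + K1 = c - l + (p - 1) * k by rw [hK1]; ring]; ring
      _ ≤ _ := mul_le_mul_of_nonneg_right hC1 (by positivity)
  · intro hle
    have low : D' * mS (2 * a) (c - s - 2) (-l - k + s) h y ≤ psl p a c k l s κ γ h y := by
      unfold psl
      rw [i2, hD']
      have : mS (2 * a) (c - s - 2) (-l - k + s) h y = mS a c (-l) h y * mS a 0 (-k) h y * mS 0 (-s - 2) s h y := by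
        rw [mS_mul _ _ _ _ _ _ hh hy, mS_mul _ _ _ _ _ _ hh hy]; congr 1 <;> ring
      rw [this]
      have h1 : 0 ≤ (p - 1) * γ * κ * (mS a c (-l) h y * mS a 0 (-k) h y * (a * (1 - a) / h ^ 2)) := by positivity
      nlinarith [h1]
    have mm := mS_pos (2 * a) (c - s - 2) (-l - k + s) hh hy
    have h1 := Real.rpow_le_rpow_of_nonpos (by positivity) low (by linarith : 1 - p ≤ 0)
    calc mS a c (-l) h y ^ p * psl p a c k l s κ γ h y ^ (1 - p)
        ≤ mS a c (-l) h y ^ p * (D' * mS (2 * a) (c - s - 2) (-l - k + s) h y) ^ (1 - p) :=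
          mul_le_mul_of_nonneg_left h1 (by positivity)
      _ = D' ^ (1 - p) * mS (a * (2 - p)) (c + (p - 1) * s + 2 * (p - 1)) K2 h y := by
          rw [Real.mul_rpow hD0'.le mm.le, mS_rpow _ _ _ _ hh hy, mS_rpow _ _ _ _ hh hy, mul_left_comm,
            mS_mul _ _ _ _ _ _ hh hy, hK2]
          congr 2 <;> ring
      _ ≤ D' ^ (1 - p) * (2 ^ |K2 / 2| * (h ^ (a * (2 - p) + K2) * y ^ (c + (p - 1) * s + 2 * (p - 1)))) :=
          mul_le_mul_of_nonneg_left (mS_big _ _ _ hh hy hle).1 (by positivity)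
      _ = D' ^ (1 - p) * 2 ^ |K2 / 2| * (h ^ (-(c + (p - 1) * s - p * (θ - 2))) * y ^ (c + (p - 1) * s + 2 * (p - 1))) := by
          rw [show a * (2 - p) + K2 = -(c + (p - 1) * s - p * (θ - 2)) by rw [hK2, P.hl, P.hk]; ring]; ring
      _ ≤ _ := mul_le_mul_of_nonneg_right hC2 (by positivity)

/-- lower bound for `ψ G^{-p}` -/
lemma WP.S_bd (P : WP p c θ a k l s η κ) (hγ : 0 < γ) : ∃ C, 0 < C ∧ ∀ h y, 0 < h → 0 < y → h ≤ y →
    C * (h ^ (a * (2 - p) - 2) * y ^ (c - l + (p - 1) * k)) ≤ psl p a c k l s κ γ h y * Gs a k s η h y ^ (-p) := by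
  have hp := P.hp
  have hp1 : 0 < p - 1 := by linarith
  have hκ := P.hκ
  have ha0 := P.ha0
  have ha1 : 0 < 1 - a := by linarith [P.ha1]
  set D := (p - 1) * γ * κ * (a * (1 - a)) with hD
  have hD0 : 0 < D := by positivity
  set K1 := -l + (p - 1) * k with hK1
  set g := 1 + |η| * 2 ^ |s / 2| with hg
  have hg0 : 0 < g := by positivity
  refine ⟨D * g ^ (-p) * (2 ^ |K1 / 2|)⁻¹, by positivity, fun h y hh hy hle => ?_⟩
  have m0 := mS_pos a 0 (-k) hh hy
  have m1 := mS_pos a c (-l) hh hy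
  have t0 := TT_pos (s := s) hh hy
  have i1 : a * (1 - a) / h ^ 2 = a * (1 - a) * mS (-2) 0 0 h y := by
    unfold mS; rw [Real.rpow_neg hh.le]; simp; rfl
  have low : D * mS (2 * a - 2) c (-l - k) h y ≤ psl p a c k l s κ γ h y := by
    unfold psl
    rw [i1, hD]
    have : mS (2 * a - 2) c (-l - k) h y = mS a c (-l) h y * mS a 0 (-k) h y * mS (-2) 0 0 h y := by
      rw [mS_mul _ _ _ _ _ _ hh hy, mS_mul _ _ _ _ _ _ hh hy]; congr 1 <;> ring
    rw [this]
    have h1 : 0 ≤ (p - 1) * γ * κ * (mS a c (-l) h y * mS a 0 (-k) h y * (TT s h y / y ^ 2)) := by positivity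
    nlinarith [h1]
  have hG : Gs a k s η h y ≤ g * mS a 0 (-k) h y := by
    unfold Gs
    rw [mul_comm]
    refine mul_le_mul_of_nonneg_right ?_ m0.le
    have h1 := (mS_small 0 (-s) s hh hy hle).1
    simp only [Real.rpow_zero, neg_add_cancel, mul_one] at h1
    have h2 : η * TT s h y ≤ |η| * 2 ^ |s / 2| :=
      mul_le_mul (le_abs_self _) h1 t0.le (abs_nonneg _)
    rw [hg]; linarith
  have hG' := Real.rpow_le_rpow_of_nonpos (P.G_pos hh hy) hG (by linarith : -p ≤ 0)
  have mm := mS_pos (2 * a - 2) c (-l - k) hh hy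
  calc D * g ^ (-p) * (2 ^ |K1 / 2|)⁻¹ * (h ^ (a * (2 - p) - 2) * y ^ (c - l + (p - 1) * k))
      = D * g ^ (-p) * ((2 ^ |K1 / 2|)⁻¹ * (h ^ (a * (2 - p) - 2) * y ^ (c + K1))) := by
        rw [show c + K1 = c - l + (p - 1) * k by rw [hK1]; ring]; ring
    _ ≤ D * g ^ (-p) * mS (a * (2 - p) - 2) c K1 h y :=
        mul_le_mul_of_nonneg_left (mS_small _ _ _ hh hy hle).2 (by positivity)
    _ = (D * mS (2 * a - 2) c (-l - k) h y) * (g * mS a 0 (-k) h y) ^ (-p) := by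
        rw [Real.mul_rpow hg0.le m0.le, mS_rpow _ _ _ _ hh hy]
        have : mS (a * (2 - p) - 2) c K1 h y = mS (2 * a - 2) c (-l - k) h y * mS (a * -p) (0 * -p) (-k * -p) h y := by
          rw [mS_mul _ _ _ _ _ _ hh hy, hK1]; congr 1 <;> ring
        rw [this]; ring
    _ ≤ _ := mul_le_mul low hG' (by positivity) (psl_pos P hγ hh hy).le

end weights
end dev16

section dev17
section cutoff

def bmpX : ContDiffBump (0 : ℝ) := ⟨1, 2, by norm_num, by norm_num⟩
def cX (s : ℝ) : ℝ := bmpX s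

lemma cX_smooth : ContDiff ℝ (⊤ : ℕ∞) cX := bmpX.contDiff
lemma cX_zero {s : ℝ} (h : 2 ≤ |s|) : cX s = 0 := by
  apply bmpX.zero_of_le_dist; rw [Real.dist_eq, sub_zero]; exact h
lemma cX_one {s : ℝ} (h : |s| ≤ 1) : cX s = 1 := by
  apply bmpX.one_of_mem_closedBall; rw [Metric.mem_closedBall, Real.dist_eq, sub_zero]; exact h
lemma cX_nonneg (s : ℝ) : 0 ≤ cX s := bmpX.nonneg
lemma cX_le_one (s : ℝ) : cX s ≤ 1 := bmpX.le_one

lemma cX_compact : HasCompactSupport cX := bmpX.hasCompactSupport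

lemma cX_bounds : ∃ M, 0 ≤ M ∧ (∀ s, |deriv cX s| ≤ M) ∧ (∀ s, |deriv (deriv cX) s| ≤ M) := by
  have c1 := deriv_smooth cX_smooth
  have c2 := deriv_smooth c1
  obtain ⟨M1, h1⟩ := cX_compact.deriv.exists_bound_of_continuous c1.continuous
  obtain ⟨M2, h2⟩ := cX_compact.deriv.deriv.exists_bound_of_continuous c2.continuous
  refine ⟨max (max M1 M2) 0, le_max_right _ _, fun s => ?_, fun s => ?_⟩
  · exact (h1 s).trans ((le_max_left _ _).trans (le_max_left _ _))
  · exact (h2 s).trans ((le_max_right _ _).trans (le_max_left _ _))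

lemma dcX_zero {s : ℝ} (h : 2 < |s|) : deriv cX s = 0 ∧ deriv (deriv cX) s = 0 := by
  have e1 : cX =ᶠ[nhds s] fun _ => 0 := by
    filter_upwards [(isOpen_lt continuous_const continuous_abs).mem_nhds h] with x hx
    exact cX_zero (le_of_lt hx)
  have e2 : deriv cX =ᶠ[nhds s] fun _ => 0 := by
    have := e1.deriv
    simpa using this
  refine ⟨?_, ?_⟩
  · rw [e2.eq_of_nhds]
  · rw [e2.deriv_eq]; simp

def fn (n : ℕ) (x : ℝ) : ℝ := if 0 < x then cX (Real.log x / n) else 0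
def fn1 (n : ℕ) (x : ℝ) : ℝ := deriv cX (Real.log x / n) * (x⁻¹ / n)
def fn2 (n : ℕ) (x : ℝ) : ℝ := deriv (deriv cX) (Real.log x / n) * (x⁻¹ / n) * (x⁻¹ / n) +
  deriv cX (Real.log x / n) * (-(x ^ 2)⁻¹ / n)

lemma fn_nonneg (n : ℕ) (x : ℝ) : 0 ≤ fn n x := by
  unfold fn; split_ifs
  · exact cX_nonneg _
  · exact le_rfl
lemma fn_le_one (n : ℕ) (x : ℝ) : fn n x ≤ 1 := by
  unfold fn; split_ifs
  · exact cX_le_one _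
  · exact zero_le_one

lemma fn_cda (n : ℕ) {x : ℝ} (hx : 0 < x) : ContDiffAt ℝ (⊤ : ℕ∞) (fn n) x := by
  have : fn n =ᶠ[nhds x] fun x => cX (Real.log x / n) := by
    filter_upwards [isOpen_Ioi.mem_nhds hx] with y hy
    unfold fn; rw [if_pos (Set.mem_Ioi.mp hy)]
  refine ContDiffAt.congr_of_eventuallyEq ?_ this
  exact (cX_smooth.contDiffAt (x := Real.log x / n)).comp x ((contDiffAt_id.log hx.ne').div_const _)

lemma fn_d1 (n : ℕ) : ∀ x > 0, HasDerivAt (fn n) (fn1 n x) x := by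
  intro x hx
  have : fn n =ᶠ[nhds x] fun x => cX (Real.log x / n) := by
    filter_upwards [isOpen_Ioi.mem_nhds hx] with y hy
    unfold fn; rw [if_pos (Set.mem_Ioi.mp hy)]
  refine HasDerivAt.congr_of_eventuallyEq ?_ this
  have h1 : HasDerivAt cX (deriv cX (Real.log x / n)) (Real.log x / n) :=
    ((cX_smooth.differentiable (by simp)) _).hasDerivAt
  exact h1.comp x ((Real.hasDerivAt_log hx.ne').div_const _)

lemma fn_d2 (n : ℕ) : ∀ x > 0, HasDerivAt (fn1 n) (fn2 n x) x := by
  intro x hx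
  have h1 : HasDerivAt (deriv cX) (deriv (deriv cX) (Real.log x / n)) (Real.log x / n) :=
    (((deriv_smooth cX_smooth).differentiable (by simp)) _).hasDerivAt
  have h2 := h1.comp x ((Real.hasDerivAt_log (ne_of_gt hx)).div_const _)
  have h3 := (hasDerivAt_inv (ne_of_gt hx)).div_const (n : ℝ)
  exact h2.mul h3

/-- the dyadic-like strip -/
def stp (n : ℕ) : Set ℝ := Set.Icc (Real.exp (-(2 * n))) (Real.exp (2 * n))

lemma stp_iff {n : ℕ} (hn : 1 ≤ n) {x : ℝ} (hx : 0 < x) : x ∈ stp n ↔ |Real.log x / n| ≤ 2 := by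
  have hn0 : (0 : ℝ) < n := by exact_mod_cast hn
  rw [abs_div, abs_of_pos hn0, div_le_iff₀ hn0, abs_le, stp, Set.mem_Icc, Real.le_log_iff_exp_le hx,
    Real.log_le_iff_le_exp hx]

lemma stp_pos {n : ℕ} {x : ℝ} (h : x ∈ stp n) : 0 < x := lt_of_lt_of_le (Real.exp_pos _) h.1

lemma fn_off {n : ℕ} (hn : 1 ≤ n) {x : ℝ} (h : x ∉ stp n) : fn n x = 0 := by
  unfold fn
  split_ifs with hx
  · rw [stp_iff hn hx, not_le] at h; exact cX_zero h.le
  · rfl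

lemma fn12_off {n : ℕ} (hn : 1 ≤ n) {x : ℝ} (hx : 0 < x) (h : x ∉ stp n) : fn1 n x = 0 ∧ fn2 n x = 0 := by
  rw [stp_iff hn hx, not_le] at h
  obtain ⟨h1, h2⟩ := dcX_zero h
  unfold fn1 fn2; rw [h1, h2]; simp

lemma fn_tend {x : ℝ} (hx : 0 < x) : ∀ᶠ n : ℕ in Filter.atTop, fn n x = 1 := by
  obtain ⟨n0, h0⟩ := exists_nat_ge (max 1 |Real.log x|)
  filter_upwards [Filter.eventually_ge_atTop n0] with n hn
  have h1 : (n0 : ℝ) ≤ n := by exact_mod_cast hn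
  have h2 : |Real.log x| ≤ n := (le_max_right _ _).trans (h0.trans h1)
  have h3 : (0 : ℝ) < n := lt_of_lt_of_le one_pos ((le_max_left _ _).trans (h0.trans h1))
  unfold fn
  rw [if_pos hx]
  apply cX_one
  rw [abs_div, abs_of_pos h3, div_le_one h3]; exact h2

/-- bounds for the two cutoff error terms -/
lemma fn_err {a l c : ℝ} (ha : 0 < a) (hl : 0 < l) (hc : 1 ≤ c) : ∃ M, 0 ≤ M ∧ ∀ n : ℕ, 1 ≤ n → ∀ h y, 0 < h → 0 < y →
    |(2 * (a / h + (-l) * h / (h ^ 2 + y ^ 2)) * fn1 n h + fn2 n h)| ≤ M / n * (h ^ 2)⁻¹ ∧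
    |((c / y + 2 * (-l) * y / (h ^ 2 + y ^ 2)) * fn1 n y + fn2 n y)| ≤ M / n * (h ^ 2)⁻¹ +
      M * ((c - 1) / n + 1 / n ^ 2) * ((stp n).indicator (fun y => (y ^ 2)⁻¹) y) := by
  obtain ⟨M, hM0, hM1, hM2⟩ := cX_bounds
  refine ⟨(2 * (a + l) + 2) * M, by positivity, fun n hn h y hh hy => ?_⟩
  have hn0 : (0 : ℝ) < n := by exact_mod_cast hn
  have hn1 : (1 : ℝ) ≤ n := by exact_mod_cast hn
  have hr : 0 < h ^ 2 + y ^ 2 := by positivity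
  constructor
  · have e1 : 2 * (a / h + (-l) * h / (h ^ 2 + y ^ 2)) * fn1 n h + fn2 n h =
        (deriv cX (Real.log h / n) * (2 * a - 1 - 2 * l * (h ^ 2 / (h ^ 2 + y ^ 2))) +
          deriv (deriv cX) (Real.log h / n) * (1 / n)) * ((h ^ 2)⁻¹ / n) := by
      unfold fn1 fn2; field_simp; ring
    rw [e1, abs_mul, abs_of_pos (by positivity : 0 < (h ^ 2)⁻¹ / (n : ℝ))]
    have q0 : 0 ≤ h ^ 2 / (h ^ 2 + y ^ 2) := by positivity
    have q1 : h ^ 2 / (h ^ 2 + y ^ 2) ≤ 1 := by rw [div_le_one hr]; nlinarith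
    have b1 : |2 * a - 1 - 2 * l * (h ^ 2 / (h ^ 2 + y ^ 2))| ≤ 2 * (a + l) + 1 := by
      rw [abs_le]; constructor <;> nlinarith
    have b2 : |1 / (n : ℝ)| ≤ 1 := by rw [abs_of_pos (by positivity), div_le_one hn0]; exact hn1
    have b3 : |deriv cX (Real.log h / n) * (2 * a - 1 - 2 * l * (h ^ 2 / (h ^ 2 + y ^ 2))) +
          deriv (deriv cX) (Real.log h / n) * (1 / n)| ≤ (2 * (a + l) + 2) * M := by
      refine (abs_add_le _ _).trans ?_
      rw [abs_mul, abs_mul]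
      have t1 := mul_le_mul (hM1 (Real.log h / n)) b1 (abs_nonneg _) hM0
      have t2 := mul_le_mul (hM2 (Real.log h / n)) b2 (abs_nonneg _) hM0
      linarith
    calc _ ≤ (2 * (a + l) + 2) * M * ((h ^ 2)⁻¹ / n) := mul_le_mul_of_nonneg_right b3 (by positivity)
      _ = _ := by ring
  · by_cases hs : y ∈ stp n
    · rw [Set.indicator_of_mem hs]
      have e1 : (c / y + 2 * (-l) * y / (h ^ 2 + y ^ 2)) * fn1 n y + fn2 n y =
        deriv cX (Real.log y / n) * ((c - 1) / n) * (y ^ 2)⁻¹ + deriv (deriv cX) (Real.log y / n) * (1 / n ^ 2) * (y ^ 2)⁻¹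
          + deriv cX (Real.log y / n) * (-(2 * l * ((h ^ 2 + y ^ 2)⁻¹ / n))) := by
        unfold fn1 fn2; field_simp; ring
      rw [e1]
      have q1 : (h ^ 2 + y ^ 2)⁻¹ ≤ (h ^ 2)⁻¹ := inv_anti₀ (by positivity) (by nlinarith)
      have t1 : |deriv cX (Real.log y / n) * ((c - 1) / n) * (y ^ 2)⁻¹| ≤ M * ((c - 1) / n) * (y ^ 2)⁻¹ := by
        have : 0 ≤ (c - 1) / (n : ℝ) := div_nonneg (by linarith) hn0.le
        rw [abs_mul, abs_mul, abs_of_nonneg this, abs_of_pos (by positivity : 0 < (y ^ 2)⁻¹)]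
        exact mul_le_mul_of_nonneg_right (mul_le_mul_of_nonneg_right (hM1 _) this) (by positivity)
      have t2 : |deriv (deriv cX) (Real.log y / n) * (1 / n ^ 2) * (y ^ 2)⁻¹| ≤ M * (1 / n ^ 2) * (y ^ 2)⁻¹ := by
        have : 0 ≤ 1 / (n : ℝ) ^ 2 := by positivity
        rw [abs_mul, abs_mul, abs_of_nonneg this, abs_of_pos (by positivity : 0 < (y ^ 2)⁻¹)]
        exact mul_le_mul_of_nonneg_right (mul_le_mul_of_nonneg_right (hM2 _) this) (by positivity)
      have t3 : |deriv cX (Real.log y / n) * (-(2 * l * ((h ^ 2 + y ^ 2)⁻¹ / n)))| ≤ M * (2 * l * ((h ^ 2)⁻¹ / n)) := by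
        rw [abs_mul, abs_neg, abs_of_pos (by positivity : 0 < 2 * l * ((h ^ 2 + y ^ 2)⁻¹ / (n : ℝ)))]
        exact mul_le_mul (hM1 _) (mul_le_mul_of_nonneg_left (div_le_div_of_nonneg_right q1 hn0.le) (by positivity))
          (by positivity) hM0
      refine (abs_add_le _ _).trans ((add_le_add (abs_add_le _ _) le_rfl).trans ?_)
      refine (add_le_add (add_le_add t1 t2) t3).trans ?_
      have u1 : 0 ≤ M * ((c - 1) / n + 1 / n ^ 2) * (y ^ 2)⁻¹ := by
        have : 0 ≤ (c - 1) / (n : ℝ) := div_nonneg (by linarith) hn0.le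
        positivity
      have u2 : 0 ≤ M / n * (h ^ 2)⁻¹ := by positivity
      have v1 : M * (2 * l * ((h ^ 2)⁻¹ / n)) = (2 * l) * (M / n * (h ^ 2)⁻¹) := by ring
      have v2 : (2 * (a + l) + 2) * M / n * (h ^ 2)⁻¹ = (2 * (a + l) + 2) * (M / n * (h ^ 2)⁻¹) := by ring
      have v3 : (2 * (a + l) + 2) * M * ((c - 1) / n + 1 / n ^ 2) * (y ^ 2)⁻¹ =
        (2 * (a + l) + 2) * (M * ((c - 1) / n + 1 / n ^ 2) * (y ^ 2)⁻¹) := by ring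
      have v4 : M * ((c - 1) / n) * (y ^ 2)⁻¹ + M * (1 / n ^ 2) * (y ^ 2)⁻¹ = M * ((c - 1) / n + 1 / n ^ 2) * (y ^ 2)⁻¹ := by ring
      rw [v1, v2, v3, v4]
      have w1 : 1 * (M * ((c - 1) / n + 1 / n ^ 2) * (y ^ 2)⁻¹) ≤ (2 * (a + l) + 2) * (M * ((c - 1) / n + 1 / n ^ 2) * (y ^ 2)⁻¹) :=
        mul_le_mul_of_nonneg_right (by linarith) u1
      have w2 : (2 * l) * (M / n * (h ^ 2)⁻¹) ≤ (2 * (a + l) + 2) * (M / n * (h ^ 2)⁻¹) :=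
        mul_le_mul_of_nonneg_right (by linarith) u2
      linarith
    · obtain ⟨z1, z2⟩ := fn12_off hn hy hs
      rw [z1, z2, Set.indicator_of_notMem hs]
      simp only [mul_zero, add_zero, abs_zero]
      positivity

end cutoff

section pointwise

lemma young_psl {p q : ℝ} (hpq : p.HolderConjugate q) {Z μ0 ψ g : ℝ} (hμ : 0 ≤ μ0) (hψ : 0 < ψ) :
    p * |Z| ^ (p - 1) * (μ0 * |g|) ≤ 1 / 2 * (|Z| ^ p * ψ) + p ^ p * 2 ^ (p - 1) * (μ0 ^ p * ψ ^ (1 - p) * |g| ^ p) := by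
  have hp := hpq.lt
  have hq := hpq.symm.pos
  have hp0 : 0 < p := hpq.pos
  set t := (1 / 2 * ψ) with ht
  have ht0 : 0 < t := by positivity
  have key := young_simple hpq (x := p * (μ0 * |g|) * t ^ (-(1 / q))) (y := t ^ (1 / q) * |Z| ^ (p - 1)) (by positivity) (by positivity)
  have e0 : p * (μ0 * |g|) * t ^ (-(1 / q)) * (t ^ (1 / q) * |Z| ^ (p - 1)) = p * |Z| ^ (p - 1) * (μ0 * |g|) := by
    rw [Real.rpow_neg ht0.le]
    have : 0 < t ^ (1 / q) := by positivity
    field_simp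
  have e1 : (t ^ (1 / q) * |Z| ^ (p - 1)) ^ q = 1 / 2 * (|Z| ^ p * ψ) := by
    rw [Real.mul_rpow (by positivity) (by positivity), ← Real.rpow_mul ht0.le, ← Real.rpow_mul (abs_nonneg _),
      one_div_mul_cancel hq.ne', hpq.sub_one_mul_conj, Real.rpow_one, ht]; ring
  have e2 : (p * (μ0 * |g|) * t ^ (-(1 / q))) ^ p = p ^ p * 2 ^ (p - 1) * (μ0 ^ p * ψ ^ (1 - p) * |g| ^ p) := by
    have hh : -(1 / q) * p = 1 - p := by
      have := hpq.sub_one_mul_conj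
      field_simp; linarith
    rw [Real.mul_rpow (by positivity) (by positivity), Real.mul_rpow hp0.le (by positivity), Real.mul_rpow hμ (abs_nonneg _),
      ← Real.rpow_mul ht0.le, hh, ht, Real.mul_rpow (by norm_num) hψ.le,
      show (1 / 2 : ℝ) ^ (1 - p) = 2 ^ (p - 1) by
        rw [one_div, Real.inv_rpow (by norm_num), ← Real.rpow_neg (by norm_num), neg_sub]]
    ring
  rw [e0, e1, e2] at key
  linarith

lemma en_scalar {p q : ℝ} (hpq : p.HolderConjugate q) {Z μ0 ψ g χ G T err opG : ℝ} (hμ : 0 ≤ μ0) (hψ : 0 < ψ)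
    (hχ : 0 ≤ χ) (hG : 0 ≤ G) (hT : 0 ≤ T) (hop : ψ ≤ (p - 1) * (μ0 * (- opG))) :
    1 / 2 * (|Z| ^ p * ψ) * χ ≤ (k1 p 0 Z * (μ0 * χ * g) -
      (kk p 0 Z * (G * (- T * χ + err) - μ0 * χ * opG) + k1 p 0 Z * Z * (μ0 * χ * opG))) +
      (p ^ p * 2 ^ (p - 1) * (μ0 ^ p * ψ ^ (1 - p) * |g| ^ p) * χ + |Z| ^ p * G * |err|) := by
  have hp := hpq.lt
  rw [kk0 hp, k10_mul hp]
  have hz : 0 ≤ |Z| ^ p := by positivity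
  have y1 := mul_le_mul_of_nonneg_right (young_psl hpq (Z := Z) (g := g) hμ hψ) hχ
  have y2 : - (p * |Z| ^ (p - 1) * (μ0 * |g|) * χ) ≤ k1 p 0 Z * (μ0 * χ * g) := by
    have : |k1 p 0 Z * (μ0 * χ * g)| = p * |Z| ^ (p - 1) * (μ0 * |g|) * χ := by
      rw [abs_mul, k10_abs hp, abs_mul, abs_mul, abs_of_nonneg hμ, abs_of_nonneg hχ]; ring
    rw [← this]; exact neg_abs_le _
  have y3 : |Z| ^ p * G * err ≤ |Z| ^ p * G * |err| := mul_le_mul_of_nonneg_left (le_abs_self _) (by positivity)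
  have y4 : 0 ≤ |Z| ^ p * G * (T * χ) := by positivity
  have y5 := mul_le_mul_of_nonneg_left hop (by positivity : 0 ≤ |Z| ^ p * χ)
  linarith

end pointwise
end dev17

section dev18
section mainn
variable {N : ℕ} {ι : Type} [Fintype ι] (e : ι → Pt (N + 1))
variable {p c θ a k l s η κ γ : ℝ}

def Gz (a k s η : ℝ) (z : Pt (N + 1)) : ℝ := mon a 0 (-k) z + η * mon a (-s) (s - k) z

lemma Gz_eq {z : Pt (N + 1)} (hz : z ∈ Quad N) : Gz a k s η z = Gs a k s η (z.1 0) z.2 := by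
  unfold Gz Gs TT
  rw [mul_add, mul_one, mul_left_comm, mS_mul _ _ _ _ _ _ hz.1 hz.2]
  change mS a 0 (-k) (z.1 0) z.2 + η * mS a (-s) (s - k) (z.1 0) z.2 = _
  congr 3 <;> ring

lemma Gz_cda {z : Pt (N + 1)} (hz : z ∈ Quad N) : ContDiffAt ℝ (⊤ : ℕ∞) (Gz (N := N) a k s η) z :=
  (mon_cda _ _ _ hz).add (contDiffAt_const.mul (mon_cda _ _ _ hz))

lemma pd2_lin (v : Pt (N + 1)) (t : ℝ) {f g : Pt (N + 1) → ℝ} (hf : ∀ z ∈ Quad N, ContDiffAt ℝ (⊤ : ℕ∞) f z)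
    (hg : ∀ z ∈ Quad N, ContDiffAt ℝ (⊤ : ℕ∞) g z) {z : Pt (N + 1)} (hz : z ∈ Quad N) :
    pd v (fun z => f z + t * g z) z = pd v f z + t * pd v g z := by
  rw [pdA_add v (cda_diff (hf z hz)) ((cda_diff (hg z hz)).const_mul t)]
  congr 1
  unfold pd
  rw [fderiv_const_mul (cda_diff (hg z hz))]; rfl

lemma opL_lin (w : Pt (N + 1)) (t : ℝ) {f g : Pt (N + 1) → ℝ} (hf : ∀ z ∈ Quad N, ContDiffAt ℝ (⊤ : ℕ∞) f z)
    (hg : ∀ z ∈ Quad N, ContDiffAt ℝ (⊤ : ℕ∞) g z) {z : Pt (N + 1)} (hz : z ∈ Quad N) :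
    opL e w (fun z => f z + t * g z) z = opL e w f z + t * opL e w g z := by
  unfold opL lap
  rw [pd2_lin w t hf hg hz]
  have : ∀ i, pd (e i) (pd (e i) (fun z => f z + t * g z)) z = pd (e i) (pd (e i) f) z + t * pd (e i) (pd (e i) g) z := by
    intro i
    have ev : pd (e i) (fun z => f z + t * g z) =ᶠ[nhds z] fun z => pd (e i) f z + t * pd (e i) g z := by
      filter_upwards [Quad_open.mem_nhds hz] with x hx using pd2_lin (e i) t hf hg hx
    rw [pd_congr _ ev, pd2_lin (e i) t (fun z hz => cda_pd _ (hf z hz)) (fun z hz => cda_pd _ (hg z hz)) hz]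
  simp_rw [this]
  rw [Finset.sum_add_distrib, ← Finset.mul_sum]; ring

lemma WP.opG (P : WP p c θ a k l s η κ) (hγ : 0 < γ) {z : Pt (N + 1)} (hz : z ∈ Quad N) {w : Pt (N + 1)}
    (hw0 : w.1 0 = 0) (hw : w.2 = c * γ)
    (g1 : ∑ k, (e k).1 0 * (e k).1 0 = γ) (g2 : ∑ k, (e k).2 * (e k).2 = γ) (g3 : ∀ k, (e k).1 0 * (e k).2 = 0) :
    psl p a c k l s κ γ (z.1 0) z.2 ≤ (p - 1) * (mS a c (-l) (z.1 0) z.2 * (- opL e w (Gz a k s η) z)) := by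
  have hh := hz.1
  have hy := hz.2
  have key := P.G_op hh hy
  have e1 : opL e w (Gz a k s η) z = opL e w (mon a 0 (-k)) z + η * opL e w (mon a (-s) (s - k)) z :=
    opL_lin e w η (fun z hz => mon_cda _ _ _ hz) (fun z hz => mon_cda _ _ _ hz) hz
  rw [e1, opL_mon e a 0 (-k) c hz hw0 hw g1 g2 g3, opL_mon e a (-s) (s - k) c hz hw0 hw g1 g2 g3]
  have hkl : k + l = c + 2 * a := by rw [P.hk, P.hl]; ring
  have hc' : c = k + l - 2 * a := by linarith
  have m0 := mS_pos a 0 (-k) hh hy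
  have m1 := mS_pos a c (-l) hh hy
  have hmon : mon a (-s) (s - k) z = mS a 0 (-k) (z.1 0) z.2 * TT s (z.1 0) z.2 := by
    unfold TT; rw [mS_mul _ _ _ _ _ _ hh hy]
    change mS a (-s) (s - k) (z.1 0) z.2 = _
    congr 1 <;> ring
  rw [hmon]
  change _ ≤ (p - 1) * (_ * -(γ * (mS a 0 (-k) (z.1 0) z.2 * _) + _))
  unfold psl
  have hp1 : 0 < p - 1 := by linarith [P.hp]
  have k2 := mul_le_mul_of_nonneg_left key (by positivity :
    0 ≤ (p - 1) * γ * (mS a c (-l) (z.1 0) z.2 * mS a 0 (-k) (z.1 0) z.2))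
  refine le_trans (le_of_eq (by ring)) (k2.trans (le_of_eq ?_))
  generalize mS a c (-l) (z.1 0) z.2 = M1
  generalize mS a 0 (-k) (z.1 0) z.2 = M0
  generalize TT s (z.1 0) z.2 = T
  rw [show -k * (-k + 2 * a + 2 * 0 + c) = - (k * l) by rw [hc']; ring,
    show (s - k) * (s - k + 2 * a + 2 * -s + c) = - ((k - s) * (l - s)) by rw [hc']; ring]
  ring

lemma mu_facts {n : ℕ} (hn : 1 ≤ n) : ContDiff ℝ (⊤ : ℕ∞) (mc (N := N) a c (-l) (fn n) (fn n)) ∧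
    (∀ z, 0 ≤ mc (N := N) a c (-l) (fn n) (fn n) z) ∧
    tsupport (mc (N := N) a c (-l) (fn n) (fn n)) ⊆ {z | z.1 0 ∈ stp n ∧ z.2 ∈ stp n} := by
  have hsub : tsupport (mc (N := N) a c (-l) (fn n) (fn n)) ⊆ {z | z.1 0 ∈ stp n ∧ z.2 ∈ stp n} := by
    apply closure_minimal
    · intro z hz
      rw [Function.mem_support] at hz
      constructor
      · by_contra h; exact hz (by unfold mc; rw [fn_off hn h]; simp)
      · by_contra h; exact hz (by unfold mc; rw [fn_off hn h]; simp)
    · exact (isClosed_Icc.preimage cont_hc).inter (isClosed_Icc.preimage continuous_snd)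
  refine ⟨?_, ?_, hsub⟩
  · rw [contDiff_iff_contDiffAt]
    intro z
    by_cases hz : z ∈ tsupport (mc (N := N) a c (-l) (fn n) (fn n))
    swap
    · exact contDiffAt_const.congr_of_eventuallyEq (notMem_tsupport_iff_eventuallyEq.mp hz)
    have h := hsub hz
    have hq : z ∈ Quad N := ⟨stp_pos h.1, stp_pos h.2⟩
    have c1 : ContDiff ℝ (⊤ : ℕ∞) fun z : Pt (N + 1) => z.1 0 := by fun_prop
    have c2 : ContDiff ℝ (⊤ : ℕ∞) fun z : Pt (N + 1) => z.2 := by fun_prop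
    have d1 : ContDiffAt ℝ (⊤ : ℕ∞) (fun z : Pt (N + 1) => fn n (z.1 0)) z :=
      ContDiffAt.comp (g := fn n) z (fn_cda n hq.1) c1.contDiffAt
    have d2 : ContDiffAt ℝ (⊤ : ℕ∞) (fun z : Pt (N + 1) => fn n z.2) z :=
      ContDiffAt.comp (g := fn n) z (fn_cda n hq.2) c2.contDiffAt
    exact (mon_cda _ _ _ hq).mul (d1.mul d2)
  · intro z
    by_cases hz : z.1 0 ∈ stp n ∧ z.2 ∈ stp n
    · have hq : z ∈ Quad N := ⟨stp_pos hz.1, stp_pos hz.2⟩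
      exact mul_nonneg (mon_pos _ _ _ hq).le (mul_nonneg (fn_nonneg _ _) (fn_nonneg _ _))
    · rw [image_eq_zero_of_notMem_tsupport fun h => hz (hsub h)]

/-- the basic inequality for each cutoff -/
lemma WP.main_n {q : ℝ} (hpq : p.HolderConjugate q) (P : WP p c θ a k l s η κ) (hγ : 0 < γ) {w : Pt (N + 1)}
    (hw0 : w.1 0 = 0) (hw : w.2 = c * γ)
    (g1 : ∑ k, (e k).1 0 * (e k).1 0 = γ) (g2 : ∑ k, (e k).2 * (e k).2 = γ) (g3 : ∀ k, (e k).1 0 * (e k).2 = 0) :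
    ∃ M, 0 ≤ M ∧ ∀ W : Pt (N + 1) → ℝ, ContDiff ℝ (⊤ : ℕ∞) W → ∀ n : ℕ, 1 ≤ n →
      IsCompact ({z : Pt (N + 1) | z.1 0 ∈ stp n ∧ z.2 ∈ stp n} ∩ tsupport W) →
    ∫⁻ z in Quad N, ENNReal.ofReal (1 / 2 * (|W z| ^ p * (psl p a c k l s κ γ (z.1 0) z.2 * Gs a k s η (z.1 0) z.2 ^ (-p))) *
      (fn n (z.1 0) * fn n z.2)) ≤
    ∫⁻ z in Quad N, ENNReal.ofReal (p ^ p * 2 ^ (p - 1) * (mS a c (-l) (z.1 0) z.2 ^ p * psl p a c k l s κ γ (z.1 0) z.2 ^ (1 - p) *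
        |opL e w W z| ^ p) +
      |W z| ^ p * (mS a c (-l) (z.1 0) z.2 * Gs a k s η (z.1 0) z.2 ^ (1 - p)) * (M / n * ((z.1 0) ^ 2)⁻¹ +
        M * ((c - 1) / n + 1 / n ^ 2) * ((stp n).indicator (fun y => (y ^ 2)⁻¹) z.2))) := by
  obtain ⟨M, hM0, hM⟩ := fn_err P.ha0 P.hl0 P.hc
  refine ⟨γ * (M + M), by positivity, fun W hW n hn hKc => ?_⟩
  have hp := hpq.lt
  have hn0 : (0 : ℝ) < n := by exact_mod_cast hn
  have hc1 : 0 ≤ c - 1 := by linarith [P.hc]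
  set μ := mc (N := N) a c (-l) (fn n) (fn n) with hμ
  obtain ⟨m1, m2, m3⟩ := mu_facts (N := N) (a := a) (c := c) (l := l) hn
  have hs : tsupport μ ⊆ Quad N := fun z hz => ⟨stp_pos (m3 hz).1, stp_pos (m3 hz).2⟩
  have hK : IsCompact (tsupport μ ∩ tsupport W) := by
    refine hKc.of_isClosed_subset ((isClosed_tsupport _).inter (isClosed_tsupport _)) ?_
    exact Set.inter_subset_inter_left _ m3
  obtain ⟨i1, i2⟩ := energy0 e hp w Quad_open (fun z hz => hz.2) hW
    (G := Gz a k s η) (fun z hz => (Gz_cda hz).contDiffWithinAt) (fun z hz => by rw [Gz_eq hz]; exact P.G_pos hz.1 hz.2) m1 m2 hs hK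
  set A : Pt (N + 1) → ℝ := fun z => 1 / 2 * (|W z| ^ p * (psl p a c k l s κ γ (z.1 0) z.2 * Gs a k s η (z.1 0) z.2 ^ (-p))) *
      (fn n (z.1 0) * fn n z.2) with hA
  set B : Pt (N + 1) → ℝ := fun z => p ^ p * 2 ^ (p - 1) * (mS a c (-l) (z.1 0) z.2 ^ p * psl p a c k l s κ γ (z.1 0) z.2 ^ (1 - p) *
        |opL e w W z| ^ p) +
      |W z| ^ p * (mS a c (-l) (z.1 0) z.2 * Gs a k s η (z.1 0) z.2 ^ (1 - p)) * (γ * (M + M) / n * ((z.1 0) ^ 2)⁻¹ +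
        γ * (M + M) * ((c - 1) / n + 1 / n ^ 2) * ((stp n).indicator (fun y => (y ^ 2)⁻¹) z.2)) with hB
  have ind0 : ∀ y : ℝ, 0 ≤ (stp n).indicator (fun y => (y ^ 2)⁻¹) y := fun y =>
    Set.indicator_nonneg (fun y _ => by positivity) y
  have A0 : ∀ z ∈ Quad N, 0 ≤ A z := fun z hz => by
    have t1 := psl_pos P hγ hz.1 hz.2
    have t2 := P.G_pos hz.1 hz.2
    have t3 := fn_nonneg n (z.1 0)
    have t4 := fn_nonneg n z.2
    positivity
  have tau0 : 0 ≤ (c - 1) / (n : ℝ) + 1 / n ^ 2 := by positivity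
  have B0 : ∀ z ∈ Quad N, 0 ≤ B z := fun z hz => by
    have t1 := psl_pos P hγ hz.1 hz.2
    have t2 := P.G_pos hz.1 hz.2
    have t3 := mS_pos a c (-l) hz.1 hz.2
    have t4 := ind0 z.2
    positivity
  have key := gen_cmp i1 i2 (A := (Quad N).indicator A) (B := (Quad N).indicator B)
    (fun z => Set.indicator_nonneg A0 z) (fun z => Set.indicator_nonneg B0 z) ?_
  · have cv : ∀ F : Pt (N + 1) → ℝ, ∫⁻ z, ENNReal.ofReal ((Quad N).indicator F z) = ∫⁻ z in Quad N, ENNReal.ofReal (F z) := by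
      intro F
      rw [← lintegral_indicator Quad_open.measurableSet]
      refine lintegral_congr fun z => ?_
      by_cases hz : z ∈ Quad N <;> simp [hz]
    rw [cv, cv] at key
    exact key
  · intro z
    by_cases hz : z ∈ Quad N
    swap
    · rw [Set.indicator_of_notMem hz, Set.indicator_of_notMem hz, en_off1 e w fun h => hz (hs h)]; simp
    rw [Set.indicator_of_mem hz, Set.indicator_of_mem hz]
    have hh := hz.1
    have hy := hz.2
    have t1 := psl_pos P hγ hh hy
    have t2 := P.G_pos hh hy
    have t3 := mS_pos a c (-l) hh hy
    have t4 := fn_nonneg n (z.1 0)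
    have t5 := fn_nonneg n z.2
    have t6 := fn_le_one n (z.1 0)
    have t7 := fn_le_one n z.2
    have ea := adj_mc e a c (-l) hz hw0 hw g1 g2 g3 (fn_d1 n) (fn_d1 n) (fn_d2 n) (fn_d2 n)
    have hr : 0 < (z.1 0) ^ 2 + z.2 ^ 2 := by positivity
    have ha1 : 0 < 1 - a := by linarith [P.ha1]
    have ha0 := P.ha0
    have hk0 := P.hk0
    have hl0 := P.hl0
    set E1 := 2 * (a / z.1 0 + -l * z.1 0 / ((z.1 0) ^ 2 + z.2 ^ 2)) * fn1 n (z.1 0) + fn2 n (z.1 0) with hE1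
    set E2 := (c / z.2 + 2 * -l * z.2 / ((z.1 0) ^ 2 + z.2 ^ 2)) * fn1 n z.2 + fn2 n z.2 with hE2
    obtain ⟨b1, b2⟩ := hM n hn (z.1 0) z.2 hh hy
    rw [← hE1] at b1
    rw [← hE2] at b2
    set χ := fn n (z.1 0) * fn n z.2 with hχ
    set err := γ * (mS a c (-l) (z.1 0) z.2 * (E1 * fn n z.2 + fn n (z.1 0) * E2)) with herr
    set T := γ * (mS a c (-l) (z.1 0) z.2 * (a * (1 - a) / (z.1 0) ^ 2 + k * l / ((z.1 0) ^ 2 + z.2 ^ 2))) with hT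
    have ea' : adj e w μ z = - T * χ + err := by
      rw [hμ, ea, hT, herr]
      change γ * (mS a c (-l) (z.1 0) z.2 * _) = _
      have hc' : c = k + l - 2 * a := by rw [P.hk, P.hl]; ring
      rw [show -l * (-l + 2 * a + c) = - (k * l) by rw [hc']; ring]
      ring
    have sc := en_scalar hpq (Z := W z / Gz a k s η z) (g := opL e w W z) (χ := χ) (G := Gz a k s η z) (T := T) (err := err)
      t3.le t1 (mul_nonneg t4 t5) (by rw [Gz_eq hz]; exact t2.le) (by positivity) (P.opG e hγ hz hw0 hw g1 g2 g3)
    have emu : μ z = mS a c (-l) (z.1 0) z.2 * χ := rfl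
    have een : en e p 0 w W (Gz a k s η) μ z = k1 p 0 (W z / Gz a k s η z) * (mS a c (-l) (z.1 0) z.2 * χ * opL e w W z) -
      (kk p 0 (W z / Gz a k s η z) * (Gz a k s η z * (- T * χ + err) - mS a c (-l) (z.1 0) z.2 * χ * opL e w (Gz a k s η) z) +
        k1 p 0 (W z / Gz a k s η z) * (W z / Gz a k s η z) * (mS a c (-l) (z.1 0) z.2 * χ * opL e w (Gz a k s η) z)) := by
      unfold en; rw [ea', emu]
    rw [← een] at sc
    have hZ : |W z / Gz a k s η z| ^ p = |W z| ^ p * Gs a k s η (z.1 0) z.2 ^ (-p) := by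
      rw [Gz_eq hz, abs_div, abs_of_pos t2, Real.div_rpow (abs_nonneg _) t2.le, Real.rpow_neg t2.le]; rfl
    have hZG : |W z / Gz a k s η z| ^ p * Gz a k s η z = |W z| ^ p * Gs a k s η (z.1 0) z.2 ^ (1 - p) := by
      rw [hZ, Gz_eq hz, mul_assoc, show 1 - p = -p + 1 by ring, Real.rpow_add_one t2.ne']
    rw [hZG, hZ] at sc
    have herrb : |err| ≤ mS a c (-l) (z.1 0) z.2 * (γ * (M + M) / n * ((z.1 0) ^ 2)⁻¹ +
        γ * (M + M) * ((c - 1) / n + 1 / n ^ 2) * ((stp n).indicator (fun y => (y ^ 2)⁻¹) z.2)) := by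
      rw [herr, abs_mul, abs_mul, abs_of_pos hγ, abs_of_pos t3, mul_left_comm]
      refine mul_le_mul_of_nonneg_left ?_ t3.le
      have f1 : |E1 * fn n z.2 + fn n (z.1 0) * E2| ≤ |E1| + |E2| := by
        refine (abs_add_le _ _).trans ?_
        rw [abs_mul, abs_mul, abs_of_nonneg t4, abs_of_nonneg t5]
        exact add_le_add (mul_le_of_le_one_right (abs_nonneg _) t7) (mul_le_of_le_one_left (abs_nonneg _) t6)
      have f2 : 0 ≤ M * ((c - 1) / n + 1 / n ^ 2) * ((stp n).indicator (fun y => (y ^ 2)⁻¹) z.2) := by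
        have := ind0 z.2; positivity
      calc γ * |E1 * fn n z.2 + fn n (z.1 0) * E2| ≤ γ * (M / n * ((z.1 0) ^ 2)⁻¹ + (M / n * ((z.1 0) ^ 2)⁻¹ +
            M * ((c - 1) / n + 1 / n ^ 2) * ((stp n).indicator (fun y => (y ^ 2)⁻¹) z.2)) +
            M * ((c - 1) / n + 1 / n ^ 2) * ((stp n).indicator (fun y => (y ^ 2)⁻¹) z.2)) := by
            refine mul_le_mul_of_nonneg_left ?_ hγ.le
            linarith
        _ = _ := by ring
    have last := mul_le_mul_of_nonneg_left herrb (by positivity : 0 ≤ |W z| ^ p * Gs a k s η (z.1 0) z.2 ^ (1 - p))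
    have cl : p ^ p * 2 ^ (p - 1) * (mS a c (-l) (z.1 0) z.2 ^ p * psl p a c k l s κ γ (z.1 0) z.2 ^ (1 - p) * |opL e w W z| ^ p) * χ ≤
       p ^ p * 2 ^ (p - 1) * (mS a c (-l) (z.1 0) z.2 ^ p * psl p a c k l s κ γ (z.1 0) z.2 ^ (1 - p) * |opL e w W z| ^ p) := by
      refine mul_le_of_le_one_right ?_ ?_
      · have : 0 < p := by linarith
        positivity
      · exact mul_le_one₀ t6 t5 t7
    refine le_trans (le_of_eq ?_) (sc.trans (add_le_add le_rfl (le_trans (add_le_add cl last) (le_of_eq ?_))))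
    · rw [hA]; ring
    · rw [hB]; ring

end mainn
end dev18

section dev19
section oned
variable {p c θ a k l s η κ γ : ℝ}

/-- `ω(h) = min(1,h)^p` -/
def om (p h : ℝ) : ℝ := (min 1 h) ^ p

lemma om_le {ϑ h : ℝ} (h0 : 0 < h) (h1 : 0 ≤ ϑ) (h2 : ϑ ≤ p) : om p h ≤ h ^ ϑ := by
  unfold om
  rcases le_total h 1 with hh | hh
  · rw [min_eq_right hh]; exact Real.rpow_le_rpow_of_exponent_ge h0 hh h2
  · rw [min_eq_left hh, Real.one_rpow]; exact Real.one_le_rpow hh h1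

lemma om_nonneg {h : ℝ} (h0 : 0 < h) : 0 ≤ om p h := by
  unfold om; exact Real.rpow_nonneg (le_min zero_le_one h0.le) _

lemma om_le_one {h : ℝ} (h0 : 0 < h) (hp : 0 ≤ p) : om p h ≤ 1 := by
  have := om_le (p := p) h0 le_rfl hp
  simpa using this

/-- `P(h,y) = μ₀ G^{1-p}` -/
def Pw (p c a k l s η h y : ℝ) : ℝ := mS a c (-l) h y * Gs a k s η h y ^ (1 - p)

lemma mS_meas (A B K : ℝ) : Measurable (Function.uncurry (mS A B K)) := by
  unfold mS Function.uncurry; fun_prop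

lemma Gs_meas : Measurable (Function.uncurry (Gs a k s η)) := by
  have h1 := mS_meas a 0 (-k)
  have h2 := mS_meas 0 (-s) s
  exact h1.mul (measurable_const.add (measurable_const.mul h2))

lemma Pw_meas : Measurable (Function.uncurry (Pw p c a k l s η)) :=
  (mS_meas a c (-l)).mul (Gs_meas.pow_const _)

lemma psl_meas : Measurable (Function.uncurry (psl p a c k l s κ γ)) := by
  have h1 := mS_meas a 0 (-k)
  have h2 := mS_meas 0 (-s) s
  have h3 := mS_meas a c (-l)
  have h4 : Measurable fun q : ℝ × ℝ => a * (1 - a) / q.1 ^ 2 := by fun_prop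
  have h5 : Measurable fun q : ℝ × ℝ => q.2 ^ 2 := by fun_prop
  exact measurable_const.mul ((h3.mul h1).mul (h4.add (h2.div h5)))

lemma om_meas : Measurable (om p) := by
  unfold om; fun_prop

lemma rpow_fin {ε Y : ℝ} (hε : -1 < ε) (hY : 0 < Y) : ∫⁻ y in Set.Ioc 0 Y, ENNReal.ofReal (y ^ ε) ≠ ⊤ := by
  rw [int_small hε hY]; exact ENNReal.ofReal_ne_top

lemma lint_const {S : Set ℝ} {C : ℝ} (hC : 0 ≤ C) (f : ℝ → ℝ) :
    ∫⁻ h in S, ENNReal.ofReal (C * f h) = ENNReal.ofReal C * ∫⁻ h in S, ENNReal.ofReal (f h) := by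
  simp_rw [ENNReal.ofReal_mul hC]
  rw [lintegral_const_mul' _ _ ENNReal.ofReal_ne_top]

lemma split_y {y : ℝ} (hy : 0 < y) (F : ℝ → ENNReal) :
    ∫⁻ h in Set.Ioi 0, F h = (∫⁻ h in Set.Ioc 0 y, F h) + ∫⁻ h in Set.Ioi y, F h := by
  rw [← Set.Ioc_union_Ioi_eq_Ioi hy.le, lintegral_union measurableSet_Ioi]
  exact Set.Ioc_disjoint_Ioi le_rfl

/-- small `h` part -/
lemma WP.E_small (P : WP p c θ a k l s η κ) : ∃ C, 0 ≤ C ∧ ∀ y, 0 < y →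
    ∫⁻ h in Set.Ioc 0 y, ENNReal.ofReal (om p h * (Pw p c a k l s η h y * (h ^ 2)⁻¹)) ≤
      ENNReal.ofReal (C * y ^ (p * (θ - 1) - 1)) := by
  obtain ⟨C, hC, hb⟩ := P.P_bd
  have hp := P.hp
  set Q := p + a * (2 - p) - 2 with hQ
  have hQ1 : -1 < Q := by
    have h1 : 0 < (p - 1) * (1 - a) := mul_pos (by linarith) (by linarith [P.ha1])
    have := P.ha0
    rw [hQ]; nlinarith
  have hQ0 : 0 < Q + 1 := by linarith
  refine ⟨C / (Q + 1), by positivity, fun y hy => ?_⟩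
  calc ∫⁻ h in Set.Ioc 0 y, ENNReal.ofReal (om p h * (Pw p c a k l s η h y * (h ^ 2)⁻¹))
      ≤ ∫⁻ h in Set.Ioc 0 y, ENNReal.ofReal (C * y ^ (c - l + (p - 1) * k) * h ^ Q) := by
        refine setLIntegral_mono' measurableSet_Ioc fun h hh => ENNReal.ofReal_le_ofReal ?_
        have h0 := hh.1
        have b1 := (hb h y h0 hy).1 hh.2
        have b2 := om_le (p := p) (ϑ := p) h0 (by linarith) le_rfl
        calc om p h * (Pw p c a k l s η h y * (h ^ 2)⁻¹)
            ≤ h ^ p * ((C * (h ^ (a * (2 - p)) * y ^ (c - l + (p - 1) * k))) * (h ^ 2)⁻¹) := by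
              refine mul_le_mul b2 (mul_le_mul_of_nonneg_right b1 (by positivity)) ?_ (by positivity)
              have t2 := P.G_pos h0 hy
              have t3 := mS_pos a c (-l) h0 hy
              unfold Pw; positivity
          _ = C * y ^ (c - l + (p - 1) * k) * (h ^ p * h ^ (a * (2 - p)) * h ^ (-2 : ℝ)) := by
              rw [Real.rpow_neg h0.le, Real.rpow_two]; ring
          _ = _ := by
              rw [← Real.rpow_add h0, ← Real.rpow_add h0, hQ]; congr 2
    _ = ENNReal.ofReal (C * y ^ (c - l + (p - 1) * k)) * ENNReal.ofReal (y ^ (Q + 1) / (Q + 1)) := by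
        rw [lint_const (by positivity), int_small hQ1 hy]
    _ = _ := by
        rw [← ENNReal.ofReal_mul (by positivity)]
        congr 1
        rw [show C * y ^ (c - l + (p - 1) * k) * (y ^ (Q + 1) / (Q + 1)) =
          C / (Q + 1) * (y ^ (c - l + (p - 1) * k) * y ^ (Q + 1)) by ring, ← Real.rpow_add hy]
        congr 2
        have := P.deg
        rw [hQ]; linarith

/-- large `h` part with weight `h^{-t} y^{t-2}` -/
lemma WP.E_big (P : WP p c θ a k l s η κ) {ϑ t : ℝ} (h1 : 0 ≤ ϑ) (h2 : ϑ ≤ p)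
    (h3 : ϑ < c + (p - 1) * max s 0 - p * (θ - 2) - 1 + t) : ∃ C, 0 ≤ C ∧ ∀ y, 0 < y →
    ∫⁻ h in Set.Ioi y, ENNReal.ofReal (om p h * (Pw p c a k l s η h y * (h ^ (-t) * y ^ (t - 2)))) ≤
      ENNReal.ofReal (C * y ^ (p * (θ - 2) - 1 + ϑ)) := by
  obtain ⟨C, hC, hb⟩ := P.P_bd
  have hp := P.hp
  set ν := c + (p - 1) * max s 0 - p * (θ - 2) with hν
  set Q := ϑ - ν - t with hQ
  have hQ1 : Q < -1 := by rw [hQ]; linarith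
  have hQ0 : 0 < -(Q + 1) := by linarith
  refine ⟨C / (-(Q + 1)), by positivity, fun y hy => ?_⟩
  calc ∫⁻ h in Set.Ioi y, ENNReal.ofReal (om p h * (Pw p c a k l s η h y * (h ^ (-t) * y ^ (t - 2))))
      ≤ ∫⁻ h in Set.Ioi y, ENNReal.ofReal (C * (y ^ (c + (p - 1) * max s 0) * y ^ (t - 2)) * h ^ Q) := by
        refine setLIntegral_mono' measurableSet_Ioi fun h hh => ENNReal.ofReal_le_ofReal ?_
        have h0 : 0 < h := lt_trans hy hh
        have b1 := (hb h y h0 hy).2 (le_of_lt hh)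
        have b2 := om_le (p := p) (ϑ := ϑ) h0 h1 h2
        calc om p h * (Pw p c a k l s η h y * (h ^ (-t) * y ^ (t - 2)))
            ≤ h ^ ϑ * ((C * (h ^ (-ν) * y ^ (c + (p - 1) * max s 0))) * (h ^ (-t) * y ^ (t - 2))) := by
              refine mul_le_mul b2 (mul_le_mul_of_nonneg_right b1 (by positivity)) ?_ (by positivity)
              have t2 := P.G_pos h0 hy
              have t3 := mS_pos a c (-l) h0 hy
              unfold Pw; positivity
          _ = C * (y ^ (c + (p - 1) * max s 0) * y ^ (t - 2)) * (h ^ ϑ * h ^ (-ν) * h ^ (-t)) := by ring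
          _ = _ := by
              rw [← Real.rpow_add h0, ← Real.rpow_add h0, hQ]; congr 2
    _ = ENNReal.ofReal (C * (y ^ (c + (p - 1) * max s 0) * y ^ (t - 2))) * ENNReal.ofReal (y ^ (Q + 1) / (-(Q + 1))) := by
        rw [lint_const (by positivity), int_big hQ1 hy]
    _ = _ := by
        rw [← ENNReal.ofReal_mul (by positivity)]
        congr 1
        rw [show C * (y ^ (c + (p - 1) * max s 0) * y ^ (t - 2)) * (y ^ (Q + 1) / (-(Q + 1))) =
          C / (-(Q + 1)) * (y ^ (c + (p - 1) * max s 0) * y ^ (t - 2) * y ^ (Q + 1)) by ring, ← Real.rpow_add hy, ← Real.rpow_add hy]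
        congr 2
        rw [hQ, hν]; ring

/-- large `h` part, critical case `c = 1` -/
lemma WP.E_crit (P : WP p c θ a k l s η κ) (hc : c = 1) : ∃ C, 0 ≤ C ∧ ∀ y, 0 < y →
    ∫⁻ h in Set.Ioi y, ENNReal.ofReal (om p h * (Pw p c a k l s η h y * (y ^ 2)⁻¹)) ≤
      ENNReal.ofReal (C * y⁻¹) := by
  obtain ⟨C, hC, hb⟩ := P.P_bd
  have hp := P.hp
  have hs0 := P.hs2 hc
  have hs := P.hs
  have hneg : p * (θ - 2) < 0 := by
    have : (p - 1) * s < 0 := mul_neg_of_pos_of_neg (by linarith) hs0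
    linarith
  rw [max_eq_right hs0.le] at hb
  set ν := c + (p - 1) * 0 - p * (θ - 2) with hν
  have hν1 : 1 < ν := by rw [hν]; linarith
  have hν2 : ν < 1 + p := by
    have : 0 < p * (θ - 1) := mul_pos (by linarith) (by linarith [P.hθ1])
    rw [hν]; linarith
  set J := 1 / (p - ν + 1) + 1 / (-(-ν + 1)) with hJ
  have j1 : 0 < p - ν + 1 := by linarith
  have j2 : 0 < -(-ν + 1) := by linarith
  have hJI : ∫⁻ h in Set.Ioi 0, ENNReal.ofReal (om p h * h ^ (-ν)) ≤ ENNReal.ofReal J := by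
    rw [split_y one_pos, hJ, ENNReal.ofReal_add (by positivity) (by positivity)]
    gcongr ?_ + ?_
    · have := int_small (by linarith : -1 < p - ν) one_pos
      rw [Real.one_rpow] at this
      rw [← this]
      refine setLIntegral_mono' measurableSet_Ioc fun h hh => ENNReal.ofReal_le_ofReal ?_
      rw [sub_eq_add_neg, Real.rpow_add hh.1]
      exact mul_le_mul_of_nonneg_right (om_le hh.1 (by linarith) le_rfl) (by have := hh.1; positivity)
    · have := int_big (by linarith : -ν < -1) one_pos
      rw [Real.one_rpow] at this
      rw [← this]
      refine setLIntegral_mono' measurableSet_Ioi fun h hh => ENNReal.ofReal_le_ofReal ?_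
      have h0 : 0 < h := lt_trans one_pos hh
      exact mul_le_of_le_one_left (by positivity) (om_le_one h0 (by linarith))
  refine ⟨C * J, by positivity, fun y hy => ?_⟩
  calc ∫⁻ h in Set.Ioi y, ENNReal.ofReal (om p h * (Pw p c a k l s η h y * (y ^ 2)⁻¹))
      ≤ ∫⁻ h in Set.Ioi y, ENNReal.ofReal (C * y⁻¹ * (om p h * h ^ (-ν))) := by
        refine setLIntegral_mono' measurableSet_Ioi fun h hh => ENNReal.ofReal_le_ofReal ?_
        have h0 : 0 < h := lt_trans hy hh
        have b1 := (hb h y h0 hy).2 (le_of_lt hh)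
        calc om p h * (Pw p c a k l s η h y * (y ^ 2)⁻¹)
            ≤ om p h * ((C * (h ^ (-ν) * y ^ (c + (p - 1) * 0))) * (y ^ 2)⁻¹) := by
              exact mul_le_mul_of_nonneg_left (mul_le_mul_of_nonneg_right b1 (by positivity)) (om_nonneg h0)
          _ = _ := by
              rw [hc]; simp only [mul_zero, add_zero, Real.rpow_one]; field_simp
    _ = ENNReal.ofReal (C * y⁻¹) * ∫⁻ h in Set.Ioi y, ENNReal.ofReal (om p h * h ^ (-ν)) := by
        rw [lint_const (by positivity)]
    _ ≤ ENNReal.ofReal (C * y⁻¹) * ENNReal.ofReal J := by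
        gcongr
        exact (lintegral_mono_set (Set.Ioi_subset_Ioi hy.le)).trans hJI
    _ = _ := by rw [← ENNReal.ofReal_mul (by positivity)]; congr 1; ring

lemma stp_int (n : ℕ) : ∫⁻ y in stp n, ENNReal.ofReal (y⁻¹) = ENNReal.ofReal (4 * n) := by
  have hab : Real.exp (-(2 * (n : ℝ))) ≤ Real.exp (2 * n) := by
    apply Real.exp_le_exp.mpr
    have : (0 : ℝ) ≤ n := Nat.cast_nonneg n
    linarith
  unfold stp
  have hi : IntegrableOn (fun y : ℝ => y⁻¹) (Set.Icc (Real.exp (-(2 * (n : ℝ)))) (Real.exp (2 * n))) := by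
    apply ContinuousOn.integrableOn_Icc
    intro x hx
    exact (continuousAt_inv₀ (ne_of_gt (lt_of_lt_of_le (Real.exp_pos _) hx.1))).continuousWithinAt
  rw [← ofReal_integral_eq_lintegral_ofReal hi]
  · rw [integral_Icc_eq_integral_Ioc, ← intervalIntegral.integral_of_le hab, integral_inv_of_pos (Real.exp_pos _) (Real.exp_pos _),
      Real.log_div (Real.exp_pos _).ne' (Real.exp_pos _).ne', Real.log_exp, Real.log_exp]
    congr 1; ring
  · refine (ae_restrict_iff' measurableSet_Icc).mpr (Filter.Eventually.of_forall fun x hx => ?_)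
    exact inv_nonneg.mpr ((Real.exp_pos _).le.trans hx.1)

/-- auxiliary exponent -/
lemma WP.theta (P : WP p c θ a k l s η κ) : ∃ ϑ, 0 ≤ ϑ ∧ ϑ ≤ p ∧ p * (2 - θ) < ϑ ∧
    ϑ < c + (p - 1) * max s 0 - p * (θ - 2) - 1 + 2 ∧ (1 < c → ϑ < c + (p - 1) * max s 0 - p * (θ - 2) - 1 + 0) := by
  have hp := P.hp
  have hθ := P.hθ1
  have hp2 : p * (2 - θ) < p := by nlinarith
  have hs := P.hs
  have hm : (p - 1) * s ≤ (p - 1) * max s 0 := mul_le_mul_of_nonneg_left (le_max_left _ _) (by linarith)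
  have hm0 : 0 ≤ (p - 1) * max s 0 := mul_nonneg (by linarith) (le_max_right _ _)
  set ν1 := c + (p - 1) * max s 0 - p * (θ - 2) - 1 with hν
  have hν1 : 0 < ν1 := by linarith
  rcases P.hc.lt_or_eq with hc | hc
  · have h1 : max 0 (p * (2 - θ)) < min p ν1 := by
      refine max_lt (lt_min (by linarith) hν1) (lt_min hp2 (by rw [hν]; linarith))
    obtain ⟨x, hx1, hx2⟩ := exists_between h1
    have a1 := lt_of_le_of_lt (le_max_left _ _) hx1
    have a2 := lt_of_le_of_lt (le_max_right _ _) hx1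
    have a3 := lt_of_lt_of_le hx2 (min_le_left _ _)
    have a4 := lt_of_lt_of_le hx2 (min_le_right _ _)
    exact ⟨x, a1.le, a3.le, a2, by linarith, fun _ => by linarith⟩
  · have h1 : max 0 (p * (2 - θ)) < min p (ν1 + 2) := by
      refine max_lt (lt_min (by linarith) (by linarith)) (lt_min hp2 (by rw [hν]; linarith))
    obtain ⟨x, hx1, hx2⟩ := exists_between h1
    have a1 := lt_of_le_of_lt (le_max_left _ _) hx1
    have a2 := lt_of_le_of_lt (le_max_right _ _) hx1
    have a3 := lt_of_lt_of_le hx2 (min_le_left _ _)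
    have a4 := lt_of_lt_of_le hx2 (min_le_right _ _)
    exact ⟨x, a1.le, a3.le, a2, by linarith, fun h => by linarith⟩

/-- total error: first weight -/
lemma WP.err1 (P : WP p c θ a k l s η κ) {Y : ℝ} (hY : 0 < Y) :
    ∫⁻ y in Set.Ioc 0 Y, ∫⁻ h in Set.Ioi 0, ENNReal.ofReal (om p h * (Pw p c a k l s η h y * (h ^ 2)⁻¹)) ≠ ⊤ := by
  obtain ⟨ϑ, t1, t2, t3, t4, t5⟩ := P.theta
  obtain ⟨C1, c1, b1⟩ := P.E_small
  obtain ⟨C2, c2, b2⟩ := P.E_big (t := 2) t1 t2 t4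
  have hp := P.hp
  have x1 : -1 < p * (θ - 1) - 1 := by
    have := mul_pos (by linarith : 0 < p) (by linarith [P.hθ1] : 0 < θ - 1)
    linarith
  have x2 : -1 < p * (θ - 2) - 1 + ϑ := by linarith
  have : ∫⁻ y in Set.Ioc 0 Y, ∫⁻ h in Set.Ioi 0, ENNReal.ofReal (om p h * (Pw p c a k l s η h y * (h ^ 2)⁻¹)) ≤
      ∫⁻ y in Set.Ioc 0 Y, (ENNReal.ofReal (C1 * y ^ (p * (θ - 1) - 1)) + ENNReal.ofReal (C2 * y ^ (p * (θ - 2) - 1 + ϑ))) := by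
    refine setLIntegral_mono' measurableSet_Ioc fun y hy => ?_
    rw [split_y hy.1]
    refine add_le_add (b1 y hy.1) (le_trans (le_of_eq ?_) (b2 y hy.1))
    refine setLIntegral_congr_fun measurableSet_Ioi fun h hh => ?_
    have h0 : 0 < h := lt_trans hy.1 hh
    rw [sub_self, Real.rpow_zero, mul_one, Real.rpow_neg h0.le, Real.rpow_two]
  refine ne_top_of_le_ne_top ?_ this
  rw [lintegral_add_left (by fun_prop), lint_const c1, lint_const c2]
  exact ENNReal.add_ne_top.mpr ⟨ENNReal.mul_ne_top ENNReal.ofReal_ne_top (rpow_fin x1 hY),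
    ENNReal.mul_ne_top ENNReal.ofReal_ne_top (rpow_fin x2 hY)⟩

/-- total error: second weight -/
lemma WP.err2 (P : WP p c θ a k l s η κ) {Y : ℝ} (hY : 0 < Y) : ∃ B : ENNReal, B ≠ ⊤ ∧ ∀ n : ℕ, 1 ≤ n →
    ENNReal.ofReal ((c - 1) / n + 1 / n ^ 2) * ∫⁻ y in Set.Ioc 0 Y, ∫⁻ h in Set.Ioi 0,
      ENNReal.ofReal (om p h * (Pw p c a k l s η h y * ((stp n).indicator (fun y => (y ^ 2)⁻¹) y))) ≤ B * ENNReal.ofReal (1 / n) := by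
  have hp := P.hp
  obtain ⟨C1, c1, b1⟩ := P.E_small
  have x1 : -1 < p * (θ - 1) - 1 := by
    have := mul_pos (by linarith : 0 < p) (by linarith [P.hθ1] : 0 < θ - 1)
    linarith
  set B1 := ENNReal.ofReal C1 * ∫⁻ y in Set.Ioc 0 Y, ENNReal.ofReal (y ^ (p * (θ - 1) - 1)) with hB1
  have hB1t : B1 ≠ ⊤ := ENNReal.mul_ne_top ENNReal.ofReal_ne_top (rpow_fin x1 hY)
  have Pn : ∀ h y, 0 < h → 0 < y → 0 ≤ om p h * Pw p c a k l s η h y := fun h y hh hy => by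
    have t1 := om_nonneg (p := p) hh
    have t2 := P.G_pos hh hy
    have t3 := mS_pos a c (-l) hh hy
    unfold Pw; positivity
  have small : ∀ n : ℕ, ∀ y, 0 < y → ∫⁻ h in Set.Ioc 0 y,
      ENNReal.ofReal (om p h * (Pw p c a k l s η h y * ((stp n).indicator (fun y => (y ^ 2)⁻¹) y))) ≤
      ENNReal.ofReal (C1 * y ^ (p * (θ - 1) - 1)) := by
    intro n y hy
    refine le_trans (setLIntegral_mono' measurableSet_Ioc fun h hh => ENNReal.ofReal_le_ofReal ?_) (b1 y hy)
    have h0 := hh.1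
    rw [← mul_assoc, ← mul_assoc]
    refine mul_le_mul_of_nonneg_left ?_ (Pn h y h0 hy)
    refine (Set.indicator_le_self' (fun _ _ => by positivity) y).trans ?_
    exact inv_anti₀ (by positivity) (pow_le_pow_left₀ h0.le hh.2 2)
  have tot : ∀ (n : ℕ) (Φ : ℝ → ENNReal), (∀ y, 0 < y → ∫⁻ h in Set.Ioi y,
      ENNReal.ofReal (om p h * (Pw p c a k l s η h y * ((stp n).indicator (fun y => (y ^ 2)⁻¹) y))) ≤ Φ y) →
      ∫⁻ y in Set.Ioc 0 Y, ∫⁻ h in Set.Ioi 0,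
      ENNReal.ofReal (om p h * (Pw p c a k l s η h y * ((stp n).indicator (fun y => (y ^ 2)⁻¹) y))) ≤
      B1 + ∫⁻ y in Set.Ioc 0 Y, Φ y := by
    intro n Φ hΦ
    rw [hB1, ← lint_const c1, ← lintegral_add_left (by fun_prop)]
    refine setLIntegral_mono' measurableSet_Ioc fun y hy => ?_
    rw [split_y hy.1]
    exact add_le_add (small n y hy.1) (hΦ y hy.1)
  rcases P.hc.lt_or_eq with hc | hc
  · obtain ⟨ϑ, t1, t2, t3, t4, t5⟩ := P.theta
    obtain ⟨C2, c2, b2⟩ := P.E_big (t := 0) t1 t2 (t5 hc)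
    have x2 : -1 < p * (θ - 2) - 1 + ϑ := by linarith
    set B2 := ENNReal.ofReal C2 * ∫⁻ y in Set.Ioc 0 Y, ENNReal.ofReal (y ^ (p * (θ - 2) - 1 + ϑ)) with hB2
    have hB2t : B2 ≠ ⊤ := ENNReal.mul_ne_top ENNReal.ofReal_ne_top (rpow_fin x2 hY)
    refine ⟨ENNReal.ofReal c * (B1 + B2), ENNReal.mul_ne_top ENNReal.ofReal_ne_top (ENNReal.add_ne_top.mpr ⟨hB1t, hB2t⟩), ?_⟩
    intro n hn
    have hn0 : (0 : ℝ) < n := by exact_mod_cast hn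
    have hn1 : (1 : ℝ) ≤ n := by exact_mod_cast hn
    have T := tot n (fun y => ENNReal.ofReal (C2 * y ^ (p * (θ - 2) - 1 + ϑ))) (fun y hy => by
      refine le_trans (setLIntegral_mono' measurableSet_Ioi fun h hh => ENNReal.ofReal_le_ofReal ?_) (b2 y hy)
      have h0 : 0 < h := lt_trans hy hh
      rw [← mul_assoc, ← mul_assoc]
      refine mul_le_mul_of_nonneg_left ?_ (Pn h y h0 hy)
      refine (Set.indicator_le_self' (fun _ _ => by positivity) y).trans ?_
      rw [neg_zero, Real.rpow_zero, one_mul, zero_sub, Real.rpow_neg hy.le, Real.rpow_two])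
    rw [lint_const c2, ← hB2] at T
    have tau : ENNReal.ofReal ((c - 1) / n + 1 / n ^ 2) ≤ ENNReal.ofReal c * ENNReal.ofReal (1 / n) := by
      rw [← ENNReal.ofReal_mul (by linarith)]
      refine ENNReal.ofReal_le_ofReal ?_
      have : 1 / (n : ℝ) ^ 2 ≤ 1 / n := one_div_le_one_div_of_le hn0 (by nlinarith)
      calc (c - 1) / n + 1 / (n : ℝ) ^ 2 ≤ (c - 1) / n + 1 / n := by linarith
        _ = _ := by ring
    calc _ ≤ (ENNReal.ofReal c * ENNReal.ofReal (1 / n)) * (B1 + B2) := mul_le_mul' tau T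
      _ = _ := by ring
  · obtain ⟨C2, c2, b2⟩ := P.E_crit hc.symm
    refine ⟨B1 + ENNReal.ofReal (C2 * 4), ENNReal.add_ne_top.mpr ⟨hB1t, ENNReal.ofReal_ne_top⟩, ?_⟩
    intro n hn
    have hn0 : (0 : ℝ) < n := by exact_mod_cast hn
    have hn1 : (1 : ℝ) ≤ n := by exact_mod_cast hn
    have T := tot n ((stp n).indicator fun y => ENNReal.ofReal (C2 * y⁻¹)) (fun y hy => by
      by_cases hs : y ∈ stp n
      · rw [Set.indicator_of_mem hs, Set.indicator_of_mem hs]; exact b2 y hy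
      · rw [Set.indicator_of_notMem hs, Set.indicator_of_notMem hs]; simp)
    have T2 : ∫⁻ y in Set.Ioc 0 Y, (stp n).indicator (fun y => ENNReal.ofReal (C2 * y⁻¹)) y ≤ ENNReal.ofReal (C2 * 4 * n) := by
      refine (setLIntegral_le_lintegral _ _).trans ?_
      rw [lintegral_indicator (show MeasurableSet (stp n) from measurableSet_Icc), lint_const c2, stp_int, ← ENNReal.ofReal_mul c2]
      refine ENNReal.ofReal_le_ofReal (le_of_eq (by ring))
    have T3 := T.trans (add_le_add le_rfl T2)
    have tau : ENNReal.ofReal ((c - 1) / n + 1 / n ^ 2) = ENNReal.ofReal (1 / n) * ENNReal.ofReal (1 / n) := by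
      rw [← ENNReal.ofReal_mul (by positivity), ← hc]; congr 1; field_simp; ring
    rw [tau]
    have i1 : ENNReal.ofReal (1 / (n : ℝ)) ≤ 1 := by
      rw [ENNReal.ofReal_le_one, div_le_one hn0]; exact hn1
    calc _ ≤ (ENNReal.ofReal (1 / n) * ENNReal.ofReal (1 / n)) * (B1 + ENNReal.ofReal (C2 * 4 * n)) := by gcongr
      _ = (ENNReal.ofReal (1 / n) * B1 + ENNReal.ofReal (1 / n) * ENNReal.ofReal (C2 * 4 * n)) * ENNReal.ofReal (1 / n) := by ring
      _ ≤ _ := by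
          gcongr ?_ * _
          refine add_le_add ?_ ?_
          · calc _ ≤ 1 * B1 := by gcongr
              _ = B1 := one_mul _
          · rw [← ENNReal.ofReal_mul (by positivity)]
            refine ENNReal.ofReal_le_ofReal (le_of_eq (by field_simp))

end oned
end dev19

section dev20
section dbl
variable {N : ℕ} {ι : Type} [Fintype ι] (e : ι → Pt N)

lemma Quad_meas : MeasurableSet (Quad N) := Quad_open.measurableSet

lemma meas_hy {E : Type*} [MeasurableSpace E] {F : ℝ → ℝ → E} (hF : Measurable (Function.uncurry F)) :
    Measurable fun z : Pt (N + 1) => F (z.1 0) z.2 :=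
  hF.comp (g := Function.uncurry F) (f := fun z : Pt (N + 1) => (z.1 0, z.2)) (by fun_prop)

/-- transport from the quadrant to the half space -/
lemma shift_quad (σ : ℝ) {a : Pt N} (ha : a.2 = 0) {J : Pt N → ENNReal} (hJ : Measurable J)
    {F : ℝ → ℝ → ENNReal} (hF : Measurable (Function.uncurry F)) :
    ∫⁻ z in Quad N, J (ellL σ a z) * F (z.1 0) z.2 = ∫⁻ ζ in Half N, J ζ * ∫⁻ h in Set.Ioi 0, F h ζ.2 := by
  have hS : MeasurableSet {q : ℝ × ℝ | 0 < q.1 ∧ 0 < q.2} :=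
    (measurableSet_lt measurable_const measurable_fst).inter (measurableSet_lt measurable_const measurable_snd)
  set wg : ℝ → ℝ → ENNReal := fun h y => {q : ℝ × ℝ | 0 < q.1 ∧ 0 < q.2}.indicator (Function.uncurry F) (h, y) with hwg
  have hw : Measurable (Function.uncurry wg) := by
    have : Function.uncurry wg = {q : ℝ × ℝ | 0 < q.1 ∧ 0 < q.2}.indicator (Function.uncurry F) := by
      ext ⟨h, y⟩; rfl
    rw [this]; exact hF.indicator hS
  have key := shift_int σ ha hJ hw
  rw [← lintegral_indicator Quad_meas, ← lintegral_indicator Half_meas]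
  refine Eq.trans ?_ (key.trans ?_)
  · refine lintegral_congr fun z => ?_
    by_cases hz : z ∈ Quad N
    · have hz' : ((z.1 0, z.2) : ℝ × ℝ) ∈ {q : ℝ × ℝ | 0 < q.1 ∧ 0 < q.2} := hz
      rw [Set.indicator_of_mem hz, hwg]; simp only
      rw [Set.indicator_of_mem hz']; rfl
    · have hz' : ((z.1 0, z.2) : ℝ × ℝ) ∉ {q : ℝ × ℝ | 0 < q.1 ∧ 0 < q.2} := hz
      rw [Set.indicator_of_notMem hz, hwg]; simp only
      rw [Set.indicator_of_notMem hz', mul_zero]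
  · refine lintegral_congr fun ζ => ?_
    by_cases hz : ζ ∈ Half N
    · rw [Set.indicator_of_mem hz, ← lintegral_indicator measurableSet_Ioi]
      congr 1
      refine lintegral_congr fun h => ?_
      have hz2 : 0 < ζ.2 := hz
      by_cases hh : h ∈ Set.Ioi (0 : ℝ)
      · have hz' : ((h, ζ.2) : ℝ × ℝ) ∈ {q : ℝ × ℝ | 0 < q.1 ∧ 0 < q.2} := ⟨hh, hz⟩
        rw [Set.indicator_of_mem hh, hwg]; simp only
        rw [Set.indicator_of_mem hz']; rfl
      · have hz' : ((h, ζ.2) : ℝ × ℝ) ∉ {q : ℝ × ℝ | 0 < q.1 ∧ 0 < q.2} := fun h' => hh h'.1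
        rw [Set.indicator_of_notMem hh, hwg]; simp only
        rw [Set.indicator_of_notMem hz']
    · rw [Set.indicator_of_notMem hz]
      have : ∀ h, wg h ζ.2 = 0 := fun h => by
        have hz' : ((h, ζ.2) : ℝ × ℝ) ∉ {q : ℝ × ℝ | 0 < q.1 ∧ 0 < q.2} := fun h' => hz h'.2
        rw [hwg]; simp only
        rw [Set.indicator_of_notMem hz']
      simp [this]

/-- odd doubling -/
def Wd (σ : ℝ) (a : Pt N) (φ : Pt N → ℝ) (z : Pt (N + 1)) : ℝ := φ (ellL σ a z) - φ (ellL (-σ) a z)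

variable {σ : ℝ} {a : Pt N} {φ : Pt N → ℝ} {p : ℝ}

lemma Wd_smooth (hφ : TF φ) : ContDiff ℝ (⊤ : ℕ∞) (Wd σ a φ) :=
  (hφ.1.comp (ellL σ a).contDiff).sub (hφ.1.comp (ellL (-σ) a).contDiff)

lemma Wd_bd (hp : 1 < p) (hφ : TF φ) : ∃ M : ℝ, 0 ≤ M ∧ ∀ z : Pt (N + 1), 0 < z.1 0 →
    ENNReal.ofReal (|Wd σ a φ z| ^ p) ≤
      ((tsupport φ).indicator (fun _ => ENNReal.ofReal M) (ellL σ a z) +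
        (tsupport φ).indicator (fun _ => ENNReal.ofReal M) (ellL (-σ) a z)) * ENNReal.ofReal (om p (z.1 0)) := by
  obtain ⟨B, hB0, hB⟩ := hφ.bdd
  obtain ⟨L, hL0, hL⟩ := hφ.bddfd
  set B0 := 2 * B + L * (2 * |σ| * ‖a‖) with hB0d
  have hB0p : 0 ≤ B0 := by positivity
  refine ⟨B0 ^ p, by positivity, fun z hz => ?_⟩
  have h1 : |Wd σ a φ z| ≤ 2 * B := by
    unfold Wd
    exact (abs_sub _ _).trans (by linarith [hB (ellL σ a z), hB (ellL (-σ) a z)])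
  have h2 : |Wd σ a φ z| ≤ L * (2 * |σ| * ‖a‖) * z.1 0 := by
    unfold Wd
    have := Convex.norm_image_sub_le_of_norm_fderiv_le (s := Set.univ) (f := φ) (C := L) (𝕜 := ℝ)
      (fun x _ => hφ.diff x) (fun x _ => hL x) convex_univ (Set.mem_univ (ellL (-σ) a z)) (Set.mem_univ (ellL σ a z))
    rw [Real.norm_eq_abs] at this
    refine this.trans (le_of_eq ?_)
    have h3 : ellL σ a z - ellL (-σ) a z = (2 * σ * z.1 0) • a := by
      rw [ellL_apply, ellL_apply]; ext i <;> simp <;> ring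
    rw [h3, norm_smul, Real.norm_eq_abs, abs_mul, abs_mul, abs_of_pos hz, abs_of_pos (two_pos : (0:ℝ) < 2)]; ring
  have h3 : |Wd σ a φ z| ≤ B0 * min 1 (z.1 0) := by
    have n1 : 0 ≤ L * (2 * |σ| * ‖a‖) := by positivity
    rcases le_total (z.1 0) 1 with hh | hh
    · rw [min_eq_right hh, hB0d]; nlinarith
    · rw [min_eq_left hh, hB0d]; nlinarith
  have h4 : ENNReal.ofReal (|Wd σ a φ z| ^ p) ≤ ENNReal.ofReal (B0 ^ p) * ENNReal.ofReal (om p (z.1 0)) := by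
    rw [← ENNReal.ofReal_mul (by positivity)]
    apply ENNReal.ofReal_le_ofReal
    unfold om
    rw [← Real.mul_rpow hB0p (le_min zero_le_one hz.le)]
    exact Real.rpow_le_rpow (abs_nonneg _) h3 (by linarith)
  by_cases k1 : ellL σ a z ∈ tsupport φ
  · rw [Set.indicator_of_mem k1]
    exact h4.trans (mul_le_mul_left (le_add_right le_rfl) _)
  · by_cases k2 : ellL (-σ) a z ∈ tsupport φ
    · rw [Set.indicator_of_mem k2]
      exact h4.trans (mul_le_mul_left (le_add_left le_rfl) _)
    · have : Wd σ a φ z = 0 := by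
        unfold Wd; rw [image_eq_zero_of_notMem_tsupport k1, image_eq_zero_of_notMem_tsupport k2, sub_zero]
      rw [this, abs_zero, Real.zero_rpow (by linarith), ENNReal.ofReal_zero]; exact zero_le

lemma Wd_int (ha : a.2 = 0) (hp : 1 < p) (hφ : TF φ) : ∃ M : ENNReal, M ≠ ⊤ ∧ ∃ Y : ℝ, 0 < Y ∧
    ∀ F : ℝ → ℝ → ℝ, Measurable (Function.uncurry F) →
    ∫⁻ z in Quad N, ENNReal.ofReal (|Wd σ a φ z| ^ p * F (z.1 0) z.2) ≤
      M * ∫⁻ y in Set.Ioc 0 Y, ∫⁻ h in Set.Ioi 0, ENNReal.ofReal (om p h * F h y) := by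
  obtain ⟨M, hM0, hM⟩ := Wd_bd (σ := σ) (a := a) hp hφ
  have hK : IsCompact (tsupport φ) := hφ.2
  obtain ⟨Y0, hY0⟩ := hK.isBounded.exists_norm_le
  set S : Set (Fin N → ℝ) := Set.image Prod.fst (tsupport φ) with hS
  have hSc : IsCompact S := hK.image continuous_fst
  have hSm : MeasurableSet S := hSc.isClosed.measurableSet
  refine ⟨2 * (volume S * ENNReal.ofReal M), ENNReal.mul_ne_top (by simp) (ENNReal.mul_ne_top hSc.measure_lt_top.ne ENNReal.ofReal_ne_top),
    max Y0 1, by positivity, fun F hF => ?_⟩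
  set Y := max Y0 1 with hY
  set J : Pt N → ENNReal := (tsupport φ).indicator (fun _ => ENNReal.ofReal M) with hJ
  have hJm : Measurable J := measurable_const.indicator (isClosed_tsupport φ).measurableSet
  set G : ℝ → ℝ → ENNReal := fun h y => ENNReal.ofReal (om p h) * ENNReal.ofReal (F h y) with hG
  have hGm : Measurable (Function.uncurry G) :=
    (om_meas.comp measurable_fst).ennreal_ofReal.mul hF.ennreal_ofReal
  set Φ : ℝ → ENNReal := fun y => ∫⁻ h in Set.Ioi 0, G h y with hΦ
  have hΦm : Measurable Φ := Measurable.lintegral_prod_left' hGm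
  have hΦe : ∀ y, Φ y = ∫⁻ h in Set.Ioi 0, ENNReal.ofReal (om p h * F h y) := fun y => by
    refine setLIntegral_congr_fun measurableSet_Ioi fun h hh => ?_
    exact (ENNReal.ofReal_mul (om_nonneg hh)).symm
  have half : ∫⁻ ζ in Half N, J ζ * Φ ζ.2 ≤ volume S * ENNReal.ofReal M * ∫⁻ y in Set.Ioc 0 Y, Φ y := by
    rw [← lintegral_indicator Half_meas]
    calc _ ≤ ∫⁻ ζ : Pt N, S.indicator (fun _ => ENNReal.ofReal M) ζ.1 * (Set.Ioc 0 Y).indicator Φ ζ.2 := by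
          refine lintegral_mono fun ζ => ?_
          by_cases hz : ζ ∈ Half N
          · rw [Set.indicator_of_mem hz]
            by_cases hk : ζ ∈ tsupport φ
            · have y1 : ζ.2 ∈ Set.Ioc 0 Y := by
                refine ⟨hz, ?_⟩
                have := (norm_snd_le ζ).trans (hY0 ζ hk)
                exact (le_abs_self _).trans (this.trans (le_max_left _ _))
              rw [hJ, Set.indicator_of_mem hk, Set.indicator_of_mem (show ζ.1 ∈ S from ⟨ζ, hk, rfl⟩), Set.indicator_of_mem y1]
            · rw [hJ, Set.indicator_of_notMem hk, zero_mul]; exact zero_le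
          · rw [Set.indicator_of_notMem hz]; exact zero_le
      _ = (∫⁻ x, S.indicator (fun _ => ENNReal.ofReal M) x) * ∫⁻ y, (Set.Ioc 0 Y).indicator Φ y :=
          lintegral_prod_mul (measurable_const.indicator hSm).aemeasurable (hΦm.indicator measurableSet_Ioc).aemeasurable
      _ = _ := by
          rw [lintegral_indicator hSm, lintegral_indicator measurableSet_Ioc, setLIntegral_const, mul_comm (ENNReal.ofReal M)]
  calc ∫⁻ z in Quad N, ENNReal.ofReal (|Wd σ a φ z| ^ p * F (z.1 0) z.2)
      ≤ ∫⁻ z in Quad N, (J (ellL σ a z) * G (z.1 0) z.2 + J (ellL (-σ) a z) * G (z.1 0) z.2) := by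
        refine setLIntegral_mono' Quad_meas fun z hz => ?_
        rw [ENNReal.ofReal_mul (by positivity), ← add_mul, hG]
        simp only
        rw [← mul_assoc]
        exact mul_le_mul_left (hM z hz.1) _
    _ = (∫⁻ ζ in Half N, J ζ * Φ ζ.2) + ∫⁻ ζ in Half N, J ζ * Φ ζ.2 := by
        have hm1 : Measurable fun z : Pt (N + 1) => J (ellL σ a z) * G (z.1 0) z.2 :=
          (hJm.comp (ellL σ a).continuous.measurable).mul (meas_hy hGm)
        rw [lintegral_add_left hm1,
          shift_quad σ ha hJm hGm, shift_quad (-σ) ha hJm hGm]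
    _ ≤ _ := by
        rw [← two_mul, mul_assoc 2]
        simp_rw [← hΦe]
        gcongr

lemma Wd_compact (hφ : TF φ) (n : ℕ) :
    IsCompact ({z : Pt (N + 1) | z.1 0 ∈ stp n ∧ z.2 ∈ stp n} ∩ tsupport (Wd σ a φ)) := by
  have hcl : IsClosed ({z : Pt (N + 1) | z.1 0 ∈ stp n ∧ z.2 ∈ stp n} ∩ tsupport (Wd σ a φ)) := by
    refine IsClosed.inter ?_ (isClosed_tsupport _)
    have c1 : IsClosed (stp n) := isClosed_Icc
    exact (c1.preimage (by fun_prop : Continuous fun z : Pt (N + 1) => z.1 0)).inter (c1.preimage continuous_snd)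
  refine Metric.isCompact_of_isClosed_isBounded hcl ?_
  obtain ⟨R, hR⟩ := (show IsCompact (tsupport φ) from hφ.2).isBounded.exists_norm_le
  have sub : tsupport (Wd σ a φ) ⊆ (ellL σ a) ⁻¹' tsupport φ ∪ (ellL (-σ) a) ⁻¹' tsupport φ := by
    refine closure_minimal ?_ (((isClosed_tsupport φ).preimage (ellL σ a).continuous).union
      ((isClosed_tsupport φ).preimage (ellL (-σ) a).continuous))
    intro z hz
    by_contra hc
    rw [Set.mem_union, not_or] at hc
    apply hz
    unfold Wd
    rw [image_eq_zero_of_notMem_tsupport hc.1, image_eq_zero_of_notMem_tsupport hc.2, sub_zero]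
  set E := Real.exp (2 * n) with hE
  have hE0 : 0 < E := Real.exp_pos _
  rw [isBounded_iff_forall_norm_le]
  refine ⟨E + |R| + |σ| * E * ‖a‖, ?_⟩
  rintro z ⟨⟨hz1, hz2⟩, hz3⟩
  have e1 : |z.1 0| ≤ E := by rw [abs_of_pos (stp_pos hz1)]; exact hz1.2
  have gen : ∀ τ : ℝ, |τ| = |σ| → ellL τ a z ∈ tsupport φ → ‖z‖ ≤ E + |R| + |σ| * E * ‖a‖ := by
    intro τ hτ hk
    have k1 := hR _ hk
    have k2 : ((fun i : Fin N => z.1 i.succ, z.2) : Pt N) = ellL τ a z - (τ * z.1 0) • a := by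
      rw [ellL_apply]; abel
    have k3 : ‖((fun i : Fin N => z.1 i.succ, z.2) : Pt N)‖ ≤ |R| + |σ| * E * ‖a‖ := by
      rw [k2]
      refine (norm_sub_le _ _).trans (add_le_add (k1.trans (le_abs_self R)) ?_)
      rw [norm_smul, Real.norm_eq_abs, abs_mul, hτ]
      gcongr
    have k4 := norm_fst_le ((fun i : Fin N => z.1 i.succ, z.2) : Pt N)
    have k5 := norm_snd_le ((fun i : Fin N => z.1 i.succ, z.2) : Pt N)
    have q0 : 0 ≤ |R| + |σ| * E * ‖a‖ := by positivity
    rw [Prod.norm_def]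
    refine max_le ?_ ?_
    · rw [pi_norm_le_iff_of_nonneg (by positivity)]
      intro i
      refine Fin.cases ?_ (fun j => ?_) i
      · rw [Real.norm_eq_abs]; linarith
      · have := norm_le_pi_norm (fun i : Fin N => z.1 i.succ) j
        simp only at k4 this
        linarith
    · simp only at k5
      linarith
  rcases sub hz3 with hk | hk
  · exact gen σ rfl hk
  · exact gen (-σ) (abs_neg σ) hk

end dbl
end dev20

section dev21
section lim
variable {N : ℕ} {ι : Type} [Fintype ι] (e : ι → Pt N)
variable {p c θ a k l s η κ γ : ℝ}

lemma fn_meas (n : ℕ) : Measurable (fn n) := by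
  unfold fn
  refine Measurable.ite measurableSet_Ioi ?_ measurable_const
  exact cX_smooth.continuous.measurable.comp (by fun_prop)

lemma lintC {E : Type*} [MeasurableSpace E] {μ : Measure E} {C : ℝ} (hC : 0 ≤ C) (f : E → ℝ) :
    ∫⁻ h, ENNReal.ofReal (C * f h) ∂μ = ENNReal.ofReal C * ∫⁻ h, ENNReal.ofReal (f h) ∂μ := by
  simp_rw [ENNReal.ofReal_mul hC]
  rw [lintegral_const_mul' _ _ ENNReal.ofReal_ne_top]

/-- letting `n → ∞` -/
lemma WP.limit {e' : ι → Pt (N + 1)} {q : ℝ} (hpq : p.HolderConjugate q) (P : WP p c θ a k l s η κ) (hγ : 0 < γ) {w : Pt (N + 1)}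
    (hw0 : w.1 0 = 0) (hw : w.2 = c * γ)
    (g1 : ∑ k, (e' k).1 0 * (e' k).1 0 = γ) (g2 : ∑ k, (e' k).2 * (e' k).2 = γ) (g3 : ∀ k, (e' k).1 0 * (e' k).2 = 0)
    {σ : ℝ} {a0 : Pt N} (ha : a0.2 = 0) {φ : Pt N → ℝ} (hφ : TF φ) :
    ∫⁻ z in Quad N, ENNReal.ofReal (1 / 2 * (|Wd σ a0 φ z| ^ p * (psl p a c k l s κ γ (z.1 0) z.2 * Gs a k s η (z.1 0) z.2 ^ (-p)))) ≤
    ∫⁻ z in Quad N, ENNReal.ofReal (p ^ p * 2 ^ (p - 1) * (mS a c (-l) (z.1 0) z.2 ^ p * psl p a c k l s κ γ (z.1 0) z.2 ^ (1 - p) *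
        |opL e' w (Wd σ a0 φ) z| ^ p)) := by
  obtain ⟨M, hM0, hM⟩ := P.main_n e' hpq hγ hw0 hw g1 g2 g3
  obtain ⟨M', hM't, Y, hY, hW⟩ := Wd_int (σ := σ) ha P.hp hφ
  have E1 := P.err1 hY
  obtain ⟨B, hBt, E2⟩ := P.err2 hY
  have hp := P.hp
  have hWm : Measurable (Wd σ a0 φ) := (Wd_smooth hφ).continuous.measurable
  set R := ∫⁻ z in Quad N, ENNReal.ofReal (p ^ p * 2 ^ (p - 1) * (mS a c (-l) (z.1 0) z.2 ^ p * psl p a c k l s κ γ (z.1 0) z.2 ^ (1 - p) *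
        |opL e' w (Wd σ a0 φ) z| ^ p)) with hR
  set X : Pt (N + 1) → ℝ := fun z => 1 / 2 * (|Wd σ a0 φ z| ^ p * (psl p a c k l s κ γ (z.1 0) z.2 * Gs a k s η (z.1 0) z.2 ^ (-p))) with hX
  have hXm : Measurable X := by
    have h1 := meas_hy (N := N) (psl_meas (p := p) (a := a) (c := c) (k := k) (l := l) (s := s) (κ := κ) (γ := γ))
    have h2 := meas_hy (N := N) (Gs_meas (a := a) (k := k) (s := s) (η := η))
    exact measurable_const.mul ((hWm.abs.pow_const _).mul (h1.mul (h2.pow_const _)))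
  set T1 := ∫⁻ y in Set.Ioc 0 Y, ∫⁻ h in Set.Ioi 0, ENNReal.ofReal (om p h * (Pw p c a k l s η h y * (h ^ 2)⁻¹)) with hT1
  set K := ENNReal.ofReal M * (M' * T1) + ENNReal.ofReal M * (M' * B) with hK
  have hKt : K ≠ ⊤ := ENNReal.add_ne_top.mpr ⟨ENNReal.mul_ne_top ENNReal.ofReal_ne_top (ENNReal.mul_ne_top hM't E1),
    ENNReal.mul_ne_top ENNReal.ofReal_ne_top (ENNReal.mul_ne_top hM't hBt)⟩
  have step : ∀ n : ℕ, 1 ≤ n → ∫⁻ z in Quad N, ENNReal.ofReal (X z * (fn n (z.1 0) * fn n z.2)) ≤ R + K * ENNReal.ofReal (1 / n) := by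
    intro n hn
    have hn0 : (0 : ℝ) < n := by exact_mod_cast hn
    refine (hM _ (Wd_smooth hφ) n hn (Wd_compact hφ n)).trans ?_
    have hc1 : 0 ≤ (c - 1) / n + 1 / (n : ℝ) ^ 2 := by
      have : 0 ≤ c - 1 := by linarith [P.hc]
      positivity
    set i2 : ℝ → ℝ := (stp n).indicator (fun y => (y ^ 2)⁻¹) with hi2
    have hi2m : Measurable i2 := by
      have : Measurable fun y : ℝ => (y ^ 2)⁻¹ := by fun_prop
      exact this.indicator (show MeasurableSet (stp n) from measurableSet_Icc)
    have hi20 : ∀ y, 0 ≤ i2 y := fun y => Set.indicator_nonneg (fun y _ => by positivity) y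
    set F1 : ℝ → ℝ → ℝ := fun h y => Pw p c a k l s η h y * (h ^ 2)⁻¹ with hF1
    set F2 : ℝ → ℝ → ℝ := fun h y => Pw p c a k l s η h y * i2 y with hF2
    have hF1m : Measurable (Function.uncurry F1) := by
      have : Measurable fun x : ℝ × ℝ => (x.1 ^ 2)⁻¹ := by fun_prop
      exact Pw_meas.mul this
    have hF2m : Measurable (Function.uncurry F2) := Pw_meas.mul (hi2m.comp measurable_snd)
    have w1 := hW F1 hF1m
    have w2 := hW F2 hF2m
    have v2 := E2 n hn
    calc _ ≤ ∫⁻ z in Quad N, (ENNReal.ofReal (p ^ p * 2 ^ (p - 1) * (mS a c (-l) (z.1 0) z.2 ^ p * psl p a c k l s κ γ (z.1 0) z.2 ^ (1 - p) *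
        |opL e' w (Wd σ a0 φ) z| ^ p)) + (ENNReal.ofReal (M / n * (|Wd σ a0 φ z| ^ p * F1 (z.1 0) z.2)) +
          ENNReal.ofReal (M * ((c - 1) / n + 1 / n ^ 2) * (|Wd σ a0 φ z| ^ p * F2 (z.1 0) z.2)))) := by
          refine lintegral_mono fun z => ?_
          refine ENNReal.ofReal_add_le.trans (add_le_add le_rfl ?_)
          refine le_trans (ENNReal.ofReal_le_ofReal (le_of_eq ?_)) ENNReal.ofReal_add_le
          simp only [hF1, hF2, Pw]; ring
      _ = R + (ENNReal.ofReal (M / n) * (∫⁻ z in Quad N, ENNReal.ofReal (|Wd σ a0 φ z| ^ p * F1 (z.1 0) z.2)) +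
          ENNReal.ofReal (M * ((c - 1) / n + 1 / n ^ 2)) * ∫⁻ z in Quad N, ENNReal.ofReal (|Wd σ a0 φ z| ^ p * F2 (z.1 0) z.2)) := by
          have m1 : Measurable fun z : Pt (N + 1) => ENNReal.ofReal (M / n * (|Wd σ a0 φ z| ^ p * F1 (z.1 0) z.2)) :=
            (measurable_const.mul ((hWm.abs.pow_const _).mul (meas_hy hF1m))).ennreal_ofReal
          have m2 : Measurable fun z : Pt (N + 1) => ENNReal.ofReal (M * ((c - 1) / n + 1 / n ^ 2) * (|Wd σ a0 φ z| ^ p * F2 (z.1 0) z.2)) :=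
            (measurable_const.mul ((hWm.abs.pow_const _).mul (meas_hy hF2m))).ennreal_ofReal
          rw [lintegral_add_right _ (show Measurable (fun z : Pt (N + 1) => ENNReal.ofReal (M / n * (|Wd σ a0 φ z| ^ p * F1 (z.1 0) z.2)) + ENNReal.ofReal (M * ((c - 1) / n + 1 / n ^ 2) * (|Wd σ a0 φ z| ^ p * F2 (z.1 0) z.2))) from m1.add m2), ← hR, lintegral_add_left m1, lintC (by positivity), lintC (by positivity)]
      _ ≤ R + (ENNReal.ofReal (M / n) * (M' * T1) + ENNReal.ofReal M * (M' * (B * ENNReal.ofReal (1 / n)))) := by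
          gcongr R + (_ * ?_ + ?_)
          rw [ENNReal.ofReal_mul hM0, mul_assoc]
          gcongr ENNReal.ofReal M * ?_
          calc _ ≤ ENNReal.ofReal ((c - 1) / n + 1 / (n : ℝ) ^ 2) * (M' * _) := mul_le_mul_right w2 _
            _ = M' * (ENNReal.ofReal ((c - 1) / n + 1 / (n : ℝ) ^ 2) * _) := by ring
            _ ≤ _ := mul_le_mul_right v2 _
      _ = _ := by
          rw [show M / n = M * (1 / n) by ring, ENNReal.ofReal_mul hM0, hK]; ring
  have lim0 : Filter.Tendsto (fun n : ℕ => R + K * ENNReal.ofReal (1 / n)) Filter.atTop (nhds R) := by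
    have h1 : Filter.Tendsto (fun n : ℕ => ENNReal.ofReal (1 / (n : ℝ))) Filter.atTop (nhds 0) := by
      have := ENNReal.tendsto_ofReal tendsto_one_div_atTop_nhds_zero_nat
      rwa [ENNReal.ofReal_zero] at this
    have h2 := ENNReal.Tendsto.const_mul h1 (Or.inr hKt)
    have h3 := (tendsto_const_nhds (x := R)).add h2
    rwa [mul_zero, add_zero] at h3
  have fat := lintegral_liminf_le (u := Filter.atTop) (μ := volume.restrict (Quad N)) (f := fun (n : ℕ) (z : Pt (N + 1)) => ENNReal.ofReal (X z * (fn n (z.1 0) * fn n z.2)))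
    (fun n => (hXm.mul (((fn_meas n).comp (by fun_prop : Measurable fun z : Pt (N + 1) => z.1 0)).mul ((fn_meas n).comp measurable_snd))).ennreal_ofReal)
  have ptw : ∫⁻ z in Quad N, ENNReal.ofReal (X z) = ∫⁻ z in Quad N, Filter.liminf (fun n : ℕ => ENNReal.ofReal (X z * (fn n (z.1 0) * fn n z.2))) Filter.atTop := by
    refine setLIntegral_congr_fun Quad_meas fun z hz => ?_
    refine (Filter.Tendsto.liminf_eq ?_).symm
    refine tendsto_const_nhds.congr' ?_
    filter_upwards [fn_tend hz.1, fn_tend hz.2] with n h1 h2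
    rw [h1, h2, mul_one, mul_one]
  rw [ptw]
  refine fat.trans ?_
  rw [← lim0.liminf_eq]
  refine Filter.liminf_le_liminf ?_
  filter_upwards [Filter.eventually_ge_atTop 1] with n hn using step n hn

end lim
end dev21

section dev22
section qb
variable {N : ℕ} {ι : Type} [Fintype ι] (e : ι → Pt N)
variable {p c θ a k l s η κ γ : ℝ}

lemma WP.R_int (P : WP p c θ a k l s η κ) (hγ : 0 < γ) : ∃ C, 0 ≤ C ∧ ∀ y, 0 < y →
    ∫⁻ h in Set.Ioi 0, ENNReal.ofReal (mS a c (-l) h y ^ p * psl p a c k l s κ γ h y ^ (1 - p)) ≤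
      ENNReal.ofReal (C * y ^ (p * θ - 1)) := by
  obtain ⟨C, hC, hb⟩ := P.R_bd hγ
  have hp := P.hp
  set Q := a * (2 - p) + 2 * (p - 1) with hQ
  set ν := c + (p - 1) * s - p * (θ - 2) with hν
  have hQ1 : -1 < Q := by
    have h1 : 0 < (p - 1) * (2 - a) := mul_pos (by linarith) (by linarith [P.ha1])
    have := P.ha0
    rw [hQ]; nlinarith
  have hν1 : -ν < -1 := by rw [hν]; linarith [P.hs]
  have q0 : 0 < Q + 1 := by linarith
  have n0 : 0 < -(-ν + 1) := by linarith
  refine ⟨C / (Q + 1) + C / (-(-ν + 1)), by positivity, fun y hy => ?_⟩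
  rw [split_y hy, add_mul, ENNReal.ofReal_add (by positivity) (by positivity)]
  refine add_le_add ?_ ?_
  · calc _ ≤ ∫⁻ h in Set.Ioc 0 y, ENNReal.ofReal (C * y ^ (c - l + (p - 1) * k) * h ^ Q) := by
          refine setLIntegral_mono' measurableSet_Ioc fun h hh => ENNReal.ofReal_le_ofReal ?_
          refine ((hb h y hh.1 hy).1 hh.2).trans (le_of_eq (by ring))
      _ = ENNReal.ofReal (C * y ^ (c - l + (p - 1) * k)) * ENNReal.ofReal (y ^ (Q + 1) / (Q + 1)) := by
          rw [lint_const (by positivity), int_small hQ1 hy]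
      _ = _ := by
          rw [← ENNReal.ofReal_mul (by positivity)]
          congr 1
          rw [show C * y ^ (c - l + (p - 1) * k) * (y ^ (Q + 1) / (Q + 1)) =
            C / (Q + 1) * (y ^ (c - l + (p - 1) * k) * y ^ (Q + 1)) by ring, ← Real.rpow_add hy]
          congr 2
          have := P.deg
          rw [hQ]; linarith
  · calc _ ≤ ∫⁻ h in Set.Ioi y, ENNReal.ofReal (C * y ^ (c + (p - 1) * s + 2 * (p - 1)) * h ^ (-ν)) := by
          refine setLIntegral_mono' measurableSet_Ioi fun h hh => ENNReal.ofReal_le_ofReal ?_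
          refine ((hb h y (lt_trans hy hh) hy).2 (le_of_lt hh)).trans (le_of_eq (by ring))
      _ = ENNReal.ofReal (C * y ^ (c + (p - 1) * s + 2 * (p - 1))) * ENNReal.ofReal (y ^ (-ν + 1) / (-(-ν + 1))) := by
          rw [lint_const (by positivity), int_big hν1 hy]
      _ = _ := by
          rw [← ENNReal.ofReal_mul (by positivity)]
          congr 1
          rw [show C * y ^ (c + (p - 1) * s + 2 * (p - 1)) * (y ^ (-ν + 1) / (-(-ν + 1))) =
            C / (-(-ν + 1)) * (y ^ (c + (p - 1) * s + 2 * (p - 1)) * y ^ (-ν + 1)) by ring, ← Real.rpow_add hy]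
          congr 2
          rw [hν]; ring

lemma opL_Wd {w : Pt N} {k0 : ι} (hγ : 0 < γ) (ha : (e k0).2 = 0) {φ : Pt N → ℝ} (hφ : TF φ) {z : Pt (N + 1)} (hz : z ∈ Quad N) :
    opL (eD e γ k0) (up w) (Wd (√γ)⁻¹ (e k0) φ) z =
      opL e w φ (ellL (√γ)⁻¹ (e k0) z) - opL e w φ (ellL (-(√γ)⁻¹) (e k0) z) := by
  have hs : √γ ≠ 0 := (Real.sqrt_pos.mpr hγ).ne'
  have e1 := opL_lift e hγ k0 w ha (σ := (√γ)⁻¹) (by field_simp) hφ z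
  have e2 := opL_lift e hγ k0 w ha (σ := -(√γ)⁻¹) (by field_simp) hφ z
  have e3 := opL_lin (eD e γ k0) (up w) (-1) (f := fun z => φ (ellL (√γ)⁻¹ (e k0) z)) (g := fun z => φ (ellL (-(√γ)⁻¹) (e k0) z))
    (fun z _ => (hφ.1.comp (ellL (√γ)⁻¹ (e k0)).contDiff).contDiffAt)
    (fun z _ => (hφ.1.comp (ellL (-(√γ)⁻¹) (e k0)).contDiff).contDiffAt) hz
  rw [e1, e2] at e3
  have : Wd (√γ)⁻¹ (e k0) φ = fun z => φ (ellL (√γ)⁻¹ (e k0) z) + -1 * φ (ellL (-(√γ)⁻¹) (e k0) z) := by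
    ext z; unfold Wd; ring
  rw [this, e3]; ring

lemma WP.quad_bd {q : ℝ} (hpq : p.HolderConjugate q) (P : WP p c θ a k l s η κ) (hγ : 0 < γ) {w : Pt N}
    (hw : w.2 = c * γ) {k0 : ι} (ha : (e k0).2 = 0) (hg : ∑ k, (e k).2 ^ 2 = γ) :
    ∃ C, 0 ≤ C ∧ ∀ φ : Pt N → ℝ, TF φ →
    ∫⁻ z in Quad N, ENNReal.ofReal (|Wd (√γ)⁻¹ (e k0) φ z| ^ p * (psl p a c k l s κ γ (z.1 0) z.2 * Gs a k s η (z.1 0) z.2 ^ (-p))) ≤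
      ENNReal.ofReal C * wl p (p * θ - 1) (opL e w φ) := by
  obtain ⟨C, hC, hb⟩ := P.R_int hγ
  have hp := P.hp
  have hp0 : 0 < p := by linarith
  set D := p ^ p * 2 ^ (p - 1) * 2 ^ p with hD
  have hD0 : 0 ≤ D := by positivity
  refine ⟨2 * (D * (C + C)), by positivity, fun φ hφ => ?_⟩
  have lim := P.limit (e' := eD e γ k0) hpq hγ (w := up w) (by simp [up]) hw (gram_h e hγ k0) (gram_y e k0 ha hg)
    (gram_hy e k0) (σ := (√γ)⁻¹) ha hφ
  rw [lintC (by norm_num)] at lim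
  set X := ∫⁻ z in Quad N, ENNReal.ofReal (|Wd (√γ)⁻¹ (e k0) φ z| ^ p * (psl p a c k l s κ γ (z.1 0) z.2 * Gs a k s η (z.1 0) z.2 ^ (-p))) with hX
  set J : Pt N → ENNReal := fun ζ => ENNReal.ofReal (|opL e w φ ζ| ^ p) with hJ
  have hJm : Measurable J := ((opL_meas e hφ).abs.pow_const _).ennreal_ofReal
  set F : ℝ → ℝ → ENNReal := fun h y => ENNReal.ofReal (mS a c (-l) h y ^ p * psl p a c k l s κ γ h y ^ (1 - p)) with hF
  have hFm : Measurable (Function.uncurry F) :=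
    (((mS_meas a c (-l)).pow_const p).mul ((psl_meas (p := p) (a := a) (c := c) (k := k) (l := l) (s := s) (κ := κ) (γ := γ)).pow_const (1 - p))).ennreal_ofReal
  have one : ∀ τ : ℝ, ∫⁻ z in Quad N, J (ellL τ (e k0) z) * F (z.1 0) z.2 ≤ ENNReal.ofReal C * wl p (p * θ - 1) (opL e w φ) := by
    intro τ
    rw [shift_quad τ ha hJm hFm, wl, ← lintC hC]
    refine setLIntegral_mono' Half_meas fun ζ hζ => ?_
    have hζ' : 0 < ζ.2 := hζ
    refine (mul_le_mul_right (hb ζ.2 hζ) _).trans (le_of_eq ?_)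
    rw [hJ, ← ENNReal.ofReal_mul (by positivity)]
    congr 1; ring
  have rhs : ∫⁻ z in Quad N, ENNReal.ofReal (p ^ p * 2 ^ (p - 1) * (mS a c (-l) (z.1 0) z.2 ^ p * psl p a c k l s κ γ (z.1 0) z.2 ^ (1 - p) *
        |opL (eD e γ k0) (up w) (Wd (√γ)⁻¹ (e k0) φ) z| ^ p)) ≤
      ENNReal.ofReal D * (ENNReal.ofReal C * wl p (p * θ - 1) (opL e w φ) + ENNReal.ofReal C * wl p (p * θ - 1) (opL e w φ)) := by
    calc _ ≤ ∫⁻ z in Quad N, ENNReal.ofReal D * (J (ellL (√γ)⁻¹ (e k0) z) * F (z.1 0) z.2 + J (ellL (-(√γ)⁻¹) (e k0) z) * F (z.1 0) z.2) := by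
          refine setLIntegral_mono' Quad_meas fun z hz => ?_
          have hh0 := hz.1
          have hy0 := hz.2
          have p1 := psl_pos P hγ hh0 hy0
          have p2 := mS_pos a c (-l) hh0 hy0
          simp only [hJ, hF]
          rw [← ENNReal.ofReal_mul (by positivity), ← ENNReal.ofReal_mul (by positivity), ← ENNReal.ofReal_add (by positivity) (by positivity),
            ← ENNReal.ofReal_mul hD0]
          apply ENNReal.ofReal_le_ofReal
          rw [opL_Wd e hγ ha hφ hz]
          set A := opL e w φ (ellL (√γ)⁻¹ (e k0) z)
          set B := opL e w φ (ellL (-(√γ)⁻¹) (e k0) z)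
          have t : |A - B| ^ p ≤ 2 ^ p * (|A| ^ p + |B| ^ p) :=
            (Real.rpow_le_rpow (abs_nonneg _) (abs_sub A B) hp0.le).trans (two_rpow_bound hp0 (abs_nonneg _) (abs_nonneg _))
          calc _ ≤ p ^ p * 2 ^ (p - 1) * (mS a c (-l) (z.1 0) z.2 ^ p * psl p a c k l s κ γ (z.1 0) z.2 ^ (1 - p) *
                (2 ^ p * (|A| ^ p + |B| ^ p))) := by gcongr
            _ = _ := by rw [hD]; ring
      _ = ENNReal.ofReal D * ((∫⁻ z in Quad N, J (ellL (√γ)⁻¹ (e k0) z) * F (z.1 0) z.2) + ∫⁻ z in Quad N, J (ellL (-(√γ)⁻¹) (e k0) z) * F (z.1 0) z.2) := by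
          have hm1 : Measurable fun z : Pt (N + 1) => J (ellL (√γ)⁻¹ (e k0) z) * F (z.1 0) z.2 :=
            (hJm.comp (ellL (√γ)⁻¹ (e k0)).continuous.measurable).mul (meas_hy hFm)
          rw [lintegral_const_mul' _ _ ENNReal.ofReal_ne_top, lintegral_add_left hm1]
      _ ≤ _ := by gcongr <;> exact one _
  have fin := lim.trans rhs
  clear_value D
  calc X = ENNReal.ofReal 2 * (ENNReal.ofReal (1 / 2) * X) := by
        rw [← mul_assoc, ← ENNReal.ofReal_mul (by norm_num)]; norm_num
    _ ≤ _ := mul_le_mul_right fin _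
    _ = _ := by
        rw [← add_mul, ← ENNReal.ofReal_add hC hC, ENNReal.ofReal_mul (by norm_num), ENNReal.ofReal_mul hD0]; ring

end qb
end dev22

section dev23
section tay
variable {N : ℕ} {a : Pt N} {φ : Pt N → ℝ} {p q σ : ℝ}

lemma ell_hasD {g : Pt N → ℝ} (hg : TF g) (z : Pt (N + 1)) (t : ℝ) :
    HasDerivAt (fun t => g (ellL t a z)) (z.1 0 * pd a g (ellL t a z)) t := by
  have h1 : HasDerivAt (fun t : ℝ => ellL t a z) (z.1 0 • a) t := by
    have : (fun t : ℝ => ellL t a z) = fun t => ((fun i => z.1 i.succ, z.2) : Pt N) + (t * z.1 0) • a := by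
      ext t : 1; rw [ellL_apply]
    rw [this]
    have h2 := (((hasDerivAt_id t).mul_const (z.1 0)).smul_const a).const_add ((fun i => z.1 i.succ, z.2) : Pt N)
    simpa using h2
  have h3 := (hg.diff (ellL t a z)).hasFDerivAt.comp_hasDerivAt t h1
  refine h3.congr_deriv ?_
  unfold pd
  rw [map_smul, smul_eq_mul]

lemma ell_cont : Continuous fun x : Pt (N + 1) × ℝ => ellL x.2 a x.1 := by
  simp_rw [ellL_apply]
  fun_prop

lemma ell_cont_t (z : Pt (N + 1)) : Continuous fun t : ℝ => ellL t a z :=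
  ell_cont.comp (by fun_prop : Continuous fun t : ℝ => (z, t))

lemma taylor (hσ : 0 < σ) (hφ : TF φ) {z : Pt (N + 1)} (hz : 0 < z.1 0) :
    |pd a φ (ellL 0 a z)| ≤ |Wd σ a φ z| * (2 * σ * z.1 0)⁻¹ +
      z.1 0 * ∫ t in Set.Ioc (-σ) σ, |pd a (pd a φ) (ellL t a z)| := by
  obtain ⟨t, ht, hteq⟩ := exists_hasDerivAt_eq_slope (fun t => φ (ellL t a z)) (fun t => z.1 0 * pd a φ (ellL t a z))
    (by linarith : -σ < σ) (fun t _ => (ell_hasD hφ z t).continuousAt.continuousWithinAt) (fun t _ => ell_hasD hφ z t)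
  have e1 : pd a φ (ellL t a z) = Wd σ a φ z * (2 * σ * z.1 0)⁻¹ := by
    unfold Wd
    have : σ - -σ = 2 * σ := by ring
    rw [this, eq_div_iff (by positivity)] at hteq
    rw [← hteq]; field_simp
  have cc : Continuous fun t => pd a (pd a φ) (ellL t a z) := ((hφ.pd a).pd a).cont.comp (ell_cont_t z)
  have ftc := intervalIntegral.integral_eq_sub_of_hasDerivAt (a := 0) (b := t) (fun s _ => ell_hasD (hφ.pd a) (a := a) z s)
    ((continuous_const.mul cc).intervalIntegrable _ _)
  have e2 : |∫ s in (0:ℝ)..t, z.1 0 * pd a (pd a φ) (ellL s a z)| ≤ z.1 0 * ∫ t in Set.Ioc (-σ) σ, |pd a (pd a φ) (ellL t a z)| := by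
    have h1 := intervalIntegral.norm_integral_le_integral_norm_uIoc (f := fun s => z.1 0 * pd a (pd a φ) (ellL s a z)) (a := 0) (b := t) (μ := volume)
    rw [Real.norm_eq_abs] at h1
    refine h1.trans ?_
    have h2 : ∀ s, ‖z.1 0 * pd a (pd a φ) (ellL s a z)‖ = z.1 0 * |pd a (pd a φ) (ellL s a z)| := fun s => by
      rw [Real.norm_eq_abs, abs_mul, abs_of_pos hz]
    simp_rw [h2]
    rw [integral_const_mul]
    refine mul_le_mul_of_nonneg_left ?_ hz.le
    refine setIntegral_mono_set ?_ (Filter.Eventually.of_forall fun s => abs_nonneg _) ?_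
    · exact (cc.abs.integrableOn_Icc (a := -σ) (b := σ)).mono_set Set.Ioc_subset_Icc_self
    · refine HasSubset.Subset.eventuallyLE ?_
      intro s hs
      rw [Set.uIoc, Set.mem_Ioc] at hs
      refine ⟨lt_of_le_of_lt ?_ hs.1, hs.2.trans ?_⟩
      · exact le_min (by linarith) ht.1.le
      · exact max_le hσ.le ht.2.le
  have e3 : |pd a φ (ellL 0 a z)| ≤ |pd a φ (ellL t a z)| + |∫ s in (0:ℝ)..t, z.1 0 * pd a (pd a φ) (ellL s a z)| := by
    rw [ftc]
    have := abs_sub (pd a φ (ellL t a z)) (pd a φ (ellL t a z) - pd a φ (ellL 0 a z))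
    rwa [sub_sub_cancel] at this
  rw [e1, abs_mul, abs_of_pos (by positivity : 0 < (2 * σ * z.1 0)⁻¹)] at e3
  linarith

lemma jensen (hpq : p.HolderConjugate q) (hσ : 0 < σ) {g : ℝ → ℝ} (hg : Continuous g) :
    ENNReal.ofReal ((∫ t in Set.Ioc (-σ) σ, |g t|) ^ p) ≤
      ENNReal.ofReal ((2 * σ) ^ (p - 1)) * ∫⁻ t in Set.Ioc (-σ) σ, ENNReal.ofReal (|g t| ^ p) := by
  have hp := hpq.lt
  have hp0 := hpq.pos
  have n0 : 0 ≤ ∫ t in Set.Ioc (-σ) σ, |g t| := integral_nonneg fun t => abs_nonneg _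
  rw [← ENNReal.ofReal_rpow_of_nonneg n0 hp0.le, ofReal_integral_eq_lintegral_ofReal
    ((hg.abs.integrableOn_Icc (a := -σ) (b := σ)).mono_set Set.Ioc_subset_Icc_self) (Filter.Eventually.of_forall fun s => abs_nonneg _)]
  have H := ENNReal.lintegral_mul_le_Lp_mul_Lq (volume.restrict (Set.Ioc (-σ) σ)) hpq
    (f := fun t => ENNReal.ofReal |g t|) (g := fun _ => 1) hg.abs.measurable.ennreal_ofReal.aemeasurable aemeasurable_const
  simp only [Pi.mul_apply, mul_one, ENNReal.one_rpow, lintegral_one, Measure.restrict_apply_univ, Real.volume_Ioc] at H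
  have h1 : σ - -σ = 2 * σ := by ring
  rw [h1] at H
  have H2 := ENNReal.rpow_le_rpow H hp0.le
  refine H2.trans (le_of_eq ?_)
  rw [ENNReal.mul_rpow_of_nonneg _ _ hp0.le, ← ENNReal.rpow_mul, ← ENNReal.rpow_mul, one_div_mul_cancel hp0.ne', ENNReal.rpow_one, mul_comm]
  congr 1
  · rw [ENNReal.ofReal_rpow_of_pos (by positivity)]
    congr 2
    have := hpq.sub_one_mul_conj
    field_simp
    rw [div_eq_iff hpq.symm.pos.ne']
    linarith
  · refine lintegral_congr fun t => ?_
    rw [ENNReal.ofReal_rpow_of_nonneg (abs_nonneg _) hp0.le]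

lemma wl_fin {g : Pt N → ℝ} (hp : 0 < p) (hg : TF g) {r : ℝ} (hr : -1 < r) :
    ∫⁻ z in Half N, ENNReal.ofReal (|g z| ^ p * z.2 ^ r) ≠ ⊤ := by
  obtain ⟨B, hB0, hB⟩ := hg.bdd
  have hK : IsCompact (tsupport g) := hg.2
  obtain ⟨Y0, hY0⟩ := hK.isBounded.exists_norm_le
  set S : Set (Fin N → ℝ) := Set.image Prod.fst (tsupport g) with hS
  have hSc : IsCompact S := hK.image continuous_fst
  have hSm : MeasurableSet S := hSc.isClosed.measurableSet
  set Y := max Y0 1 with hY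
  have hY1 : 0 < Y := by positivity
  have m1 : Measurable fun y : ℝ => ENNReal.ofReal (y ^ r) := by fun_prop
  rw [← lintegral_indicator Half_meas]
  refine ne_top_of_le_ne_top ?_ (calc
    _ ≤ ∫⁻ ζ : Pt N, S.indicator (fun _ => ENNReal.ofReal (B ^ p)) ζ.1 * (Set.Ioc 0 Y).indicator (fun y => ENNReal.ofReal (y ^ r)) ζ.2 := by
      refine lintegral_mono fun ζ => ?_
      by_cases hz : ζ ∈ Half N
      · have hz2 : 0 < ζ.2 := hz
        rw [Set.indicator_of_mem hz]
        by_cases hk : ζ ∈ tsupport g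
        · have y1 : ζ.2 ∈ Set.Ioc 0 Y := by
            refine ⟨hz, ?_⟩
            have := (norm_snd_le ζ).trans (hY0 ζ hk)
            exact (le_abs_self _).trans (this.trans (le_max_left _ _))
          rw [Set.indicator_of_mem (show ζ.1 ∈ S from ⟨ζ, hk, rfl⟩), Set.indicator_of_mem y1, ← ENNReal.ofReal_mul (by positivity)]
          apply ENNReal.ofReal_le_ofReal
          gcongr
          exact hB ζ
        · rw [image_eq_zero_of_notMem_tsupport hk, abs_zero, Real.zero_rpow hp.ne', zero_mul, ENNReal.ofReal_zero]; exact zero_le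
      · rw [Set.indicator_of_notMem hz]; exact zero_le
    _ = (∫⁻ x, S.indicator (fun _ => ENNReal.ofReal (B ^ p)) x) * ∫⁻ y, (Set.Ioc 0 Y).indicator (fun y => ENNReal.ofReal (y ^ r)) y :=
      lintegral_prod_mul (measurable_const.indicator hSm).aemeasurable (m1.indicator measurableSet_Ioc).aemeasurable)
  rw [lintegral_indicator hSm, lintegral_indicator measurableSet_Ioc, setLIntegral_const]
  exact ENNReal.mul_ne_top (ENNReal.mul_ne_top ENNReal.ofReal_ne_top hSc.measure_lt_top.ne) (rpow_fin hr hY1)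

end tay
end dev23

section dev24
section th1
variable {N : ℕ} {ι : Type} [Fintype ι] (e : ι → Pt N)
variable {p c θ a k l s η κ γ : ℝ}

/-- averaging weight on `εy < h ≤ 2εy` -/
def fw (ε r h y : ℝ) : ℝ := (Set.Ioc (ε * y) (2 * (ε * y))).indicator (fun _ => y ^ r * (ε * y)⁻¹) h

lemma fw_meas (ε r : ℝ) : Measurable (Function.uncurry (fw ε r)) := by
  have hS : MeasurableSet {x : ℝ × ℝ | ε * x.2 < x.1 ∧ x.1 ≤ 2 * (ε * x.2)} := by
    have a1 : MeasurableSet {x : ℝ × ℝ | ε * x.2 < x.1} := measurableSet_lt (by fun_prop) (by fun_prop)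
    have a2 : MeasurableSet {x : ℝ × ℝ | x.1 ≤ 2 * (ε * x.2)} := measurableSet_le (by fun_prop) (by fun_prop)
    exact a1.inter a2
  have hm : Measurable fun x : ℝ × ℝ => x.2 ^ r * (ε * x.2)⁻¹ := by fun_prop
  have : Function.uncurry (fw ε r) = {x : ℝ × ℝ | ε * x.2 < x.1 ∧ x.1 ≤ 2 * (ε * x.2)}.indicator fun x => x.2 ^ r * (ε * x.2)⁻¹ := by
    ext ⟨h, y⟩
    by_cases hx : ε * y < h ∧ h ≤ 2 * (ε * y)
    · rw [Set.indicator_of_mem (show ((h, y) : ℝ × ℝ) ∈ _ from hx)]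
      simp only [Function.uncurry, fw]
      rw [Set.indicator_of_mem (show h ∈ _ from hx)]
    · rw [Set.indicator_of_notMem (show ((h, y) : ℝ × ℝ) ∉ _ from hx)]
      simp only [Function.uncurry, fw]
      rw [Set.indicator_of_notMem (show h ∉ _ from hx)]
  rw [this]; exact hm.indicator hS

lemma fw_nonneg {ε y : ℝ} (hε : 0 < ε) (hy : 0 < y) (r h : ℝ) : 0 ≤ fw ε r h y :=
  Set.indicator_nonneg (fun _ _ => by positivity) _

lemma fw_int {ε y : ℝ} (hε : 0 < ε) (hy : 0 < y) (r : ℝ) : ∫⁻ h in Set.Ioi 0, ENNReal.ofReal (fw ε r h y) = ENNReal.ofReal (y ^ r) := by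
  have h1 : ∀ h, ENNReal.ofReal (fw ε r h y) = (Set.Ioc (ε * y) (2 * (ε * y))).indicator (fun _ => ENNReal.ofReal (y ^ r * (ε * y)⁻¹)) h := by
    intro h
    unfold fw
    by_cases hx : h ∈ Set.Ioc (ε * y) (2 * (ε * y))
    · rw [Set.indicator_of_mem hx, Set.indicator_of_mem hx]
    · rw [Set.indicator_of_notMem hx, Set.indicator_of_notMem hx, ENNReal.ofReal_zero]
  simp_rw [h1]
  have hey : 0 < ε * y := by positivity
  rw [setLIntegral_indicator measurableSet_Ioc, Set.inter_eq_left.mpr (show Set.Ioc (ε * y) (2 * (ε * y)) ⊆ Set.Ioi 0 from fun h hh => lt_trans hey hh.1), setLIntegral_const,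
    Real.volume_Ioc, ← ENNReal.ofReal_mul (by positivity)]
  congr 1
  field_simp; ring

/-- the weight is dominated by the good term -/
lemma WP.fw_S (P : WP p c θ a k l s η κ) (hγ : 0 < γ) {ε : ℝ} (hε : 0 < ε) (hε2 : ε ≤ 1 / 2) : ∃ K, 0 ≤ K ∧ ∀ h y, 0 < h → 0 < y →
    h⁻¹ ^ p * fw ε (p * θ - 1 - p) h y ≤ K * (psl p a c k l s κ γ h y * Gs a k s η h y ^ (-p)) := by
  obtain ⟨C, hC, hb⟩ := P.S_bd hγ
  have hp := P.hp
  set r := a * (2 - p) - 2 with hr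
  set m0 := min (ε ^ r) ((2 * ε) ^ r) with hm0
  have hm0p : 0 < m0 := lt_min (by positivity) (by positivity)
  refine ⟨ε⁻¹ ^ p * ε⁻¹ * (C * m0)⁻¹, by positivity, fun h y hh hy => ?_⟩
  have p1 := psl_pos P hγ hh hy
  have p2 := P.G_pos hh hy
  by_cases hx : h ∈ Set.Ioc (ε * y) (2 * (ε * y))
  · have hle : h ≤ y := hx.2.trans (by nlinarith)
    have b1 := hb h y hh hy hle
    unfold fw
    rw [Set.indicator_of_mem hx]
    have b2 : m0 * y ^ r ≤ h ^ r := by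
      rcases le_total 0 r with h0 | h0
      · calc m0 * y ^ r ≤ ε ^ r * y ^ r := by gcongr; exact min_le_left _ _
          _ = (ε * y) ^ r := (Real.mul_rpow hε.le hy.le).symm
          _ ≤ _ := Real.rpow_le_rpow (by positivity) hx.1.le h0
      · calc m0 * y ^ r ≤ (2 * ε) ^ r * y ^ r := by gcongr; exact min_le_right _ _
          _ = (2 * (ε * y)) ^ r := by rw [← Real.mul_rpow (by positivity) hy.le, mul_assoc]
          _ ≤ _ := Real.rpow_le_rpow_of_nonpos hh hx.2 h0
    have b3 : h⁻¹ ^ p ≤ ε⁻¹ ^ p * y ^ (-p) := by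
      rw [Real.rpow_neg hy.le, ← Real.inv_rpow hy.le, ← Real.mul_rpow (by positivity) (by positivity), ← mul_inv]
      exact Real.rpow_le_rpow (by positivity) (inv_anti₀ (by positivity) hx.1.le) (by linarith)
    calc h⁻¹ ^ p * (y ^ (p * θ - 1 - p) * (ε * y)⁻¹) ≤ (ε⁻¹ ^ p * y ^ (-p)) * (y ^ (p * θ - 1 - p) * (ε * y)⁻¹) := by gcongr
      _ = ε⁻¹ ^ p * ε⁻¹ * (y ^ (-p) * y ^ (p * θ - 1 - p) * y ^ (-1 : ℝ)) := by rw [Real.rpow_neg_one, mul_inv]; ring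
      _ = ε⁻¹ ^ p * ε⁻¹ * (y ^ r * y ^ (c - l + (p - 1) * k)) := by
          rw [← Real.rpow_add hy, ← Real.rpow_add hy, ← Real.rpow_add hy]
          congr 2
          have := P.deg
          rw [hr]; linarith
      _ = ε⁻¹ ^ p * ε⁻¹ * (C * m0)⁻¹ * (C * (m0 * y ^ r * y ^ (c - l + (p - 1) * k))) := by field_simp
      _ ≤ ε⁻¹ ^ p * ε⁻¹ * (C * m0)⁻¹ * (C * (h ^ r * y ^ (c - l + (p - 1) * k))) := by gcongr
      _ ≤ _ := by gcongr
  · unfold fw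
    rw [Set.indicator_of_notMem hx, mul_zero]; positivity

lemma thm1_pre {q : ℝ} (hpq : p.HolderConjugate q) (P : WP p c θ a k l s η κ) (hγ : 0 < γ) {w : Pt N}
    (hw : w.2 = c * γ) {k0 : ι} (ha : (e k0).2 = 0) (hg : ∑ k, (e k).2 ^ 2 = γ) :
    ∃ C0, 0 ≤ C0 ∧ ∀ ε, 0 < ε → ε ≤ 1 / 2 → ∃ K, 0 ≤ K ∧ ∀ φ : Pt N → ℝ, TF φ →
      wl p (p * θ - 1) (fun z => z.2⁻¹ * pd (e k0) φ z) ≤ ENNReal.ofReal K * wl p (p * θ - 1) (opL e w φ) +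
        ENNReal.ofReal (C0 * ε ^ p) * wl p (p * θ - 1) (pd (e k0) (pd (e k0) φ)) := by
  obtain ⟨C, hC, hQ⟩ := P.quad_bd e hpq hγ hw ha hg
  have hp := P.hp
  have hp0 : 0 < p := by linarith
  set σ := (√γ)⁻¹ with hσd
  have hσ : 0 < σ := inv_pos.mpr (Real.sqrt_pos.mpr hγ)
  refine ⟨2 ^ p * (2 * σ) ^ (p - 1) * 2 ^ p * (2 * σ), by positivity, fun ε hε hε2 => ?_⟩
  obtain ⟨K, hK, hKb⟩ := P.fw_S hγ hε hε2
  set K1 := 2 ^ p * ((2 * σ)⁻¹ ^ p * K) with hK1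
  have hK10 : 0 ≤ K1 := by positivity
  refine ⟨K1 * C, by positivity, fun φ hφ => ?_⟩
  set r := p * θ - 1 - p with hr
  set a0 := e k0 with ha0
  set J1 : Pt N → ENNReal := fun ζ => ENNReal.ofReal (|pd a0 φ ζ| ^ p) with hJ1
  set J2 : Pt N → ENNReal := fun ζ => ENNReal.ofReal (|pd a0 (pd a0 φ) ζ| ^ p) with hJ2
  have hJ1m : Measurable J1 := ((hφ.pd a0).cont.measurable.abs.pow_const _).ennreal_ofReal
  have hJ2m : Measurable J2 := (((hφ.pd a0).pd a0).cont.measurable.abs.pow_const _).ennreal_ofReal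
  set F1 : ℝ → ℝ → ENNReal := fun h y => ENNReal.ofReal (fw ε r h y) with hF1
  set D2 := 2 ^ p * (2 * σ) ^ (p - 1) * (2 * ε) ^ p with hD2
  have hD20 : 0 ≤ D2 := by positivity
  set F2 : ℝ → ℝ → ENNReal := fun h y => ENNReal.ofReal (D2 * y ^ p) * ENNReal.ofReal (fw ε r h y) with hF2
  have hF1m : Measurable (Function.uncurry F1) := (fw_meas ε r).ennreal_ofReal
  have hF2m : Measurable (Function.uncurry F2) := by
    have : Measurable fun x : ℝ × ℝ => ENNReal.ofReal (D2 * x.2 ^ p) := by fun_prop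
    exact this.mul (fw_meas ε r).ennreal_ofReal
  have lhs : wl p (p * θ - 1) (fun z => z.2⁻¹ * pd a0 φ z) = ∫⁻ z in Quad N, J1 (ellL 0 a0 z) * F1 (z.1 0) z.2 := by
    rw [shift_quad 0 ha hJ1m hF1m, wl]
    refine setLIntegral_congr_fun Half_meas fun ζ hζ => ?_
    have hζ' : 0 < ζ.2 := hζ
    simp only [hF1, hJ1]
    rw [fw_int hε hζ', ← ENNReal.ofReal_mul (by positivity)]
    congr 1
    rw [abs_mul, abs_of_pos (inv_pos.mpr hζ'), Real.mul_rpow (by positivity) (by positivity), hr, Real.rpow_sub hζ' (p * θ - 1) p,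
      Real.inv_rpow hζ'.le]
    field_simp
  have ptw : ∀ z ∈ Quad N, J1 (ellL 0 a0 z) * F1 (z.1 0) z.2 ≤
      ENNReal.ofReal (K1 * (|Wd σ a0 φ z| ^ p * (psl p a c k l s κ γ (z.1 0) z.2 * Gs a k s η (z.1 0) z.2 ^ (-p)))) +
        ∫⁻ t in Set.Ioc (-σ) σ, J2 (ellL t a0 z) * F2 (z.1 0) z.2 := by
    intro z hz
    have hh := hz.1
    have hy := hz.2
    set h := z.1 0 with hhd
    set y := z.2 with hyd
    have T := taylor (a := a0) hσ hφ hh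
    rw [← hhd] at T
    set I := ∫ t in Set.Ioc (-σ) σ, |pd a0 (pd a0 φ) (ellL t a0 z)| with hI
    have hI0 : 0 ≤ I := integral_nonneg fun t => abs_nonneg _
    have Je := jensen hpq hσ (g := fun t => pd a0 (pd a0 φ) (ellL t a0 z)) (((hφ.pd a0).pd a0).cont.comp (ell_cont_t z))
    have T2 : |pd a0 φ (ellL 0 a0 z)| ^ p ≤ 2 ^ p * ((2 * σ)⁻¹ ^ p * h⁻¹ ^ p * |Wd σ a0 φ z| ^ p + h ^ p * I ^ p) := by
      refine (Real.rpow_le_rpow (abs_nonneg _) T hp0.le).trans ((two_rpow_bound hp0 (by positivity) (by positivity)).trans (le_of_eq ?_))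
      rw [Real.mul_rpow (abs_nonneg _) (by positivity), Real.mul_rpow hh.le hI0, mul_inv, Real.mul_rpow (by positivity) (by positivity)]
      ring
    have f0 := fw_nonneg hε hy r h
    have hf : h ^ p * fw ε r h y ≤ (2 * ε) ^ p * y ^ p * fw ε r h y := by
      by_cases hx : h ∈ Set.Ioc (ε * y) (2 * (ε * y))
      · gcongr
        rw [← Real.mul_rpow (by positivity) hy.le]
        exact Real.rpow_le_rpow hh.le (by linarith [hx.2]) hp0.le
      · unfold fw
        rw [Set.indicator_of_notMem hx]; simp
    have t1 : |pd a0 φ (ellL 0 a0 z)| ^ p * fw ε r h y ≤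
        K1 * (|Wd σ a0 φ z| ^ p * (psl p a c k l s κ γ h y * Gs a k s η h y ^ (-p))) +
          (2 ^ p * (2 * ε) ^ p) * y ^ p * fw ε r h y * I ^ p := by
      calc _ ≤ 2 ^ p * ((2 * σ)⁻¹ ^ p * h⁻¹ ^ p * |Wd σ a0 φ z| ^ p + h ^ p * I ^ p) * fw ε r h y := by gcongr
        _ = 2 ^ p * (2 * σ)⁻¹ ^ p * |Wd σ a0 φ z| ^ p * (h⁻¹ ^ p * fw ε r h y) + 2 ^ p * I ^ p * (h ^ p * fw ε r h y) := by ring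
        _ ≤ 2 ^ p * (2 * σ)⁻¹ ^ p * |Wd σ a0 φ z| ^ p * (K * (psl p a c k l s κ γ h y * Gs a k s η h y ^ (-p))) +
            2 ^ p * I ^ p * ((2 * ε) ^ p * y ^ p * fw ε r h y) := by
              exact add_le_add (mul_le_mul_of_nonneg_left (hKb h y hh hy) (by positivity)) (mul_le_mul_of_nonneg_left hf (by positivity))
        _ = _ := by rw [hK1]; ring
    have p1 := psl_pos P hγ hh hy
    have p2 := P.G_pos hh hy
    simp only [hJ1, hF1]
    rw [← ENNReal.ofReal_mul (by positivity)]
    refine (ENNReal.ofReal_le_ofReal t1).trans ?_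
    rw [ENNReal.ofReal_add (by positivity) (by positivity)]
    refine add_le_add le_rfl ?_
    rw [lintegral_mul_const _ (show Measurable fun t : ℝ => J2 (ellL t a0 z) from hJ2m.comp (ell_cont_t z).measurable), ENNReal.ofReal_mul (by positivity)]
    refine (mul_le_mul_right Je _).trans (le_of_eq ?_)
    simp only [hF2, hJ2]
    rw [← mul_assoc, ← ENNReal.ofReal_mul (by positivity), mul_comm, ← ENNReal.ofReal_mul (by positivity)]
    congr 2
    rw [hD2]; ring
  have rhs2 : ∫⁻ z in Quad N, ∫⁻ t in Set.Ioc (-σ) σ, J2 (ellL t a0 z) * F2 (z.1 0) z.2 =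
      ENNReal.ofReal (D2 * (2 * σ)) * wl p (p * θ - 1) (pd a0 (pd a0 φ)) := by
    rw [lintegral_lintegral_swap]
    · have : ∀ t : ℝ, ∫⁻ z in Quad N, J2 (ellL t a0 z) * F2 (z.1 0) z.2 = ENNReal.ofReal D2 * wl p (p * θ - 1) (pd a0 (pd a0 φ)) := by
        intro t
        rw [shift_quad t ha hJ2m hF2m, wl, ← lintC hD20]
        refine setLIntegral_congr_fun Half_meas fun ζ hζ => ?_
        have hζ' : 0 < ζ.2 := hζ
        simp only [hF2, hJ2]
        rw [lintegral_const_mul' _ _ ENNReal.ofReal_ne_top, fw_int hε hζ', ← ENNReal.ofReal_mul (by positivity), ← ENNReal.ofReal_mul (by positivity)]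
        congr 1
        rw [hr, Real.rpow_sub hζ' (p * θ - 1) p]
        field_simp
      simp_rw [this]
      rw [setLIntegral_const, Real.volume_Ioc, ENNReal.ofReal_mul hD20, show σ - -σ = 2 * σ by ring]; ring
    · refine Measurable.aemeasurable ?_
      exact (hJ2m.comp ell_cont.measurable).mul ((meas_hy hF2m).comp measurable_fst)
  rw [lhs]
  refine (setLIntegral_mono' Quad_meas ptw).trans ?_
  have hm1 : Measurable fun z : Pt (N + 1) => ENNReal.ofReal (K1 * (|Wd σ a0 φ z| ^ p * (psl p a c k l s κ γ (z.1 0) z.2 * Gs a k s η (z.1 0) z.2 ^ (-p)))) := by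
    have h1 := meas_hy (N := N) (psl_meas (p := p) (a := a) (c := c) (k := k) (l := l) (s := s) (κ := κ) (γ := γ))
    have h2 := meas_hy (N := N) (Gs_meas (a := a) (k := k) (s := s) (η := η))
    exact (measurable_const.mul (((Wd_smooth hφ).continuous.measurable.abs.pow_const _).mul (h1.mul (h2.pow_const _)))).ennreal_ofReal
  rw [lintegral_add_left hm1, lintC hK10, rhs2]
  refine add_le_add ?_ (le_of_eq ?_)
  · rw [ENNReal.ofReal_mul hK10, mul_assoc]
    exact mul_le_mul_right (hQ φ hφ) _
  · congr 2
    rw [hD2, Real.mul_rpow (by norm_num : (0:ℝ) ≤ 2) hε.le]; ring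

lemma thm1 {q : ℝ} (hpq : p.HolderConjugate q) (hc : 1 ≤ c) (h1 : 1 < θ) (h2 : θ < c + 1) (hγ : 0 < γ) {w : Pt N} {ω : ι → ℝ}
    (hwe : w = ∑ j, ω j • e j) (hw : w.2 = c * γ) {k0 : ι} (ha : (e k0).2 = 0) (hg : ∑ k, (e k).2 ^ 2 = γ) :
    ∃ C, 0 ≤ C ∧ ∀ φ : Pt N → ℝ, TF φ →
      wl p (p * θ - 1) (fun z => z.2⁻¹ * pd (e k0) φ z) ≤ ENNReal.ofReal C * wl p (p * θ - 1) (opL e w φ) := by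
  classical
  obtain ⟨a, k, l, s, η, κ, P⟩ := WP_exists hpq.lt hc h1 h2
  have hp0 := hpq.pos
  obtain ⟨C0, hC0, H0⟩ := thm1_pre e hpq P hγ hw ha hg
  obtain ⟨C2, hC2, H2⟩ := thm2 e (p * θ - 1) hpq (a := e k0) (α := Pi.single k0 1) (by simp [Pi.single_apply]) hwe ha
  set t := (2 * (C0 * C2) + 1)⁻¹ with ht
  have ht0 : 0 < t := by positivity
  set ε := min (1 / 2) (t ^ p⁻¹) with hε
  have hε0 : 0 < ε := lt_min (by norm_num) (by positivity)
  have hεp : ε ^ p ≤ t := by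
    calc ε ^ p ≤ (t ^ p⁻¹) ^ p := Real.rpow_le_rpow hε0.le (min_le_right _ _) hp0.le
      _ = t := Real.rpow_inv_rpow ht0.le hp0.ne'
  obtain ⟨K, hK, H⟩ := H0 ε hε0 (min_le_left _ _)
  have small : C0 * ε ^ p * C2 ≤ 1 / 2 := by
    calc C0 * ε ^ p * C2 ≤ C0 * t * C2 := by gcongr
      _ = (C0 * C2) * t := by ring
      _ ≤ 1 / 2 := by
        have : 0 ≤ C0 * C2 := by positivity
        rw [ht, ← div_eq_mul_inv, div_le_iff₀ (by positivity)]; linarith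
  refine ⟨2 * K + 1, by positivity, fun φ hφ => ?_⟩
  have A := H φ hφ
  have B := H2 φ hφ k0
  set X := wl p (p * θ - 1) (fun z => z.2⁻¹ * pd (e k0) φ z) with hX
  set F := wl p (p * θ - 1) (opL e w φ) with hF
  have hXt : X ≠ ⊤ := by
    have := wl_fin (p := p) hp0 (hφ.pd (e k0)) (r := p * θ - 1 - p) (by nlinarith)
    convert this using 1
    rw [hX, wl]
    refine setLIntegral_congr_fun Half_meas fun ζ hζ => ?_
    have hζ' : 0 < ζ.2 := hζ
    congr 1
    rw [abs_mul, abs_of_pos (inv_pos.mpr hζ'), Real.mul_rpow (by positivity) (by positivity), Real.rpow_sub hζ' (p * θ - 1) p,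
      Real.inv_rpow hζ'.le]
    field_simp
  by_cases hFt : F = ⊤
  · rw [hFt, ENNReal.mul_top (by simp; positivity)]; exact le_top
  have E : X ≤ ENNReal.ofReal K * F + ENNReal.ofReal (1 / 2) * (F + X) := by
    refine A.trans (add_le_add le_rfl ?_)
    calc _ ≤ ENNReal.ofReal (C0 * ε ^ p) * (ENNReal.ofReal C2 * (F + X)) := mul_le_mul_right B _
      _ = ENNReal.ofReal (C0 * ε ^ p * C2) * (F + X) := by rw [ENNReal.ofReal_mul (p := C0 * ε ^ p) (by positivity)]; ring
      _ ≤ _ := mul_le_mul_left (ENNReal.ofReal_le_ofReal small) _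
  lift X to NNReal using hXt with x hx
  lift F to NNReal using hFt with f hf
  rw [← ENNReal.ofReal_coe_nnreal, ← ENNReal.ofReal_coe_nnreal (p := f), ← ENNReal.ofReal_add (by positivity) (by positivity),
    ← ENNReal.ofReal_mul (by positivity), ← ENNReal.ofReal_mul (by positivity), ← ENNReal.ofReal_add (by positivity) (by positivity),
    ENNReal.ofReal_le_ofReal_iff (by positivity)] at E
  rw [← ENNReal.ofReal_coe_nnreal, ← ENNReal.ofReal_coe_nnreal (p := f), ← ENNReal.ofReal_mul (by positivity)]
  apply ENNReal.ofReal_le_ofReal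
  linarith

end th1
end dev24

section dev25
section fin1
variable {N : ℕ} {ι : Type} [Fintype ι] (e : ι → Pt N)

lemma posdef_decomp {n : ℕ} {A : Matrix (Fin n) (Fin n) ℝ} (hA : A.PosDef) :
    ∃ lam : ℝ, 0 < lam ∧ ∃ S : Fin n → Fin n → ℝ, ∀ i j, A i j = (if i = j then lam else 0) + ∑ k, S i k * S j k := by
  classical
  have hH := hA.isHermitian
  obtain ⟨lam, hl0, hl⟩ : ∃ lam : ℝ, 0 < lam ∧ ∀ k, lam ≤ hH.eigenvalues k := by
    rcases isEmpty_or_nonempty (Fin n) with h | h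
    · exact ⟨1, one_pos, fun k => (h.false k).elim⟩
    · obtain ⟨k0, hk0⟩ := Finite.exists_min hH.eigenvalues
      exact ⟨_, hA.eigenvalues_pos k0, hk0⟩
  set U : Matrix (Fin n) (Fin n) ℝ := (hH.eigenvectorUnitary : Matrix (Fin n) (Fin n) ℝ) with hU
  have hUU : U * star U = 1 := Unitary.mul_star_self_of_mem hH.eigenvectorUnitary.2
  have hs : A = U * Matrix.diagonal hH.eigenvalues * star U := by
    have := hH.spectral_theorem
    rw [Unitary.conjStarAlgAut_apply] at this
    exact this
  refine ⟨lam, hl0, fun i k => U i k * √(hH.eigenvalues k - lam), fun i j => ?_⟩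
  have h1 : A i j = ∑ k, U i k * hH.eigenvalues k * U j k := by
    conv_lhs => rw [hs]
    rw [Matrix.mul_apply]
    refine Finset.sum_congr rfl fun k _ => ?_
    rw [Matrix.mul_diagonal]; simp [Matrix.star_apply]
  have h2 : (if i = j then (1 : ℝ) else 0) = ∑ k, U i k * U j k := by
    have := congrFun (congrFun hUU i) j
    rw [Matrix.mul_apply, Matrix.one_apply] at this
    rw [← this]; simp [Matrix.star_apply]
  have h3 : (if i = j then lam else 0) = lam * (if i = j then (1 : ℝ) else 0) := by split_ifs <;> simp
  rw [h1, h3, h2, Finset.mul_sum, ← Finset.sum_add_distrib]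
  refine Finset.sum_congr rfl fun k _ => ?_
  have := Real.mul_self_sqrt (sub_nonneg.mpr (hl k))
  linear_combination (-(U i k * U j k)) * this

/-- the family of directions -/
def dirs (lam : ℝ) (S : Fin (N + 1) → Fin (N + 1) → ℝ) : Fin (N + 1) ⊕ Fin (N + 1) → Pt N :=
  Sum.elim (fun j => √lam • bvec j) fun k => ∑ i, S i k • bvec i

lemma bvec_cast (i : Fin N) : bvec i.castSucc = ex i := by simp [bvec]
lemma bvec_last : bvec (Fin.last N) = ey := by simp [bvec]
lemma pt_exp (w : Pt N) : w = ∑ j, (Fin.snoc w.1 w.2 : Fin (N + 1) → ℝ) j • bvec j := by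
  rw [Fin.sum_univ_castSucc]
  simp only [bvec_cast, bvec_last, Fin.snoc_castSucc, Fin.snoc_last]
  ext i
  · simp [ex, ey, Pi.single_apply, Prod.fst_sum]
  · simp [ex, ey, Prod.snd_sum]

lemma pd_exp (w : Pt N) (g : Pt N → ℝ) (z : Pt N) : pd w g z = (∑ i, w.1 i * pd (ex i) g z) + w.2 * pd ey g z := by
  conv_lhs => rw [pt_exp w]
  rw [pd_lin, Fin.sum_univ_castSucc]
  simp only [bvec_cast, bvec_last, Fin.snoc_castSucc, Fin.snoc_last]

lemma dirs_exp {lam : ℝ} (hl : 0 < lam) (S : Fin (N + 1) → Fin (N + 1) → ℝ) (w : Pt N) :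
    ∃ ω : Fin (N + 1) ⊕ Fin (N + 1) → ℝ, w = ∑ j, ω j • dirs lam S j := by
  refine ⟨Sum.elim (fun j => (√lam)⁻¹ * (Fin.snoc w.1 w.2 : Fin (N + 1) → ℝ) j) fun _ => 0, ?_⟩
  have : √lam ≠ 0 := (Real.sqrt_pos.mpr hl).ne'
  rw [Fintype.sum_sum_type]
  simp only [dirs, Sum.elim_inl, Sum.elim_inr, zero_smul, Finset.sum_const_zero, add_zero, smul_smul]
  conv_lhs => rw [pt_exp w]
  refine Finset.sum_congr rfl fun j _ => ?_
  congr 1; field_simp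

lemma pd_pd_lin {κ : Type*} [Fintype κ] {f : κ → Pt N} (α : κ → ℝ) {φ : Pt N → ℝ} (hφ : TF φ) (z : Pt N) :
    pd (∑ i, α i • f i) (pd (∑ i, α i • f i) φ) z = ∑ i, ∑ j, α i * α j * pd (f i) (pd (f j) φ) z := by
  have h0 : pd (∑ i, α i • f i) φ = fun z => ∑ j, α j * pd (f j) φ z := by
    ext z; unfold pd; rw [map_sum]; simp
  have h1 : ∀ g : Pt N → ℝ, pd (∑ i, α i • f i) g z = ∑ j, α j * pd (f j) g z := by
    intro g; unfold pd; rw [map_sum]; simp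
  rw [h1, h0]
  refine Finset.sum_congr rfl fun i _ => ?_
  rw [pd_sum _ (fun j z => α j * pd (f j) φ z) _ (fun j _ => ((hφ.pd _).const_mul _).diff), Finset.mul_sum]
  refine Finset.sum_congr rfl fun j _ => ?_
  rw [pd_const_mul _ _ (hφ.pd _).diff]; ring

lemma lap_dirs {lam : ℝ} (hl : 0 < lam) {S : Fin (N + 1) → Fin (N + 1) → ℝ} {A : Matrix (Fin (N + 1)) (Fin (N + 1)) ℝ}
    (hA : ∀ i j, A i j = (if i = j then lam else 0) + ∑ k, S i k * S j k) {φ : Pt N → ℝ} (hφ : TF φ) (z : Pt N) :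
    lap (dirs lam S) φ z = ∑ i, ∑ j, A i j * pd (bvec i) (pd (bvec j) φ) z := by
  unfold lap
  rw [Fintype.sum_sum_type]
  simp only [dirs, Sum.elim_inl, Sum.elim_inr]
  have e1 : ∀ j : Fin (N + 1), pd (√lam • bvec j) (pd (√lam • bvec j) φ) z = lam * pd (bvec j) (pd (bvec j) φ) z := by
    intro j
    have := pd_pd_lin (κ := Unit) (f := fun _ => bvec j) (fun _ => √lam) hφ z
    simp only [Finset.univ_unique, Finset.sum_singleton] at this
    rw [this, Real.mul_self_sqrt hl.le]
  simp_rw [e1, fun k => pd_pd_lin (f := bvec) (fun i => S i k) hφ z, hA, add_mul, Finset.sum_add_distrib]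
  congr 1
  · refine Finset.sum_congr rfl fun i _ => ?_
    simp
  · rw [Finset.sum_comm]
    refine Finset.sum_congr rfl fun i _ => ?_
    rw [Finset.sum_comm]
    refine Finset.sum_congr rfl fun j _ => ?_
    rw [Finset.sum_mul]

lemma dirs_g {lam : ℝ} (hl : 0 < lam) {S : Fin (N + 1) → Fin (N + 1) → ℝ} {A : Matrix (Fin (N + 1)) (Fin (N + 1)) ℝ}
    (hA : ∀ i j, A i j = (if i = j then lam else 0) + ∑ k, S i k * S j k) :
    ∑ k, (dirs lam S k).2 ^ 2 = A (Fin.last N) (Fin.last N) := by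
  rw [Fintype.sum_sum_type, Fin.sum_univ_castSucc, hA]
  simp only [dirs, Sum.elim_inl, Sum.elim_inr, bvec_cast, bvec_last]
  have : ∀ k, (∑ i, S i k • bvec i : Pt N).2 = S (Fin.last N) k := by
    intro k
    rw [Fin.sum_univ_castSucc]
    simp [bvec_cast, bvec_last, ex, ey, Prod.snd_sum]
  simp [this, ex, ey, Real.sq_sqrt hl.le, sq]
end fin1
end dev25

section dev26
section fin2
variable {N : ℕ} {ι : Type} [Fintype ι] (e : ι → Pt N) {p m : ℝ} {w : Pt N}

/-- `T φ` is controlled by `opL e w φ` -/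
def Ctl (p m : ℝ) (w : Pt N) (T : (Pt N → ℝ) → Pt N → ℝ) : Prop :=
  (∀ φ, TF φ → Measurable (T φ)) ∧
    ∃ C, 0 ≤ C ∧ ∀ φ, TF φ → wl p m (T φ) ≤ ENNReal.ofReal C * wl p m (opL e w φ)

lemma wl_mono (hp : 0 < p) {F G : Pt N → ℝ} (h : ∀ z, 0 < z.2 → |F z| ≤ |G z|) : wl p m F ≤ wl p m G := by
  refine setLIntegral_mono' Half_meas fun z hz => ?_
  have hz' : 0 < z.2 := hz
  apply ENNReal.ofReal_le_ofReal
  exact mul_le_mul_of_nonneg_right (Real.rpow_le_rpow (abs_nonneg _) (h z hz') hp.le) (by positivity)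

lemma wl_add (hp : 0 < p) {F G : Pt N → ℝ} (hF : Measurable F) :
    wl p m (fun z => F z + G z) ≤ ENNReal.ofReal (2 ^ p) * (wl p m F + wl p m G) := by
  have hm : Measurable fun z : Pt N => ENNReal.ofReal (|F z| ^ p * z.2 ^ m) := by fun_prop
  unfold wl
  rw [← lintegral_add_left hm, ← lintegral_const_mul' _ _ ENNReal.ofReal_ne_top]
  refine setLIntegral_mono' Half_meas fun z hz => ?_
  have hz' : 0 < z.2 := hz
  rw [← ENNReal.ofReal_add (by positivity) (by positivity), ← ENNReal.ofReal_mul (by positivity)]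
  apply ENNReal.ofReal_le_ofReal
  rw [← add_mul, ← mul_assoc]
  refine mul_le_mul_of_nonneg_right ?_ (by positivity)
  exact (Real.rpow_le_rpow (abs_nonneg _) (abs_add_le _ _) hp.le).trans (two_rpow_bound hp (abs_nonneg _) (abs_nonneg _))

lemma wl_const_mul (hp : 0 < p) (c : ℝ) (F : Pt N → ℝ) : wl p m (fun z => c * F z) = ENNReal.ofReal (|c| ^ p) * wl p m F := by
  unfold wl
  rw [← lintegral_const_mul' _ _ ENNReal.ofReal_ne_top]
  refine setLIntegral_congr_fun Half_meas fun z hz => ?_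
  rw [← ENNReal.ofReal_mul (by positivity), abs_mul, Real.mul_rpow (abs_nonneg _) (abs_nonneg _), mul_assoc]

variable {e}
variable {T T' : (Pt N → ℝ) → Pt N → ℝ}

lemma Ctl.self : Ctl e p m w (opL e w) :=
  ⟨fun _ hφ => opL_meas e hφ, 1, zero_le_one, fun φ _ => by simp⟩

lemma Ctl.mono (hp : 0 < p) (h : Ctl e p m w T) (hm : ∀ φ, TF φ → Measurable (T' φ)) (hle : ∀ φ z, 0 < z.2 → |T' φ z| ≤ |T φ z|) : Ctl e p m w T' := by
  obtain ⟨C, hC, H⟩ := h.2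
  exact ⟨hm, C, hC, fun φ hφ => (wl_mono hp (hle φ)).trans (H φ hφ)⟩

lemma Ctl.add (hp : 0 < p) (h : Ctl e p m w T) (h' : Ctl e p m w T') : Ctl e p m w (fun φ z => T φ z + T' φ z) := by
  obtain ⟨C, hC, H⟩ := h.2
  obtain ⟨C', hC', H'⟩ := h'.2
  refine ⟨fun φ hφ => (h.1 φ hφ).add (h'.1 φ hφ), 2 ^ p * (C + C'), by positivity, fun φ hφ => ?_⟩
  refine (wl_add hp (h.1 φ hφ)).trans ?_
  rw [ENNReal.ofReal_mul (by positivity), mul_assoc, ENNReal.ofReal_add hC hC', add_mul]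
  exact mul_le_mul_right (add_le_add (H φ hφ) (H' φ hφ)) _

lemma Ctl.const_mul (hp : 0 < p) (c : ℝ) (h : Ctl e p m w T) : Ctl e p m w (fun φ z => c * T φ z) := by
  obtain ⟨C, hC, H⟩ := h.2
  refine ⟨fun φ hφ => (h.1 φ hφ).const_mul c, |c| ^ p * C, by positivity, fun φ hφ => ?_⟩
  rw [wl_const_mul hp, ENNReal.ofReal_mul (by positivity), mul_assoc]
  exact mul_le_mul_right (H φ hφ) _

lemma Ctl.sum (hp : 0 < p) {κ : Type*} (s : Finset κ) (F : κ → (Pt N → ℝ) → Pt N → ℝ) (h : ∀ k ∈ s, Ctl e p m w (F k)) :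
    Ctl e p m w (fun φ z => ∑ k ∈ s, F k φ z) := by
  classical
  induction s using Finset.induction_on with
  | empty =>
    have := (Ctl.self (e := e) (p := p) (m := m) (w := w)).const_mul hp 0
    simpa using this
  | insert k s hk ih =>
    simp only [Finset.sum_insert hk]
    exact (h k (Finset.mem_insert_self _ _)).add hp (ih fun j hj => h j (Finset.mem_insert_of_mem hj))

lemma Ctl.abs (hp : 0 < p) (h : Ctl e p m w T) : Ctl e p m w (fun φ z => |T φ z|) :=
  h.mono hp (fun φ hφ => (h.1 φ hφ).abs) fun φ z _ => by rw [abs_abs]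

lemma LpmNorm_eq (m β : ℝ) {f G : Pt N → ℝ} (hG : Measurable G) (hf : ∀ z : Pt N, 0 < z.2 → f z = z.2 ^ β * G z) :
    LpmNorm N p m f = (wl p (m + β * p) G).toReal ^ (1 / p) := by
  unfold LpmNorm
  congr 1
  have h1 : ∫ z in {z : Pt N | 0 < z.2}, |f z| ^ p * z.2 ^ m = ∫ z in Half N, |G z| ^ p * z.2 ^ (m + β * p) := by
    refine setIntegral_congr_fun Half_meas fun z hz => ?_
    have hz' : 0 < z.2 := hz
    simp only [hf z hz']
    rw [abs_mul, abs_of_pos (by positivity : 0 < z.2 ^ β), Real.mul_rpow (by positivity) (by positivity), ← Real.rpow_mul hz'.le,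
      Real.rpow_add hz']
    ring
  have hm : Measurable fun z : Pt N => |G z| ^ p * z.2 ^ (m + β * p) := by fun_prop
  rw [h1, integral_eq_lintegral_of_nonneg_ae _ hm.aestronglyMeasurable]
  · rfl
  · filter_upwards [ae_restrict_mem Half_meas] with z hz
    have hz' : 0 < z.2 := hz
    simp only [Pi.zero_apply]
    positivity

lemma opL_fin (hp : 0 < p) (hm : p - 1 < m) {φ : Pt N → ℝ} (hφ : TF φ) : wl p m (opL e w φ) ≠ ⊤ := by
  have h1 : wl p m (lap e φ) ≠ ⊤ := wl_fin hp (lap_TF e hφ) (by linarith)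
  have h2 : wl p m (fun z => z.2⁻¹ * pd w φ z) ≠ ⊤ := by
    have := wl_fin (p := p) hp (hφ.pd w) (r := m - p) (by linarith)
    convert this using 1
    rw [wl]
    refine setLIntegral_congr_fun Half_meas fun ζ hζ => ?_
    have hζ' : 0 < ζ.2 := hζ
    congr 1
    rw [abs_mul, abs_of_pos (inv_pos.mpr hζ'), Real.mul_rpow (by positivity) (by positivity), Real.rpow_sub hζ' m p,
      Real.inv_rpow hζ'.le]
    field_simp
  refine ne_top_of_le_ne_top ?_ (wl_add hp (lap_TF e hφ).cont.measurable)
  exact ENNReal.mul_ne_top ENNReal.ofReal_ne_top (ENNReal.add_ne_top.mpr ⟨h1, h2⟩)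

/-- from control to norms -/
lemma Ctl.norm (hp : 0 < p) {β : ℝ} (hm : p - 1 < m + β * p) (h : Ctl e p (m + β * p) w T) : ∃ C, 0 ≤ C ∧ ∀ φ, TF φ → ∀ f g : Pt N → ℝ,
    (∀ z : Pt N, 0 < z.2 → f z = z.2 ^ β * T φ z) → (∀ z : Pt N, 0 < z.2 → g z = z.2 ^ β * opL e w φ z) →
      LpmNorm N p m f ≤ C * LpmNorm N p m g := by
  obtain ⟨C, hC, H⟩ := h.2
  refine ⟨C ^ (1 / p), by positivity, fun φ hφ f g hf hg => ?_⟩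
  rw [LpmNorm_eq m β (h.1 φ hφ) hf, LpmNorm_eq m β (opL_meas e hφ) hg, ← Real.mul_rpow hC ENNReal.toReal_nonneg]
  refine Real.rpow_le_rpow ENNReal.toReal_nonneg ?_ (by positivity)
  have := ENNReal.toReal_mono (ENNReal.mul_ne_top ENNReal.ofReal_ne_top (opL_fin hp hm hφ)) (H φ hφ)
  rwa [ENNReal.toReal_mul, ENNReal.toReal_ofReal hC] at this

/-! ### Conjugation by a power of `y` -/

lemma pd_rpow (r : ℝ) {g : Pt N → ℝ} {z : Pt N} (hz : 0 < z.2) (hg : DifferentiableAt ℝ g z) (v : Pt N) :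
    pd v (fun z => z.2 ^ r * g z) z = z.2 ^ r * pd v g z + r * v.2 * (z.2 ^ (r - 1) * g z) := by
  have hd : DifferentiableAt ℝ (fun z : Pt N => z.2) z := differentiableAt_snd
  have h1 := pdA_comp (f := fun z : Pt N => z.2) v (Real.hasDerivAt_rpow_const (p := r) (Or.inl hz.ne')) hd
  have h2 : pd v (fun z : Pt N => z.2) z = v.2 := by
    unfold pd; rw [show (fun z : Pt N => z.2) = Prod.snd from rfl, fderiv_snd]; rfl
  rw [pdA_mul v (hd.rpow_const (Or.inl hz.ne')) hg, h1, h2]; ring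

lemma pd_pd_rpow (r : ℝ) {φ : Pt N → ℝ} (hφ : TF φ) {z : Pt N} (hz : 0 < z.2) (v v' : Pt N) :
    pd v' (pd v (fun z => z.2 ^ r * φ z)) z = z.2 ^ r * (pd v' (pd v φ) z + r * z.2⁻¹ * (v'.2 * pd v φ z + v.2 * pd v' φ z)
      + r * (r - 1) * z.2⁻¹ ^ 2 * (v.2 * v'.2 * φ z)) := by
  have hev : pd v (fun z => z.2 ^ r * φ z) =ᶠ[nhds z] fun z => z.2 ^ r * pd v φ z + z.2 ^ (r - 1) * (r * v.2 * φ z) := by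
    filter_upwards [(isOpen_lt continuous_const continuous_snd).mem_nhds hz] with x hx
    rw [pd_rpow r hx (hφ.diff x)]; ring
  have d1 := (hφ.pd v).diff z
  have d2 := (hφ.const_mul (r * v.2)).diff z
  have hd : DifferentiableAt ℝ (fun z : Pt N => z.2) z := differentiableAt_snd
  have D1 : DifferentiableAt ℝ (fun z : Pt N => z.2 ^ r * pd v φ z) z := (hd.rpow_const (Or.inl hz.ne')).mul d1
  have D2 : DifferentiableAt ℝ (fun z : Pt N => z.2 ^ (r - 1) * (r * v.2 * φ z)) z := (hd.rpow_const (Or.inl hz.ne')).mul d2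
  rw [pd_congr v' hev, pdA_add v' D1 D2, pd_rpow r hz d1, pd_rpow (r - 1) hz d2,
    pd_const_mul _ _ hφ.diff, Real.rpow_sub_one hz.ne' (r - 1), Real.rpow_sub_one hz.ne' r]
  field_simp
  ring
end fin2
end dev26

section dev27
section fin3
variable {N : ℕ}

lemma sum_block (Q : Matrix (Fin N) (Fin N) ℝ) (q : Fin N → ℝ) (γ : ℝ) (X : Fin (N + 1) → Fin (N + 1) → ℝ) :
    ∑ i, ∑ j, blockA Q q γ i j * X i j = (∑ i, ∑ j, Q i j * X i.castSucc j.castSucc) + (∑ i, q i * X i.castSucc (Fin.last N))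
      + (∑ j, q j * X (Fin.last N) j.castSucc) + γ * X (Fin.last N) (Fin.last N) := by
  rw [Fin.sum_univ_castSucc]
  simp_rw [Fin.sum_univ_castSucc (n := N)]
  rw [Finset.sum_add_distrib]
  simp [blockA]
  ring

lemma trHess_block (Q : Matrix (Fin N) (Fin N) ℝ) (q : Fin N → ℝ) (γ : ℝ) (u : Pt N → ℝ) (z : Pt N) :
    trHess (blockA Q q γ) u z = (∑ i, ∑ j, Q i j * pd (ex i) (pd (ex j) u) z) + (∑ i, q i * pd (ex i) (pd ey u) z)
      + (∑ j, q j * pd ey (pd (ex j) u) z) + γ * pd ey (pd ey u) z := by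
  unfold trHess
  rw [sum_block Q q γ fun i j => pd (bvec i) (pd (bvec j) u) z]
  simp only [bvec_cast, bvec_last]

variable {α r : ℝ} {φ : Pt N → ℝ} {z : Pt N}

lemma u_ij (r : ℝ) (hφ : TF φ) (hz : 0 < z.2) (i j : Fin N) :
    pd (ex i) (pd (ex j) fun z => z.2 ^ r * φ z) z = z.2 ^ r * pd (ex i) (pd (ex j) φ) z := by
  rw [pd_pd_rpow r hφ hz]; simp [ex]

lemma u_iy (r : ℝ) (hφ : TF φ) (hz : 0 < z.2) (i : Fin N) :
    pd (ex i) (pd ey fun z => z.2 ^ r * φ z) z = z.2 ^ r * (pd (ex i) (pd ey φ) z + r * z.2⁻¹ * pd (ex i) φ z) := by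
  rw [pd_pd_rpow r hφ hz]; simp [ex, ey]

lemma u_yi (r : ℝ) (hφ : TF φ) (hz : 0 < z.2) (i : Fin N) :
    pd ey (pd (ex i) fun z => z.2 ^ r * φ z) z = z.2 ^ r * (pd ey (pd (ex i) φ) z + r * z.2⁻¹ * pd (ex i) φ z) := by
  rw [pd_pd_rpow r hφ hz]; simp [ex, ey]

lemma u_yy (r : ℝ) (hφ : TF φ) (hz : 0 < z.2) :
    pd ey (pd ey fun z => z.2 ^ r * φ z) z = z.2 ^ r * (pd ey (pd ey φ) z + 2 * r * z.2⁻¹ * pd ey φ z + r * (r - 1) * z.2⁻¹ ^ 2 * φ z) := by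
  rw [pd_pd_rpow r hφ hz]; simp only [ey]; ring

lemma u_i (r : ℝ) (hφ : TF φ) (hz : 0 < z.2) (i : Fin N) : pd (ex i) (fun z => z.2 ^ r * φ z) z = z.2 ^ r * pd (ex i) φ z := by
  rw [pd_rpow r hz (hφ.diff z)]; simp [ex]

lemma u_y (r : ℝ) (hφ : TF φ) (hz : 0 < z.2) : pd ey (fun z => z.2 ^ r * φ z) z = z.2 ^ r * (pd ey φ z + r * z.2⁻¹ * φ z) := by
  rw [pd_rpow r hz (hφ.diff z), Real.rpow_sub_one hz.ne']; simp [ey]; field_simp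

lemma rp1 (α : ℝ) (hz : 0 < z.2) : z.2 ^ (α - 1) = z.2 ^ α * z.2⁻¹ := by rw [Real.rpow_sub_one hz.ne']; rfl
lemma rp2 (α : ℝ) (hz : 0 < z.2) : z.2 ^ (α - 2) = z.2 ^ α * z.2⁻¹ ^ 2 := by
  rw [Real.rpow_sub hz, Real.rpow_two]; field_simp

lemma opL_block {lam : ℝ} (hl : 0 < lam) {S : Fin (N + 1) → Fin (N + 1) → ℝ} {Q : Matrix (Fin N) (Fin N) ℝ} {q : Fin N → ℝ} {γ : ℝ}
    (hA : ∀ i j, blockA Q q γ i j = (if i = j then lam else 0) + ∑ k, S i k * S j k) (d : Fin N → ℝ) (c s : ℝ) (hφ : TF φ) (z : Pt N) :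
    opL (dirs lam S) (fun i => d i + 2 * s * q i, c + 2 * s * γ) φ z = (∑ i, ∑ j, Q i j * pd (ex i) (pd (ex j) φ) z)
      + 2 * (∑ i, q i * pd ey (pd (ex i) φ) z) + γ * pd ey (pd ey φ) z
      + z.2⁻¹ * ((∑ i, d i * pd (ex i) φ z) + 2 * s * (∑ i, q i * pd (ex i) φ z) + (c + 2 * s * γ) * pd ey φ z) := by
  have h := trHess_block Q q γ φ z
  have h' : ∀ i, pd (ex i) (pd ey φ) z = pd ey (pd (ex i) φ) z := fun i => congrFun (pd_comm hφ.1 _ _) z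
  unfold trHess at h
  simp only [h'] at h
  unfold opL
  rw [lap_dirs hl hA hφ, h, pd_exp (fun i => d i + 2 * s * q i, c + 2 * s * γ)]
  have e1 : ∑ i, (d i + 2 * s * q i) * pd (ex i) φ z = (∑ i, d i * pd (ex i) φ z) + 2 * s * (∑ i, q i * pd (ex i) φ z) := by
    rw [Finset.mul_sum, ← Finset.sum_add_distrib]
    exact Finset.sum_congr rfl fun i _ => by ring
  simp only [e1]
  ring

lemma Lu_eq {lam : ℝ} (hl : 0 < lam) {S : Fin (N + 1) → Fin (N + 1) → ℝ} {Q : Matrix (Fin N) (Fin N) ℝ} {q : Fin N → ℝ} {γ : ℝ}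
    (hA : ∀ i j, blockA Q q γ i j = (if i = j then lam else 0) + ∑ k, S i k * S j k) (d : Fin N → ℝ) {c b s : ℝ}
    (hq : γ * (s * (s - 1)) + c * s - b = 0) (hφ : TF φ) (α : ℝ) (hz : 0 < z.2) :
    z.2 ^ α * trHess (blockA Q q γ) (fun z => z.2 ^ s * φ z) z
        + z.2 ^ (α - 1) * ((∑ i, d i * pd (ex i) (fun z => z.2 ^ s * φ z) z) + c * pd ey (fun z => z.2 ^ s * φ z) z)
        - b * z.2 ^ (α - 2) * (z.2 ^ s * φ z)
      = z.2 ^ (α + s) * opL (dirs lam S) (fun i => d i + 2 * s * q i, c + 2 * s * γ) φ z := by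
  have h' : ∀ i, pd (ex i) (pd ey φ) z = pd ey (pd (ex i) φ) z := fun i => congrFun (pd_comm hφ.1 _ _) z
  rw [opL_block hl hA d c s hφ, trHess_block, Real.rpow_add hz, rp1 α hz, rp2 α hz]
  simp only [u_ij s hφ hz, u_iy s hφ hz, u_yi s hφ hz, u_yy s hφ hz, u_i s hφ hz, u_y s hφ hz, h']
  have e1 : ∑ i, ∑ j, Q i j * (z.2 ^ s * pd (ex i) (pd (ex j) φ) z) = z.2 ^ s * ∑ i, ∑ j, Q i j * pd (ex i) (pd (ex j) φ) z := by
    simp only [Finset.mul_sum]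
    exact Finset.sum_congr rfl fun i _ => Finset.sum_congr rfl fun j _ => by ring
  have e2 : ∑ i, q i * (z.2 ^ s * (pd ey (pd (ex i) φ) z + s * z.2⁻¹ * pd (ex i) φ z)) =
      z.2 ^ s * ((∑ i, q i * pd ey (pd (ex i) φ) z) + s * z.2⁻¹ * ∑ i, q i * pd (ex i) φ z) := by
    simp only [Finset.mul_sum]
    rw [← Finset.sum_add_distrib, Finset.mul_sum]
    exact Finset.sum_congr rfl fun i _ => by ring
  have e3 : ∑ i, d i * (z.2 ^ s * pd (ex i) φ z) = z.2 ^ s * ∑ i, d i * pd (ex i) φ z := by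
    simp only [Finset.mul_sum]
    exact Finset.sum_congr rfl fun i _ => by ring
  rw [e1, e2, e3]
  linear_combination (z.2 ^ α * z.2⁻¹ ^ 2 * z.2 ^ s * φ z) * hq

lemma Bu_eq {lam : ℝ} (hl : 0 < lam) {S : Fin (N + 1) → Fin (N + 1) → ℝ} {Q : Matrix (Fin N) (Fin N) ℝ} {q : Fin N → ℝ} {γ : ℝ}
    (hA : ∀ i j, blockA Q q γ i j = (if i = j then lam else 0) + ∑ k, S i k * S j k) (d : Fin N → ℝ) {c b s : ℝ}
    (hq : γ * (s * (s - 1)) + c * s - b = 0) (hφ : TF φ) (α : ℝ) (hz : 0 < z.2) :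
    z.2 ^ α * (γ * pd ey (pd ey fun z => z.2 ^ s * φ z) z + c * z.2 ^ (-1 : ℝ) * pd ey (fun z => z.2 ^ s * φ z) z
        - b * z.2 ^ (-2 : ℝ) * (z.2 ^ s * φ z))
      = z.2 ^ (α + s) * (opL (dirs lam S) (fun i => d i + 2 * s * q i, c + 2 * s * γ) φ z
        + (∑ i, ((∑ j, (-Q i j) * pd (ex i) (pd (ex j) φ) z) + ((-2 * q i) * pd ey (pd (ex i) φ) z
          + (-(d i + 2 * s * q i)) * (z.2⁻¹ * pd (ex i) φ z))))) := by
  rw [opL_block hl hA d c s hφ, Real.rpow_add hz, Real.rpow_neg_one, u_yy s hφ hz, u_y s hφ hz]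
  have e0 : z.2 ^ (-2 : ℝ) = z.2⁻¹ ^ 2 := by rw [Real.rpow_neg hz.le, Real.rpow_two, inv_pow]
  have e1 : (∑ i, ((∑ j, (-Q i j) * pd (ex i) (pd (ex j) φ) z) + ((-2 * q i) * pd ey (pd (ex i) φ) z
          + (-(d i + 2 * s * q i)) * (z.2⁻¹ * pd (ex i) φ z)))) = - (∑ i, ∑ j, Q i j * pd (ex i) (pd (ex j) φ) z)
        - 2 * (∑ i, q i * pd ey (pd (ex i) φ) z) - z.2⁻¹ * ((∑ i, d i * pd (ex i) φ z) + 2 * s * (∑ i, q i * pd (ex i) φ z)) := by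
    simp only [Finset.mul_sum, mul_add, neg_mul, Finset.sum_neg_distrib, Finset.sum_add_distrib, neg_add, add_mul]
    have a1 : ∑ i, 2 * q i * pd ey (pd (ex i) φ) z = ∑ i, 2 * (q i * pd ey (pd (ex i) φ) z) := Finset.sum_congr rfl fun i _ => by ring
    have a2 : ∑ i, d i * (z.2⁻¹ * pd (ex i) φ z) = ∑ i, z.2⁻¹ * (d i * pd (ex i) φ z) := Finset.sum_congr rfl fun i _ => by ring
    have a3 : ∑ i, 2 * s * q i * (z.2⁻¹ * pd (ex i) φ z) = ∑ i, z.2⁻¹ * (2 * s * (q i * pd (ex i) φ z)) := Finset.sum_congr rfl fun i _ => by ring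
    rw [a1, a2, a3]; ring
  rw [e0, e1]
  linear_combination (z.2 ^ α * z.2⁻¹ ^ 2 * z.2 ^ s * φ z) * hq

end fin3
end dev27

section dev28
section fin4
variable {N : ℕ} {p θ c γ lam : ℝ} {S : Fin (N + 1) → Fin (N + 1) → ℝ} {w : Pt N}

lemma ctl1 (hp : 1 < p) (hc : 1 ≤ c) (h1 : 1 < θ) (h2 : θ < c + 1) (hγ : 0 < γ) (hl : 0 < lam)
    (hw : w.2 = c * γ) (hg : ∑ k, (dirs lam S k).2 ^ 2 = γ) (i : Fin N) :
    Ctl (dirs lam S) p (p * θ - 1) w (fun φ z => z.2⁻¹ * pd (ex i) φ z) := by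
  have hpq : p.HolderConjugate _ := Real.HolderConjugate.conjExponent hp
  obtain ⟨ω, hω⟩ := dirs_exp hl S w
  have he : dirs lam S (Sum.inl i.castSucc) = √lam • ex i := by simp [dirs, bvec_cast]
  obtain ⟨C, hC, H⟩ := thm1 (dirs lam S) hpq hc h1 h2 hγ hω hw (k0 := Sum.inl i.castSucc) (by rw [he]; simp [ex]) hg
  have K : Ctl (dirs lam S) p (p * θ - 1) w (fun φ z => z.2⁻¹ * pd (dirs lam S (Sum.inl i.castSucc)) φ z) :=
    ⟨fun φ hφ => measurable_snd.inv.mul (hφ.pd _).cont.measurable, C, hC, H⟩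
  have K2 := K.const_mul hpq.pos (√lam)⁻¹
  have : √lam ≠ 0 := (Real.sqrt_pos.mpr hl).ne'
  convert K2 using 3 with φ z
  rw [he, pd_smul_dir]; field_simp

lemma ctl2 (hp : 1 < p) (hc : 1 ≤ c) (h1 : 1 < θ) (h2 : θ < c + 1) (hγ : 0 < γ) (hl : 0 < lam)
    (hw : w.2 = c * γ) (hg : ∑ k, (dirs lam S k).2 ^ 2 = γ) (i : Fin N) (v : Pt N) :
    Ctl (dirs lam S) p (p * θ - 1) w (fun φ z => pd v (pd (ex i) φ) z) := by
  have hpq : p.HolderConjugate _ := Real.HolderConjugate.conjExponent hp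
  obtain ⟨ω, hω⟩ := dirs_exp hl S w
  obtain ⟨a, ha⟩ := dirs_exp hl S (ex i)
  obtain ⟨β, hβ⟩ := dirs_exp hl S v
  obtain ⟨C, hC, H⟩ := thm2 (dirs lam S) (p * θ - 1) hpq ha hω (by simp [ex])
  have K1 := ctl1 hp hc h1 h2 hγ hl hw hg i
  obtain ⟨C1, hC1, H1⟩ := K1.2
  have K : ∀ k, Ctl (dirs lam S) p (p * θ - 1) w (fun φ z => pd (dirs lam S k) (pd (ex i) φ) z) := by
    intro k
    refine ⟨fun φ hφ => ((hφ.pd _).pd _).cont.measurable, C * (1 + C1), by positivity, fun φ hφ => ?_⟩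
    refine (H φ hφ k).trans ?_
    rw [ENNReal.ofReal_mul hC, mul_assoc, ENNReal.ofReal_add zero_le_one hC1, add_mul, ENNReal.ofReal_one, one_mul]
    exact mul_le_mul_right (add_le_add le_rfl (H1 φ hφ)) _
  have K2 := Ctl.sum hpq.pos Finset.univ (fun k φ z => β k * pd (dirs lam S k) (pd (ex i) φ) z) fun k _ => (K k).const_mul hpq.pos (β k)
  convert K2 using 3 with φ z
  conv_lhs => rw [hβ]
  rw [pd_lin]

lemma sqrt_sum_le (x : Fin N → ℝ) : √(∑ i, x i ^ 2) ≤ ∑ i, |x i| := by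
  rw [Real.sqrt_le_left (Finset.sum_nonneg fun i _ => abs_nonneg _)]
  calc ∑ i, x i ^ 2 = ∑ i, |x i| ^ 2 := by simp
    _ ≤ _ := Finset.sum_sq_le_sq_sum_of_nonneg fun i _ => abs_nonneg _

end fin4
end dev28

/-- Improved elliptic estimate for the operator
`ℒu = y^α Tr(A D²u) + y^{α-1} v·∇u − b y^{α-2} u` on functions of the form
`u = y^{−s₁} φ` with `φ` smooth, compactly supported and satisfying the Neumann
condition `∂_y φ ≡ 0` near `{y = 0}`. -/
theorem statement2 (N : ℕ) (hN : 1 ≤ N) (p m α : ℝ) (hp : 1 < p) (hα : α < 2)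
    (Q : Matrix (Fin N) (Fin N) ℝ) (q : Fin N → ℝ) (γ : ℝ) (hγ : 0 < γ)
    (hsym : (blockA Q q γ).IsSymm) (hposdef : (blockA Q q γ).PosDef)
    (d : Fin N → ℝ) (c b : ℝ)
    (D s₁ s₂ : ℝ) (hD : D = b / γ + ((c / γ - 1) / 2) ^ 2) (hDpos : 0 ≤ D)
    (hs₁ : s₁ = (c / γ - 1) / 2 - Real.sqrt D) (hs₂ : s₂ = (c / γ - 1) / 2 + Real.sqrt D)
    (h1 : s₁ + max (-α) 0 < (m + 1) / p) (h2 : (m + 1) / p < s₂ + 2 - α)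
    (h3 : (m + 1) / p > s₁ + 1 - α) :
    ∃ C > 0, ∀ φ : Pt N → ℝ, ContDiff ℝ (⊤ : ℕ∞) φ → HasCompactSupport φ →
      (∃ δ > 0, ∀ z : Pt N, 0 ≤ z.2 → z.2 ≤ δ → pd ey φ z = 0) →
      ∀ u : Pt N → ℝ, u = (fun z : Pt N => z.2 ^ (-s₁) * φ z) →
      (∑ i, ∑ j, LpmNorm N p m fun z => z.2 ^ α * pd (ex i) (pd (ex j) u) z)
        + (LpmNorm N p m fun z =>
            z.2 ^ α * (γ * pd ey (pd ey u) z + c * z.2 ^ (-1 : ℝ) * pd ey u z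
              - b * z.2 ^ (-2 : ℝ) * u z))
        + (∑ i, LpmNorm N p m fun z => z.2 ^ α * pd (ex i) (pd ey u) z)
        + (LpmNorm N p m fun z =>
            z.2 ^ (α - 1) * Real.sqrt (∑ i, pd (ex i) u z ^ 2))
      ≤ C * LpmNorm N p m fun z =>
          z.2 ^ α * trHess (blockA Q q γ) u z
            + z.2 ^ (α - 1) * ((∑ i, d i * pd (ex i) u z) + c * pd ey u z)
            - b * z.2 ^ (α - 2) * u z := by
  obtain ⟨lam, hl, S, hA⟩ := posdef_decomp hposdef
  have hp0 : 0 < p := by linarith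
  set r : ℝ := -s₁ with hr
  have hsD := Real.sq_sqrt hDpos
  have hs0 := Real.sqrt_nonneg D
  have hquad : γ * (r * (r - 1)) + c * r - b = 0 := by
    have e1 : √D = (c / γ - 1) / 2 - s₁ := by linarith
    rw [e1, hD] at hsD
    have : γ * (((c / γ - 1) / 2 - s₁) ^ 2 - (b / γ + ((c / γ - 1) / 2) ^ 2)) = 0 := by rw [hsD]; ring
    rw [← this, hr]; field_simp; ring
  set β := α + r with hβ
  set θ := (m + 1) / p + β with hθ
  have hmθ : m + β * p = p * θ - 1 := by rw [hθ]; field_simp; ring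
  set w : Pt N := (fun i => d i + 2 * r * q i, c + 2 * r * γ) with hw
  set c' := 1 + 2 * √D with hc'
  have hw2 : w.2 = c' * γ := by
    have : √D = (c / γ - 1) / 2 - s₁ := by linarith
    rw [hc', this]; simp only [hw, hr]; field_simp; ring
  have hg : ∑ k, (dirs lam S k).2 ^ 2 = γ := by
    rw [dirs_g hl hA]; simp [blockA]
  have hc1 : 1 ≤ c' := by linarith
  have t1 : 1 < θ := by linarith
  have t2 : θ < c' + 1 := by linarith
  have hm : p - 1 < m + β * p := by rw [hmθ]; nlinarith
  have K1 : ∀ i, Ctl (dirs lam S) p (m + β * p) w (fun φ z => z.2⁻¹ * pd (ex i) φ z) := by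
    rw [hmθ]; exact ctl1 hp hc1 t1 t2 hγ hl hw2 hg
  have K2 : ∀ i v, Ctl (dirs lam S) p (m + β * p) w (fun φ z => pd v (pd (ex i) φ) z) := by
    rw [hmθ]; exact ctl2 hp hc1 t1 t2 hγ hl hw2 hg
  have KB : Ctl (dirs lam S) p (m + β * p) w (fun φ z => opL (dirs lam S) w φ z
        + (∑ i, ((∑ j, (-Q i j) * pd (ex i) (pd (ex j) φ) z) + ((-2 * q i) * pd ey (pd (ex i) φ) z
          + (-(d i + 2 * r * q i)) * (z.2⁻¹ * pd (ex i) φ z))))) :=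
    Ctl.self.add hp0 (Ctl.sum hp0 _ _ fun i _ => (Ctl.sum hp0 _ _ fun j _ => (K2 j _).const_mul hp0 _).add hp0
      (((K2 i _).const_mul hp0 _).add hp0 ((K1 i).const_mul hp0 _)))
  have KM : ∀ i, Ctl (dirs lam S) p (m + β * p) w (fun φ z => pd ey (pd (ex i) φ) z + r * (z.2⁻¹ * pd (ex i) φ z)) :=
    fun i => (K2 i _).add hp0 ((K1 i).const_mul hp0 _)
  have KG : Ctl (dirs lam S) p (m + β * p) w (fun φ z => z.2⁻¹ * √(∑ i, pd (ex i) φ z ^ 2)) := by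
    refine (Ctl.sum hp0 Finset.univ _ fun i _ => (K1 i).abs hp0).mono hp0 (fun φ hφ => ?_) fun φ z hz => ?_
    · have : Continuous fun z => √(∑ i, pd (ex i) φ z ^ 2) :=
        (continuous_finsetSum _ fun i _ => (hφ.pd (ex i)).cont.pow 2).sqrt
      exact measurable_snd.inv.mul this.measurable
    · rw [abs_of_nonneg (by positivity), abs_of_nonneg (Finset.sum_nonneg fun i _ => abs_nonneg _)]
      simp only [abs_mul, ← Finset.mul_sum]
      rw [abs_of_pos (inv_pos.mpr hz)]
      exact mul_le_mul_of_nonneg_left (sqrt_sum_le _) (by positivity)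
  choose C2 hC2 H2 using fun i j => (K2 j (ex i)).norm hp0 hm
  obtain ⟨CB, hCB, HB⟩ := KB.norm hp0 hm
  choose CM hCM HM using fun i => (KM i).norm hp0 hm
  obtain ⟨CG, hCG, HG⟩ := KG.norm hp0 hm
  have hs2 : 0 ≤ ∑ i, ∑ j, C2 i j := Finset.sum_nonneg fun i _ => Finset.sum_nonneg fun j _ => hC2 i j
  have hsM : 0 ≤ ∑ i, CM i := Finset.sum_nonneg fun i _ => hCM i
  refine ⟨(∑ i, ∑ j, C2 i j) + CB + (∑ i, CM i) + CG + 1, by positivity, fun φ hφ1 hφ2 _ u hu => ?_⟩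
  have hφ : TF φ := ⟨hφ1, hφ2⟩
  subst hu
  set g : Pt N → ℝ := fun z => z.2 ^ α * trHess (blockA Q q γ) (fun z => z.2 ^ r * φ z) z
        + z.2 ^ (α - 1) * ((∑ i, d i * pd (ex i) (fun z => z.2 ^ r * φ z) z) + c * pd ey (fun z => z.2 ^ r * φ z) z)
        - b * z.2 ^ (α - 2) * (z.2 ^ r * φ z) with hgd
  have hgz : ∀ z : Pt N, 0 < z.2 → g z = z.2 ^ β * opL (dirs lam S) w φ z := fun z hz => Lu_eq hl hA d hquad hφ α hz
  have hg0 : 0 ≤ LpmNorm N p m g := by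
    rw [LpmNorm_eq m β (opL_meas _ hφ) hgz]; positivity
  have A1 : (∑ i, ∑ j, LpmNorm N p m fun z => z.2 ^ α * pd (ex i) (pd (ex j) fun z => z.2 ^ r * φ z) z) ≤ (∑ i, ∑ j, C2 i j) * LpmNorm N p m g := by
    rw [Finset.sum_mul]
    refine Finset.sum_le_sum fun i _ => ?_
    rw [Finset.sum_mul]
    refine Finset.sum_le_sum fun j _ => H2 i j φ hφ _ _ (fun z hz => ?_) hgz
    rw [u_ij r hφ hz, hβ, Real.rpow_add hz]; ring
  have A2 := HB φ hφ _ _ (fun z hz => Bu_eq hl hA d hquad hφ α hz) hgz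
  have A3 : (∑ i, LpmNorm N p m fun z => z.2 ^ α * pd (ex i) (pd ey fun z => z.2 ^ r * φ z) z) ≤ (∑ i, CM i) * LpmNorm N p m g := by
    rw [Finset.sum_mul]
    refine Finset.sum_le_sum fun i _ => HM i φ hφ _ _ (fun z hz => ?_) hgz
    have h' : pd (ex i) (pd ey φ) z = pd ey (pd (ex i) φ) z := congrFun (pd_comm hφ.1 _ _) z
    rw [u_iy r hφ hz, hβ, Real.rpow_add hz, h']; ring
  have A4 : (LpmNorm N p m fun z => z.2 ^ (α - 1) * Real.sqrt (∑ i, pd (ex i) (fun z => z.2 ^ r * φ z) z ^ 2)) ≤ CG * LpmNorm N p m g := by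
    refine HG φ hφ _ _ (fun z hz => ?_) hgz
    have e : ∑ i, pd (ex i) (fun z => z.2 ^ r * φ z) z ^ 2 = (z.2 ^ r) ^ 2 * ∑ i, pd (ex i) φ z ^ 2 := by
      rw [Finset.mul_sum]
      refine Finset.sum_congr rfl fun i _ => ?_
      rw [u_i r hφ hz]; ring
    rw [e, Real.sqrt_mul (by positivity), Real.sqrt_sq (by positivity), hβ, Real.rpow_add hz, rp1 α hz]; ring
  linarith
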